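/- Let Ω ⊂ ℝ be an open bounded interval, let f satisfy hypothesis (F), and let the initial data satisfy u₀ ∈ W₀^{1,2}(Ω), u_{0t} ∈ L²(Ω), and Θ₀ ∈ L²(Ω) with Θ₀ ≥ 0 a.e. in Ω. Then there exists precisely one global weak solution (u,Θ) of the thermoelastic system (P) (weak solution on Ω×(0,T) for every T > 0) which additionally satisfies u ∈ C⁰([0,∞);W₀^{1,2}(Ω)), u_t ∈ C⁰([0,∞);L²(Ω)), and Θ ∈ C⁰([0,∞);L²(Ω)) ∩ L²_loc([0,∞);W^{1,2}(Ω)). -/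

import Mathlib

open MeasureTheory Filter Set Function

noncomputable section

/-- Integral over `Ω = (a,b)`. -/
def intOm (a b : ℝ) (g : ℝ → ℝ) : ℝ := ∫ x in Ioo a b, g x

/-- Double integral over `Ω × (0,T)`. -/
def intOmT (a b T : ℝ) (F : ℝ → ℝ → ℝ) : ℝ :=
  ∫ p in (Ioo a b) ×ˢ (Ioo 0 T), F p.1 p.2

/-- Squared `L²(Ω)` integral of `g`. -/
def sqOm (a b : ℝ) (g : ℝ → ℝ) : ℝ := ∫ x in Ioo a b, (g x) ^ 2

/-- `L²(Ω)` norm. -/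
def nrmL2 (a b : ℝ) (g : ℝ → ℝ) : ℝ := (∫ x in Ioo a b, (g x) ^ 2) ^ (1 / 2 : ℝ)

/-- `L¹(Ω)` norm. -/
def nrmL1 (a b : ℝ) (g : ℝ → ℝ) : ℝ := ∫ x in Ioo a b, |g x|

/-- Membership in `L²(Ω)`. -/
def MemL2 (a b : ℝ) (g : ℝ → ℝ) : Prop :=
  AEStronglyMeasurable g (volume.restrict (Ioo a b)) ∧
    IntegrableOn (fun x => (g x) ^ 2) (Ioo a b)

/-- Zero-trace weak derivative on `(a,b)`: `g ∈ W₀^{1,1}(a,b)` with weak derivative `g'`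
(integration by parts against all smooth test functions, with no boundary terms). -/
def WeakDerivZ (a b : ℝ) (g g' : ℝ → ℝ) : Prop :=
  ∀ ψ : ℝ → ℝ, ContDiff ℝ (⊤ : ℕ∞) ψ →
    ∫ x in Ioo a b, g x * deriv ψ x = - ∫ x in Ioo a b, g' x * ψ x

/-- Interior weak derivative on `(a,b)`: `g ∈ W^{1,1}(a,b)` with weak derivative `g'`. -/
def WeakDerivI (a b : ℝ) (g g' : ℝ → ℝ) : Prop :=
  ∀ ψ : ℝ → ℝ, ContDiff ℝ (⊤ : ℕ∞) ψ → tsupport ψ ⊆ Ioo a b →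
    ∫ x in Ioo a b, g x * deriv ψ x = - ∫ x in Ioo a b, g' x * ψ x

/-- Hypothesis (F) on the nonlinearity `f`, where `f'`, `f''` denote its first and second
derivatives on `[0,∞)`: `f ∈ C²([0,∞))`, `f(0)=0`, `f' > 0` on `[0,∞)`,
and `f' ∈ W^{1,∞}((0,∞))` (i.e. `f'` and `f''` are bounded). -/
structure HypF (f f' f'' : ℝ → ℝ) : Prop where
  hasDeriv₁ : ∀ x ∈ Ici (0 : ℝ), HasDerivWithinAt f (f' x) (Ici 0) x
  hasDeriv₂ : ∀ x ∈ Ici (0 : ℝ), HasDerivWithinAt f' (f'' x) (Ici 0) x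
  cont₂ : ContinuousOn f'' (Ici 0)
  zero : f 0 = 0
  pos : ∀ x ∈ Ici (0 : ℝ), 0 < f' x
  bdd : ∃ M : ℝ, ∀ x ∈ Ici (0 : ℝ), |f' x| ≤ M ∧ |f'' x| ≤ M

/-- Partial derivative in the first (spatial) variable. -/
def pdx (w : ℝ → ℝ → ℝ) : ℝ → ℝ → ℝ := fun x t => deriv (fun y => w y t) x

/-- Partial derivative in the second (time) variable. -/
def pdt (w : ℝ → ℝ → ℝ) : ℝ → ℝ → ℝ := fun x t => deriv (fun s => w x s) t

/-- Test functions in `C₀^∞(Ω × [0,T))`. -/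
structure TestU (a b T : ℝ) (φ : ℝ → ℝ → ℝ) : Prop where
  smooth : ContDiff ℝ (⊤ : ℕ∞) (uncurry φ)
  suppx : ∃ K : Set ℝ, IsCompact K ∧ K ⊆ Ioo a b ∧ ∀ x t, x ∉ K → φ x t = 0
  suppt : ∃ T' : ℝ, T' < T ∧ ∀ x t, T' ≤ t → φ x t = 0

/-- Test functions in `C^∞(Ω̄ × [0,T))`, compactly supported in time. -/
structure TestT (T : ℝ) (φ : ℝ → ℝ → ℝ) : Prop where
  smooth : ContDiff ℝ (⊤ : ℕ∞) (uncurry φ)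
  suppt : ∃ T' : ℝ, T' < T ∧ ∀ x t, T' ≤ t → φ x t = 0

/-- Test functions in `C₀^∞(Ω × (0,T))`. -/
structure TestInt (a b T : ℝ) (φ : ℝ → ℝ → ℝ) : Prop where
  smooth : ContDiff ℝ (⊤ : ℕ∞) (uncurry φ)
  suppx : ∃ K : Set ℝ, IsCompact K ∧ K ⊆ Ioo a b ∧ ∀ x t, x ∉ K → φ x t = 0
  supptime : ∃ K : Set ℝ, IsCompact K ∧ K ⊆ Ioo 0 T ∧ ∀ x t, t ∉ K → φ x t = 0

/-- Definition (W): weak solution of (P) on `Ω × (0,T)`.  Here `ut`, `ux`, `Θx` denote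
the weak derivatives of `u` (in time and space) and of `Θ` (in space). -/
structure IsWeakSol (a b T : ℝ) (f f' : ℝ → ℝ) (u0 u0t Θ0 : ℝ → ℝ)
    (u ut ux Θ Θx : ℝ → ℝ → ℝ) : Prop where
  u_sliceL1 : ∀ t ∈ Icc 0 T, IntegrableOn (fun x => u x t) (Ioo a b)
  u_contL1 : ∀ t₀ ∈ Icc 0 T,
    Tendsto (fun t => ∫ x in Ioo a b, |u x t - u x t₀|) (nhdsWithin t₀ (Icc 0 T)) (nhds 0)
  u_int : IntegrableOn (fun p : ℝ × ℝ => u p.1 p.2) ((Ioo a b) ×ˢ (Ioo 0 T))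
  ux_int : IntegrableOn (fun p : ℝ × ℝ => ux p.1 p.2) ((Ioo a b) ×ˢ (Ioo 0 T))
  u_W0 : ∀ᵐ t ∂volume.restrict (Ioo 0 T), WeakDerivZ a b (fun x => u x t) (fun x => ux x t)
  Θ_int : IntegrableOn (fun p : ℝ × ℝ => Θ p.1 p.2) ((Ioo a b) ×ˢ (Ioo 0 T))
  Θx_int : IntegrableOn (fun p : ℝ × ℝ => Θx p.1 p.2) ((Ioo a b) ×ˢ (Ioo 0 T))
  Θ_W : ∀ᵐ t ∂volume.restrict (Ioo 0 T), WeakDerivI a b (fun x => Θ x t) (fun x => Θx x t)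
  Θ_nonneg : ∀ᵐ p ∂volume.restrict ((Ioo a b) ×ˢ (Ioo 0 T)), 0 ≤ Θ p.1 p.2
  ut_weak : ∀ φ : ℝ → ℝ → ℝ, TestInt a b T φ →
    intOmT a b T (fun x t => u x t * pdt φ x t) = - intOmT a b T (fun x t => ut x t * φ x t)
  ut_int : IntegrableOn (fun p : ℝ × ℝ => ut p.1 p.2) ((Ioo a b) ×ˢ (Ioo 0 T))
  g1_int : IntegrableOn (fun p : ℝ × ℝ => f' (Θ p.1 p.2) * Θx p.1 p.2)
    ((Ioo a b) ×ˢ (Ioo 0 T))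
  g2_int : IntegrableOn (fun p : ℝ × ℝ => f' (Θ p.1 p.2) * Θx p.1 p.2 * ut p.1 p.2)
    ((Ioo a b) ×ˢ (Ioo 0 T))
  g3_int : IntegrableOn (fun p : ℝ × ℝ => f (Θ p.1 p.2) * ut p.1 p.2)
    ((Ioo a b) ×ˢ (Ioo 0 T))
  weak_u : ∀ φ : ℝ → ℝ → ℝ, TestU a b T φ →
    intOmT a b T (fun x t => u x t * pdt (pdt φ) x t)
        - intOm a b (fun x => u0t x * φ x 0) + intOm a b (fun x => u0 x * pdt φ x 0)
      = - intOmT a b T (fun x t => ux x t * pdx φ x t)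
        - intOmT a b T (fun x t => f' (Θ x t) * Θx x t * φ x t)
  weak_Θ : ∀ φ : ℝ → ℝ → ℝ, TestT T φ →
    - intOmT a b T (fun x t => Θ x t * pdt φ x t) - intOm a b (fun x => Θ0 x * φ x 0)
      = - intOmT a b T (fun x t => Θx x t * pdx φ x t)
        + intOmT a b T (fun x t => f' (Θ x t) * Θx x t * ut x t * φ x t)
        + intOmT a b T (fun x t => f (Θ x t) * ut x t * pdx φ x t)

/-- Continuity of `t ↦ w(·,t)` as a map `J → L²(Ω)` (with slices in `L²(Ω)`). -/
def ContL2 (a b : ℝ) (J : Set ℝ) (w : ℝ → ℝ → ℝ) : Prop :=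
  (∀ t ∈ J, MemL2 a b (fun x => w x t)) ∧
    ∀ t₀ ∈ J, Tendsto (fun t => ∫ x in Ioo a b, (w x t - w x t₀) ^ 2)
      (nhdsWithin t₀ J) (nhds 0)

/-- The regularity class (R_T):  `u ∈ C⁰([0,T];W₀^{1,2})`, `u_t ∈ C⁰([0,T];L²)`,
`Θ ∈ C⁰([0,T];L²) ∩ L²((0,T);W^{1,2})`. -/
structure RegT (a b T : ℝ) (u ut ux Θ Θx : ℝ → ℝ → ℝ) : Prop where
  u_cont : ContL2 a b (Icc 0 T) u
  ux_cont : ContL2 a b (Icc 0 T) ux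
  u_W0 : ∀ t ∈ Icc (0 : ℝ) T, WeakDerivZ a b (fun x => u x t) (fun x => ux x t)
  ut_cont : ContL2 a b (Icc 0 T) ut
  Θ_cont : ContL2 a b (Icc 0 T) Θ
  Θ_sq_int : IntegrableOn (fun p : ℝ × ℝ => (Θ p.1 p.2) ^ 2) ((Ioo a b) ×ˢ (Ioo 0 T))
  Θx_sq_int : IntegrableOn (fun p : ℝ × ℝ => (Θx p.1 p.2) ^ 2) ((Ioo a b) ×ˢ (Ioo 0 T))

/-- Data hypothesis (I), with `u0x` the weak derivative of `u0 ∈ W₀^{1,2}(Ω)`. -/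
structure DataI (a b : ℝ) (u0 u0x u0t Θ0 : ℝ → ℝ) : Prop where
  u0_L2 : MemL2 a b u0
  u0x_L2 : MemL2 a b u0x
  u0_W0 : WeakDerivZ a b u0 u0x
  u0t_L2 : MemL2 a b u0t
  Θ0_L2 : MemL2 a b Θ0
  Θ0_nonneg : ∀ᵐ x ∂volume.restrict (Ioo a b), 0 ≤ Θ0 x

/-- Smooth-data hypothesis (I∞). -/
structure SmoothData (a b : ℝ) (v0 u0 Θ0 : ℝ → ℝ) : Prop where
  v0_smooth : ContDiff ℝ (⊤ : ℕ∞) v0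
  v0_supp : ∃ K : Set ℝ, IsCompact K ∧ K ⊆ Ioo a b ∧ ∀ x, x ∉ K → v0 x = 0
  u0_smooth : ContDiff ℝ (⊤ : ℕ∞) u0
  u0_supp : ∃ K : Set ℝ, IsCompact K ∧ K ⊆ Ioo a b ∧ ∀ x, x ∉ K → u0 x = 0
  Θ0_smooth : ContDiff ℝ (⊤ : ℕ∞) Θ0
  Θ0_pos : ∀ x ∈ Icc a b, 0 < Θ0 x
  Θ0x_supp : ∃ K : Set ℝ, IsCompact K ∧ K ⊆ Ioo a b ∧ ∀ x, x ∉ K → deriv Θ0 x = 0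

/-- Classical solution of the regularized problem (P_ε), of class
`C^{4,1} × C^{2,1} × C^{2,1}(Ω̄ × [0,∞))`, with positive temperature. -/
structure IsClassicalSolEps (a b : ℝ) (f : ℝ → ℝ) (ε : ℝ) (v0 u0 Θ0 : ℝ → ℝ)
    (v u Θ : ℝ → ℝ → ℝ) : Prop where
  diffx_v : ∀ k < 4, ∀ x ∈ Icc a b, ∀ t ∈ Ici (0 : ℝ),
    DifferentiableAt ℝ (fun y => pdx^[k] v y t) x
  difft_v : ∀ x ∈ Icc a b, ∀ t ∈ Ici (0 : ℝ), DifferentiableAt ℝ (fun s => v x s) t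
  cont_v : ∀ k ≤ 4, ContinuousOn (uncurry (pdx^[k] v)) ((Icc a b) ×ˢ (Ici 0))
  contt_v : ContinuousOn (uncurry (pdt v)) ((Icc a b) ×ˢ (Ici 0))
  diffx_u : ∀ k < 2, ∀ x ∈ Icc a b, ∀ t ∈ Ici (0 : ℝ),
    DifferentiableAt ℝ (fun y => pdx^[k] u y t) x
  difft_u : ∀ x ∈ Icc a b, ∀ t ∈ Ici (0 : ℝ), DifferentiableAt ℝ (fun s => u x s) t
  cont_u : ∀ k ≤ 2, ContinuousOn (uncurry (pdx^[k] u)) ((Icc a b) ×ˢ (Ici 0))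
  contt_u : ContinuousOn (uncurry (pdt u)) ((Icc a b) ×ˢ (Ici 0))
  diffx_Θ : ∀ k < 2, ∀ x ∈ Icc a b, ∀ t ∈ Ici (0 : ℝ),
    DifferentiableAt ℝ (fun y => pdx^[k] Θ y t) x
  difft_Θ : ∀ x ∈ Icc a b, ∀ t ∈ Ici (0 : ℝ), DifferentiableAt ℝ (fun s => Θ x s) t
  cont_Θ : ∀ k ≤ 2, ContinuousOn (uncurry (pdx^[k] Θ)) ((Icc a b) ×ˢ (Ici 0))
  contt_Θ : ContinuousOn (uncurry (pdt Θ)) ((Icc a b) ×ˢ (Ici 0))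
  Θ_pos : ∀ x ∈ Icc a b, ∀ t ∈ Ici (0 : ℝ), 0 < Θ x t
  eq_v : ∀ x ∈ Ioo a b, ∀ t ∈ Ioi (0 : ℝ),
    pdt v x t = -ε * pdx^[4] v x t + pdx^[2] u x t - pdx (fun y s => f (Θ y s)) x t
  eq_u : ∀ x ∈ Ioo a b, ∀ t ∈ Ioi (0 : ℝ), pdt u x t = ε * pdx^[2] u x t + v x t
  eq_Θ : ∀ x ∈ Ioo a b, ∀ t ∈ Ioi (0 : ℝ),
    pdt Θ x t = pdx^[2] Θ x t - f (Θ x t) * pdx v x t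
  bc_v : ∀ t ∈ Ioi (0 : ℝ),
    v a t = 0 ∧ v b t = 0 ∧ pdx^[2] v a t = 0 ∧ pdx^[2] v b t = 0
  bc_u : ∀ t ∈ Ioi (0 : ℝ), u a t = 0 ∧ u b t = 0
  bc_Θ : ∀ t ∈ Ioi (0 : ℝ), pdx Θ a t = 0 ∧ pdx Θ b t = 0
  init : ∀ x ∈ Icc a b, v x 0 = v0 x ∧ u x 0 = u0 x ∧ Θ x 0 = Θ0 x

/-- Weak convergence in `L²_loc(Ω̄ × [0,∞))`. -/
def WkL2loc (a b : ℝ) (wj : ℕ → ℝ → ℝ → ℝ) (w : ℝ → ℝ → ℝ) : Prop :=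
  ∀ T > (0 : ℝ), ∀ ψ : ℝ → ℝ → ℝ,
    AEStronglyMeasurable (fun p : ℝ × ℝ => ψ p.1 p.2)
      (volume.restrict ((Icc a b) ×ˢ (Icc 0 T))) →
    IntegrableOn (fun p : ℝ × ℝ => (ψ p.1 p.2) ^ 2) ((Icc a b) ×ˢ (Icc 0 T)) →
    Tendsto (fun j => ∫ p in (Icc a b) ×ˢ (Icc 0 T), wj j p.1 p.2 * ψ p.1 p.2) atTop
      (nhds (∫ p in (Icc a b) ×ˢ (Icc 0 T), w p.1 p.2 * ψ p.1 p.2))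

set_option linter.unusedSectionVars false

namespace TE
open scoped InnerProductSpace ENNReal Topology

section

/-- Lebesgue measure on `(a,b)`. -/
abbrev mu (a b : ℝ) : Measure ℝ := volume.restrict (Ioo a b)

/-- The Hilbert space `L²(a,b)`. -/
abbrev HS (a b : ℝ) := Lp ℝ 2 (mu a b)

/-- The frequency `nπ/(b-a)`. -/
def kf (a b : ℝ) (n : ℕ) : ℝ := n * Real.pi / (b - a)

lemma kf_zero (a b : ℝ) : kf a b 0 = 0 := by simp [kf]

lemma ae_mu_mem (a b : ℝ) : ∀ᵐ x ∂mu a b, x ∈ Ioo a b := ae_restrict_mem measurableSet_Ioo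

lemma integral_mu_eq {a b : ℝ} (hab : a ≤ b) (g : ℝ → ℝ) :
    ∫ x, g x ∂mu a b = ∫ x in a..b, g x := by
  rw [intervalIntegral.integral_of_le hab, integral_Ioc_eq_integral_Ioo]

lemma exists_bound_of_continuous {g : ℝ → ℝ} (hg : Continuous g) (a b : ℝ) :
    ∃ C, ∀ x ∈ Icc a b, |g x| ≤ C := isCompact_Icc.exists_bound_of_continuousOn hg.continuousOn

lemma memLp_of_continuous {g : ℝ → ℝ} (hg : Continuous g) (a b : ℝ) (p : ℝ≥0∞) :
    MemLp g p (mu a b) := by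
  obtain ⟨C, hC⟩ := exists_bound_of_continuous hg a b
  refine MemLp.of_bound hg.aestronglyMeasurable C ?_
  filter_upwards [ae_mu_mem a b] with x hx using hC x (Ioo_subset_Icc_self hx)

lemma integrable_mul_continuous {h g : ℝ → ℝ} {a b : ℝ} (hh : Integrable h (mu a b))
    (hg : Continuous g) : Integrable (fun x => h x * g x) (mu a b) := by
  obtain ⟨C, hC⟩ := exists_bound_of_continuous hg a b
  refine hh.mul_bdd (c := C) hg.aestronglyMeasurable ?_
  filter_upwards [ae_mu_mem a b] with x hx using hC x (Ioo_subset_Icc_self hx)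

lemma integral_cos_freq {a b : ℝ} (hab : a < b) (m : ℤ) (hm : m ≠ 0) :
    ∫ x, Real.cos (m * Real.pi / (b - a) * (x - a)) ∂mu a b = 0 := by
  rw [integral_mu_eq hab.le]
  have hL : b - a ≠ 0 := (sub_pos.2 hab).ne'
  set α : ℝ := m * Real.pi / (b - a) with hα
  have hα0 : α ≠ 0 := by
    have : (m : ℝ) ≠ 0 := by exact_mod_cast hm
    positivity
  have h1 : ∀ x ∈ uIcc a b, HasDerivAt (fun x => Real.sin (α * (x - a)) / α)
      (Real.cos (α * (x - a))) x := by
    intro x _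
    have := (((hasDerivAt_id x).sub_const a).const_mul α).sin.div_const α
    refine this.congr_deriv ?_
    field_simp; simp
  rw [intervalIntegral.integral_eq_sub_of_hasDerivAt h1
    (Continuous.intervalIntegrable (by fun_prop) _ _)]
  have : α * (b - a) = m * Real.pi := by rw [hα]; field_simp
  simp [this, Real.sin_int_mul_pi]

lemma integral_one_mu {a b : ℝ} (hab : a < b) : ∫ _x, (1 : ℝ) ∂mu a b = b - a := by
  rw [integral_mu_eq hab.le]; simp

lemma kf_sub (a b : ℝ) (n m : ℕ) (x : ℝ) : kf a b n * (x - a) - kf a b m * (x - a) =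
    ((n - m : ℤ) : ℝ) * Real.pi / (b - a) * (x - a) := by
  simp only [kf]; push_cast; ring

lemma kf_add (a b : ℝ) (n m : ℕ) (x : ℝ) : kf a b n * (x - a) + kf a b m * (x - a) =
    ((n + m : ℤ) : ℝ) * Real.pi / (b - a) * (x - a) := by
  simp only [kf]; push_cast; ring

lemma integral_cos_mul_cos {a b : ℝ} (hab : a < b) (n m : ℕ) :
    ∫ x, Real.cos (kf a b n * (x - a)) * Real.cos (kf a b m * (x - a)) ∂mu a b =
      if n = m then (if n = 0 then b - a else (b - a) / 2) else 0 := by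
  have h1 : ∀ x, Real.cos (kf a b n * (x - a)) * Real.cos (kf a b m * (x - a)) =
      (1 / 2) * (Real.cos (((n - m : ℤ) : ℝ) * Real.pi / (b - a) * (x - a)) +
        Real.cos (((n + m : ℤ) : ℝ) * Real.pi / (b - a) * (x - a))) := by
    intro x
    rw [← kf_sub, ← kf_add, Real.cos_sub, Real.cos_add]; ring
  simp_rw [h1]
  rw [integral_const_mul, integral_add ((memLp_of_continuous (by fun_prop) a b 1).integrable le_rfl)
    ((memLp_of_continuous (by fun_prop) a b 1).integrable le_rfl)]
  by_cases hnm : n = m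
  · subst hnm
    by_cases hn : n = 0
    · subst hn; simp [integral_one_mu hab]; linarith
    · rw [integral_cos_freq hab ((n + n : ℤ)) (by omega)]
      simp [integral_one_mu hab, hn]; linarith
  · rw [integral_cos_freq hab _ (by omega), integral_cos_freq hab _ (by omega)]; simp [hnm]

lemma integral_sin_mul_sin {a b : ℝ} (hab : a < b) (n m : ℕ) :
    ∫ x, Real.sin (kf a b (n + 1) * (x - a)) * Real.sin (kf a b (m + 1) * (x - a)) ∂mu a b =
      if n = m then (b - a) / 2 else 0 := by
  have h1 : ∀ x, Real.sin (kf a b (n + 1) * (x - a)) * Real.sin (kf a b (m + 1) * (x - a)) =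
      (1 / 2) * (Real.cos ((((n + 1 : ℕ) - (m + 1 : ℕ) : ℤ) : ℝ) * Real.pi / (b - a) * (x - a)) -
        Real.cos ((((n + 1 : ℕ) + (m + 1 : ℕ) : ℤ) : ℝ) * Real.pi / (b - a) * (x - a))) := by
    intro x
    rw [← kf_sub, ← kf_add, Real.cos_sub, Real.cos_add]; ring
  simp_rw [h1]
  rw [integral_const_mul, integral_sub ((memLp_of_continuous (by fun_prop) a b 1).integrable le_rfl)
    ((memLp_of_continuous (by fun_prop) a b 1).integrable le_rfl)]
  by_cases hnm : n = m
  · subst hnm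
    rw [integral_cos_freq hab (((n + 1 : ℕ) + (n + 1 : ℕ) : ℤ)) (by omega)]
    simp [integral_one_mu hab]; linarith
  · rw [integral_cos_freq hab _ (by omega), integral_cos_freq hab _ (by omega)]; simp [hnm]

lemma integral_mul_cos_pow_eq_zero {a b : ℝ} {h : ℝ → ℝ} (hh : Integrable h (mu a b))
    (H : ∀ n : ℕ, ∫ x, h x * Real.cos (kf a b n * (x - a)) ∂mu a b = 0) (j : ℕ) :
    ∀ n : ℕ, ∫ x, h x * (Real.cos (kf a b 1 * (x - a)) ^ j * Real.cos (kf a b n * (x - a)))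
      ∂mu a b = 0 := by
  induction j with
  | zero => intro n; simpa using H n
  | succ j ih =>
    intro n
    rcases n with _ | n
    · have := ih 1
      simpa [kf_zero, pow_succ] using this
    · have h1 : ∀ x, h x * (Real.cos (kf a b 1 * (x - a)) ^ (j + 1) *
          Real.cos (kf a b (n + 1) * (x - a))) =
          (1 / 2) * (h x * (Real.cos (kf a b 1 * (x - a)) ^ j * Real.cos (kf a b (n + 2) * (x - a)))
            + h x * (Real.cos (kf a b 1 * (x - a)) ^ j * Real.cos (kf a b n * (x - a)))) := by
        intro x
        have e1 : kf a b (n + 2) * (x - a) = kf a b (n + 1) * (x - a) + kf a b 1 * (x - a) := by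
          simp only [kf]; push_cast; ring
        have e2 : kf a b n * (x - a) = kf a b (n + 1) * (x - a) - kf a b 1 * (x - a) := by
          simp only [kf]; push_cast; ring
        rw [e1, e2, Real.cos_add, Real.cos_sub]; ring
      simp_rw [h1]
      rw [integral_const_mul, integral_add (integrable_mul_continuous hh (by fun_prop))
        (integrable_mul_continuous hh (by fun_prop)), ih, ih]
      simp

lemma integral_mul_polynomial_cos_eq_zero {a b : ℝ} {h : ℝ → ℝ} (hh : Integrable h (mu a b))
    (H : ∀ n : ℕ, ∫ x, h x * Real.cos (kf a b n * (x - a)) ∂mu a b = 0) (p : Polynomial ℝ) :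
    ∫ x, h x * p.eval (Real.cos (kf a b 1 * (x - a))) ∂mu a b = 0 := by
  have hc : ∀ q : Polynomial ℝ, Integrable
      (fun x => h x * q.eval (Real.cos (kf a b 1 * (x - a)))) (mu a b) := fun q =>
    integrable_mul_continuous hh (q.continuous.comp (by fun_prop))
  induction p using Polynomial.induction_on' with
  | add p q hp hq =>
    simp only [Polynomial.eval_add, mul_add]
    rw [integral_add (hc p) (hc q), hp, hq, add_zero]
  | monomial j c =>
    have := integral_mul_cos_pow_eq_zero hh H j 0
    simp only [kf_zero, zero_mul, Real.cos_zero, mul_one] at this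
    simp only [Polynomial.eval_monomial]
    simp_rw [mul_left_comm _ c]
    rw [integral_const_mul, this, mul_zero]

lemma integral_mul_continuous_eq_zero {a b : ℝ} (hab : a < b) {h : ℝ → ℝ}
    (hh : Integrable h (mu a b))
    (H : ∀ n : ℕ, ∫ x, h x * Real.cos (kf a b n * (x - a)) ∂mu a b = 0) {φ : ℝ → ℝ}
    (hφ : Continuous φ) : ∫ x, h x * φ x ∂mu a b = 0 := by
  have hL : 0 < b - a := sub_pos.2 hab
  set ψ : ℝ → ℝ := fun y => φ (a + (b - a) / Real.pi * Real.arccos y) with hψ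
  have hψc : ContinuousOn ψ (Icc (-1) 1) := by
    apply Continuous.continuousOn
    have := Real.continuous_arccos
    fun_prop
  have hkey : ∀ x ∈ Ioo a b, φ x = ψ (Real.cos (kf a b 1 * (x - a))) := by
    intro x hx
    simp only [hψ, kf]
    rw [Real.arccos_cos]
    · congr 1
      have := Real.pi_pos.ne'
      push_cast
      field_simp; ring
    · have := hx.1
      have : 0 < x - a := by linarith
      positivity
    · push_cast
      rw [one_mul, div_mul_eq_mul_div, div_le_iff₀ hL]
      have := Real.pi_pos
      have := hx.2
      nlinarith
  have hle : ∀ ε > 0, |∫ x, h x * φ x ∂mu a b| ≤ ε * ∫ x, |h x| ∂mu a b := by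
    intro ε hε
    obtain ⟨p, hp⟩ := exists_polynomial_near_of_continuousOn (-1) 1 ψ hψc ε hε
    have h0 := integral_mul_polynomial_cos_eq_zero hh H p
    have hpi : Integrable (fun x => h x * p.eval (Real.cos (kf a b 1 * (x - a)))) (mu a b) :=
      integrable_mul_continuous hh (p.continuous.comp (by fun_prop))
    rw [← sub_zero (∫ x, h x * φ x ∂mu a b), ← h0,
      ← integral_sub (integrable_mul_continuous hh hφ) hpi, ← integral_const_mul,
      ← Real.norm_eq_abs]
    refine norm_integral_le_of_norm_le (hh.abs.const_mul ε) ?_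
    filter_upwards [ae_mu_mem a b] with x hx
    rw [← mul_sub, norm_mul, mul_comm, hkey x hx, Real.norm_eq_abs, Real.norm_eq_abs, abs_sub_comm]
    gcongr
    exact (hp _ ⟨Real.neg_one_le_cos _, Real.cos_le_one _⟩).le
  by_contra hne
  have hpos := abs_pos.2 hne
  have hI : 0 ≤ ∫ x, |h x| ∂mu a b := integral_nonneg fun x => abs_nonneg _
  have := hle (|∫ x, h x * φ x ∂mu a b| / (2 * ((∫ x, |h x| ∂mu a b) + 1))) (by positivity)
  rw [div_mul_eq_mul_div, le_div_iff₀ (by positivity)] at this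
  nlinarith

lemma ae_eq_zero_of_integral_contDiff {a b : ℝ} {h : ℝ → ℝ} (hh : Integrable h (mu a b))
    (H : ∀ φ : ℝ → ℝ, ContDiff ℝ (⊤ : ℕ∞) φ → tsupport φ ⊆ Ioo a b →
      ∫ x, h x * φ x ∂mu a b = 0) : h =ᵐ[mu a b] 0 := by
  have := isOpen_Ioo.ae_eq_zero_of_integral_contDiff_smul_eq_zero (U := Ioo a b) (μ := volume)
    (f := h) (IntegrableOn.locallyIntegrableOn hh) ?_
  · exact (ae_restrict_iff' measurableSet_Ioo).2 this
  · intro g hg _ hgs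
    rw [← setIntegral_eq_integral_of_forall_compl_eq_zero (s := Ioo a b)]
    · rw [← H g hg hgs]
      simp [mul_comm]
    · intro x hx
      rw [image_eq_zero_of_notMem_tsupport (fun h => hx (hgs h)), zero_smul]

lemma ae_eq_zero_of_cos {a b : ℝ} (hab : a < b) {h : ℝ → ℝ} (hh : Integrable h (mu a b))
    (H : ∀ n : ℕ, ∫ x, h x * Real.cos (kf a b n * (x - a)) ∂mu a b = 0) : h =ᵐ[mu a b] 0 :=
  ae_eq_zero_of_integral_contDiff hh fun _ hφ _ =>
    integral_mul_continuous_eq_zero hab hh H hφ.continuous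

lemma ae_eq_zero_of_sin {a b : ℝ} (hab : a < b) {h : ℝ → ℝ} (hh : Integrable h (mu a b))
    (H : ∀ n : ℕ, ∫ x, h x * Real.sin (kf a b (n + 1) * (x - a)) ∂mu a b = 0) :
    h =ᵐ[mu a b] 0 := by
  have H' : ∀ n : ℕ, ∫ x, h x * Real.sin (kf a b n * (x - a)) ∂mu a b = 0 := by
    intro n
    rcases n with _ | n
    · simp [kf_zero]
    · exact H n
  have h2 : (fun x => h x * Real.sin (kf a b 1 * (x - a))) =ᵐ[mu a b] 0 := by
    refine ae_eq_zero_of_cos hab (integrable_mul_continuous hh (by fun_prop)) fun n => ?_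
    rcases n with _ | n
    · simpa [kf_zero] using H' 1
    have h1 : ∀ x, h x * Real.sin (kf a b 1 * (x - a)) * Real.cos (kf a b (n + 1) * (x - a)) =
        (1 / 2) * (h x * Real.sin (kf a b (n + 2) * (x - a))
          - h x * Real.sin (kf a b n * (x - a))) := by
      intro x
      have e1 : kf a b (n + 2) * (x - a) = kf a b (n + 1) * (x - a) + kf a b 1 * (x - a) := by
        simp only [kf]; push_cast; ring
      have e2 : kf a b n * (x - a) = kf a b (n + 1) * (x - a) - kf a b 1 * (x - a) := by
        simp only [kf]; push_cast; ring
      rw [e1, e2, Real.sin_add, Real.sin_sub]; ring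
    simp_rw [h1]
    rw [integral_const_mul, integral_sub (integrable_mul_continuous hh (by fun_prop))
      (integrable_mul_continuous hh (by fun_prop)), H', H']
    simp
  filter_upwards [h2, ae_mu_mem a b] with x hx hxm
  rcases mul_eq_zero.1 hx with h | h
  · exact h
  · exfalso
    have hL : 0 < b - a := sub_pos.2 hab
    have hx1 : 0 < x - a := sub_pos.2 hxm.1
    refine (Real.sin_pos_of_pos_of_lt_pi ?_ ?_).ne' h
    · simp only [kf]; push_cast; positivity
    · simp only [kf]; push_cast
      rw [one_mul, div_mul_eq_mul_div, div_lt_iff₀ hL]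
      have := hxm.2
      nlinarith [Real.pi_pos]

/-- The `L²(a,b)`-class of a continuous function. -/
def toH (a b : ℝ) (g : ℝ → ℝ) (hg : Continuous g) : HS a b := (memLp_of_continuous hg a b 2).toLp g

lemma coeFn_toH {a b : ℝ} {g : ℝ → ℝ} (hg : Continuous g) : toH a b g hg =ᵐ[mu a b] g :=
  MemLp.coeFn_toLp _

lemma inner_HS {a b : ℝ} (g h : HS a b) : ⟪g, h⟫_ℝ = ∫ x, g x * h x ∂mu a b := by
  rw [L2.inner_def]
  simp [mul_comm]

lemma integrable_mul_HS {a b : ℝ} (g h : HS a b) : Integrable (fun x => g x * h x) (mu a b) :=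
  (Lp.memLp g).integrable_mul (Lp.memLp h)

lemma integrable_HS {a b : ℝ} (g : HS a b) : Integrable g (mu a b) :=
  (Lp.memLp g).integrable (by norm_num)

lemma inner_toH {a b : ℝ} (h : HS a b) {g : ℝ → ℝ} (hg : Continuous g) :
    ⟪toH a b g hg, h⟫_ℝ = ∫ x, h x * g x ∂mu a b := by
  rw [inner_HS]
  refine integral_congr_ae ?_
  filter_upwards [coeFn_toH (a := a) (b := b) hg] with x hx
  rw [hx, mul_comm]

lemma inner_toH_toH {a b : ℝ} {g h : ℝ → ℝ} (hg : Continuous g) (hh : Continuous h) :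
    ⟪toH a b g hg, toH a b h hh⟫_ℝ = ∫ x, h x * g x ∂mu a b := by
  rw [inner_toH]
  refine integral_congr_ae ?_
  filter_upwards [coeFn_toH (a := a) (b := b) hh] with x hx
  rw [hx]

/-- Normalization of the cosine functions. -/
def cA (a b : ℝ) (n : ℕ) : ℝ := if n = 0 then √(1 / (b - a)) else √(2 / (b - a))

/-- Normalized cosine functions. -/
def cosF (a b : ℝ) (n : ℕ) (x : ℝ) : ℝ := cA a b n * Real.cos (kf a b n * (x - a))

/-- Normalized sine functions. -/
def sinF (a b : ℝ) (n : ℕ) (x : ℝ) : ℝ := √(2 / (b - a)) * Real.sin (kf a b (n + 1) * (x - a))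

@[fun_prop] lemma continuous_cosF (a b : ℝ) (n : ℕ) : Continuous (cosF a b n) := by
  unfold cosF; fun_prop

@[fun_prop] lemma continuous_sinF (a b : ℝ) (n : ℕ) : Continuous (sinF a b n) := by
  unfold sinF; fun_prop

lemma contDiff_cosF (a b : ℝ) (n : ℕ) : ContDiff ℝ (⊤ : ℕ∞) (cosF a b n) := by
  unfold cosF
  exact contDiff_const.mul (Real.contDiff_cos.comp (by fun_prop))

lemma hasDerivAt_sinF (a b : ℝ) (n : ℕ) (x : ℝ) :
    HasDerivAt (sinF a b n) (kf a b (n + 1) * cosF a b (n + 1) x) x := by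
  have := (((hasDerivAt_id x).sub_const a).const_mul (kf a b (n + 1))).sin.const_mul
    √(2 / (b - a))
  refine this.congr_deriv ?_
  simp [cosF, cA]; ring

lemma hasDerivAt_cosF_succ (a b : ℝ) (n : ℕ) (x : ℝ) :
    HasDerivAt (cosF a b (n + 1)) (-kf a b (n + 1) * sinF a b n x) x := by
  have := (((hasDerivAt_id x).sub_const a).const_mul (kf a b (n + 1))).cos.const_mul
    √(2 / (b - a))
  have h2 : cosF a b (n + 1) = fun x => √(2 / (b - a)) * Real.cos
      (kf a b (n + 1) * (id x - a)) := by
    funext x; simp [cosF, cA]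
  rw [h2]
  refine this.congr_deriv ?_
  simp [sinF]; ring

lemma cosF_zero (a b x : ℝ) : cosF a b 0 x = √(1 / (b - a)) := by simp [cosF, cA, kf_zero]

/-- Cosine basis vector. -/
def cosH (a b : ℝ) (n : ℕ) : HS a b := toH a b (cosF a b n) (by fun_prop)
/-- Sine basis vector. -/
def sinH (a b : ℝ) (n : ℕ) : HS a b := toH a b (sinF a b n) (by fun_prop)

lemma inner_cosH (a b : ℝ) (n : ℕ) (h : HS a b) : ⟪cosH a b n, h⟫_ℝ =
    ∫ x, h x * cosF a b n x ∂mu a b :=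
  inner_toH _ _

lemma inner_sinH (a b : ℝ) (n : ℕ) (h : HS a b) : ⟪sinH a b n, h⟫_ℝ =
    ∫ x, h x * sinF a b n x ∂mu a b :=
  inner_toH _ _

section
variable (a b : ℝ) [hab : Fact (a < b)]

lemma orthonormal_cosH : Orthonormal ℝ (cosH a b) := by
  have hL : 0 < b - a := sub_pos.2 hab.out
  rw [orthonormal_iff_ite]
  intro n m
  rw [cosH, cosH, inner_toH_toH]
  have : ∀ x, cosF a b m x * cosF a b n x = (cA a b n * cA a b m) *
      (Real.cos (kf a b n * (x - a)) * Real.cos (kf a b m * (x - a))) := by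
    intro x; simp only [cosF]; ring
  simp_rw [this]
  rw [integral_const_mul, integral_cos_mul_cos hab.out]
  split_ifs with h1 h2
  · subst h1; subst h2
    simp only [cA, if_true]
    rw [Real.mul_self_sqrt (by positivity)]; field_simp
  · subst h1
    simp only [cA, h2, if_false]
    rw [Real.mul_self_sqrt (by positivity)]; field_simp
  · simp

lemma orthonormal_sinH : Orthonormal ℝ (sinH a b) := by
  have hL : 0 < b - a := sub_pos.2 hab.out
  rw [orthonormal_iff_ite]
  intro n m
  rw [sinH, sinH, inner_toH_toH]
  have : ∀ x, sinF a b m x * sinF a b n x = (√(2 / (b - a)) * √(2 / (b - a))) *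
      (Real.sin (kf a b (n + 1) * (x - a)) * Real.sin (kf a b (m + 1) * (x - a))) := by
    intro x; simp only [sinF]; ring
  simp_rw [this]
  rw [integral_const_mul, integral_sin_mul_sin hab.out, Real.mul_self_sqrt (by positivity)]
  split_ifs with h1
  · field_simp
  · simp

lemma cA_pos (n : ℕ) : 0 < cA a b n := by
  have hL : 0 < b - a := sub_pos.2 hab.out
  unfold cA; split_ifs <;> positivity

lemma cosH_total : (Submodule.span ℝ (range (cosH a b)))ᗮ = ⊥ := by
  rw [Submodule.eq_bot_iff]
  intro h hh
  rw [Submodule.mem_orthogonal] at hh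
  rw [Lp.eq_zero_iff_ae_eq_zero]
  refine ae_eq_zero_of_cos hab.out (integrable_HS h) fun n => ?_
  have := hh (cosH a b n) (Submodule.subset_span ⟨n, rfl⟩)
  rw [inner_cosH] at this
  simp only [cosF] at this
  simp_rw [mul_left_comm _ (cA a b n)] at this
  rw [integral_const_mul] at this
  exact (mul_eq_zero.1 this).resolve_left (cA_pos a b n).ne'

lemma sinH_total : (Submodule.span ℝ (range (sinH a b)))ᗮ = ⊥ := by
  rw [Submodule.eq_bot_iff]
  intro h hh
  rw [Submodule.mem_orthogonal] at hh
  rw [Lp.eq_zero_iff_ae_eq_zero]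
  refine ae_eq_zero_of_sin hab.out (integrable_HS h) fun n => ?_
  have := hh (sinH a b n) (Submodule.subset_span ⟨n, rfl⟩)
  rw [inner_sinH] at this
  simp only [sinF] at this
  simp_rw [mul_left_comm _ √(2 / (b - a))] at this
  rw [integral_const_mul] at this
  have hL : 0 < b - a := sub_pos.2 hab.out
  exact (mul_eq_zero.1 this).resolve_left (by positivity)

/-- The cosine Hilbert basis. -/
def cosB : HilbertBasis ℕ ℝ (HS a b) :=
  HilbertBasis.mkOfOrthogonalEqBot (orthonormal_cosH a b) (cosH_total a b)

/-- The sine Hilbert basis. -/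
def sinB : HilbertBasis ℕ ℝ (HS a b) :=
  HilbertBasis.mkOfOrthogonalEqBot (orthonormal_sinH a b) (sinH_total a b)

lemma cosB_apply (n : ℕ) : cosB a b n = cosH a b n := by
  simp [cosB]

lemma sinB_apply (n : ℕ) : sinB a b n = sinH a b n := by
  simp [sinB]

end

end

section

section generic
variable {E : Type*} [NormedAddCommGroup E] [InnerProductSpace ℝ E]

lemma hasSum_sq_inner (B : HilbertBasis ℕ ℝ E) (h : E) :
    HasSum (fun n => ⟪B n, h⟫_ℝ ^ 2) (‖h‖ ^ 2) := by
  have := B.hasSum_inner_mul_inner h h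
  rw [real_inner_self_eq_norm_sq] at this
  refine this.congr_fun fun n => ?_
  rw [real_inner_comm h, sq]

lemma ext_basis (B : HilbertBasis ℕ ℝ E) {g h : E} (H : ∀ n, ⟪B n, g⟫_ℝ = ⟪B n, h⟫_ℝ) : g = h := by
  apply B.repr.injective
  ext n
  rw [B.repr_apply_apply, B.repr_apply_apply, H]

lemma exists_of_summable_sq (B : HilbertBasis ℕ ℝ E) {c : ℕ → ℝ} (hc : Summable fun n => c n ^ 2) :
    ∃ h : E, ∀ n, ⟪B n, h⟫_ℝ = c n := by
  have hm : Memℓp c 2 := by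
    refine memℓp_gen ?_
    simpa using hc
  refine ⟨B.repr.symm ⟨c, hm⟩, fun n => ?_⟩
  rw [← B.repr_apply_apply]
  simp

lemma inner_sum_basis (B : HilbertBasis ℕ ℝ E) (c : ℕ → ℝ) (N m : ℕ) :
    ⟪B m, ∑ n ∈ Finset.range N, c n • B n⟫_ℝ = if m < N then c m else 0 := by
  rw [inner_sum]
  have h1 : ∀ n, ⟪B m, c n • B n⟫_ℝ = if m = n then c m else 0 := by
    intro n
    rw [real_inner_smul_right, orthonormal_iff_ite.1 B.orthonormal]
    split_ifs with h
    · subst h; simp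
    · simp
  simp_rw [h1]
  simp

/-- If `|⟪B n, g⟫| ≤ |⟪B n, h⟫|` for all `n` then `‖g‖ ≤ ‖h‖`. -/
lemma norm_le_of_coef_le (B : HilbertBasis ℕ ℝ E) {g h : E}
    (H : ∀ n, ⟪B n, g⟫_ℝ ^ 2 ≤ ⟪B n, h⟫_ℝ ^ 2) : ‖g‖ ≤ ‖h‖ := by
  have := hasSum_le H (hasSum_sq_inner B g) (hasSum_sq_inner B h)
  exact (sq_le_sq₀ (norm_nonneg _) (norm_nonneg _)).1 this

lemma tendsto_sum_basis (B : HilbertBasis ℕ ℝ E) (h : E) :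
    Tendsto (fun N => ∑ n ∈ Finset.range N, ⟪B n, h⟫_ℝ • B n) atTop (𝓝 h) := by
  have := (B.hasSum_repr h).tendsto_sum_nat
  simpa only [B.repr_apply_apply] using this

end generic

section
variable {a b : ℝ}

/-- `h'` is the weak derivative of `h`, expressed in Fourier coefficients. -/
def HasD (h h' : HS a b) : Prop :=
  ∀ n, ⟪sinH a b n, h'⟫_ℝ = -kf a b (n + 1) * ⟪cosH a b (n + 1), h⟫_ℝ

/-- Membership in `W^{1,2}(a,b)`. -/
def InV (h : HS a b) : Prop := ∃ h', HasD h h'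

open Classical in
/-- The weak derivative (zero outside of `W^{1,2}`). -/
def Dx (h : HS a b) : HS a b := if H : InV h then H.choose else 0

lemma HasD.add {h h' g g' : HS a b} (H : HasD h h') (G : HasD g g') : HasD (h + g) (h' + g') := by
  intro n; rw [inner_add_right, inner_add_right, H n, G n]; ring

lemma HasD.sub {h h' g g' : HS a b} (H : HasD h h') (G : HasD g g') : HasD (h - g) (h' - g') := by
  intro n; rw [inner_sub_right, inner_sub_right, H n, G n]; ring

lemma HasD.smul {h h' : HS a b} (c : ℝ) (H : HasD h h') : HasD (c • h) (c • h') := by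
  intro n; rw [real_inner_smul_right, real_inner_smul_right, H n]; ring

lemma hasD_zero : HasD (0 : HS a b) 0 := by intro n; simp

lemma HasD.inV {h h' : HS a b} (H : HasD h h') : InV h := ⟨h', H⟩

lemma InV.hasD {h : HS a b} (H : InV h) : HasD h (Dx h) := by
  rw [Dx, dif_pos H]; exact H.choose_spec

lemma InV.sub {h g : HS a b} (H : InV h) (G : InV g) : InV (h - g) := (H.hasD.sub G.hasD).inV
lemma InV.add {h g : HS a b} (H : InV h) (G : InV g) : InV (h + g) := (H.hasD.add G.hasD).inV
lemma InV.smul {h : HS a b} (c : ℝ) (H : InV h) : InV (c • h) := (H.hasD.smul c).inV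
lemma inV_zero : InV (0 : HS a b) := hasD_zero.inV
end

section
variable {a b : ℝ} [hab : Fact (a < b)]

lemma hasSum_sq_cos (h : HS a b) : HasSum (fun n => ⟪cosH a b n, h⟫_ℝ ^ 2) (‖h‖ ^ 2) := by
  simpa only [cosB_apply] using hasSum_sq_inner (cosB a b) h

lemma hasSum_sq_sin (h : HS a b) : HasSum (fun n => ⟪sinH a b n, h⟫_ℝ ^ 2) (‖h‖ ^ 2) := by
  simpa only [sinB_apply] using hasSum_sq_inner (sinB a b) h

lemma ext_cos {g h : HS a b} (H : ∀ n, ⟪cosH a b n, g⟫_ℝ = ⟪cosH a b n, h⟫_ℝ) : g = h :=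
  ext_basis (cosB a b) (by simpa only [cosB_apply] using H)

lemma ext_sin {g h : HS a b} (H : ∀ n, ⟪sinH a b n, g⟫_ℝ = ⟪sinH a b n, h⟫_ℝ) : g = h :=
  ext_basis (sinB a b) (by simpa only [sinB_apply] using H)

lemma exists_cos {c : ℕ → ℝ} (hc : Summable fun n => c n ^ 2) :
    ∃ h : HS a b, ∀ n, ⟪cosH a b n, h⟫_ℝ = c n := by
  simpa only [cosB_apply] using exists_of_summable_sq (cosB a b) hc

lemma exists_sin {c : ℕ → ℝ} (hc : Summable fun n => c n ^ 2) :
    ∃ h : HS a b, ∀ n, ⟪sinH a b n, h⟫_ℝ = c n := by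
  simpa only [sinB_apply] using exists_of_summable_sq (sinB a b) hc

lemma HasD.unique {h h' h'' : HS a b} (H : HasD h h') (H' : HasD h h'') : h' = h'' :=
  ext_sin fun n => by rw [H n, H' n]

lemma HasD.eq {h h' : HS a b} (H : HasD h h') : Dx h = h' := H.inV.hasD.unique H

lemma Dx_sub {h g : HS a b} (H : InV h) (G : InV g) : Dx (h - g) = Dx h - Dx g :=
  (H.hasD.sub G.hasD).eq
lemma Dx_add {h g : HS a b} (H : InV h) (G : InV g) : Dx (h + g) = Dx h + Dx g :=
  (H.hasD.add G.hasD).eq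
lemma Dx_smul {h : HS a b} (c : ℝ) (H : InV h) : Dx (c • h) = c • Dx h := (H.hasD.smul c).eq
lemma Dx_zero : Dx (0 : HS a b) = 0 := hasD_zero.eq

lemma InV.hasSum {h : HS a b} (H : InV h) :
    HasSum (fun n => (kf a b n * ⟪cosH a b n, h⟫_ℝ) ^ 2) (‖Dx h‖ ^ 2) := by
  have h1 := hasSum_sq_sin (Dx h)
  have h2 := (hasSum_nat_add_iff' (f := fun n => (kf a b n * ⟪cosH a b n, h⟫_ℝ) ^ 2)
    (g := ‖Dx h‖ ^ 2) 1).1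
  apply h2
  simp only [Finset.range_one, Finset.sum_singleton, kf_zero, zero_mul, ne_eq, OfNat.ofNat_ne_zero,
    not_false_eq_true, zero_pow, sub_zero]
  refine h1.congr_fun fun n => ?_
  rw [H.hasD n]; ring

lemma inV_of_summable {h : HS a b} (H : Summable fun n => (kf a b n * ⟪cosH a b n, h⟫_ℝ) ^ 2) :
    InV h := by
  have h1 := (summable_nat_add_iff 1).2 H
  obtain ⟨g, hg⟩ := exists_sin (a := a) (b := b)
    (c := fun n => -kf a b (n + 1) * ⟪cosH a b (n + 1), h⟫_ℝ) (h1.congr fun n => by ring)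
  exact ⟨g, hg⟩

/-- The Dirichlet energy `‖h_x‖²` as an extended nonnegative number. -/
def qD (h : HS a b) : ℝ≥0∞ := ∑' n, ENNReal.ofReal ((kf a b n * ⟪cosH a b n, h⟫_ℝ) ^ 2)

lemma InV.qD_eq {h : HS a b} (H : InV h) : qD h = ENNReal.ofReal (‖Dx h‖ ^ 2) := by
  rw [qD, ← H.hasSum.tsum_eq, ENNReal.ofReal_tsum_of_nonneg
      (fun n => sq_nonneg _) H.hasSum.summable]

lemma inV_iff {h : HS a b} : InV h ↔ qD h < ∞ := by
  constructor
  · intro H; rw [H.qD_eq]; exact ENNReal.ofReal_lt_top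
  · intro H
    apply inV_of_summable
    have h1 := ENNReal.summable_toReal (f := fun n =>
      ENNReal.ofReal ((kf a b n * ⟪cosH a b n, h⟫_ℝ) ^ 2)) H.ne
    refine h1.congr fun n => ?_
    rw [ENNReal.toReal_ofReal (sq_nonneg _)]

instance : MeasurableSpace (HS a b) := borel _
instance : BorelSpace (HS a b) := ⟨rfl⟩

lemma measurable_qD : Measurable (qD : HS a b → ℝ≥0∞) := by
  unfold qD
  refine Measurable.tsum fun n => ?_
  apply Measurable.ennreal_ofReal
  exact Continuous.measurable (by fun_prop)

/-- Fourier truncation. -/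
def PN (N : ℕ) (h : HS a b) : HS a b :=
  ∑ n ∈ Finset.range (N + 1), ⟪cosH a b n, h⟫_ℝ • cosH a b n

/-- Derivative of the Fourier truncation. -/
def DN (N : ℕ) (h : HS a b) : HS a b :=
  ∑ n ∈ Finset.range N, (-kf a b (n + 1) * ⟪cosH a b (n + 1), h⟫_ℝ) • sinH a b n

lemma continuous_PN (N : ℕ) : Continuous (PN N : HS a b → HS a b) := by
  unfold PN; fun_prop

lemma continuous_DN (N : ℕ) : Continuous (DN N : HS a b → HS a b) := by
  unfold DN; fun_prop

lemma inner_cosH_PN (N : ℕ) (h : HS a b) (m : ℕ) :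
    ⟪cosH a b m, PN N h⟫_ℝ = if m < N + 1 then ⟪cosH a b m, h⟫_ℝ else 0 := by
  have := inner_sum_basis (cosB a b) (fun n => ⟪cosH a b n, h⟫_ℝ) (N + 1) m
  simp only [cosB_apply] at this
  exact this

lemma inner_sinH_DN (N : ℕ) (h : HS a b) (m : ℕ) :
    ⟪sinH a b m, DN N h⟫_ℝ = if m < N then -kf a b (m + 1) * ⟪cosH a b (m + 1), h⟫_ℝ else 0 := by
  have := inner_sum_basis (sinB a b) (fun n => -kf a b (n + 1) * ⟪cosH a b (n + 1), h⟫_ℝ) N m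
  simp only [sinB_apply] at this
  exact this

lemma hasD_PN (N : ℕ) (h : HS a b) : HasD (PN N h) (DN N h) := by
  intro n
  rw [inner_sinH_DN, inner_cosH_PN]
  by_cases hn : n < N <;> simp [hn]

lemma norm_PN_le (N : ℕ) (h : HS a b) : ‖PN N h‖ ≤ ‖h‖ := by
  refine norm_le_of_coef_le (cosB a b) fun n => ?_
  rw [cosB_apply, inner_cosH_PN]
  split_ifs
  · exact le_rfl
  · simpa using sq_nonneg _

lemma norm_DN_le (N : ℕ) {h : HS a b} (H : InV h) : ‖DN N h‖ ≤ ‖Dx h‖ := by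
  refine norm_le_of_coef_le (sinB a b) fun n => ?_
  rw [sinB_apply, inner_sinH_DN, H.hasD n]
  split_ifs
  · exact le_rfl
  · simpa using sq_nonneg _

lemma tendsto_PN (h : HS a b) : Tendsto (fun N => PN N h) atTop (𝓝 h) := by
  have := (tendsto_sum_basis (cosB a b) h).comp (tendsto_add_atTop_nat 1)
  simp only [cosB_apply] at this
  exact this

lemma tendsto_DN {h : HS a b} (H : InV h) : Tendsto (fun N => DN N h) atTop (𝓝 (Dx h)) := by
  have := tendsto_sum_basis (sinB a b) (Dx h)
  simp only [sinB_apply, H.hasD _] at this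
  exact this

lemma PN_sub (N : ℕ) (g h : HS a b) : PN N (g - h) = PN N g - PN N h := by
  refine ext_cos fun n => ?_
  rw [inner_sub_right]
  simp only [inner_cosH_PN, inner_sub_right]
  split_ifs <;> simp

/-- Pointwise representative of the Fourier truncation. -/
def pF (a b : ℝ) (c : ℕ → ℝ) (N : ℕ) (x : ℝ) : ℝ := ∑ n ∈ Finset.range (N + 1), c n * cosF a b n x

/-- Pointwise derivative of the Fourier truncation. -/
def dF (a b : ℝ) (c : ℕ → ℝ) (N : ℕ) (x : ℝ) : ℝ :=
  ∑ n ∈ Finset.range N, (-kf a b (n + 1) * c (n + 1)) * sinF a b n x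

@[fun_prop] lemma continuous_pF (c : ℕ → ℝ) (N : ℕ) : Continuous (pF a b c N) := by
  unfold pF; fun_prop

@[fun_prop] lemma continuous_dF (c : ℕ → ℝ) (N : ℕ) : Continuous (dF a b c N) := by
  unfold dF; fun_prop

lemma hasDerivAt_pF (c : ℕ → ℝ) (N : ℕ) (x : ℝ) : HasDerivAt (pF a b c N) (dF a b c N x) x := by
  have h1 : pF a b c N = fun x => ∑ n ∈ Finset.range N, c (n + 1) * cosF a b (n + 1) x
      + c 0 * √(1 / (b - a)) := by
    funext x
    rw [pF, Finset.sum_range_succ', cosF_zero]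
  rw [h1, dF]
  have h2 := HasDerivAt.fun_sum (u := Finset.range N) (x := x)
    (A := fun n x => c (n + 1) * cosF a b (n + 1) x)
    (A' := fun n => c (n + 1) * (-kf a b (n + 1) * sinF a b n x))
    (fun n _ => (hasDerivAt_cosF_succ a b n x).const_mul (c (n + 1)))
  refine (h2.add_const _).congr_deriv ?_
  exact Finset.sum_congr rfl fun n _ => by ring

lemma coeFn_sum_smul (c : ℕ → ℝ) (N : ℕ) (e : ℕ → HS a b) (φ : ℕ → ℝ → ℝ)
    (he : ∀ n, e n =ᵐ[mu a b] φ n) :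
    (∑ n ∈ Finset.range N, c n • e n : HS a b) =ᵐ[mu a b]
      fun x => ∑ n ∈ Finset.range N, c n * φ n x := by
  induction N with
  | zero =>
    filter_upwards [Lp.coeFn_zero ℝ 2 (mu a b)] with x hx
    simpa using hx
  | succ N ih =>
    rw [Finset.sum_range_succ]
    filter_upwards [ih, Lp.coeFn_add (∑ n ∈ Finset.range N, c n • e n) (c N • e N),
      Lp.coeFn_smul (c N) (e N), he N] with x h1 h2 h3 h4
    rw [h2, Pi.add_apply, h1, h3, Pi.smul_apply, h4, Finset.sum_range_succ, smul_eq_mul]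

lemma coeFn_PN (N : ℕ) (h : HS a b) :
    PN N h =ᵐ[mu a b] pF a b (fun n => ⟪cosH a b n, h⟫_ℝ) N :=
  coeFn_sum_smul _ _ _ _ fun _ => coeFn_toH _

lemma coeFn_DN (N : ℕ) (h : HS a b) :
    DN N h =ᵐ[mu a b] dF a b (fun n => ⟪cosH a b n, h⟫_ℝ) N :=
  coeFn_sum_smul _ _ _ _ fun _ => coeFn_toH _

lemma norm_sq_HS (h : HS a b) : ‖h‖ ^ 2 = ∫ x, h x ^ 2 ∂mu a b := by
  rw [← real_inner_self_eq_norm_sq, inner_HS]; simp [sq]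

lemma integral_abs_mul_le (g h : HS a b) : ∫ x, |g x * h x| ∂mu a b ≤ ‖g‖ * ‖h‖ := by
  have h1 : ∫ x, |g x * h x| ∂mu a b = ⟪|g|, |h|⟫_ℝ := by
    rw [inner_HS]
    refine integral_congr_ae ?_
    filter_upwards [Lp.coeFn_abs g, Lp.coeFn_abs h] with x h1 h2
    rw [h1, h2, abs_mul]
  rw [h1]
  refine (real_inner_le_norm _ _).trans_eq ?_
  rw [norm_abs_eq_norm, norm_abs_eq_norm]

/-- Sobolev constant. -/
def C0 (a b : ℝ) : ℝ := 1 / (b - a) + 2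

lemma C0_pos : 0 < C0 a b := by
  have : 0 < b - a := sub_pos.2 hab.out
  unfold C0; positivity

lemma sq_pF_le (c : ℕ → ℝ) (N : ℕ) {x : ℝ} (hx : x ∈ Ioo a b) :
    pF a b c N x ^ 2 ≤ 1 / (b - a) * ∫ y, pF a b c N y ^ 2 ∂mu a b
      + 2 * ∫ y, |pF a b c N y * dF a b c N y| ∂mu a b := by
  have hL : 0 < b - a := sub_pos.2 hab.out
  set p := pF a b c N
  set d := dF a b c N
  have hpc : Continuous p := continuous_pF c N
  have hdc : Continuous d := continuous_dF c N
  set I := ∫ y, |p y * d y| ∂mu a b with hI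
  have hxy : ∀ y ∈ Ioo a b, p x ^ 2 ≤ p y ^ 2 + 2 * I := by
    intro y hy
    have h1 : ∫ s in y..x, 2 * (p s * d s) = p x ^ 2 - p y ^ 2 := by
      refine intervalIntegral.integral_eq_sub_of_hasDerivAt (f := fun s => p s ^ 2) (fun s _ => ?_)
        (Continuous.intervalIntegrable (by fun_prop) _ _)
      exact ((hasDerivAt_pF c N s).pow 2).congr_deriv (by simp [p, d]; ring)
    have h2 : |∫ s in y..x, 2 * (p s * d s)| ≤ ∫ s in Ioo a b, |2 * (p s * d s)| := by
      have h3 := intervalIntegral.norm_integral_le_integral_norm_uIoc (μ := volume) (a := y)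
          (b := x)
        (f := fun s => 2 * (p s * d s))
      simp only [Real.norm_eq_abs] at h3
      refine h3.trans (setIntegral_mono_set ?_ (Eventually.of_forall fun s => abs_nonneg _) ?_)
      · exact (memLp_of_continuous (by fun_prop) a b 1).integrable le_rfl
      · refine (LE.le.eventuallyLE ?_)
        intro s hs
        rw [uIoc, mem_Ioc] at hs
        exact ⟨(lt_min hy.1 hx.1).trans hs.1, lt_of_le_of_lt hs.2 (max_lt hy.2 hx.2)⟩
    have h4 : ∫ s in Ioo a b, |2 * (p s * d s)| = 2 * I := by
      rw [hI, ← integral_const_mul]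
      simp [abs_mul]
    have := le_abs_self (∫ s in y..x, 2 * (p s * d s))
    linarith
  have h5 : ∫ _y, p x ^ 2 ∂mu a b ≤ ∫ y, (p y ^ 2 + 2 * I) ∂mu a b := by
    refine integral_mono_ae (integrable_const _)
      ((memLp_of_continuous (by fun_prop) a b 1).integrable le_rfl) ?_
    filter_upwards [ae_mu_mem a b] with y hy using hxy y hy
  rw [integral_add ((memLp_of_continuous (by fun_prop) a b 1).integrable le_rfl)
    (integrable_const _)] at h5
  have h6 : ∀ r : ℝ, ∫ _y, r ∂mu a b = (b - a) * r := by
    intro r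
    simp [hL.le]
  rw [h6, h6] at h5
  have h7 : 1 / (b - a) * ((b - a) * p x ^ 2) ≤
      1 / (b - a) * (∫ y, p y ^ 2 ∂mu a b + (b - a) * (2 * I)) :=
    mul_le_mul_of_nonneg_left h5 (by positivity)
  have e1 : 1 / (b - a) * ((b - a) * p x ^ 2) = p x ^ 2 := by field_simp
  have e2 : 1 / (b - a) * (∫ y, p y ^ 2 ∂mu a b + (b - a) * (2 * I)) =
      1 / (b - a) * ∫ y, p y ^ 2 ∂mu a b + 2 * I := by field_simp
  linarith

/-- Sobolev bound for the supremum of `h`. -/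
def Sb (h : HS a b) : ℝ := √(C0 a b * (‖h‖ * (‖h‖ + ‖Dx h‖)))

lemma Sb_nonneg (h : HS a b) : 0 ≤ Sb h := Real.sqrt_nonneg _

lemma Sb_sq (h : HS a b) : Sb h ^ 2 = C0 a b * (‖h‖ * (‖h‖ + ‖Dx h‖)) := by
  have := C0_pos (a := a) (b := b)
  rw [Sb, Real.sq_sqrt (by positivity)]

lemma exists_subseq_ae {u : ℕ → HS a b} {h : HS a b} (hu : Tendsto u atTop (𝓝 h)) :
    ∃ ns : ℕ → ℕ, StrictMono ns ∧ ∀ᵐ x ∂mu a b, Tendsto (fun i => u (ns i) x) atTop (𝓝 (h x)) :=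
  (tendstoInMeasure_of_tendsto_Lp hu).exists_seq_tendsto_ae

lemma abs_le_Sb {h : HS a b} (H : InV h) : ∀ᵐ x ∂mu a b, |h x| ≤ Sb h := by
  have hL : 0 < b - a := sub_pos.2 hab.out
  obtain ⟨ns, -, hns⟩ := exists_subseq_ae (tendsto_PN h)
  have h1 : ∀ᵐ x ∂mu a b, ∀ N, PN N h x = pF a b (fun n => ⟪cosH a b n, h⟫_ℝ) N x :=
    ae_all_iff.2 fun N => coeFn_PN N h
  filter_upwards [hns, h1, ae_mu_mem a b] with x hx h1x hxm
  refine le_of_tendsto hx.abs (Eventually.of_forall fun i => ?_)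
  rw [Sb]
  apply Real.le_sqrt_of_sq_le
  rw [sq_abs, h1x]
  refine (sq_pF_le _ _ hxm).trans ?_
  set N := ns i
  have e1 : ∫ y, pF a b (fun n => ⟪cosH a b n, h⟫_ℝ) N y ^ 2 ∂mu a b = ‖PN N h‖ ^ 2 := by
    rw [norm_sq_HS]
    refine integral_congr_ae ?_
    filter_upwards [coeFn_PN N h] with y hy
    rw [hy]
  have e2 : ∫ y, |pF a b (fun n => ⟪cosH a b n, h⟫_ℝ) N y * dF a b (fun n => ⟪cosH a b n, h⟫_ℝ) N y|
      ∂mu a b = ∫ y, |PN N h y * DN N h y| ∂mu a b := by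
    refine integral_congr_ae ?_
    filter_upwards [coeFn_PN N h, coeFn_DN N h] with y hy hy'
    rw [hy, hy']
  rw [e1, e2]
  have h3 := integral_abs_mul_le (PN N h) (DN N h)
  have h4 := norm_PN_le N h
  have h5 := norm_DN_le N H
  have h6 : ‖PN N h‖ * ‖DN N h‖ ≤ ‖h‖ * ‖Dx h‖ := by gcongr
  have h7 : ‖PN N h‖ ^ 2 ≤ ‖h‖ ^ 2 := by gcongr
  have h8 : 1 / (b - a) * ‖PN N h‖ ^ 2 ≤ 1 / (b - a) * ‖h‖ ^ 2 := by gcongr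
  have h9 : 0 ≤ 1 / (b - a) * (‖h‖ * ‖Dx h‖) := by positivity
  unfold C0
  nlinarith [sq_nonneg ‖h‖]

end

end

section

/-- `g` vanishes at zero and has a bounded Lipschitz derivative `g'`. -/
structure C11 (g g' : ℝ → ℝ) (M : ℝ) : Prop where
  zero : g 0 = 0
  deriv : ∀ x, HasDerivAt g (g' x) x
  bdd : ∀ x, |g' x| ≤ M
  lip : ∀ x y, |g' x - g' y| ≤ M * |x - y|

namespace C11
variable {g g' : ℝ → ℝ} {M : ℝ}

lemma M_nonneg (G : C11 g g' M) : 0 ≤ M := (abs_nonneg _).trans (G.bdd 0)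

lemma continuous (G : C11 g g' M) : Continuous g :=
  continuous_iff_continuousAt.2 fun x => (G.deriv x).continuousAt

lemma continuous' (G : C11 g g' M) : Continuous g' := by
  have : LipschitzWith ⟨M, G.M_nonneg⟩ g' := LipschitzWith.of_dist_le_mul fun x y => by
    rw [Real.dist_eq, Real.dist_eq]; exact G.lip x y
  exact this.continuous

lemma abs_sub_le (G : C11 g g' M) (x y : ℝ) : |g x - g y| ≤ M * |x - y| := by
  have := convex_univ.norm_image_sub_le_of_norm_hasDerivWithin_le (f := g) (f' := g') (C := M)
    (fun x _ => (G.deriv x).hasDerivWithinAt) (fun x _ => G.bdd x) (mem_univ y) (mem_univ x)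
  simpa using this

lemma abs_le (G : C11 g g' M) (x : ℝ) : |g x| ≤ M * |x| := by
  simpa [G.zero] using G.abs_sub_le x 0

end C11

lemma c11_id : C11 (fun x => x) (fun _ => 1) 1 where
  zero := rfl
  deriv x := hasDerivAt_id x
  bdd _ := by simp
  lip x y := by simp

section
variable {a b : ℝ} [hab : Fact (a < b)]

open Classical in
/-- The class of a function in `L²(a,b)` (zero if not square integrable). -/
def mkH (a b : ℝ) (φ : ℝ → ℝ) : HS a b := if h : MemLp φ 2 (mu a b) then h.toLp φ else 0

lemma coeFn_mkH {φ : ℝ → ℝ} (h : MemLp φ 2 (mu a b)) : mkH a b φ =ᵐ[mu a b] φ := by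
  rw [mkH, dif_pos h]; exact h.coeFn_toLp

lemma aesm_HS (k : HS a b) : AEStronglyMeasurable k (mu a b) := Lp.aestronglyMeasurable k

lemma memLp_of_le_mul {φ : ℝ → ℝ} (hφ : AEStronglyMeasurable φ (mu a b)) (k : HS a b) {c : ℝ}
    (H : ∀ᵐ x ∂mu a b, |φ x| ≤ c * |k x|) : MemLp φ 2 (mu a b) :=
  (Lp.memLp k).of_le_mul hφ H

lemma norm_le_of_ae {h k : HS a b} {c : ℝ} (H : ∀ᵐ x ∂mu a b, |h x| ≤ c * |k x|) :
    ‖h‖ ≤ c * ‖k‖ := Lp.norm_le_mul_norm_of_ae_le_mul H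

lemma norm_mkH_le {φ : ℝ → ℝ} (hφ : AEStronglyMeasurable φ (mu a b)) (k : HS a b) {c : ℝ}
    (H : ∀ᵐ x ∂mu a b, |φ x| ≤ c * |k x|) : ‖mkH a b φ‖ ≤ c * ‖k‖ := by
  refine norm_le_of_ae ?_
  filter_upwards [coeFn_mkH (memLp_of_le_mul hφ k H), H] with x h1 h2
  rwa [h1]

/-- Superposition operator. -/
def nem (g : ℝ → ℝ) (h : HS a b) : HS a b := mkH a b fun x => g (h x)

/-- `g'(h) h_x`. -/
def FN (g' : ℝ → ℝ) (h : HS a b) : HS a b := mkH a b fun x => g' (h x) * Dx h x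

variable {g g' : ℝ → ℝ} {M : ℝ}

lemma memLp_nem (G : C11 g g' M) (h : HS a b) : MemLp (fun x => g (h x)) 2 (mu a b) :=
  memLp_of_le_mul (G.continuous.comp_aestronglyMeasurable (aesm_HS h)) h
    (Eventually.of_forall fun _ => G.abs_le _)

lemma coeFn_nem (G : C11 g g' M) (h : HS a b) : nem g h =ᵐ[mu a b] fun x => g (h x) :=
  coeFn_mkH (memLp_nem G h)

lemma aesm_FN (G : C11 g g' M) (h k : HS a b) :
    AEStronglyMeasurable (fun x => g' (h x) * k x) (mu a b) :=
  (G.continuous'.comp_aestronglyMeasurable (aesm_HS h)).mul (aesm_HS k)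

lemma abs_FN_le (G : C11 g g' M) (h k : HS a b) (x : ℝ) : |g' (h x) * k x| ≤ M * |k x| := by
  rw [abs_mul]
  exact mul_le_mul_of_nonneg_right (G.bdd _) (abs_nonneg _)

lemma coeFn_FN (G : C11 g g' M) (h : HS a b) : FN g' h =ᵐ[mu a b] fun x => g' (h x) * Dx h x :=
  coeFn_mkH (memLp_of_le_mul (aesm_FN G h (Dx h)) (Dx h) (Eventually.of_forall (abs_FN_le G h _)))

lemma norm_FN_le (G : C11 g g' M) (h : HS a b) : ‖FN g' h‖ ≤ M * ‖Dx h‖ :=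
  norm_mkH_le (aesm_FN G h (Dx h)) (Dx h) (Eventually.of_forall (abs_FN_le G h _))

lemma norm_nem_le (G : C11 g g' M) (h : HS a b) : ‖nem g h‖ ≤ M * ‖h‖ :=
  norm_mkH_le (G.continuous.comp_aestronglyMeasurable (aesm_HS h)) h
    (Eventually.of_forall fun _ => G.abs_le _)

lemma norm_nem_sub_le (G : C11 g g' M) (h k : HS a b) : ‖nem g h - nem g k‖ ≤ M * ‖h - k‖ := by
  refine norm_le_of_ae ?_
  filter_upwards [coeFn_nem G h, coeFn_nem G k, Lp.coeFn_sub (nem g h) (nem g k),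
    Lp.coeFn_sub h k] with x h1 h2 h3 h4
  rw [h3, h4, Pi.sub_apply, Pi.sub_apply, h1, h2]
  exact G.abs_sub_le _ _

lemma continuous_nem (G : C11 g g' M) : Continuous (nem g : HS a b → HS a b) := by
  have : LipschitzWith ⟨M, G.M_nonneg⟩ (nem g : HS a b → HS a b) :=
    LipschitzWith.of_dist_le_mul fun x y => by
      rw [dist_eq_norm, dist_eq_norm]; exact norm_nem_sub_le G x y
  exact this.continuous

lemma abs_sub_le_Sb {h k : HS a b} (H : InV h) (K : InV k) :
    ∀ᵐ x ∂mu a b, |h x - k x| ≤ Sb (h - k) := by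
  filter_upwards [abs_le_Sb (H.sub K), Lp.coeFn_sub h k] with x h1 h2
  rw [h2] at h1
  exact h1

lemma norm_FN_sub_le (G : C11 g g' M) {h k : HS a b} (H : InV h) (K : InV k) :
    ‖FN g' h - FN g' k‖ ≤ M * ‖Dx h - Dx k‖ + M * Sb (h - k) * ‖Dx k‖ := by
  set A : HS a b := mkH a b fun x => g' (h x) * (Dx h - Dx k : HS a b) x
  set B : HS a b := mkH a b fun x => (g' (h x) - g' (k x)) * Dx k x with hB
  have hBm : AEStronglyMeasurable (fun x => (g' (h x) - g' (k x)) * Dx k x) (mu a b) :=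
    ((G.continuous'.comp_aestronglyMeasurable (aesm_HS h)).sub
      (G.continuous'.comp_aestronglyMeasurable (aesm_HS k))).mul (aesm_HS _)
  have hBb : ∀ᵐ x ∂mu a b, |(g' (h x) - g' (k x)) * Dx k x| ≤ M * Sb (h - k) * |Dx k x| := by
    filter_upwards [abs_sub_le_Sb H K] with x hx
    rw [abs_mul]
    refine mul_le_mul_of_nonneg_right ((G.lip _ _).trans ?_) (abs_nonneg _)
    exact mul_le_mul_of_nonneg_left hx G.M_nonneg
  have hAb := Eventually.of_forall (f := ae (mu a b)) (abs_FN_le G h (Dx h - Dx k : HS a b))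
  have h1 : FN g' h - FN g' k = A + B := by
    apply Lp.ext
    filter_upwards [Lp.coeFn_sub (FN g' h) (FN g' k), Lp.coeFn_add A B, coeFn_FN G h, coeFn_FN G k,
      coeFn_mkH (memLp_of_le_mul (aesm_FN G h (Dx h - Dx k)) _ hAb),
      coeFn_mkH (memLp_of_le_mul hBm _ hBb), Lp.coeFn_sub (Dx h) (Dx k)] with x e1 e2 e3 e4 e5 e6 e7
    rw [e1, e2, Pi.sub_apply, Pi.add_apply, e3, e4, e5, e6, e7, Pi.sub_apply]; ring
  rw [h1]
  exact (norm_add_le _ _).trans (add_le_add (norm_mkH_le (aesm_FN G h _) _ hAb)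
    (norm_mkH_le hBm _ hBb))

lemma tendsto_Sb_zero {u : ℕ → HS a b} (hu : Tendsto u atTop (𝓝 0)) {C : ℝ}
    (hC : ∀ n, ‖Dx (u n)‖ ≤ C) : Tendsto (fun n => Sb (u n)) atTop (𝓝 0) := by
  have h1 : Tendsto (fun n => √(C0 a b * (‖u n‖ * (‖u n‖ + C)))) atTop (𝓝 0) := by
    have := (((hu.norm.mul (hu.norm.add_const C)).const_mul (C0 a b)).sqrt)
    simpa using this
  refine squeeze_zero (fun n => Sb_nonneg _) (fun n => ?_) h1
  rw [Sb]
  have := C0_pos (a := a) (b := b)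
  gcongr
  exact hC n

lemma HasD.of_tendsto {u u' : ℕ → HS a b} {h h' : HS a b} (H : ∀ n, HasD (u n) (u' n))
    (hu : Tendsto u atTop (𝓝 h)) (hu' : Tendsto u' atTop (𝓝 h')) : HasD h h' := by
  intro n
  have h1 : Tendsto (fun i => ⟪sinH a b n, u' i⟫_ℝ) atTop (𝓝 ⟪sinH a b n, h'⟫_ℝ) :=
    tendsto_const_nhds.inner hu'
  have h2 : Tendsto (fun i => -kf a b (n + 1) * ⟪cosH a b (n + 1), u i⟫_ℝ) atTop
      (𝓝 (-kf a b (n + 1) * ⟪cosH a b (n + 1), h⟫_ℝ)) :=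
    (tendsto_const_nhds.inner hu).const_mul _
  exact tendsto_nhds_unique (h1.congr fun i => H i n) h2

lemma sinF_left (n : ℕ) : sinF a b n a = 0 := by simp [sinF]

lemma sinF_right (n : ℕ) : sinF a b n b = 0 := by
  have hL : b - a ≠ 0 := (sub_pos.2 hab.out).ne'
  have : kf a b (n + 1) * (b - a) = ((n + 1 : ℕ) : ℝ) * Real.pi := by
    rw [kf]; field_simp
  rw [sinF, this, Real.sin_nat_mul_pi, mul_zero]

lemma hasD_of_deriv {p d : ℝ → ℝ} (hp : ∀ x, HasDerivAt p (d x) x) (hd : Continuous d)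
    {h h' : HS a b} (hh : h =ᵐ[mu a b] p) (hh' : h' =ᵐ[mu a b] d) : HasD h h' := by
  have hpc : Continuous p := continuous_iff_continuousAt.2 fun x => (hp x).continuousAt
  intro n
  have h1 := intervalIntegral.integral_mul_deriv_eq_deriv_mul (a := a) (b := b)
    (fun x _ => hasDerivAt_sinF a b n x) (fun x _ => hp x)
    (Continuous.intervalIntegrable (by fun_prop) _ _) (hd.intervalIntegrable _ _)
  rw [sinF_left, sinF_right, ← integral_mu_eq hab.out.le, ← integral_mu_eq hab.out.le] at h1
  rw [inner_sinH, inner_cosH, ← integral_const_mul]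
  have e1 : ∫ x, h' x * sinF a b n x ∂mu a b = ∫ x, sinF a b n x * d x ∂mu a b :=
    integral_congr_ae (by filter_upwards [hh'] with x hx; rw [hx, mul_comm])
  have e2 : ∫ x, -kf a b (n + 1) * (h x * cosF a b (n + 1) x) ∂mu a b =
      -∫ x, kf a b (n + 1) * cosF a b (n + 1) x * p x ∂mu a b := by
    rw [← integral_neg]
    exact integral_congr_ae (by filter_upwards [hh] with x hx; rw [hx]; ring)
  rw [e1, e2, h1]; ring

lemma inV_PN (N : ℕ) (h : HS a b) : InV (PN N h) := (hasD_PN N h).inV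
lemma Dx_PN (N : ℕ) (h : HS a b) : Dx (PN N h) = DN N h := (hasD_PN N h).eq

lemma tendsto_Sb_PN {h : HS a b} (H : InV h) :
    Tendsto (fun N => Sb (PN N h - h)) atTop (𝓝 0) := by
  refine tendsto_Sb_zero (C := ‖Dx h‖ + ‖Dx h‖) ?_ fun N => ?_
  · simpa using (tendsto_PN h).sub_const h
  · rw [Dx_sub (inV_PN N h) H, Dx_PN]
    exact (norm_sub_le _ _).trans (add_le_add (norm_DN_le N H) le_rfl)

lemma tendsto_FN_PN (G : C11 g g' M) {h : HS a b} (H : InV h) :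
    Tendsto (fun N => FN g' (PN N h)) atTop (𝓝 (FN g' h)) := by
  rw [tendsto_iff_norm_sub_tendsto_zero]
  have h1 : Tendsto (fun N => M * ‖DN N h - Dx h‖ + M * Sb (PN N h - h) * ‖Dx h‖) atTop (𝓝 0) := by
    have := ((tendsto_iff_norm_sub_tendsto_zero.1 (tendsto_DN H)).const_mul M).add
      (((tendsto_Sb_PN H).const_mul M).mul_const ‖Dx h‖)
    simpa using this
  refine squeeze_zero (fun N => norm_nonneg _) (fun N => ?_) h1
  have := norm_FN_sub_le G (inV_PN N h) H
  rwa [Dx_PN] at this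

lemma hasD_nem (G : C11 g g' M) {h : HS a b} (H : InV h) : HasD (nem g h) (FN g' h) := by
  refine HasD.of_tendsto (fun N => ?_) (((continuous_nem G).tendsto h).comp (tendsto_PN h))
    (tendsto_FN_PN G H)
  refine hasD_of_deriv (p := fun x => g (pF a b (fun n => ⟪cosH a b n, h⟫_ℝ) N x))
    (d := fun x => g' (pF a b (fun n => ⟪cosH a b n, h⟫_ℝ) N x) *
      dF a b (fun n => ⟪cosH a b n, h⟫_ℝ) N x)
    (fun x => (G.deriv _).comp x (hasDerivAt_pF _ N x)) ?_ ?_ ?_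
  · exact (G.continuous'.comp (continuous_pF _ N)).mul (continuous_dF _ N)
  · filter_upwards [coeFn_nem G (PN N h), coeFn_PN N h] with x h1 h2
    simp only [comp_apply]
    rw [h1, h2]
  · filter_upwards [coeFn_FN G (PN N h), coeFn_PN N h, coeFn_DN N h] with x h1 h2 h3
    rw [h1, h2, Dx_PN, h3]

lemma Dx_nem (G : C11 g g' M) {h : HS a b} (H : InV h) : Dx (nem g h) = FN g' h := (hasD_nem G H).eq

lemma inV_nem (G : C11 g g' M) {h : HS a b} (H : InV h) : InV (nem g h) := (hasD_nem G H).inV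

lemma Sb_le_add {η : ℝ} (hη : 0 < η) (h : HS a b) :
    Sb h ≤ η * ‖Dx h‖ + (C0 a b / η + C0 a b + 1) * ‖h‖ := by
  have hC := C0_pos (a := a) (b := b)
  have h1 : 0 ≤ ‖h‖ := norm_nonneg _
  have h2 : 0 ≤ ‖Dx h‖ := norm_nonneg _
  rw [Sb]
  apply Real.sqrt_le_iff.2 ⟨by positivity, ?_⟩
  have e : η * (C0 a b / η) = C0 a b := by field_simp
  have e2 : (η * ‖Dx h‖ + (C0 a b / η + C0 a b + 1) * ‖h‖) ^ 2 =
      η ^ 2 * ‖Dx h‖ ^ 2 + 2 * (C0 a b + η * (C0 a b + 1)) * (‖h‖ * ‖Dx h‖) +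
       (C0 a b / η + C0 a b + 1) ^ 2 * ‖h‖ ^ 2 := by
    rw [← e]; ring_nf
    field_simp
    ring
  rw [e2]
  have h3 : C0 a b ≤ (C0 a b / η + C0 a b + 1) ^ 2 := by
    have : 0 < C0 a b / η := by positivity
    nlinarith
  have h4 : C0 a b * ‖h‖ ^ 2 ≤ (C0 a b / η + C0 a b + 1) ^ 2 * ‖h‖ ^ 2 := by gcongr
  have h5 : 0 ≤ η * (C0 a b + 1) * (‖h‖ * ‖Dx h‖) := by positivity
  have h6 : 0 ≤ C0 a b * (‖h‖ * ‖Dx h‖) := by positivity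
  have h7 : 0 ≤ η ^ 2 * ‖Dx h‖ ^ 2 := by positivity
  linarith

/-- Simple Sobolev constant. -/
def C1 (a b : ℝ) : ℝ := 2 * C0 a b + 2

lemma C1_pos : 0 < C1 a b := by have := C0_pos (a := a) (b := b); unfold C1; linarith

lemma Sb_le (h : HS a b) : Sb h ≤ C1 a b * (‖h‖ + ‖Dx h‖) := by
  have := Sb_le_add one_pos h
  have hC := C0_pos (a := a) (b := b)
  have h1 : 0 ≤ ‖h‖ := norm_nonneg _
  have h2 : 0 ≤ ‖Dx h‖ := norm_nonneg _
  unfold C1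
  rw [div_one] at this
  nlinarith [mul_nonneg hC.le h2, mul_nonneg hC.le h1]

/-- Trilinear integral. -/
def tri (p q r : HS a b) : ℝ := ∫ x, p x * q x * r x ∂mu a b

/-- Essential boundedness. -/
def Bd (S : ℝ) (q : HS a b) : Prop := ∀ᵐ x ∂mu a b, |q x| ≤ S

lemma integrable_tri {S : ℝ} {q : HS a b} (hq : Bd S q) (p r : HS a b) :
    Integrable (fun x => p x * q x * r x) (mu a b) := by
  have := (integrable_mul_HS p r).mul_bdd (c := S) (aesm_HS q) hq
  refine this.congr (Eventually.of_forall fun x => ?_)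
  simp only; ring

lemma abs_tri_le {S : ℝ} (hS : 0 ≤ S) {q : HS a b} (hq : Bd S q) (p r : HS a b) :
    |tri p q r| ≤ S * (‖p‖ * ‖r‖) := by
  rw [tri, ← Real.norm_eq_abs]
  refine (norm_integral_le_of_norm_le (g := fun x => S * |p x * r x|)
    ((integrable_mul_HS p r).abs.const_mul S) ?_).trans ?_
  · filter_upwards [hq] with x hx
    have : p x * q x * r x = q x * (p x * r x) := by ring
    rw [this, Real.norm_eq_abs, abs_mul]
    gcongr
  · rw [integral_const_mul]
    exact mul_le_mul_of_nonneg_left (integral_abs_mul_le p r) hS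

lemma tri_sub_left {S : ℝ} {q : HS a b} (hq : Bd S q) (p p' r : HS a b) :
    tri (p - p') q r = tri p q r - tri p' q r := by
  rw [tri, tri, tri, ← integral_sub (integrable_tri hq p r) (integrable_tri hq p' r)]
  refine integral_congr_ae ?_
  filter_upwards [Lp.coeFn_sub p p'] with x hx
  rw [hx, Pi.sub_apply]; ring

lemma tri_add_left {S : ℝ} {q : HS a b} (hq : Bd S q) (p p' r : HS a b) :
    tri (p + p') q r = tri p q r + tri p' q r := by
  rw [tri, tri, tri, ← integral_add (integrable_tri hq p r) (integrable_tri hq p' r)]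
  refine integral_congr_ae ?_
  filter_upwards [Lp.coeFn_add p p'] with x hx
  rw [hx, Pi.add_apply]; ring

lemma tri_sub_right {S : ℝ} {q : HS a b} (hq : Bd S q) (p r r' : HS a b) :
    tri p q (r - r') = tri p q r - tri p q r' := by
  rw [tri, tri, tri, ← integral_sub (integrable_tri hq p r) (integrable_tri hq p r')]
  refine integral_congr_ae ?_
  filter_upwards [Lp.coeFn_sub r r'] with x hx
  rw [hx, Pi.sub_apply]; ring

lemma tri_sub_mid {S S' : ℝ} {q q' : HS a b} (hq : Bd S q) (hq' : Bd S' q') (p r : HS a b) :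
    tri p (q - q') r = tri p q r - tri p q' r := by
  rw [tri, tri, tri, ← integral_sub (integrable_tri hq p r) (integrable_tri hq' p r)]
  refine integral_congr_ae ?_
  filter_upwards [Lp.coeFn_sub q q'] with x hx
  rw [hx, Pi.sub_apply]; ring

lemma tri_add_mid {S S' : ℝ} {q q' : HS a b} (hq : Bd S q) (hq' : Bd S' q') (p r : HS a b) :
    tri p (q + q') r = tri p q r + tri p q' r := by
  rw [tri, tri, tri, ← integral_add (integrable_tri hq p r) (integrable_tri hq' p r)]
  refine integral_congr_ae ?_
  filter_upwards [Lp.coeFn_add q q'] with x hx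
  rw [hx, Pi.add_apply]; ring

lemma tri_smul_left (c : ℝ) (p q r : HS a b) : tri (c • p) q r = c * tri p q r := by
  rw [tri, tri, ← integral_const_mul]
  refine integral_congr_ae ?_
  filter_upwards [Lp.coeFn_smul c p] with x hx
  rw [hx, Pi.smul_apply, smul_eq_mul]; ring

lemma tri_smul_mid (c : ℝ) (p q r : HS a b) : tri p (c • q) r = c * tri p q r := by
  rw [tri, tri, ← integral_const_mul]
  refine integral_congr_ae ?_
  filter_upwards [Lp.coeFn_smul c q] with x hx
  rw [hx, Pi.smul_apply, smul_eq_mul]; ring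

lemma InV.bd {h : HS a b} (H : InV h) : Bd (Sb h) h := abs_le_Sb H

lemma bd_nem (G : C11 g g' M) {h : HS a b} (H : InV h) : Bd (M * Sb h) (nem g h) := by
  filter_upwards [coeFn_nem G h, abs_le_Sb H] with x h1 h2
  rw [h1]
  exact (G.abs_le _).trans (mul_le_mul_of_nonneg_left h2 G.M_nonneg)

lemma bd_nem_sub (G : C11 g g' M) {h k : HS a b} (H : InV h) (K : InV k) :
    Bd (M * Sb (h - k)) (nem g h - nem g k) := by
  filter_upwards [coeFn_nem G h, coeFn_nem G k, Lp.coeFn_sub (nem g h) (nem g k),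
    abs_sub_le_Sb H K] with x h1 h2 h3 h4
  rw [h3, Pi.sub_apply, h1, h2]
  exact (G.abs_sub_le _ _).trans (mul_le_mul_of_nonneg_left h4 G.M_nonneg)

/-- The heat source functional `φ ↦ ∫ (f(θ))_x v φ + f(θ) v φ_x`. -/
def Gf (f f' : ℝ → ℝ) (v θ φ : HS a b) : ℝ := tri (FN f' θ) φ v + tri (Dx φ) (nem f θ) v

/-- A linear functional on `W^{1,2}` with a bound. -/
structure LinV (G : HS a b → ℝ) (γ : ℝ) : Prop where
  add : ∀ φ ψ, InV φ → InV ψ → G (φ + ψ) = G φ + G ψ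
  smul : ∀ (c : ℝ) φ, InV φ → G (c • φ) = c * G φ
  bound : ∀ φ, InV φ → |G φ| ≤ γ * (‖φ‖ + ‖Dx φ‖)

lemma abs_Gf_le (G : C11 g g' M) (v : HS a b) {θ φ : HS a b} (H : InV θ) (K : InV φ) :
    |Gf g g' v θ φ| ≤ M * ‖v‖ * (‖Dx θ‖ * Sb φ + Sb θ * ‖Dx φ‖) := by
  have hM := G.M_nonneg
  have h1 := abs_tri_le (Sb_nonneg φ) K.bd (FN g' θ) v
  have h2 := abs_tri_le (mul_nonneg hM (Sb_nonneg θ)) (bd_nem G H) (Dx φ) v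
  have h3 := norm_FN_le G θ
  have h4 : Sb φ * (‖FN g' θ‖ * ‖v‖) ≤ Sb φ * ((M * ‖Dx θ‖) * ‖v‖) := by
    have := Sb_nonneg φ
    gcongr
  calc |Gf g g' v θ φ| ≤ |tri (FN g' θ) φ v| + |tri (Dx φ) (nem g θ) v| := abs_add_le _ _
    _ ≤ Sb φ * ((M * ‖Dx θ‖) * ‖v‖) + (M * Sb θ) * (‖Dx φ‖ * ‖v‖) := by linarith
    _ = _ := by ring

lemma linV_Gf (G : C11 g g' M) (v : HS a b) {θ : HS a b} (H : InV θ) :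
    LinV (Gf g g' v θ) (2 * M * C1 a b * ‖v‖ * (‖θ‖ + ‖Dx θ‖)) where
  add φ ψ hφ hψ := by
    rw [Gf, Gf, Gf, Dx_add hφ hψ, tri_add_mid hφ.bd hψ.bd, tri_add_left (bd_nem G H)]; ring
  smul c φ hφ := by
    rw [Gf, Gf, Dx_smul c hφ, tri_smul_mid, tri_smul_left]; ring
  bound φ hφ := by
    refine (abs_Gf_le G v H hφ).trans ?_
    have hM := G.M_nonneg
    have h1 := Sb_le φ
    have h2 := Sb_le θ
    have hC := C1_pos (a := a) (b := b)
    have : ‖Dx θ‖ * Sb φ + Sb θ * ‖Dx φ‖ ≤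
        2 * C1 a b * (‖θ‖ + ‖Dx θ‖) * (‖φ‖ + ‖Dx φ‖) := by
      calc _ ≤ (‖θ‖ + ‖Dx θ‖) * (C1 a b * (‖φ‖ + ‖Dx φ‖))
            + C1 a b * (‖θ‖ + ‖Dx θ‖) * (‖φ‖ + ‖Dx φ‖) := by
            have e1 : ‖Dx θ‖ ≤ ‖θ‖ + ‖Dx θ‖ := by linarith [norm_nonneg θ]
            have e2 : ‖Dx φ‖ ≤ ‖φ‖ + ‖Dx φ‖ := by linarith [norm_nonneg φ]
            have := Sb_nonneg φ
            gcongr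
        _ = _ := by ring
    calc _ ≤ M * ‖v‖ * (2 * C1 a b * (‖θ‖ + ‖Dx θ‖) * (‖φ‖ + ‖Dx φ‖)) := by gcongr
      _ = _ := by ring

lemma abs_Gf_sub_le (G : C11 g g' M) (v₁ v₂ : HS a b) {θ₁ θ₂ φ : HS a b} (H₁ : InV θ₁)
    (H₂ : InV θ₂) (K : InV φ) :
    |Gf g g' v₁ θ₁ φ - Gf g g' v₂ θ₂ φ| ≤
      M * ‖v₁‖ * ((‖Dx (θ₁ - θ₂)‖ + Sb (θ₁ - θ₂) * ‖Dx θ₂‖) * Sb φ + Sb (θ₁ - θ₂) * ‖Dx φ‖) +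
      M * ‖v₁ - v₂‖ * (‖Dx θ₂‖ * Sb φ + Sb θ₂ * ‖Dx φ‖) := by
  have hM := G.M_nonneg
  have e : Gf g g' v₁ θ₁ φ - Gf g g' v₂ θ₂ φ =
      tri (FN g' θ₁ - FN g' θ₂) φ v₁ + tri (Dx φ) (nem g θ₁ - nem g θ₂) v₁ +
        Gf g g' (v₁ - v₂) θ₂ φ := by
    rw [tri_sub_left K.bd, tri_sub_mid (bd_nem G H₁) (bd_nem G H₂), Gf, Gf, Gf,
      tri_sub_right K.bd, tri_sub_right (bd_nem G H₂)]; ring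
  have h1 := abs_tri_le (Sb_nonneg φ) K.bd (FN g' θ₁ - FN g' θ₂) v₁
  have h2 := abs_tri_le (mul_nonneg hM (Sb_nonneg (θ₁ - θ₂))) (bd_nem_sub G H₁ H₂) (Dx φ) v₁
  have h3 := abs_Gf_le G (v₁ - v₂) H₂ K
  have h4 := norm_FN_sub_le G H₁ H₂
  rw [← Dx_sub H₁ H₂] at h4
  have h5 : Sb φ * (‖FN g' θ₁ - FN g' θ₂‖ * ‖v₁‖) ≤
      Sb φ * ((M * ‖Dx (θ₁ - θ₂)‖ + M * Sb (θ₁ - θ₂) * ‖Dx θ₂‖) * ‖v₁‖) := by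
    have := Sb_nonneg φ
    gcongr
  rw [e]
  have h6 := abs_add_three (tri (FN g' θ₁ - FN g' θ₂) φ v₁) (tri (Dx φ) (nem g θ₁ - nem g θ₂) v₁)
    (Gf g g' (v₁ - v₂) θ₂ φ)
  linarith

end

end

section

lemma ac_of_dist_le {f A : ℝ → ℝ} {s t K : ℝ} (hA : AbsolutelyContinuousOnInterval A s t)
    (hK : 0 ≤ K) (H : ∀ p ∈ uIcc s t, ∀ q ∈ uIcc s t, dist (f p) (f q) ≤ K * dist (A p) (A q)) :
    AbsolutelyContinuousOnInterval f s t := by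
  rw [absolutelyContinuousOnInterval_iff] at hA ⊢
  intro ε hε
  obtain ⟨δ, hδ, h⟩ := hA (ε / (K + 1)) (by positivity)
  refine ⟨δ, hδ, fun E hE hlt => ?_⟩
  have h1 := h E hE hlt
  have h2 : ∑ i ∈ Finset.range E.1, dist (f (E.2 i).1) (f (E.2 i).2) ≤
      K * ∑ i ∈ Finset.range E.1, dist (A (E.2 i).1) (A (E.2 i).2) := by
    rw [Finset.mul_sum]
    exact Finset.sum_le_sum fun i hi => H _ (hE.1 i hi).1 _ (hE.1 i hi).2
  have h0 : 0 ≤ ∑ i ∈ Finset.range E.1, dist (A (E.2 i).1) (A (E.2 i).2) :=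
    Finset.sum_nonneg fun _ _ => dist_nonneg
  rw [lt_div_iff₀ (by positivity)] at h1
  nlinarith

lemma integral_chain {E : Type*} [NormedAddCommGroup E] [NormedSpace ℝ E] [CompleteSpace E]
    {s t : ℝ} (hst : s ≤ t) {y h : ℝ → E} (hh : IntervalIntegrable h volume s t)
    (hy : ∀ r ∈ Icc s t, y r = y s + ∫ q in s..r, h q)
    {Ξ : E → ℝ} {Ξ' : E → E →L[ℝ] ℝ} (hΞ : ∀ x, HasFDerivAt Ξ (Ξ' x) x) {K : ℝ} (hK0 : 0 ≤ K)
    (hK : ∀ p ∈ Icc s t, ∀ q ∈ Icc s t, |Ξ (y p) - Ξ (y q)| ≤ K * ‖y p - y q‖)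
    (hint : IntervalIntegrable (fun r => Ξ' (y r) (h r)) volume s t) :
    Ξ (y t) - Ξ (y s) = ∫ r in s..t, Ξ' (y r) (h r) := by
  set A : ℝ → ℝ := fun r => ∫ q in s..r, ‖h q‖
  have hsub : ∀ r ∈ Icc s t, IntervalIntegrable h volume s r := fun r hr =>
    hh.mono_set (by rw [uIcc_of_le hst, uIcc_of_le hr.1]; exact Icc_subset_Icc_right hr.2)
  have hA : AbsolutelyContinuousOnInterval A s t :=
    hh.norm.absolutelyContinuousOnInterval_intervalIntegral (by simp)
  set Y : ℝ → E := fun r => y s + ∫ q in s..r, h q with hY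
  have hYy : ∀ r ∈ Icc s t, Y r = y r := fun r hr => (hy r hr).symm
  have hYA : ∀ p ∈ Icc s t, ∀ q ∈ Icc s t, ‖Y p - Y q‖ ≤ |A p - A q| := by
    intro p hp q hq
    have e1 : Y p - Y q = ∫ r in q..p, h r := by
      simp only [hY, add_sub_add_left_eq_sub]
      exact intervalIntegral.integral_interval_sub_left (hsub p hp) (hsub q hq)
    have e2 : A p - A q = ∫ r in q..p, ‖h r‖ :=
      intervalIntegral.integral_interval_sub_left (hsub p hp).norm (hsub q hq).norm
    rw [e1, e2]
    exact intervalIntegral.norm_integral_le_abs_integral_norm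
  have hac : AbsolutelyContinuousOnInterval (fun r => Ξ (Y r)) s t := by
    refine ac_of_dist_le hA hK0 fun p hp q hq => ?_
    rw [uIcc_of_le hst] at hp hq
    rw [Real.dist_eq, Real.dist_eq, hYy p hp, hYy q hq]
    refine (hK p hp q hq).trans (mul_le_mul_of_nonneg_left ?_ hK0)
    rw [← hYy p hp, ← hYy q hq]
    exact hYA p hp q hq
  have hI : AbsolutelyContinuousOnInterval (fun r => ∫ q in s..r, Ξ' (y q) (h q)) s t :=
    hint.absolutelyContinuousOnInterval_intervalIntegral (by simp)
  obtain ⟨C, hC⟩ := (hac.sub hI).const_of_ae_hasDerivAt_zero (by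
    filter_upwards [hh.ae_hasDerivAt_integral, hint.ae_hasDerivAt_integral] with x h1 h2 hx
    have d1 : HasDerivAt Y (h x) x := (h1 hx s (by simp)).const_add (y s)
    have d2 := (hΞ (Y x)).comp_hasDerivAt x d1
    have d3 := d2.sub (h2 hx s (by simp))
    rw [hYy x (by rwa [uIcc_of_le hst] at hx), sub_self] at d3
    exact d3)
  have c1 := hC s (by simp)
  have c2 := hC t (by simp)
  simp only [Pi.sub_apply, intervalIntegral.integral_same, sub_zero] at c1 c2
  rw [hYy s (left_mem_Icc.2 hst)] at c1
  rw [hYy t (right_mem_Icc.2 hst)] at c2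
  linarith

lemma sq_chain {s t : ℝ} (hst : s ≤ t) {y h : ℝ → ℝ} (hh : IntervalIntegrable h volume s t)
    (hc : ContinuousOn y (Icc s t))
    (hy : ∀ r ∈ Icc s t, y r = y s + ∫ q in s..r, h q) :
    y t ^ 2 - y s ^ 2 = ∫ r in s..t, 2 * y r * h r := by
  obtain ⟨K, hK⟩ := isCompact_Icc.exists_bound_of_continuousOn hc
  have hK0 : 0 ≤ K := (norm_nonneg _).trans (hK s (left_mem_Icc.2 hst))
  have hint : IntervalIntegrable (fun r => 2 * y r * h r) volume s t :=
    hh.continuousOn_mul (by rw [uIcc_of_le hst]; exact continuousOn_const.mul hc)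
  have := integral_chain hst hh hy (Ξ := fun x => x ^ 2)
    (Ξ' := fun x => ContinuousLinearMap.toSpanSingleton ℝ (2 * x)) (fun x => by
      simpa using (hasDerivAt_pow 2 x).hasFDerivAt) (K := 2 * K) (by positivity)
          (fun p hp q hq => by
      have h1 := hK p hp
      have h2 := hK q hq
      rw [Real.norm_eq_abs] at h1 h2
      have : y p ^ 2 - y q ^ 2 = (y p + y q) * (y p - y q) := by ring
      rw [this, abs_mul, Real.norm_eq_abs]
      refine mul_le_mul_of_nonneg_right ?_ (abs_nonneg _)
      linarith [abs_add_le (y p) (y q)]) (by simpa [mul_comm] using hint)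
  simpa [mul_comm, mul_left_comm, mul_assoc] using this

/-- Cauchy-Schwarz for nonnegative functions with given bounds. -/
lemma cs_integral {α : Type*} [MeasurableSpace α] {ν : Measure α} {f g : α → ℝ} {F G : ℝ}
    (hF : 0 ≤ F) (hG : 0 ≤ G)
    (hf : AEStronglyMeasurable f ν) (hg : AEStronglyMeasurable g ν)
    (hf2 : Integrable (fun x => f x ^ 2) ν) (hg2 : Integrable (fun x => g x ^ 2) ν)
    (hfF : ∫ x, f x ^ 2 ∂ν ≤ F ^ 2) (hgG : ∫ x, g x ^ 2 ∂ν ≤ G ^ 2) :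
    Integrable (fun x => |f x| * |g x|) ν ∧ ∫ x, |f x| * |g x| ∂ν ≤ F * G := by
  have hfm : MemLp f 2 ν := (memLp_two_iff_integrable_sq hf).2 hf2
  have hgm : MemLp g 2 ν := (memLp_two_iff_integrable_sq hg).2 hg2
  refine ⟨(hfm.abs).integrable_mul hgm.abs, ?_⟩
  have h2 : ENNReal.ofReal 2 = 2 := by norm_num
  have := integral_mul_le_Lp_mul_Lq_of_nonneg (μ := ν) Real.HolderConjugate.two_two
    (f := fun x => |f x|) (g := fun x => |g x|)
    (Eventually.of_forall fun x => abs_nonneg _) (Eventually.of_forall fun x => abs_nonneg _)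
    (by rw [h2]; exact hfm.abs) (by rw [h2]; exact hgm.abs)
  refine this.trans ?_
  simp only [Real.rpow_two, sq_abs, ← Real.sqrt_eq_rpow]
  exact mul_le_mul ((Real.sqrt_le_sqrt hfF).trans_eq (Real.sqrt_sq hF))
    ((Real.sqrt_le_sqrt hgG).trans_eq (Real.sqrt_sq hG)) (Real.sqrt_nonneg _) hF

lemma integral_indicator_Ioc {s t r : ℝ} (hr : r ∈ Icc s t) (g : ℝ → ℝ) :
    ∫ q in s..r, (Ioc s t).indicator g q = ∫ q in s..r, g q := by
  refine intervalIntegral.integral_congr_ae (Eventually.of_forall fun q hq => ?_)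
  rw [uIoc_of_le hr.1] at hq
  exact indicator_of_mem (Ioc_subset_Ioc_right hr.2 hq) _

lemma exists_primitive {s t : ℝ} (hst : s ≤ t) {g : ℝ → ℝ} (hg : IntervalIntegrable g volume s t) :
    ∃ I : ℝ → ℝ, Continuous I ∧ I s = 0 ∧ ∀ r ∈ Icc s t, I r = ∫ q in s..r, g q := by
  have hi : Integrable ((Ioc s t).indicator g) :=
    (((intervalIntegrable_iff_integrableOn_Ioc_of_le hst).1 hg).integrable_indicator
      measurableSet_Ioc)
  exact ⟨fun r => ∫ q in s..r, (Ioc s t).indicator g q,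
    intervalIntegral.continuous_primitive (fun _ _ => hi.intervalIntegrable) s, by simp,
    fun r hr => integral_indicator_Ioc hr g⟩

lemma heat_mode_exists {s t : ℝ} (hst : s ≤ t) (l y0 : ℝ) {g : ℝ → ℝ}
    (hg : IntervalIntegrable g volume s t) :
    ∃ y : ℝ → ℝ, Continuous y ∧ y s = y0 ∧
      ∀ r ∈ Icc s t, y r = y0 + ∫ q in s..r, (-l * y q + g q) := by
  obtain ⟨I, hI, hI0, hIr⟩ := exists_primitive hst hg
  have hint : Continuous fun q => Real.exp (l * (q - s)) * I q := by fun_prop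
  set Q : ℝ → ℝ := fun r => y0 - l * ∫ q in s..r, Real.exp (l * (q - s)) * I q with hQ
  have hQd : ∀ r, HasDerivAt Q (-(l * (Real.exp (l * (r - s)) * I r))) r := fun r =>
    ((hint.integral_hasStrictDerivAt s r).hasDerivAt.const_mul l).const_sub y0
  set Y : ℝ → ℝ := fun r => Real.exp (-l * (r - s)) * Q r with hY
  have hYd : ∀ r, HasDerivAt Y (-l * (I r + Y r)) r := fun r => by
    have h1 : HasDerivAt (fun r => Real.exp (-l * (r - s)))
        (Real.exp (-l * (r - s)) * (-l * 1)) r :=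
      (((hasDerivAt_id r).sub_const s).const_mul (-l)).exp
    have h2 := h1.mul (hQd r)
    refine h2.congr_deriv ?_
    have : Real.exp (-l * (r - s)) * Real.exp (l * (r - s)) = 1 := by
      rw [← Real.exp_add]; simp
    rw [show Y r = Real.exp (-l * (r - s)) * Q r from rfl]
    linear_combination (-l * I r) * this
  have hYc : Continuous Y := continuous_iff_continuousAt.2 fun r => (hYd r).continuousAt
  refine ⟨fun r => I r + Y r, hI.add hYc, by simp [hI0, hY, hQ], fun r hr => ?_⟩
  have hc : Continuous fun q => -l * (I q + Y q) := by fun_prop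
  rw [intervalIntegral.integral_add (hc.intervalIntegrable _ _)
    (hg.mono_set (by rw [uIcc_of_le hst, uIcc_of_le hr.1]; exact Icc_subset_Icc_right hr.2)),
    intervalIntegral.integral_eq_sub_of_hasDerivAt (fun q _ => hYd q) (hc.intervalIntegrable _ _),
    ← hIr r hr]
  have : Y s = y0 := by simp [hY, hQ]
  rw [this]; ring

lemma wave_mode_exists {s t : ℝ} (hst : s ≤ t) (k v0 w0 : ℝ) {g : ℝ → ℝ}
    (hg : IntervalIntegrable g volume s t) :
    ∃ v w : ℝ → ℝ, Continuous v ∧ Continuous w ∧ v s = v0 ∧ w s = w0 ∧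
      (∀ r ∈ Icc s t, v r = v0 + ∫ q in s..r, (-k * w q - g q)) ∧
      (∀ r ∈ Icc s t, w r = w0 + ∫ q in s..r, k * v q) := by
  obtain ⟨I, hI, hI0, hIr⟩ := exists_primitive hst hg
  have hint1 : Continuous fun q => Real.sin (k * (q - s)) * I q := by fun_prop
  have hint2 : Continuous fun q => Real.cos (k * (q - s)) * I q := by fun_prop
  set P : ℝ → ℝ := fun r => v0 - k * ∫ q in s..r, Real.sin (k * (q - s)) * I q with hP
  set Q : ℝ → ℝ := fun r => w0 - k * ∫ q in s..r, Real.cos (k * (q - s)) * I q with hQ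
  have hPd : ∀ r, HasDerivAt P (-(k * (Real.sin (k * (r - s)) * I r))) r := fun r =>
    ((hint1.integral_hasStrictDerivAt s r).hasDerivAt.const_mul k).const_sub v0
  have hQd : ∀ r, HasDerivAt Q (-(k * (Real.cos (k * (r - s)) * I r))) r := fun r =>
    ((hint2.integral_hasStrictDerivAt s r).hasDerivAt.const_mul k).const_sub w0
  set V : ℝ → ℝ := fun r => Real.cos (k * (r - s)) * P r - Real.sin (k * (r - s)) * Q r with hV
  set W : ℝ → ℝ := fun r => Real.sin (k * (r - s)) * P r + Real.cos (k * (r - s)) * Q r with hW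
  have hin : ∀ r, HasDerivAt (fun r => k * (r - s)) (k * 1) r := fun r =>
    ((hasDerivAt_id r).sub_const s).const_mul k
  have hVd : ∀ r, HasDerivAt V (-k * W r) r := fun r => by
    have h2 := ((hin r).cos.mul (hPd r)).sub ((hin r).sin.mul (hQd r))
    refine h2.congr_deriv ?_
    rw [show W r = Real.sin (k * (r - s)) * P r + Real.cos (k * (r - s)) * Q r from rfl]; ring
  have hWd : ∀ r, HasDerivAt W (k * (V r - I r)) r := fun r => by
    have h2 := ((hin r).sin.mul (hPd r)).add ((hin r).cos.mul (hQd r))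
    refine h2.congr_deriv ?_
    rw [show V r = Real.cos (k * (r - s)) * P r - Real.sin (k * (r - s)) * Q r from rfl]
    linear_combination (-k * I r) * (Real.sin_sq_add_cos_sq (k * (r - s)))
  have hVc : Continuous V := continuous_iff_continuousAt.2 fun r => (hVd r).continuousAt
  have hWc : Continuous W := continuous_iff_continuousAt.2 fun r => (hWd r).continuousAt
  refine ⟨fun r => V r - I r, W, hVc.sub hI, hWc, by simp [hI0, hV, hP], by simp [hW, hQ],
    fun r hr => ?_, fun r hr => ?_⟩
  · have hc : Continuous fun q => -k * W q := by fun_prop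
    rw [intervalIntegral.integral_sub (hc.intervalIntegrable _ _)
      (hg.mono_set (by rw [uIcc_of_le hst, uIcc_of_le hr.1]; exact Icc_subset_Icc_right hr.2)),
      intervalIntegral.integral_eq_sub_of_hasDerivAt (fun q _ => hVd q) (hc.intervalIntegrable _ _),
      ← hIr r hr]
    have : V s = v0 := by simp [hV, hP]
    rw [this]; ring
  · have hc : Continuous fun q => k * (V q - I q) := by fun_prop
    rw [intervalIntegral.integral_eq_sub_of_hasDerivAt (fun q _ => hWd q)
      (hc.intervalIntegrable _ _)]
    have : W s = w0 := by simp [hW, hQ]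
    rw [this]; ring

/-- A short-time Gronwall inequality. -/
lemma sup_le_of_integral {s t a0 : ℝ} (hst : s ≤ t) (hl : t - s ≤ 1 / 2) {m : ℝ → ℝ}
    (hc : ContinuousOn m (Icc s t)) (hm0 : ∀ r ∈ Icc s t, 0 ≤ m r)
    (H : ∀ r ∈ Icc s t, m r ≤ a0 + ∫ q in s..r, m q) : ∀ r ∈ Icc s t, m r ≤ 2 * a0 := by
  obtain ⟨p, hp, hmax⟩ := isCompact_Icc.exists_isMaxOn (nonempty_Icc.2 hst) hc
  have hle : ∀ r ∈ Icc s t, m r ≤ m p := fun r hr => hmax hr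
  have hci : ContinuousOn m (uIcc s p) := by
    rw [uIcc_of_le hp.1]; exact hc.mono (Icc_subset_Icc_right hp.2)
  have h1 : ∫ q in s..p, m q ≤ ∫ q in s..p, m p :=
    intervalIntegral.integral_mono_on hp.1 hci.intervalIntegrable (by simp)
      fun q hq => hle q ⟨hq.1, hq.2.trans hp.2⟩
  rw [intervalIntegral.integral_const, smul_eq_mul] at h1
  have h2 := H p hp
  have h3 := hm0 p hp
  have h4 : (p - s) * m p ≤ 1 / 2 * m p :=
    mul_le_mul_of_nonneg_right (by linarith [hp.2]) h3
  intro r hr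
  linarith [hle r hr]

lemma IntervalIntegrable.of_sq {s t : ℝ} (hst : s ≤ t) {g : ℝ → ℝ}
    (hm : AEStronglyMeasurable g (volume.restrict (Ioc s t)))
    (h2 : IntervalIntegrable (fun r => g r ^ 2) volume s t) : IntervalIntegrable g volume s t := by
  rw [intervalIntegrable_iff_integrableOn_Ioc_of_le hst] at h2 ⊢
  exact ((memLp_two_iff_integrable_sq hm).2 h2).integrable one_le_two

lemma sub_Icc {s t r : ℝ} (hr : r ∈ Icc s t) : uIcc s r ⊆ uIcc s t := by
  rw [uIcc_of_le hr.1, uIcc_of_le (hr.1.trans hr.2)]; exact Icc_subset_Icc_right hr.2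

lemma heat_mode_bound {s t k : ℝ} (hst : s ≤ t) (hl : t - s ≤ 1 / 2) {y g : ℝ → ℝ}
    (hg : IntervalIntegrable g volume s t) (hg2 : IntervalIntegrable (fun r => g r ^ 2) volume s t)
    (hc : ContinuousOn y (Icc s t))
    (hy : ∀ r ∈ Icc s t, y r = y s + ∫ q in s..r, (-k ^ 2 * y q + g q)) :
    (∀ r ∈ Icc s t, y r ^ 2 ≤ 2 * (y s ^ 2 + ∫ q in s..t, g q ^ 2 / (1 + k ^ 2))) ∧
    k ^ 2 * ∫ q in s..t, y q ^ 2 ≤ 2 * (y s ^ 2 + ∫ q in s..t, g q ^ 2 / (1 + k ^ 2)) := by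
  have hk : 0 < 1 + k ^ 2 := by positivity
  set a0 := y s ^ 2 + ∫ q in s..t, g q ^ 2 / (1 + k ^ 2) with ha0
  have hcu : ContinuousOn y (uIcc s t) := by rwa [uIcc_of_le hst]
  have hy2 : IntervalIntegrable (fun q => y q ^ 2) volume s t := (hcu.pow 2).intervalIntegrable
  have hgd := hg2.div_const (1 + k ^ 2)
  have key : ∀ r ∈ Icc s t, y r ^ 2 + k ^ 2 * ∫ q in s..r, y q ^ 2 ≤ a0 + ∫ q in s..r, y q ^ 2 := by
    intro r hr
    have hs := sub_Icc hr
    have hcr := hcu.mono hs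
    have i1 : IntervalIntegrable (fun q => -k ^ 2 * y q + g q) volume s r :=
      ((continuousOn_const.mul hcr).intervalIntegrable).add (hg.mono_set hs)
    have h1 := sq_chain hr.1 i1 (hc.mono (Icc_subset_Icc_right hr.2))
      (fun q hq => hy q ⟨hq.1, hq.2.trans hr.2⟩)
    have h2 : ∫ q in s..r, 2 * y q * (-k ^ 2 * y q + g q) ≤
        ∫ q in s..r, ((1 - k ^ 2) * y q ^ 2 + g q ^ 2 / (1 + k ^ 2)) := by
      refine intervalIntegral.integral_mono_on hr.1
        (i1.continuousOn_mul (continuousOn_const.mul hcr))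
        (((hy2.mono_set hs).const_mul _).add (hgd.mono_set hs)) fun q _ => ?_
      have : g q ^ 2 / (1 + k ^ 2) - 2 * y q * g q + (1 + k ^ 2) * y q ^ 2 =
        (g q - (1 + k ^ 2) * y q) ^ 2 / (1 + k ^ 2) := by field_simp; ring
      have h3 : 0 ≤ (g q - (1 + k ^ 2) * y q) ^ 2 / (1 + k ^ 2) := by positivity
      linarith
    rw [intervalIntegral.integral_add ((hy2.mono_set hs).const_mul _) (hgd.mono_set hs),
      intervalIntegral.integral_const_mul] at h2
    have h4 : ∫ q in s..r, g q ^ 2 / (1 + k ^ 2) ≤ ∫ q in s..t, g q ^ 2 / (1 + k ^ 2) :=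
      intervalIntegral.integral_mono_interval le_rfl hr.1 hr.2
        (Eventually.of_forall fun q => by simp only [Pi.zero_apply]; positivity) hgd
    linarith
  have hnn : ∀ r ∈ Icc s t, 0 ≤ ∫ q in s..r, y q ^ 2 := fun r hr =>
    intervalIntegral.integral_nonneg hr.1 fun _ _ => sq_nonneg _
  have hsup := sup_le_of_integral hst hl (m := fun r => y r ^ 2) (a0 := a0) (hc.pow 2)
    (fun _ _ => sq_nonneg _) fun r hr => by
      have := mul_nonneg (sq_nonneg k) (hnn r hr)
      linarith [key r hr]
  refine ⟨hsup, ?_⟩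
  have h5 : ∫ q in s..t, y q ^ 2 ≤ ∫ q in s..t, 2 * a0 :=
    intervalIntegral.integral_mono_on hst hy2 (by simp) hsup
  rw [intervalIntegral.integral_const, smul_eq_mul] at h5
  have ht := right_mem_Icc.2 hst
  have h6 := key t ht
  have h7 := (sq_nonneg (y t)).trans (hsup t ht)
  have h8 : (t - s) * (2 * a0) ≤ 1 / 2 * (2 * a0) := mul_le_mul_of_nonneg_right hl h7
  linarith [sq_nonneg (y t)]

lemma wave_mode_energy {s t k : ℝ} (hst : s ≤ t) {v w g : ℝ → ℝ}
    (hg : IntervalIntegrable g volume s t)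
    (hcv : ContinuousOn v (Icc s t)) (hcw : ContinuousOn w (Icc s t))
    (hv : ∀ r ∈ Icc s t, v r = v s + ∫ q in s..r, (-k * w q - g q))
    (hw : ∀ r ∈ Icc s t, w r = w s + ∫ q in s..r, k * v q) :
    v t ^ 2 + w t ^ 2 = v s ^ 2 + w s ^ 2 - ∫ q in s..t, 2 * v q * g q := by
  have hcv' : ContinuousOn v (uIcc s t) := by rwa [uIcc_of_le hst]
  have hcw' : ContinuousOn w (uIcc s t) := by rwa [uIcc_of_le hst]
  have i1 : IntervalIntegrable (fun q => -k * w q - g q) volume s t :=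
    ((continuousOn_const.mul hcw').intervalIntegrable).sub hg
  have i2 : IntervalIntegrable (fun q => k * v q) volume s t :=
    (continuousOn_const.mul hcv').intervalIntegrable
  have h1 := sq_chain hst i1 hcv hv
  have h2 := sq_chain hst i2 hcw hw
  have j1 : IntervalIntegrable (fun q => 2 * v q * (-k * w q - g q)) volume s t :=
    i1.continuousOn_mul (continuousOn_const.mul hcv')
  have j2 : IntervalIntegrable (fun q => 2 * w q * (k * v q)) volume s t :=
    i2.continuousOn_mul (continuousOn_const.mul hcw')
  have h3 := intervalIntegral.integral_add j1 j2
  have h4 : ∫ q in s..t, 2 * v q * g q =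
      - ∫ q in s..t, (2 * v q * (-k * w q - g q) + 2 * w q * (k * v q)) := by
    rw [← intervalIntegral.integral_neg]
    exact intervalIntegral.integral_congr fun q _ => by ring
  rw [h4, h3]
  linarith

lemma wave_mode_bound {s t k : ℝ} (hst : s ≤ t) (hl : t - s ≤ 1 / 2) {v w g : ℝ → ℝ}
    (hg : IntervalIntegrable g volume s t) (hg2 : IntervalIntegrable (fun r => g r ^ 2) volume s t)
    (hcv : ContinuousOn v (Icc s t)) (hcw : ContinuousOn w (Icc s t))
    (hv : ∀ r ∈ Icc s t, v r = v s + ∫ q in s..r, (-k * w q - g q))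
    (hw : ∀ r ∈ Icc s t, w r = w s + ∫ q in s..r, k * v q) :
    ∀ r ∈ Icc s t, v r ^ 2 + w r ^ 2 ≤ 2 * (v s ^ 2 + w s ^ 2 + ∫ q in s..t, g q ^ 2) := by
  refine sup_le_of_integral hst hl ((hcv.pow 2).add (hcw.pow 2)) (fun _ _ => by positivity) ?_
  intro r hr
  have hs := sub_Icc hr
  have hcv' : ContinuousOn v (uIcc s r) := by
    rw [uIcc_of_le hr.1]; exact hcv.mono (Icc_subset_Icc_right hr.2)
  have hcw' : ContinuousOn w (uIcc s r) := by
    rw [uIcc_of_le hr.1]; exact hcw.mono (Icc_subset_Icc_right hr.2)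
  have h1 := wave_mode_energy hr.1 (hg.mono_set hs) (hcv.mono (Icc_subset_Icc_right hr.2))
    (hcw.mono (Icc_subset_Icc_right hr.2)) (fun q hq => hv q ⟨hq.1, hq.2.trans hr.2⟩)
    (fun q hq => hw q ⟨hq.1, hq.2.trans hr.2⟩)
  have i1 : IntervalIntegrable (fun q => 2 * v q * g q) volume s r :=
    (hg.mono_set hs).continuousOn_mul (continuousOn_const.mul hcv')
  have i2 : IntervalIntegrable (fun q => v q ^ 2 + w q ^ 2) volume s r :=
    ((hcv'.pow 2).add (hcw'.pow 2)).intervalIntegrable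
  have h2 : ∫ q in s..r, -(2 * v q * g q) ≤ ∫ q in s..r, (g q ^ 2 + (v q ^ 2 + w q ^ 2)) :=
    intervalIntegral.integral_mono_on hr.1 i1.neg ((hg2.mono_set hs).add i2) fun q _ => by
      nlinarith [sq_nonneg (v q + g q), sq_nonneg (w q)]
  rw [intervalIntegral.integral_add (hg2.mono_set hs) i2, intervalIntegral.integral_neg] at h2
  have h4 : ∫ q in s..r, g q ^ 2 ≤ ∫ q in s..t, g q ^ 2 :=
    intervalIntegral.integral_mono_interval le_rfl hr.1 hr.2
      (Eventually.of_forall fun q => sq_nonneg _) hg2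
  linarith

end

section

lemma modes_to_curve {E : Type*} [NormedAddCommGroup E] [InnerProductSpace ℝ E] [CompleteSpace E]
    (B : HilbertBasis ℕ ℝ E) {S : Set ℝ} {y : ℕ → ℝ → ℝ} {c : ℕ → ℝ}
    (hy : ∀ n, ContinuousOn (y n) S) (hb : ∀ n, ∀ r ∈ S, y n r ^ 2 ≤ c n) (hc : Summable c) :
    ∃ z : ℝ → E, ContinuousOn z S ∧ ∀ r ∈ S, ∀ n, ⟪B n, z r⟫_ℝ = y n r := by
  have hex : ∀ r, ∃ h : E, r ∈ S → ∀ n, ⟪B n, h⟫_ℝ = y n r := by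
    intro r
    by_cases hr : r ∈ S
    · obtain ⟨h, hh⟩ := exists_of_summable_sq B (c := fun n => y n r)
        (Summable.of_nonneg_of_le (fun _ => sq_nonneg _) (fun n => hb n r hr) hc)
      exact ⟨h, fun _ => hh⟩
    · exact ⟨0, fun h => absurd h hr⟩
  choose z hz using hex
  refine ⟨z, ?_, fun r hr => hz r hr⟩
  have hlim : Tendsto (fun N => ∑' n, c (n + N)) atTop (𝓝 0) := tendsto_sum_nat_add c
  have hu : TendstoUniformlyOn (fun (N : ℕ) r => ∑ n ∈ Finset.range N, y n r • B n) z atTop S := by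
    rw [Metric.tendstoUniformlyOn_iff]
    intro ε hε
    have h1 : ∀ᶠ N in atTop, ∑' n, c (n + N) < ε ^ 2 := hlim.eventually_lt_const (by positivity)
    filter_upwards [h1] with N hN r hr
    rw [dist_eq_norm]
    have h2 := hasSum_sq_inner B (z r - ∑ n ∈ Finset.range N, y n r • B n)
    have h3 := (hasSum_nat_add_iff' N).2 h2
    have h4 : ∀ n, ⟪B n, z r - ∑ n ∈ Finset.range N, y n r • B n⟫_ℝ =
        if n < N then 0 else y n r := by
      intro n
      rw [inner_sub_right, inner_sum_basis B (fun n => y n r), hz r hr]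
      split_ifs <;> simp
    have h5 : ∑ n ∈ Finset.range N, ⟪B n, z r - ∑ n ∈ Finset.range N, y n r • B n⟫_ℝ ^ 2 = 0 :=
      Finset.sum_eq_zero fun n hn => by rw [h4, if_pos (Finset.mem_range.1 hn)]; simp
    rw [h5, sub_zero] at h3
    have h6 := hasSum_le (fun n => by
      rw [h4, if_neg (by omega)]; exact hb _ r hr) h3 ((summable_nat_add_iff N).2 hc).hasSum
    exact (sq_lt_sq₀ (norm_nonneg _) hε.le).1 (h6.trans_lt hN)
  exact hu.continuousOn (Eventually.of_forall fun N =>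
    continuousOn_finsetSum _ fun n _ => (hy n).smul continuousOn_const).frequently

section
variable {a b : ℝ} [hab : Fact (a < b)]

lemma hasSum_cos_finset (N : ℕ) (c : ℕ → ℝ) :
    let φ : HS a b := ∑ n ∈ Finset.range N, c n • cosH a b n
    InV φ ∧ ‖φ‖ ^ 2 = ∑ n ∈ Finset.range N, c n ^ 2 ∧
      ‖Dx φ‖ ^ 2 = ∑ n ∈ Finset.range N, (kf a b n * c n) ^ 2 := by
  intro φ
  have hφ : ∀ m, ⟪cosH a b m, φ⟫_ℝ = if m < N then c m else 0 := by
    intro m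
    have := inner_sum_basis (cosB a b) c N m
    simpa only [cosB_apply] using this
  have h0 : ∀ m ∉ Finset.range N, (kf a b m * ⟪cosH a b m, φ⟫_ℝ) ^ 2 = 0 := fun m hm => by
    rw [hφ, if_neg (by simpa using hm)]; simp
  have h0' : ∀ m ∉ Finset.range N, ⟪cosH a b m, φ⟫_ℝ ^ 2 = 0 := fun m hm => by
    rw [hφ, if_neg (by simpa using hm)]; simp
  have h1 : HasSum (fun m => (kf a b m * ⟪cosH a b m, φ⟫_ℝ) ^ 2)
      (∑ m ∈ Finset.range N, (kf a b m * ⟪cosH a b m, φ⟫_ℝ) ^ 2) :=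
    hasSum_sum_of_ne_finset_zero h0
  have h2 : HasSum (fun m => ⟪cosH a b m, φ⟫_ℝ ^ 2) (∑ m ∈ Finset.range N, ⟪cosH a b m, φ⟫_ℝ ^ 2) :=
    hasSum_sum_of_ne_finset_zero h0'
  have hV : InV φ := inV_of_summable h1.summable
  refine ⟨hV, ?_, ?_⟩
  · rw [(hasSum_sq_cos φ).unique h2]
    exact Finset.sum_congr rfl fun m hm => by rw [hφ, if_pos (by simpa using hm)]
  · rw [hV.hasSum.unique h1]
    exact Finset.sum_congr rfl fun m hm => by rw [hφ, if_pos (by simpa using hm)]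

lemma inV_cosH (n : ℕ) : InV (cosH a b n) := by
  refine inV_of_summable (summable_of_ne_finset_zero (s := {n}) fun m hm => ?_)
  have := orthonormal_cosH a b
  rw [this.2 (by simpa using hm)]; simp

lemma InV.sum {s : Finset ℕ} {c : ℕ → ℝ} :
    InV (∑ n ∈ s, c n • cosH a b n) := by
  induction s using Finset.induction_on with
  | empty => simpa using inV_zero
  | insert n s hn ih => rw [Finset.sum_insert hn]; exact ((inV_cosH n).smul _).add ih

lemma LinV.sum {G : HS a b → ℝ} {γ : ℝ} (hG : LinV G γ) (s : Finset ℕ) (c : ℕ → ℝ) :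
    G (∑ n ∈ s, c n • cosH a b n) = ∑ n ∈ s, c n * G (cosH a b n) := by
  induction s using Finset.induction_on with
  | empty => simpa using hG.smul 0 0 inV_zero
  | insert n s hn ih =>
    rw [Finset.sum_insert hn, Finset.sum_insert hn, hG.add _ _ ((inV_cosH n).smul _) InV.sum, ih,
      hG.smul _ _ (inV_cosH n)]

lemma LinV.sum_sq_le {G : HS a b → ℝ} {γ : ℝ} (hG : LinV G γ) (N : ℕ) :
    ∑ n ∈ Finset.range N, G (cosH a b n) ^ 2 / (1 + kf a b n ^ 2) ≤ 2 * γ ^ 2 := by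
  set S := ∑ n ∈ Finset.range N, G (cosH a b n) ^ 2 / (1 + kf a b n ^ 2) with hS
  set c : ℕ → ℝ := fun n => G (cosH a b n) / (1 + kf a b n ^ 2)
  obtain ⟨hV, h1, h2⟩ := hasSum_cos_finset (a := a) (b := b) N c
  set φ : HS a b := ∑ n ∈ Finset.range N, c n • cosH a b n
  have h3 : G φ = S := by
    rw [hG.sum, hS]
    exact Finset.sum_congr rfl fun n _ => by simp only [c]; ring
  have h4 : ‖φ‖ ^ 2 + ‖Dx φ‖ ^ 2 = S := by
    rw [h1, h2, ← Finset.sum_add_distrib, hS]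
    refine Finset.sum_congr rfl fun n _ => ?_
    have : 0 < 1 + kf a b n ^ 2 := by positivity
    simp only [c]; field_simp
  have h5 := hG.bound φ hV
  rw [h3] at h5
  have h6 : S ≤ γ * (‖φ‖ + ‖Dx φ‖) := (le_abs_self S).trans h5
  nlinarith [sq_nonneg (2 * γ - (‖φ‖ + ‖Dx φ‖)), sq_nonneg (‖φ‖ - ‖Dx φ‖)]

/-- Curves in `C([s,t]; L²) ∩ L²(s,t; W^{1,2})`. -/
structure CurV (s t : ℝ) (θ : ℝ → HS a b) : Prop where
  cont : ContinuousOn θ (Icc s t)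
  inV : ∀ᵐ r ∂volume.restrict (Ioc s t), InV (θ r)
  sq : IntervalIntegrable (fun r => ‖Dx (θ r)‖ ^ 2) volume s t

lemma aemeasurable_qD {s t : ℝ} {θ : ℝ → HS a b} (hc : ContinuousOn θ (Icc s t)) :
    AEMeasurable (fun r => qD (θ r)) (volume.restrict (Ioc s t)) :=
  measurable_qD.comp_aemeasurable ((hc.mono Ioc_subset_Icc_self).aemeasurable measurableSet_Ioc)

lemma lintegral_qD {s t : ℝ} (hst : s ≤ t) {θ : ℝ → HS a b} (H : CurV s t θ) :
    ∫⁻ r in Ioc s t, qD (θ r) = ENNReal.ofReal (∫ r in s..t, ‖Dx (θ r)‖ ^ 2) := by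
  rw [intervalIntegral.integral_of_le hst, ofReal_integral_eq_lintegral_ofReal
    ((intervalIntegrable_iff_integrableOn_Ioc_of_le hst).1 H.sq)
    (Eventually.of_forall fun _ => sq_nonneg _)]
  refine lintegral_congr_ae ?_
  filter_upwards [H.inV] with r hr
  exact hr.qD_eq

lemma CurV.of_lintegral {s t : ℝ} (hst : s ≤ t) {θ : ℝ → HS a b} (hc : ContinuousOn θ (Icc s t))
    (H : ∫⁻ r in Ioc s t, qD (θ r) < ∞) : CurV s t θ := by
  have hm := aemeasurable_qD hc
  have hV : ∀ᵐ r ∂volume.restrict (Ioc s t), InV (θ r) := by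
    filter_upwards [ae_lt_top' hm H.ne] with r hr
    exact inV_iff.2 hr
  refine ⟨hc, hV, ?_⟩
  rw [intervalIntegrable_iff_integrableOn_Ioc_of_le hst]
  refine (integrable_toReal_of_lintegral_ne_top hm H.ne).congr ?_
  filter_upwards [hV] with r hr
  rw [hr.qD_eq, ENNReal.toReal_ofReal (sq_nonneg _)]

lemma CurV.mono {s t s' t' : ℝ} {θ : ℝ → HS a b} (H : CurV s t θ) (hs : s ≤ s') (h : s' ≤ t')
    (ht : t' ≤ t) : CurV s' t' θ where
  cont := H.cont.mono (Icc_subset_Icc hs ht)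
  inV := ae_restrict_of_ae_restrict_of_subset (Ioc_subset_Ioc hs ht) H.inV
  sq := H.sq.mono_set (by
    rw [uIcc_of_le h, uIcc_of_le (hs.trans (h.trans ht))]; exact Icc_subset_Icc hs ht)

lemma CurV.aesm {s t : ℝ} (hst : s ≤ t) {θ : ℝ → HS a b} (H : CurV s t θ) :
    AEStronglyMeasurable (fun r => ‖Dx (θ r)‖) (volume.restrict (Ioc s t)) := by
  have h1 := ((intervalIntegrable_iff_integrableOn_Ioc_of_le hst).1 H.sq).aestronglyMeasurable
  refine (Real.continuous_sqrt.comp_aestronglyMeasurable h1).congr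
      (Eventually.of_forall fun r => ?_)
  exact Real.sqrt_sq (norm_nonneg _)

lemma CurV.sub {s t : ℝ} (hst : s ≤ t) {θ η : ℝ → HS a b} (H : CurV s t θ) (K : CurV s t η) :
    CurV s t (fun r => θ r - η r) := by
  refine CurV.of_lintegral hst (H.cont.sub K.cont) ?_
  have hi := (intervalIntegrable_iff_integrableOn_Ioc_of_le hst).1
    ((H.sq.const_mul 2).add (K.sq.const_mul 2))
  refine lt_of_le_of_lt (lintegral_mono_ae ?_) hi.lintegral_lt_top
  filter_upwards [H.inV, K.inV] with r h k
  rw [(h.sub k).qD_eq, Dx_sub h k]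
  refine ENNReal.ofReal_le_ofReal ?_
  have := norm_sub_le (Dx (θ r)) (Dx (η r))
  nlinarith [norm_nonneg (Dx (θ r)), norm_nonneg (Dx (η r)), norm_nonneg (Dx (θ r) - Dx (η r)),
    sq_nonneg (‖Dx (θ r)‖ - ‖Dx (η r)‖)]

/-- A time dependent functional, square integrable with values in the dual of `W^{1,2}`. -/
structure Force (s t : ℝ) (G : ℝ → HS a b → ℝ) (γ : ℝ → ℝ) : Prop where
  lin : ∀ᵐ r ∂volume.restrict (Ioc s t), LinV (G r) (γ r)
  sq : IntervalIntegrable (fun r => γ r ^ 2) volume s t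
  meas : ∀ n, AEStronglyMeasurable (fun r => G r (cosH a b n)) (volume.restrict (Ioc s t))

/-- The heat equation with source `G`, in Fourier modes. -/
def HeatEq (s t : ℝ) (G : ℝ → HS a b → ℝ) (z : ℝ → HS a b) : Prop :=
  ∀ n, ∀ r ∈ Icc s t, ⟪cosH a b n, z r⟫_ℝ = ⟪cosH a b n, z s⟫_ℝ +
    ∫ q in s..r, (-kf a b n ^ 2 * ⟪cosH a b n, z q⟫_ℝ + G q (cosH a b n))

lemma Force.int_sq {s t : ℝ} (hst : s ≤ t) {G : ℝ → HS a b → ℝ} {γ : ℝ → ℝ} (H : Force s t G γ)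
    (n : ℕ) : IntervalIntegrable (fun r => G r (cosH a b n) ^ 2) volume s t := by
  rw [intervalIntegrable_iff_integrableOn_Ioc_of_le hst]
  have hi := (intervalIntegrable_iff_integrableOn_Ioc_of_le hst).1
    (H.sq.const_mul ((1 + kf a b n) ^ 2))
  refine hi.mono' ((H.meas n).pow 2) ?_
  filter_upwards [H.lin] with r hr
  have h1 := hr.bound _ (inV_cosH n)
  have h2 : ‖Dx (cosH a b n)‖ = |kf a b n| := by
    have := ((inV_cosH n (a := a) (b := b)).hasSum).unique (hasSum_single n fun m hm => by
      rw [(orthonormal_cosH a b).2 hm]; simp)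
    rw [real_inner_self_eq_norm_sq, (orthonormal_cosH a b).1] at this
    have h3 : ‖Dx (cosH a b n)‖ ^ 2 = kf a b n ^ 2 := by rw [this]; ring
    rw [← abs_norm, ← sq_eq_sq_iff_abs_eq_abs]; exact h3
  have hk : 0 ≤ kf a b n := by
    have := hab.out
    unfold kf; have : 0 < b - a := by linarith
    positivity
  rw [h2, (orthonormal_cosH a b).1, abs_of_nonneg hk] at h1
  rw [Real.norm_eq_abs, abs_pow, ← mul_pow, mul_comm (1 + kf a b n)]
  exact pow_le_pow_left₀ (abs_nonneg _) h1 2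

lemma Force.int {s t : ℝ} (hst : s ≤ t) {G : ℝ → HS a b → ℝ} {γ : ℝ → ℝ} (H : Force s t G γ)
    (n : ℕ) : IntervalIntegrable (fun r => G r (cosH a b n)) volume s t :=
  IntervalIntegrable.of_sq hst (H.meas n) (H.int_sq hst n)

theorem heat_solve {s t : ℝ} (hst : s ≤ t) (hl : t - s ≤ 1 / 2) {G : ℝ → HS a b → ℝ} {γ : ℝ → ℝ}
    (H : Force s t G γ) (z0 : HS a b) :
    ∃ z : ℝ → HS a b, z s = z0 ∧ CurV s t z ∧ HeatEq s t G z := by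
  have hmode := fun n => heat_mode_exists hst (kf a b n ^ 2) ⟪cosH a b n, z0⟫_ℝ (H.int hst n)
  choose y hyc hy0 hy using hmode
  have hbd := fun n => heat_mode_bound (k := kf a b n) hst hl (H.int hst n) (H.int_sq hst n)
    (hyc n).continuousOn (fun r hr => by rw [hy0]; exact hy n r hr)
  set c : ℕ → ℝ := fun n => 2 * (y n s ^ 2 +
    ∫ q in s..t, G q (cosH a b n) ^ 2 / (1 + kf a b n ^ 2)) with hcdef
  have hint : ∀ n, IntervalIntegrable (fun q => G q (cosH a b n) ^ 2 / (1 + kf a b n ^ 2))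
      volume s t := fun n => (H.int_sq hst n).div_const _
  have hc : Summable c := by
    refine Summable.mul_left 2 (Summable.add ?_ ?_)
    · simp only [hy0]; exact (hasSum_sq_cos z0).summable
    · refine summable_of_sum_range_le (c := ∫ q in s..t, 2 * γ q ^ 2)
        (fun n => intervalIntegral.integral_nonneg hst fun q _ => by positivity) fun N => ?_
      rw [← intervalIntegral.integral_finsetSum fun n _ => hint n]
      have hs := IntervalIntegrable.sum (Finset.range N) (fun n _ => hint n)
      rw [intervalIntegral.integral_of_le hst, intervalIntegral.integral_of_le hst]
      refine integral_mono_ae ((intervalIntegrable_iff_integrableOn_Ioc_of_le hst).1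
        (by rw [Finset.sum_fn] at hs; exact hs))
        ((intervalIntegrable_iff_integrableOn_Ioc_of_le hst).1 (H.sq.const_mul 2)) ?_
      filter_upwards [H.lin] with q hq
      exact hq.sum_sq_le N
  obtain ⟨z, hzc, hz⟩ := modes_to_curve (cosB a b) (fun n => (hyc n).continuousOn)
    (fun n => (hbd n).1) hc
  simp only [cosB_apply] at hz
  have hzs : z s = z0 := ext_cos fun n => by rw [hz s (left_mem_Icc.2 hst), hy0]
  refine ⟨z, hzs, CurV.of_lintegral hst hzc ?_, fun n r hr => ?_⟩
  · have e1 : ∫⁻ r in Ioc s t, qD (z r) =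
        ∫⁻ r in Ioc s t, ∑' n, ENNReal.ofReal ((kf a b n * y n r) ^ 2) :=
      setLIntegral_congr_fun measurableSet_Ioc fun r hr => by
        simp only [qD, hz r (Ioc_subset_Icc_self hr)]
    have hcon : ∀ n, Continuous fun r => (kf a b n * y n r) ^ 2 := fun n =>
      (continuous_const.mul (hyc n)).pow 2
    rw [e1, lintegral_tsum fun n => (hcon n).measurable.ennreal_ofReal.aemeasurable]
    have e2 : ∀ n, ∫⁻ r in Ioc s t, ENNReal.ofReal ((kf a b n * y n r) ^ 2) ≤
        ENNReal.ofReal (c n) := fun n => by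
      rw [← ofReal_integral_eq_lintegral_ofReal
        ((intervalIntegrable_iff_integrableOn_Ioc_of_le hst).1 ((hcon n).intervalIntegrable s t))
        (Eventually.of_forall fun _ => sq_nonneg _), ← intervalIntegral.integral_of_le hst]
      refine ENNReal.ofReal_le_ofReal ?_
      simp only [mul_pow]
      rw [intervalIntegral.integral_const_mul]
      exact (hbd n).2
    refine (ENNReal.tsum_le_tsum e2).trans_lt ?_
    rw [← ENNReal.ofReal_tsum_of_nonneg (fun n => (sq_nonneg _).trans ((hbd n).1 s
      (left_mem_Icc.2 hst))) hc]
    exact ENNReal.ofReal_lt_top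
  · rw [hz r hr, hzs, hy n r hr]
    congr 1
    refine intervalIntegral.integral_congr fun q hq => ?_
    rw [uIcc_of_le hr.1] at hq
    simp only [hz q ⟨hq.1, hq.2.trans hr.2⟩]

/-- Square integrable forcing for the wave equation. -/
structure WForce (s t : ℝ) (F : ℝ → HS a b) : Prop where
  meas : ∀ n, AEStronglyMeasurable (fun r => ⟪sinH a b n, F r⟫_ℝ) (volume.restrict (Ioc s t))
  bound : ∃ φ : ℝ → ℝ, IntervalIntegrable (fun r => φ r ^ 2) volume s t ∧
    ∀ᵐ r ∂volume.restrict (Ioc s t), ‖F r‖ ≤ φ r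

/-- The wave system `v_t = w_x - F`, `w_t = v_x` in Fourier modes. -/
structure WaveEq (s t : ℝ) (F : ℝ → HS a b) (v w : ℝ → HS a b) : Prop where
  cv : ContinuousOn v (Icc s t)
  cw : ContinuousOn w (Icc s t)
  eqv : ∀ n, ∀ r ∈ Icc s t, ⟪sinH a b n, v r⟫_ℝ = ⟪sinH a b n, v s⟫_ℝ +
    ∫ q in s..r, (-kf a b (n + 1) * ⟪cosH a b (n + 1), w q⟫_ℝ - ⟪sinH a b n, F q⟫_ℝ)
  eqw : ∀ n, ∀ r ∈ Icc s t, ⟪cosH a b (n + 1), w r⟫_ℝ = ⟪cosH a b (n + 1), w s⟫_ℝ +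
    ∫ q in s..r, kf a b (n + 1) * ⟪sinH a b n, v q⟫_ℝ
  zero : ∀ r ∈ Icc s t, ⟪cosH a b 0, w r⟫_ℝ = ⟪cosH a b 0, w s⟫_ℝ

lemma WForce.int_sq {s t : ℝ} (hst : s ≤ t) {F : ℝ → HS a b} (H : WForce s t F) (n : ℕ) :
    IntervalIntegrable (fun r => ⟪sinH a b n, F r⟫_ℝ ^ 2) volume s t := by
  obtain ⟨φ, h1, h2⟩ := H.bound
  rw [intervalIntegrable_iff_integrableOn_Ioc_of_le hst] at h1 ⊢
  refine h1.mono' ((H.meas n).pow 2) ?_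
  filter_upwards [h2] with r hr
  rw [norm_pow]
  refine pow_le_pow_left₀ (norm_nonneg _) (((norm_inner_le_norm _ _).trans ?_).trans hr) 2
  have : ‖sinH a b n‖ = 1 := (orthonormal_sinH a b).1 n
  rw [this, one_mul]

lemma WForce.int {s t : ℝ} (hst : s ≤ t) {F : ℝ → HS a b} (H : WForce s t F) (n : ℕ) :
    IntervalIntegrable (fun r => ⟪sinH a b n, F r⟫_ℝ) volume s t :=
  IntervalIntegrable.of_sq hst (H.meas n) (H.int_sq hst n)

theorem wave_solve {s t : ℝ} (hst : s ≤ t) (hl : t - s ≤ 1 / 2) {F : ℝ → HS a b}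
    (H : WForce s t F) (v0 w0 : HS a b) :
    ∃ v w : ℝ → HS a b, v s = v0 ∧ w s = w0 ∧ WaveEq s t F v w := by
  have hmode := fun n => wave_mode_exists hst (kf a b (n + 1)) ⟪sinH a b n, v0⟫_ℝ
    ⟪cosH a b (n + 1), w0⟫_ℝ (H.int hst n)
  choose y x hyc hxc hy0 hx0 hy hx using hmode
  have hbd := fun n => wave_mode_bound (k := kf a b (n + 1)) hst hl (H.int hst n) (H.int_sq hst n)
    (hyc n).continuousOn (hxc n).continuousOn (fun r hr => by rw [hy0]; exact hy n r hr)
    (fun r hr => by rw [hx0]; exact hx n r hr)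
  set c : ℕ → ℝ := fun n => 2 * (y n s ^ 2 + x n s ^ 2 +
    ∫ q in s..t, ⟪sinH a b n, F q⟫_ℝ ^ 2) with hcdef
  have hc : Summable c := by
    refine Summable.mul_left 2 (Summable.add (Summable.add ?_ ?_) ?_)
    · simp only [hy0]; exact (hasSum_sq_sin v0).summable
    · simp only [hx0]; exact (summable_nat_add_iff 1).2 (hasSum_sq_cos w0).summable
    · obtain ⟨φ, h1, h2⟩ := H.bound
      refine summable_of_sum_range_le (c := ∫ q in s..t, φ q ^ 2)
        (fun n => intervalIntegral.integral_nonneg hst fun q _ => by positivity) fun N => ?_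
      rw [← intervalIntegral.integral_finsetSum fun n _ => H.int_sq hst n]
      have hs := IntervalIntegrable.sum (Finset.range N) (fun n _ => H.int_sq hst n)
      rw [intervalIntegral.integral_of_le hst, intervalIntegral.integral_of_le hst]
      refine integral_mono_ae ((intervalIntegrable_iff_integrableOn_Ioc_of_le hst).1
        (by rw [Finset.sum_fn] at hs; exact hs))
        ((intervalIntegrable_iff_integrableOn_Ioc_of_le hst).1 h1) ?_
      filter_upwards [h2] with q hq
      refine (sum_le_hasSum _ (fun _ _ => sq_nonneg _) (hasSum_sq_sin (F q))).trans ?_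
      exact pow_le_pow_left₀ (norm_nonneg _) hq 2
  obtain ⟨v, hvc, hv⟩ := modes_to_curve (sinB a b) (fun n => (hyc n).continuousOn)
    (fun n r hr => le_trans (by linarith [sq_nonneg (x n r)]) (hbd n r hr)) hc
  set X : ℕ → ℝ → ℝ := fun n => Nat.casesOn n (fun _ => ⟪cosH a b 0, w0⟫_ℝ) x with hX
  obtain ⟨w, hwc, hw⟩ := modes_to_curve (cosB a b) (S := Icc s t) (y := X)
    (c := fun n => Nat.casesOn n (⟪cosH a b 0, w0⟫_ℝ ^ 2) c)
    (fun n => by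
      cases n with
      | zero => exact continuousOn_const
      | succ n => exact (hxc n).continuousOn)
    (fun n r hr => by
      cases n with
      | zero => exact le_rfl
      | succ n => exact le_trans (by linarith [sq_nonneg (y n r)]) (hbd n r hr))
    ((summable_nat_add_iff 1).1 hc)
  simp only [cosB_apply] at hw
  simp only [sinB_apply] at hv
  have hs := left_mem_Icc.2 hst
  have hvs : v s = v0 := ext_sin fun n => by rw [hv s hs, hy0]
  have hws : w s = w0 := ext_cos fun n => by
    rw [hw s hs]
    cases n with
    | zero => rfl
    | succ n => exact hx0 n
  have hw' : ∀ r ∈ Icc s t, ∀ n, ⟪cosH a b (n + 1), w r⟫_ℝ = x n r := fun r hr n => hw r hr (n + 1)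
  refine ⟨v, w, hvs, hws, hvc, hwc, fun n r hr => ?_, fun n r hr => ?_, fun r hr => ?_⟩
  · rw [hv r hr, hvs, hy n r hr]
    congr 1
    refine intervalIntegral.integral_congr fun q hq => ?_
    rw [uIcc_of_le hr.1] at hq
    simp only [hw' q ⟨hq.1, hq.2.trans hr.2⟩]
  · rw [hw' r hr, hws, hx n r hr]
    congr 1
    refine intervalIntegral.integral_congr fun q hq => ?_
    rw [uIcc_of_le hr.1] at hq
    simp only [hv q ⟨hq.1, hq.2.trans hr.2⟩]
  · exact (hw r hr 0).trans (hw s hs 0).symm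

end

end

section

variable {a b : ℝ} [hab : Fact (a < b)] {g g' : ℝ → ℝ} {M : ℝ}

lemma LinV.sub' {G : HS a b → ℝ} {γ : ℝ} (hG : LinV G γ) {φ ψ : HS a b} (hφ : InV φ)
    (hψ : InV ψ) : G (φ - ψ) = G φ - G ψ := by
  have h1 := hG.add φ ((-1 : ℝ) • ψ) hφ (hψ.smul _)
  rw [hG.smul _ _ hψ] at h1
  rw [sub_eq_add_neg, ← neg_one_smul ℝ ψ, h1]; ring

lemma LinV.tendsto {G : HS a b → ℝ} {γ : ℝ} (hG : LinV G γ) {u : ℕ → HS a b} {φ : HS a b}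
    (hu : ∀ n, InV (u n)) (hφ : InV φ) (h : Tendsto u atTop (𝓝 φ))
    (h' : Tendsto (fun n => Dx (u n)) atTop (𝓝 (Dx φ))) :
    Tendsto (fun n => G (u n)) atTop (𝓝 (G φ)) := by
  rw [tendsto_iff_norm_sub_tendsto_zero] at h h' ⊢
  have h1 : Tendsto (fun n => γ * (‖u n - φ‖ + ‖Dx (u n) - Dx φ‖)) atTop (𝓝 0) := by
    simpa using (h.add h').const_mul γ
  refine squeeze_zero (fun n => norm_nonneg _) (fun n => ?_) h1
  rw [← hG.sub' (hu n) hφ, ← Dx_sub (hu n) hφ]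
  exact hG.bound _ ((hu n).sub hφ)

lemma LinV.nonneg {G : HS a b → ℝ} {γ : ℝ} (hG : LinV G γ) : 0 ≤ γ := by
  have h1 := hG.bound _ (inV_cosH 0)
  have h2 : ‖cosH a b 0‖ = 1 := (orthonormal_cosH a b).1 0
  rw [h2] at h1
  by_contra h
  have := (abs_nonneg _).trans h1
  nlinarith [norm_nonneg (Dx (cosH a b 0))]

lemma inner_DN (N : ℕ) (h k : HS a b) : ⟪DN N h, k⟫_ℝ =
    ∑ n ∈ Finset.range N, (-kf a b (n + 1) * ⟪cosH a b (n + 1), h⟫_ℝ) * ⟪sinH a b n, k⟫_ℝ := by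
  simp only [DN, sum_inner, inner_smul_left, RCLike.conj_to_real]

lemma tendsto_PN_PN {u : ℕ → HS a b} {h : HS a b} (hu : Tendsto u atTop (𝓝 h)) :
    Tendsto (fun N => PN N (u N)) atTop (𝓝 h) := by
  have h1 : Tendsto (fun N => PN N (u N) - PN N h) atTop (𝓝 0) := by
    refine squeeze_zero_norm (fun N => ?_) (tendsto_iff_norm_sub_tendsto_zero.1 hu)
    rw [← PN_sub]; exact norm_PN_le _ _
  simpa using h1.add (tendsto_PN h)

lemma tendsto_DN_PN {u : ℕ → HS a b} {h : HS a b} (hV : ∀ n, InV (u n)) (H : InV h)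
    (hu : Tendsto (fun n => Dx (u n)) atTop (𝓝 (Dx h))) :
    Tendsto (fun N => DN N (u N)) atTop (𝓝 (Dx h)) := by
  have h1 : Tendsto (fun N => DN N (u N) - DN N h) atTop (𝓝 0) := by
    refine squeeze_zero_norm (fun N => ?_) (tendsto_iff_norm_sub_tendsto_zero.1 hu)
    have e : DN N (u N) - DN N h = DN N (u N - h) := by
      rw [← Dx_PN, ← Dx_PN, ← Dx_PN, PN_sub, Dx_sub (inV_PN _ _) (inV_PN _ _)]
    rw [e, ← Dx_sub (hV N) H]; exact norm_DN_le _ ((hV N).sub H)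
  simpa using h1.add (tendsto_DN H)

lemma heat_flux_trunc {G : HS a b → ℝ} {γ : ℝ} (hG : LinV G γ) (N : ℕ) {h k : HS a b}
    (K : InV k) :
    ∑ n ∈ Finset.range (N + 1), (-kf a b n ^ 2 * ⟪cosH a b n, h⟫_ℝ + G (cosH a b n)) *
      ⟪cosH a b n, k⟫_ℝ = -⟪DN N h, Dx k⟫_ℝ + G (PN N k) := by
  have h1 : G (PN N k) = ∑ n ∈ Finset.range (N + 1), ⟪cosH a b n, k⟫_ℝ * G (cosH a b n) := by
    rw [PN, hG.sum]
  rw [h1, inner_DN]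
  simp only [add_mul, Finset.sum_add_distrib]
  congr 1
  · rw [Finset.sum_range_succ', kf_zero, ← Finset.sum_neg_distrib]
    simp only [K.hasD _]
    have e0 : -(0 : ℝ) ^ 2 * ⟪cosH a b 0, h⟫_ℝ * ⟪cosH a b 0, k⟫_ℝ = 0 := by ring
    rw [e0, add_zero]
    exact Finset.sum_congr rfl fun n _ => by ring
  · exact Finset.sum_congr rfl fun n _ => by ring

/-- The chain rule for an integral functional along a solution of the heat equation. -/
theorem heat_chain {s t : ℝ} (hst : s ≤ t) {G : ℝ → HS a b → ℝ} {γ : ℝ → ℝ}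
    (H : Force s t G γ) {z : ℝ → HS a b} (hz : CurV s t z) (hz' : HeatEq s t G z)
    (hg : C11 g g' M) {E : HS a b → ℝ} (hE : ∀ h, HasFDerivAt E (innerSL ℝ (nem g h)) h) :
    IntervalIntegrable (fun q => -⟪Dx (z q), FN g' (z q)⟫_ℝ + G q (nem g (z q))) volume s t ∧
    E (z t) - E (z s) = ∫ q in s..t, (-⟪Dx (z q), FN g' (z q)⟫_ℝ + G q (nem g (z q))) := by
  have hM := hg.M_nonneg
  have hcE : Continuous E := continuous_iff_continuousAt.2 fun h => (hE h).continuousAt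
  set α : ℕ → ℝ → ℝ := fun n q => -kf a b n ^ 2 * ⟪cosH a b n, z q⟫_ℝ + G q (cosH a b n) with hα
  have hzc : ContinuousOn z (uIcc s t) := by rw [uIcc_of_le hst]; exact hz.cont
  have hci : ∀ n, ContinuousOn (fun q => ⟪cosH a b n, z q⟫_ℝ) (uIcc s t) := fun n =>
    continuousOn_const.inner hzc
  have hαi : ∀ n, IntervalIntegrable (α n) volume s t := fun n =>
    ((hci n).const_mul _).intervalIntegrable.add (H.int hst n)
  set f : ℕ → ℝ → ℝ := fun N q => ∑ n ∈ Finset.range (N + 1), α n q *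
    ⟪cosH a b n, nem g (PN N (z q))⟫_ℝ with hf
  have hfi : ∀ N, IntervalIntegrable (f N) volume s t := fun N => by
    have h1 : ∀ n ∈ Finset.range (N + 1), IntervalIntegrable (fun q => α n q *
        ⟪cosH a b n, nem g (PN N (z q))⟫_ℝ) volume s t := fun n _ =>
      (hαi n).mul_continuousOn (continuousOn_const.inner
        ((continuous_nem hg).comp_continuousOn ((continuous_PN N).comp_continuousOn hzc)))
    have := IntervalIntegrable.sum _ h1
    rw [Finset.sum_fn] at this; exact this
  have hFT : ∀ N, E (PN N (z t)) - E (PN N (z s)) = ∫ q in s..t, f N q := fun N => by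
    set h : ℝ → HS a b := fun q => ∑ n ∈ Finset.range (N + 1), α n q • cosH a b n with hh
    have hhi : IntervalIntegrable h volume s t := by
      have h1 : ∀ n ∈ Finset.range (N + 1),
        IntervalIntegrable (fun q => α n q • cosH a b n) volume s t := fun n _ =>
          (hαi n).smul_continuousOn continuousOn_const
      have := IntervalIntegrable.sum _ h1
      rw [Finset.sum_fn] at this; exact this
    have hfe : ∀ q, innerSL ℝ (nem g (PN N (z q))) (h q) = f N q := fun q => by
      simp only [innerSL_apply_apply, hh, inner_sum, inner_smul_right, hf]
      exact Finset.sum_congr rfl fun n _ => by rw [real_inner_comm]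
    have hy : ∀ r ∈ Icc s t, PN N (z r) = PN N (z s) + ∫ q in s..r, h q := fun r hr => by
      rw [hh, intervalIntegral.integral_finsetSum]
      · simp only [intervalIntegral.integral_smul_const, PN]
        rw [← Finset.sum_add_distrib]
        refine Finset.sum_congr rfl fun n _ => ?_
        rw [← add_smul, hz' n r hr]
      · exact fun n _ => ((hαi n).mono_set (sub_Icc hr)).smul_continuousOn continuousOn_const
    obtain ⟨R, hR⟩ := isCompact_Icc.exists_bound_of_continuousOn
      ((continuous_PN N).comp_continuousOn hz.cont)
    have hR0 : 0 ≤ R := (norm_nonneg _).trans (hR s (left_mem_Icc.2 hst))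
    have := integral_chain hst hhi hy hE (mul_nonneg hM hR0) (fun p hp q hq => by
      refine (convex_closedBall (0 : HS a b) R).norm_image_sub_le_of_norm_hasFDerivWithin_le
        (𝕜 := ℝ) (f' := fun h => innerSL ℝ (nem g h))
        (fun x _ => (hE x).hasFDerivWithinAt) (fun x hx => ?_) (x := PN N (z q))
          (y := PN N (z p)) (by simpa using hR q hq) (by simpa using hR p hp)
      rw [innerSL_apply_norm]
      exact (norm_nem_le hg x).trans (mul_le_mul_of_nonneg_left (by simpa using hx) hM))
      (by simp only [hfe]; exact hfi N)
    simpa only [hfe] using this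
  set L : ℝ → ℝ := fun q => -⟪Dx (z q), FN g' (z q)⟫_ℝ + G q (nem g (z q)) with hL
  obtain ⟨R, hR⟩ := isCompact_Icc.exists_bound_of_continuousOn hz.cont
  set B : ℝ → ℝ := fun q => M * ‖Dx (z q)‖ ^ 2 + M * (γ q ^ 2 + R ^ 2 + ‖Dx (z q)‖ ^ 2) with hB
  have hBi : IntervalIntegrable B volume s t :=
    (hz.sq.const_mul M).add (((H.sq.add intervalIntegrable_const).add hz.sq).const_mul M)
  have hev : ∀ᵐ q ∂volume.restrict (Ioc s t), (∀ N, ‖f N q‖ ≤ B q) ∧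
      Tendsto (fun N => f N q) atTop (𝓝 (L q)) := by
    filter_upwards [hz.inV, H.lin, ae_restrict_mem measurableSet_Ioc] with q hV hG hq
    have hγ := hG.nonneg
    have hK : ∀ N, InV (nem g (PN N (z q))) := fun N => inV_nem hg (inV_PN _ _)
    have e : ∀ N, f N q = -⟪DN N (z q), FN g' (PN N (z q))⟫_ℝ +
        G q (PN N (nem g (PN N (z q)))) := fun N => by
      rw [← Dx_nem hg (inV_PN N (z q)), ← heat_flux_trunc hG N (hK N)]
    constructor
    · intro N
      rw [e N, Real.norm_eq_abs]
      have i0 : ‖DN N (z q)‖ ≤ ‖Dx (z q)‖ := norm_DN_le N hV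
      have i1 : ‖FN g' (PN N (z q))‖ ≤ M * ‖Dx (z q)‖ := by
        refine (norm_FN_le hg _).trans (mul_le_mul_of_nonneg_left ?_ hM)
        rwa [Dx_PN]
      have i2 : |⟪DN N (z q), FN g' (PN N (z q))⟫_ℝ| ≤ ‖Dx (z q)‖ * (M * ‖Dx (z q)‖) :=
        (abs_real_inner_le_norm _ _).trans (mul_le_mul i0 i1 (norm_nonneg _) (norm_nonneg _))
      have i3 := hG.bound _ (inV_PN N (nem g (PN N (z q))))
      have i4 : ‖PN N (nem g (PN N (z q)))‖ ≤ M * R :=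
        (norm_PN_le _ _).trans ((norm_nem_le hg _).trans (mul_le_mul_of_nonneg_left
          ((norm_PN_le _ _).trans (hR q (Ioc_subset_Icc_self hq))) hM))
      have i5 : ‖Dx (PN N (nem g (PN N (z q))))‖ ≤ M * ‖Dx (z q)‖ := by
        rw [Dx_PN]
        refine (norm_DN_le N (hK N)).trans ?_
        rw [Dx_nem hg (inV_PN _ _)]; exact i1
      have i6 := i3.trans (mul_le_mul_of_nonneg_left (add_le_add i4 i5) hγ)
      have i7 := abs_add_le (-⟪DN N (z q), FN g' (PN N (z q))⟫_ℝ) (G q (PN N (nem g (PN N (z q)))))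
      rw [abs_neg] at i7
      have i8 : γ q * (M * R + M * ‖Dx (z q)‖) ≤ M * (γ q ^ 2 + R ^ 2 + ‖Dx (z q)‖ ^ 2) := by
        have : γ q * (R + ‖Dx (z q)‖) ≤ γ q ^ 2 + R ^ 2 + ‖Dx (z q)‖ ^ 2 := by
          nlinarith [sq_nonneg (γ q - 2 * R), sq_nonneg (γ q - 2 * ‖Dx (z q)‖), sq_nonneg (γ q),
            sq_nonneg R, sq_nonneg (‖Dx (z q)‖)]
        nlinarith
      simp only [hB]
      linarith
    · simp only [e, hL]
      have k1 := tendsto_FN_PN hg hV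
      refine Tendsto.add ((tendsto_DN hV).inner k1).neg ?_
      have k2 : Tendsto (fun N => nem g (PN N (z q))) atTop (𝓝 (nem g (z q))) :=
        ((continuous_nem hg).tendsto _).comp (tendsto_PN _)
      refine hG.tendsto (fun N => inV_PN _ _) (inV_nem hg hV) (tendsto_PN_PN k2) ?_
      simp only [Dx_PN]
      refine tendsto_DN_PN hK (inV_nem hg hV) ?_
      simpa only [Dx_nem hg (inV_PN _ _), Dx_nem hg hV] using k1
  have hmeas : ∀ N, AEStronglyMeasurable (f N) (volume.restrict (Ioc s t)) := fun N =>
    ((intervalIntegrable_iff_integrableOn_Ioc_of_le hst).1 (hfi N)).aestronglyMeasurable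
  constructor
  · rw [intervalIntegrable_iff_integrableOn_Ioc_of_le hst] at hBi ⊢
    refine hBi.mono' (aestronglyMeasurable_of_tendsto_ae atTop hmeas
      (hev.mono fun q hq => hq.2)) ?_
    filter_upwards [hev] with q hq
    exact le_of_tendsto hq.2.norm (Eventually.of_forall hq.1)
  · have l1 : Tendsto (fun N => ∫ q in s..t, f N q) atTop (𝓝 (∫ q in s..t, L q)) := by
      refine intervalIntegral.tendsto_integral_filter_of_dominated_convergence B
        (Eventually.of_forall fun N => by rw [uIoc_of_le hst]; exact hmeas N)
        (Eventually.of_forall fun N => ?_) hBi ?_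
      · rw [← uIoc_of_le hst, ae_restrict_iff' measurableSet_uIoc] at hev
        filter_upwards [hev] with q hq hq'
        exact (hq hq').1 N
      · rw [← uIoc_of_le hst, ae_restrict_iff' measurableSet_uIoc] at hev
        filter_upwards [hev] with q hq hq'
        exact (hq hq').2
    have l2 : Tendsto (fun N => E (PN N (z t)) - E (PN N (z s))) atTop (𝓝 (E (z t) - E (z s))) :=
      ((hcE.tendsto _).comp (tendsto_PN _)).sub ((hcE.tendsto _).comp (tendsto_PN _))
    simp only [hFT] at l2
    exact tendsto_nhds_unique l2 l1

end

section

variable {a b : ℝ} [hab : Fact (a < b)] {f f' : ℝ → ℝ} {M : ℝ}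

lemma nem_id (h : HS a b) : nem (fun x => x) h = h := Lp.ext (coeFn_nem c11_id h)

lemma FN_one (h : HS a b) : FN (fun _ => 1) h = Dx h := by
  refine Lp.ext ((coeFn_FN c11_id h).trans (Eventually.of_forall fun x => ?_))
  simp

lemma Force.mono {s t s' t' : ℝ} {G : ℝ → HS a b → ℝ} {γ : ℝ → ℝ} (H : Force s t G γ)
    (hs : s ≤ s') (h : s' ≤ t') (ht : t' ≤ t) : Force s' t' G γ where
  lin := ae_restrict_of_ae_restrict_of_subset (Ioc_subset_Ioc hs ht) H.lin
  sq := H.sq.mono_set (by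
    rw [uIcc_of_le h, uIcc_of_le (hs.trans (h.trans ht))]; exact Icc_subset_Icc hs ht)
  meas n := (H.meas n).mono_measure (Measure.restrict_mono (Ioc_subset_Ioc hs ht) le_rfl)

lemma WForce.mono {s t s' t' : ℝ} {F : ℝ → HS a b} (H : WForce s t F)
    (hs : s ≤ s') (h : s' ≤ t') (ht : t' ≤ t) : WForce s' t' F where
  meas n := (H.meas n).mono_measure (Measure.restrict_mono (Ioc_subset_Ioc hs ht) le_rfl)
  bound := by
    obtain ⟨φ, h1, h2⟩ := H.bound
    refine ⟨φ, h1.mono_set ?_, ae_restrict_of_ae_restrict_of_subset (Ioc_subset_Ioc hs ht) h2⟩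
    rw [uIcc_of_le h, uIcc_of_le (hs.trans (h.trans ht))]; exact Icc_subset_Icc hs ht

lemma sub_uIcc {s t p q : ℝ} (hp : p ∈ Icc s t) (hq : q ∈ Icc s t) : uIcc p q ⊆ uIcc s t := by
  rw [uIcc_of_le (hp.1.trans hp.2)]; exact uIcc_subset_Icc hp hq

/-- Restarting an integral equation at a later time. -/
lemma restart {s t s' : ℝ} {y h : ℝ → ℝ} (hh : IntervalIntegrable h volume s t)
    (hy : ∀ r ∈ Icc s t, y r = y s + ∫ q in s..r, h q) (hs' : s' ∈ Icc s t) :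
    ∀ r ∈ Icc s t, y r = y s' + ∫ q in s'..r, h q := by
  intro r hr
  have hs := left_mem_Icc.2 (hr.1.trans hr.2)
  have h1 := intervalIntegral.integral_add_adjacent_intervals
    (hh.mono_set (sub_uIcc hs hs')) (hh.mono_set (sub_uIcc hs' hr))
  rw [hy r hr, hy s' hs', ← h1]; ring

lemma CurV.cOn {s t : ℝ} (hst : s ≤ t) {z : ℝ → HS a b} (hz : CurV s t z) :
    ContinuousOn z (uIcc s t) := by rw [uIcc_of_le hst]; exact hz.cont

lemma HeatEq.mono {s t s' t' : ℝ} {G : ℝ → HS a b → ℝ} {γ : ℝ → ℝ} (H : Force s t G γ)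
    {z : ℝ → HS a b} (hz : CurV s t z) (hz' : HeatEq s t G z)
    (hs : s ≤ s') (h : s' ≤ t') (ht : t' ≤ t) : HeatEq s' t' G z := fun n r hr => by
  have hst : s ≤ t := hs.trans (h.trans ht)
  exact restart (y := fun r => ⟪cosH a b n, z r⟫_ℝ)
    (((continuousOn_const.inner (hz.cOn hst)).const_mul _).intervalIntegrable.add (H.int hst n))
    (hz' n) ⟨hs, h.trans ht⟩ r ⟨hs.trans hr.1, hr.2.trans ht⟩

lemma WaveEq.int_v {s t : ℝ} (hst : s ≤ t) {F v w : ℝ → HS a b} (hF : WForce s t F)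
    (h : WaveEq s t F v w) (n : ℕ) : IntervalIntegrable (fun q =>
      -kf a b (n + 1) * ⟪cosH a b (n + 1), w q⟫_ℝ - ⟪sinH a b n, F q⟫_ℝ) volume s t := by
  have hw := h.cw
  rw [← uIcc_of_le hst] at hw
  exact ((continuousOn_const.inner hw).const_mul _).intervalIntegrable.sub (hF.int hst n)

lemma WaveEq.int_w {s t : ℝ} (hst : s ≤ t) {F v w : ℝ → HS a b}
    (h : WaveEq s t F v w) (n : ℕ) : IntervalIntegrable (fun q =>
      kf a b (n + 1) * ⟪sinH a b n, v q⟫_ℝ) volume s t := by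
  have hw := h.cv
  rw [← uIcc_of_le hst] at hw
  exact ((continuousOn_const.inner hw).const_mul _).intervalIntegrable

lemma WaveEq.mono {s t s' t' : ℝ} {F v w : ℝ → HS a b} (hF : WForce s t F)
    (H : WaveEq s t F v w) (hs : s ≤ s') (h : s' ≤ t') (ht : t' ≤ t) : WaveEq s' t' F v w := by
  have hst : s ≤ t := hs.trans (h.trans ht)
  have hs' : s' ∈ Icc s t := ⟨hs, h.trans ht⟩
  exact ⟨H.cv.mono (Icc_subset_Icc hs ht), H.cw.mono (Icc_subset_Icc hs ht),
    fun n r hr => restart (y := fun r => ⟪sinH a b n, v r⟫_ℝ) (H.int_v hst hF n) (H.eqv n) hs' r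
      ⟨hs.trans hr.1, hr.2.trans ht⟩,
    fun n r hr => restart (y := fun r => ⟪cosH a b (n + 1), w r⟫_ℝ) (H.int_w hst n) (H.eqw n) hs' r
      ⟨hs.trans hr.1, hr.2.trans ht⟩,
    fun r hr => (H.zero r ⟨hs.trans hr.1, hr.2.trans ht⟩).trans (H.zero s' hs').symm⟩

theorem heat_energy {s t : ℝ} (hst : s ≤ t) {G : ℝ → HS a b → ℝ} {γ : ℝ → ℝ}
    (H : Force s t G γ) {z : ℝ → HS a b} (hz : CurV s t z) (hz' : HeatEq s t G z) :
    IntervalIntegrable (fun q => G q (z q)) volume s t ∧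
    ‖z t‖ ^ 2 + 2 * ∫ q in s..t, ‖Dx (z q)‖ ^ 2 = ‖z s‖ ^ 2 + 2 * ∫ q in s..t, G q (z q) := by
  have hE : ∀ h : HS a b, HasFDerivAt (fun h : HS a b => (1 / 2 : ℝ) * ‖h‖ ^ 2)
      (innerSL ℝ (nem (fun x => x) h)) h := fun h => by
    have := (hasStrictFDerivAt_norm_sq h).hasFDerivAt.const_mul (1 / 2 : ℝ)
    rw [nem_id]
    refine this.congr_fderiv ?_
    ext k; simp
  obtain ⟨h1, h2⟩ := heat_chain hst H hz hz' c11_id hE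
  simp only [nem_id, FN_one, real_inner_self_eq_norm_sq] at h1 h2
  have h3 : IntervalIntegrable (fun q => G q (z q)) volume s t := by
    have := h1.add hz.sq
    refine this.congr fun q _ => ?_
    simp
  refine ⟨h3, ?_⟩
  have h4 : IntervalIntegrable (fun q => -‖Dx (z q)‖ ^ 2) volume s t := hz.sq.neg
  rw [intervalIntegral.integral_add h4 h3, intervalIntegral.integral_neg] at h2
  linarith

theorem wave_energy {s t : ℝ} (hst : s ≤ t) {F v w : ℝ → HS a b} (hF : WForce s t F)
    (H : WaveEq s t F v w) :
    IntervalIntegrable (fun q => ⟪v q, F q⟫_ℝ) volume s t ∧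
    ‖v t‖ ^ 2 + ‖w t‖ ^ 2 = ‖v s‖ ^ 2 + ‖w s‖ ^ 2 - 2 * ∫ q in s..t, ⟪v q, F q⟫_ℝ := by
  have hv := H.cv
  rw [← uIcc_of_le hst] at hv
  have hsmem := left_mem_Icc.2 hst
  have htmem := right_mem_Icc.2 hst
  obtain ⟨φ, hφ1, hφ2⟩ := hF.bound
  set g : ℕ → ℝ → ℝ := fun N q => ∑ n ∈ Finset.range N, ⟪v q, sinH a b n⟫_ℝ * ⟪sinH a b n, F q⟫_ℝ
    with hg
  have hgi1 : ∀ n, IntervalIntegrable (fun q => ⟪v q, sinH a b n⟫_ℝ * ⟪sinH a b n, F q⟫_ℝ)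
      volume s t := fun n => (hF.int hst n).continuousOn_mul (hv.inner continuousOn_const)
  have hgi : ∀ N, IntervalIntegrable (g N) volume s t := fun N => by
    have := IntervalIntegrable.sum (Finset.range N) fun n _ => hgi1 n
    rw [Finset.sum_fn] at this; exact this
  have hmode : ∀ n, ⟪sinH a b n, v t⟫_ℝ ^ 2 + ⟪cosH a b (n + 1), w t⟫_ℝ ^ 2 =
      ⟪sinH a b n, v s⟫_ℝ ^ 2 + ⟪cosH a b (n + 1), w s⟫_ℝ ^ 2 -
        2 * ∫ q in s..t, ⟪v q, sinH a b n⟫_ℝ * ⟪sinH a b n, F q⟫_ℝ := fun n => by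
    have := wave_mode_energy hst (hF.int hst n) (continuousOn_const.inner H.cv)
      (continuousOn_const.inner H.cw) (H.eqv n) (H.eqw n)
    rw [this, ← intervalIntegral.integral_const_mul]
    congr 1
    refine intervalIntegral.integral_congr fun q _ => ?_
    simp only [real_inner_comm (sinH a b n) (v q)]; ring
  have hsum : ∀ r, HasSum (fun n => ⟪sinH a b n, v r⟫_ℝ ^ 2 + ⟪cosH a b (n + 1), w r⟫_ℝ ^ 2)
      (‖v r‖ ^ 2 + (‖w r‖ ^ 2 - ⟪cosH a b 0, w r⟫_ℝ ^ 2)) := fun r => by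
    refine (hasSum_sq_sin (v r)).add ?_
    have := (hasSum_nat_add_iff' 1).2 (hasSum_sq_cos (w r))
    simpa using this
  have hpt : ∀ q, Tendsto (fun N => g N q) atTop (𝓝 ⟪v q, F q⟫_ℝ) := fun q => by
    have := (sinB a b).hasSum_inner_mul_inner (v q) (F q)
    simp only [sinB_apply] at this
    exact this.tendsto_sum_nat
  set B : ℝ → ℝ := fun q => ‖v q‖ ^ 2 + φ q ^ 2 with hB
  have hBi : IntervalIntegrable B volume s t := (hv.norm.pow 2).intervalIntegrable.add hφ1
  have hbd : ∀ᵐ q ∂volume.restrict (Ioc s t), ∀ N, ‖g N q‖ ≤ B q := by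
    filter_upwards [hφ2] with q hq N
    have i1 := sum_le_hasSum (Finset.range N) (fun _ _ => sq_nonneg _) (hasSum_sq_sin (F q))
    have i2 := sum_le_hasSum (Finset.range N) (fun _ _ => sq_nonneg _) (hasSum_sq_sin (v q))
    have i3 : ‖F q‖ ^ 2 ≤ φ q ^ 2 := pow_le_pow_left₀ (norm_nonneg _) hq 2
    calc ‖g N q‖ ≤ ∑ n ∈ Finset.range N, ‖⟪v q, sinH a b n⟫_ℝ * ⟪sinH a b n, F q⟫_ℝ‖ :=
          norm_sum_le _ _
      _ ≤ ∑ n ∈ Finset.range N, (⟪sinH a b n, v q⟫_ℝ ^ 2 + ⟪sinH a b n, F q⟫_ℝ ^ 2) := by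
          refine Finset.sum_le_sum fun n _ => ?_
          rw [real_inner_comm, Real.norm_eq_abs, abs_le]
          constructor <;> nlinarith [sq_nonneg (⟪sinH a b n, v q⟫_ℝ + ⟪sinH a b n, F q⟫_ℝ),
            sq_nonneg (⟪sinH a b n, v q⟫_ℝ - ⟪sinH a b n, F q⟫_ℝ)]
      _ ≤ B q := by rw [Finset.sum_add_distrib]; simp only [hB]; linarith
  have hmeas : ∀ N, AEStronglyMeasurable (g N) (volume.restrict (Ioc s t)) := fun N =>
    ((intervalIntegrable_iff_integrableOn_Ioc_of_le hst).1 (hgi N)).aestronglyMeasurable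
  have l1 : Tendsto (fun N => ∫ q in s..t, g N q) atTop (𝓝 (∫ q in s..t, ⟪v q, F q⟫_ℝ)) := by
    refine intervalIntegral.tendsto_integral_filter_of_dominated_convergence B
      (Eventually.of_forall fun N => by rw [uIoc_of_le hst]; exact hmeas N)
      (Eventually.of_forall fun N => ?_) hBi (Eventually.of_forall fun q _ => hpt q)
    rw [← uIoc_of_le hst, ae_restrict_iff' measurableSet_uIoc] at hbd
    filter_upwards [hbd] with q hq hq' using hq hq' N
  constructor
  · rw [intervalIntegrable_iff_integrableOn_Ioc_of_le hst] at hBi ⊢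
    refine hBi.mono' (aestronglyMeasurable_of_tendsto_ae atTop hmeas
      (Eventually.of_forall hpt)) ?_
    filter_upwards [hbd] with q hq
    exact le_of_tendsto (hpt q).norm (Eventually.of_forall hq)
  · have l2 := ((hsum s).sub (hsum t)).tendsto_sum_nat
    have l3 : (fun N => ∑ n ∈ Finset.range N, (⟪sinH a b n, v s⟫_ℝ ^ 2 +
        ⟪cosH a b (n + 1), w s⟫_ℝ ^ 2 - (⟪sinH a b n, v t⟫_ℝ ^ 2 +
        ⟪cosH a b (n + 1), w t⟫_ℝ ^ 2))) = fun N => 2 * ∫ q in s..t, g N q := by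
      ext N
      rw [hg, intervalIntegral.integral_finsetSum fun n _ => hgi1 n, Finset.mul_sum]
      refine Finset.sum_congr rfl fun n _ => ?_
      rw [hmode n]; ring
    rw [l3] at l2
    have l4 := tendsto_nhds_unique l2 (l1.const_mul 2)
    rw [H.zero t htmem] at l4
    linarith

lemma tendsto_Gf (G : C11 f f' M) {ι : Type*} {l : Filter ι} {v : ι → HS a b} {θ : ι → HS a b}
    {v₀ θ₀ φ : HS a b} (hV : ∀ i, InV (θ i)) (H : InV θ₀) (K : InV φ) (hv : Tendsto v l (𝓝 v₀))
    (hθ : Tendsto θ l (𝓝 θ₀)) (hD : Tendsto (fun i => Dx (θ i)) l (𝓝 (Dx θ₀))) :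
    Tendsto (fun i => Gf f f' (v i) (θ i) φ) l (𝓝 (Gf f f' v₀ θ₀ φ)) := by
  have h0 := tendsto_iff_norm_sub_tendsto_zero.1 hθ
  have h1 : Tendsto (fun i => ‖Dx (θ i - θ₀)‖) l (𝓝 0) := by
    have := tendsto_iff_norm_sub_tendsto_zero.1 hD
    simpa only [Dx_sub (hV _) H] using this
  have h2 : Tendsto (fun i => Sb (θ i - θ₀)) l (𝓝 0) := by
    have := ((h0.mul (h0.add h1)).const_mul (C0 a b)).sqrt
    simp only [add_zero, mul_zero, Real.sqrt_zero] at this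
    exact this
  have h3 := hv.norm
  have h4 := tendsto_iff_norm_sub_tendsto_zero.1 hv
  rw [tendsto_iff_norm_sub_tendsto_zero]
  refine squeeze_zero (fun _ => norm_nonneg _)
    (fun i => abs_Gf_sub_le G (v i) v₀ (hV i) H K) ?_
  have := ((h3.const_mul M).mul (((h1.add (h2.mul_const ‖Dx θ₀‖)).mul_const (Sb φ)).add
    (h2.mul_const ‖Dx φ‖))).add ((h4.const_mul M).mul_const (‖Dx θ₀‖ * Sb φ + Sb θ₀ * ‖Dx φ‖))
  simpa using this

lemma CurV.int_D {s t : ℝ} (hst : s ≤ t) {z : ℝ → HS a b} (hz : CurV s t z) :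
    IntervalIntegrable (fun r => ‖Dx (z r)‖) volume s t :=
  IntervalIntegrable.of_sq hst (hz.aesm hst) hz.sq

lemma force_Gf (G : C11 f f' M) {s t : ℝ} (hst : s ≤ t) {v θ : ℝ → HS a b}
    (hv : ContinuousOn v (Icc s t)) (hθ : CurV s t θ) :
    Force s t (fun r => Gf f f' (v r) (θ r))
      (fun r => 2 * M * C1 a b * ‖v r‖ * (‖θ r‖ + ‖Dx (θ r)‖)) where
  lin := hθ.inV.mono fun r hr => linV_Gf G (v r) hr
  sq := by
    have hv' : ContinuousOn v (uIcc s t) := by rwa [uIcc_of_le hst]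
    have h1 : IntervalIntegrable (fun r => ‖θ r‖ ^ 2 + 2 * (‖θ r‖ * ‖Dx (θ r)‖) + ‖Dx (θ r)‖ ^ 2)
        volume s t :=
      (((hθ.cOn hst).norm.pow 2).intervalIntegrable.add
        (((hθ.int_D hst).continuousOn_mul (hθ.cOn hst).norm).const_mul 2)).add hθ.sq
    have h2 := h1.continuousOn_mul ((hv'.norm.const_mul (2 * M * C1 a b)).pow 2)
    refine h2.congr fun r _ => ?_
    rw [Pi.pow_apply]; ring
  meas n := by
    refine aestronglyMeasurable_of_tendsto_ae atTop
      (f := fun N r => Gf f f' (v r) (PN N (θ r)) (cosH a b n)) (fun N => ?_) ?_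
    · refine ContinuousOn.aestronglyMeasurable (fun r hr => ?_) measurableSet_Ioc
      have hr' := Ioc_subset_Icc_self hr
      have hθr := (hθ.cont r hr').mono Ioc_subset_Icc_self
      refine tendsto_Gf G (fun i => inV_PN _ _) (inV_PN _ _) (inV_cosH n)
        ((hv r hr').mono Ioc_subset_Icc_self)
        (((continuous_PN N).tendsto _).comp hθr) ?_
      simp only [Dx_PN]
      exact ((continuous_DN N).tendsto _).comp hθr
    · filter_upwards [hθ.inV] with r hr
      refine tendsto_Gf G (fun i => inV_PN _ _) hr (inV_cosH n) tendsto_const_nhds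
        (tendsto_PN _) ?_
      simp only [Dx_PN]
      exact tendsto_DN hr

lemma wforce_FN (G : C11 f f' M) {s t : ℝ} {θ : ℝ → HS a b} (hθ : CurV s t θ) :
    WForce s t (fun r => FN f' (θ r)) where
  meas n := by
    have h1 : ContinuousOn (fun r => -kf a b (n + 1) * ⟪cosH a b (n + 1), nem f (θ r)⟫_ℝ)
        (Ioc s t) := (continuousOn_const.inner ((continuous_nem G).comp_continuousOn
          (hθ.cont.mono Ioc_subset_Icc_self))).const_mul _
    refine (h1.aestronglyMeasurable measurableSet_Ioc).congr ?_
    filter_upwards [hθ.inV] with r hr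
    exact (hasD_nem G hr n).symm
  bound := ⟨fun r => M * ‖Dx (θ r)‖, by simpa only [mul_pow] using hθ.sq.const_mul (M ^ 2),
    Eventually.of_forall fun r => norm_FN_le G _⟩

end

section

variable {a b : ℝ} [hab : Fact (a < b)] {f f' : ℝ → ℝ} {M : ℝ}

lemma add_le_sqrt (x y : ℝ) : x + y ≤ √(2 * x ^ 2 + 2 * y ^ 2) :=
  Real.le_sqrt_of_sq_le (by nlinarith [sq_nonneg (x - y)])

lemma Force.sub {s t : ℝ} {G₁ G₂ : ℝ → HS a b → ℝ} {γ₁ γ₂ : ℝ → ℝ} (H₁ : Force s t G₁ γ₁)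
    (H₂ : Force s t G₂ γ₂) : Force s t (fun r φ => G₁ r φ - G₂ r φ)
      (fun r => √(2 * γ₁ r ^ 2 + 2 * γ₂ r ^ 2)) where
  lin := by
    filter_upwards [H₁.lin, H₂.lin] with r h₁ h₂
    refine ⟨fun φ ψ hφ hψ => ?_, fun c φ hφ => ?_, fun φ hφ => ?_⟩
    · rw [h₁.add _ _ hφ hψ, h₂.add _ _ hφ hψ]; ring
    · rw [h₁.smul _ _ hφ, h₂.smul _ _ hφ]; ring
    · refine (abs_sub _ _).trans ((add_le_add (h₁.bound φ hφ) (h₂.bound φ hφ)).trans ?_)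
      rw [← add_mul]
      exact mul_le_mul_of_nonneg_right (add_le_sqrt _ _) (by positivity)
  sq := by
    have : ∀ r, √(2 * γ₁ r ^ 2 + 2 * γ₂ r ^ 2) ^ 2 = 2 * γ₁ r ^ 2 + 2 * γ₂ r ^ 2 := fun r =>
      Real.sq_sqrt (by positivity)
    simp only [this]
    exact (H₁.sq.const_mul 2).add (H₂.sq.const_mul 2)
  meas n := (H₁.meas n).sub (H₂.meas n)

lemma WForce.sub {s t : ℝ} {F₁ F₂ : ℝ → HS a b} (H₁ : WForce s t F₁)
    (H₂ : WForce s t F₂) : WForce s t (fun r => F₁ r - F₂ r) where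
  meas n := by simp only [inner_sub_right]; exact (H₁.meas n).sub (H₂.meas n)
  bound := by
    obtain ⟨φ₁, h₁, k₁⟩ := H₁.bound
    obtain ⟨φ₂, h₂, k₂⟩ := H₂.bound
    refine ⟨fun r => √(2 * φ₁ r ^ 2 + 2 * φ₂ r ^ 2), ?_, ?_⟩
    · have : ∀ r, √(2 * φ₁ r ^ 2 + 2 * φ₂ r ^ 2) ^ 2 = 2 * φ₁ r ^ 2 + 2 * φ₂ r ^ 2 := fun r =>
        Real.sq_sqrt (by positivity)
      simp only [this]
      exact (h₁.const_mul 2).add (h₂.const_mul 2)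
    · filter_upwards [k₁, k₂] with r i j
      exact (norm_sub_le _ _).trans ((add_le_add i j).trans (add_le_sqrt _ _))

lemma HeatEq.sub {s t : ℝ} (hst : s ≤ t) {G₁ G₂ : ℝ → HS a b → ℝ} {γ₁ γ₂ : ℝ → ℝ}
    {z₁ z₂ : ℝ → HS a b} (H₁ : Force s t G₁ γ₁) (H₂ : Force s t G₂ γ₂)
    (c₁ : CurV s t z₁) (c₂ : CurV s t z₂) (h₁ : HeatEq s t G₁ z₁) (h₂ : HeatEq s t G₂ z₂) :
    HeatEq s t (fun r φ => G₁ r φ - G₂ r φ) (fun r => z₁ r - z₂ r) := fun n r hr => by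
  have i₁ : IntervalIntegrable (fun q => -kf a b n ^ 2 * ⟪cosH a b n, z₁ q⟫_ℝ +
      G₁ q (cosH a b n)) volume s r := (((continuousOn_const.inner (c₁.cOn hst)).const_mul
    (-kf a b n ^ 2)).intervalIntegrable.add (H₁.int hst n)).mono_set (sub_Icc hr)
  have i₂ : IntervalIntegrable (fun q => -kf a b n ^ 2 * ⟪cosH a b n, z₂ q⟫_ℝ +
      G₂ q (cosH a b n)) volume s r := (((continuousOn_const.inner (c₂.cOn hst)).const_mul
    (-kf a b n ^ 2)).intervalIntegrable.add (H₂.int hst n)).mono_set (sub_Icc hr)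
  have := intervalIntegral.integral_sub i₁ i₂
  rw [inner_sub_right, inner_sub_right, h₁ n r hr, h₂ n r hr, add_sub_add_comm, ← this]
  congr 1
  refine intervalIntegral.integral_congr fun q _ => ?_
  simp only [inner_sub_right]; ring

lemma WaveEq.sub {s t : ℝ} (hst : s ≤ t) {F₁ F₂ v₁ v₂ w₁ w₂ : ℝ → HS a b} (H₁ : WForce s t F₁)
    (H₂ : WForce s t F₂) (h₁ : WaveEq s t F₁ v₁ w₁) (h₂ : WaveEq s t F₂ v₂ w₂) :
    WaveEq s t (fun r => F₁ r - F₂ r) (fun r => v₁ r - v₂ r) (fun r => w₁ r - w₂ r) where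
  cv := h₁.cv.sub h₂.cv
  cw := h₁.cw.sub h₂.cw
  eqv n r hr := by
    have := intervalIntegral.integral_sub ((h₁.int_v hst H₁ n).mono_set (sub_Icc hr))
      ((h₂.int_v hst H₂ n).mono_set (sub_Icc hr))
    rw [inner_sub_right, inner_sub_right, h₁.eqv n r hr, h₂.eqv n r hr, add_sub_add_comm, ← this]
    congr 1
    refine intervalIntegral.integral_congr fun q _ => ?_
    simp only [inner_sub_right]; ring
  eqw n r hr := by
    have := intervalIntegral.integral_sub ((h₁.int_w hst n).mono_set (sub_Icc hr))
      ((h₂.int_w hst n).mono_set (sub_Icc hr))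
    rw [inner_sub_right, inner_sub_right, h₁.eqw n r hr, h₂.eqw n r hr, add_sub_add_comm, ← this]
    congr 1
    refine intervalIntegral.integral_congr fun q _ => ?_
    simp only [inner_sub_right]; ring
  zero r hr := by rw [inner_sub_right, inner_sub_right, h₁.zero r hr, h₂.zero r hr]

/-- Size of a curve in `C([s,t]; L²) ∩ L²(s,t; W^{1,2})`. -/
structure Sz (s t : ℝ) (θ : ℝ → HS a b) (d : ℝ) : Prop where
  nonneg : 0 ≤ d
  cur : CurV s t θ
  sup : ∀ r ∈ Icc s t, ‖θ r‖ ≤ d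
  J : ∫ r in Ioc s t, ‖Dx (θ r)‖ ^ 2 ≤ d ^ 2

lemma CurV.iD2 {s t : ℝ} (hst : s ≤ t) {θ : ℝ → HS a b} (H : CurV s t θ) :
    IntegrableOn (fun r => ‖Dx (θ r)‖ ^ 2) (Ioc s t) :=
  (intervalIntegrable_iff_integrableOn_Ioc_of_le hst).1 H.sq

lemma Sz.mono {s t : ℝ} {θ : ℝ → HS a b} {d : ℝ} (H : Sz s t θ d) {r : ℝ} (hr : r ∈ Icc s t) :
    Sz s r θ d where
  nonneg := H.nonneg
  cur := H.cur.mono le_rfl hr.1 hr.2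
  sup q hq := H.sup q ⟨hq.1, hq.2.trans hr.2⟩
  J := (setIntegral_mono_set (H.cur.iD2 (hr.1.trans hr.2)) (Eventually.of_forall
      fun _ => sq_nonneg _)
    (Eventually.of_forall (Ioc_subset_Ioc_right hr.2))).trans H.J

lemma Sz.mono_d {s t : ℝ} {θ : ℝ → HS a b} {d d' : ℝ} (H : Sz s t θ d) (h : d ≤ d') :
    Sz s t θ d' where
  nonneg := H.nonneg.trans h
  cur := H.cur
  sup q hq := (H.sup q hq).trans h
  J := H.J.trans (pow_le_pow_left₀ H.nonneg h 2)

lemma sz_exact {s t : ℝ} (hst : s ≤ t) {θ : ℝ → HS a b} (H : CurV s t θ) :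
    ∃ E, Sz s t θ E ∧ ((∃ r ∈ Icc s t, ‖θ r‖ = E) ∨ ∫ r in Ioc s t, ‖Dx (θ r)‖ ^ 2 = E ^ 2) := by
  obtain ⟨p, hp, hmax⟩ := isCompact_Icc.exists_isMaxOn (nonempty_Icc.2 hst) H.cont.norm
  have h1 : ∀ r ∈ Icc s t, ‖θ r‖ ≤ ‖θ p‖ := fun r hr => hmax hr
  have hJ : 0 ≤ ∫ r in Ioc s t, ‖Dx (θ r)‖ ^ 2 := integral_nonneg fun _ => sq_nonneg _
  rcases le_total (√(∫ r in Ioc s t, ‖Dx (θ r)‖ ^ 2)) ‖θ p‖ with h | h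
  · exact ⟨‖θ p‖, ⟨norm_nonneg _, H, h1, (Real.sqrt_le_left (norm_nonneg _)).1 h⟩,
      Or.inl ⟨p, hp, rfl⟩⟩
  · exact ⟨_, ⟨Real.sqrt_nonneg _, H, fun r hr => (h1 r hr).trans h, (Real.sq_sqrt hJ).ge⟩,
      Or.inr (Real.sq_sqrt hJ).symm⟩

lemma CurV.mN {s t : ℝ} {θ : ℝ → HS a b} (H : CurV s t θ) :
    AEStronglyMeasurable (fun r => ‖θ r‖) (volume.restrict (Ioc s t)) :=
  (H.cont.norm.mono Ioc_subset_Icc_self).aestronglyMeasurable measurableSet_Ioc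

lemma CurV.mS {s t : ℝ} (hst : s ≤ t) {θ : ℝ → HS a b} (H : CurV s t θ) :
    AEStronglyMeasurable (fun r => Sb (θ r)) (volume.restrict (Ioc s t)) :=
  Real.continuous_sqrt.comp_aestronglyMeasurable
    ((H.mN.mul (H.mN.add (H.aesm hst))).const_mul (C0 a b))

lemma integrable_one_Ioc (s t : ℝ) (c : ℝ) : IntegrableOn (fun _ => c) (Ioc s t) :=
  integrableOn_const (by simp)

lemma integral_const_Ioc {s t : ℝ} (hst : s ≤ t) (c : ℝ) : ∫ _ in Ioc s t, c = (t - s) * c := by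
  rw [← intervalIntegral.integral_of_le hst, intervalIntegral.integral_const, smul_eq_mul]

lemma Sz.int_D {s t : ℝ} (hst : s ≤ t) {θ : ℝ → HS a b} {d : ℝ} (H : Sz s t θ d) :
    IntegrableOn (fun r => ‖Dx (θ r)‖) (Ioc s t) ∧
      ∫ r in Ioc s t, ‖Dx (θ r)‖ ≤ √(t - s) * d := by
  have h := cs_integral (ν := volume.restrict (Ioc s t)) (f := fun _ => (1 : ℝ))
    (Real.sqrt_nonneg (t - s)) H.nonneg
    aestronglyMeasurable_const (H.cur.aesm hst) (by simp)
    (H.cur.iD2 hst) (by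
      simp only [one_pow]
      rw [integral_const_Ioc hst, Real.sq_sqrt (by linarith), mul_one]) H.J
  simp only [abs_one, one_mul, abs_norm] at h
  exact h

lemma Sz.int_Sb {s t : ℝ} (hst : s ≤ t) (h1 : t - s ≤ 1) {θ : ℝ → HS a b} {d κ : ℝ}
    (H : Sz s t θ d) (hκ : 2 * C0 a b * √(t - s) ≤ κ ^ 2) :
    IntegrableOn (fun r => Sb (θ r) ^ 2) (Ioc s t) ∧
      ∫ r in Ioc s t, Sb (θ r) ^ 2 ≤ (κ * d) ^ 2 := by
  have hC := C0_pos (a := a) (b := b)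
  have hd := H.nonneg
  obtain ⟨i1, i2⟩ := H.int_D hst
  have hb : IntegrableOn (fun r => C0 a b * (d * (d + ‖Dx (θ r)‖))) (Ioc s t) :=
    (((integrable_one_Ioc s t d).add i1).const_mul d).const_mul _
  have hle : ∀ r ∈ Ioc s t, Sb (θ r) ^ 2 ≤ C0 a b * (d * (d + ‖Dx (θ r)‖)) := fun r hr => by
    have := H.sup r (Ioc_subset_Icc_self hr)
    rw [Sb_sq]; gcongr
  have hi : IntegrableOn (fun r => Sb (θ r) ^ 2) (Ioc s t) := by
    refine Integrable.mono' hb ((H.cur.mS hst).pow 2) ?_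
    filter_upwards [ae_restrict_mem measurableSet_Ioc] with r hr
    rw [Real.norm_eq_abs, abs_of_nonneg (sq_nonneg _)]; exact hle r hr
  refine ⟨hi, (setIntegral_mono_on hi hb measurableSet_Ioc hle).trans ?_⟩
  rw [integral_const_mul, integral_const_mul, integral_add (integrable_one_Ioc s t d) i1,
    integral_const_Ioc hst]
  have h2 : t - s ≤ √(t - s) := Real.le_sqrt_of_sq_le (by nlinarith)
  have h3 : (t - s) * d + ∫ r in Ioc s t, ‖Dx (θ r)‖ ≤ 2 * √(t - s) * d := by nlinarith
  calc C0 a b * (d * ((t - s) * d + ∫ r in Ioc s t, ‖Dx (θ r)‖))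
      ≤ C0 a b * (d * (2 * √(t - s) * d)) := by gcongr
    _ = 2 * C0 a b * √(t - s) * d ^ 2 := by ring
    _ ≤ κ ^ 2 * d ^ 2 := by gcongr
    _ = _ := by ring

lemma Sz.int_sum {s t : ℝ} (hst : s ≤ t) (h1 : t - s ≤ 1) {θ : ℝ → HS a b} {d : ℝ}
    (H : Sz s t θ d) :
    IntegrableOn (fun r => (‖θ r‖ + ‖Dx (θ r)‖) ^ 2) (Ioc s t) ∧
      ∫ r in Ioc s t, (‖θ r‖ + ‖Dx (θ r)‖) ^ 2 ≤ (2 * d) ^ 2 := by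
  have hd := H.nonneg
  have hb : IntegrableOn (fun r => 2 * d ^ 2 + 2 * ‖Dx (θ r)‖ ^ 2) (Ioc s t) :=
    (integrable_one_Ioc s t _).add ((H.cur.iD2 hst).const_mul 2)
  have hle : ∀ r ∈ Ioc s t, (‖θ r‖ + ‖Dx (θ r)‖) ^ 2 ≤ 2 * d ^ 2 + 2 * ‖Dx (θ r)‖ ^ 2 :=
    fun r hr => by
      have := H.sup r (Ioc_subset_Icc_self hr)
      nlinarith [sq_nonneg (‖θ r‖ - ‖Dx (θ r)‖), norm_nonneg (θ r)]
  have hi : IntegrableOn (fun r => (‖θ r‖ + ‖Dx (θ r)‖) ^ 2) (Ioc s t) := by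
    refine Integrable.mono' hb ((H.cur.mN.add (H.cur.aesm hst)).pow 2) ?_
    filter_upwards [ae_restrict_mem measurableSet_Ioc] with r hr
    rw [Real.norm_eq_abs, abs_of_nonneg (sq_nonneg _)]; exact hle r hr
  refine ⟨hi, (setIntegral_mono_on hi hb measurableSet_Ioc hle).trans ?_⟩
  have e : ∫ r in Ioc s t, 2 * ‖Dx (θ r)‖ ^ 2 = 2 * ∫ r in Ioc s t, ‖Dx (θ r)‖ ^ 2 :=
    integral_const_mul _ _
  rw [integral_add (integrable_one_Ioc s t _) ((H.cur.iD2 hst).const_mul 2), e,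
    integral_const_Ioc hst]
  nlinarith [H.J]

lemma Sz.int_Sb_Sb {s t : ℝ} (hst : s ≤ t) (h1 : t - s ≤ 1) {θ ζ : ℝ → HS a b} {d E : ℝ}
    (H : Sz s t θ d) (K : Sz s t ζ E) :
    IntegrableOn (fun r => (Sb (θ r) * Sb (ζ r)) ^ 2) (Ioc s t) ∧
      ∫ r in Ioc s t, (Sb (θ r) * Sb (ζ r)) ^ 2 ≤ (2 * C0 a b * d * E) ^ 2 := by
  have hC := C0_pos (a := a) (b := b)
  have hd := H.nonneg
  have hE := K.nonneg
  obtain ⟨i1, i2⟩ := H.int_sum hst h1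
  obtain ⟨j1, j2⟩ := K.int_sum hst h1
  obtain ⟨k1, k2⟩ := cs_integral (by positivity) (by positivity) (H.cur.mN.add (H.cur.aesm hst))
    (K.cur.mN.add (K.cur.aesm hst)) i1 j1 i2 j2
  have hb := k1.const_mul (C0 a b ^ 2 * (d * E))
  have hle : ∀ r ∈ Ioc s t, (Sb (θ r) * Sb (ζ r)) ^ 2 ≤ C0 a b ^ 2 * (d * E) *
      (|‖θ r‖ + ‖Dx (θ r)‖| * |‖ζ r‖ + ‖Dx (ζ r)‖|) := fun r hr => by
    have h2 := H.sup r (Ioc_subset_Icc_self hr)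
    have h3 := K.sup r (Ioc_subset_Icc_self hr)
    rw [abs_of_nonneg (by positivity), abs_of_nonneg (by positivity), mul_pow, Sb_sq, Sb_sq]
    calc _ = C0 a b ^ 2 * (‖θ r‖ * ‖ζ r‖) * ((‖θ r‖ + ‖Dx (θ r)‖) * (‖ζ r‖ + ‖Dx (ζ r)‖)) := by ring
      _ ≤ _ := by gcongr
  have hi : IntegrableOn (fun r => (Sb (θ r) * Sb (ζ r)) ^ 2) (Ioc s t) := by
    refine Integrable.mono' hb (((H.cur.mS hst).mul (K.cur.mS hst)).pow 2) ?_
    filter_upwards [ae_restrict_mem measurableSet_Ioc] with r hr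
    rw [Real.norm_eq_abs, abs_of_nonneg (sq_nonneg _)]; exact hle r hr
  refine ⟨hi, (setIntegral_mono_on hi hb measurableSet_Ioc hle).trans ?_⟩
  rw [integral_const_mul]
  calc _ ≤ C0 a b ^ 2 * (d * E) * (2 * d * (2 * E)) := by gcongr
    _ = _ := by ring

lemma Gf_diff_int (G : C11 f f' M) {s t : ℝ} (hst : s ≤ t) (h1 : t - s ≤ 1)
    {v₁ v₂ θ₁ θ₂ Z : ℝ → HS a b} {R ρ κ d E : ℝ} (hκ0 : 0 ≤ κ)
    (hκ : 2 * C0 a b * √(t - s) ≤ κ ^ 2) (c₁ : CurV s t θ₁)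
    (hR : ∀ r ∈ Icc s t, ‖v₁ r‖ ≤ R) (hθ₂ : Sz s t θ₂ R) (hρ0 : 0 ≤ ρ) (hρR : ρ ≤ R)
    (hρ : ∫ r in Ioc s t, ‖Dx (θ₂ r)‖ ^ 2 ≤ ρ ^ 2) (hδ : Sz s t (fun r => θ₁ r - θ₂ r) d)
    (hν : ∀ r ∈ Icc s t, ‖v₁ r - v₂ r‖ ≤ d) (hZ : Sz s t Z E)
    (hi : IntegrableOn (fun r => Gf f f' (v₁ r) (θ₁ r) (Z r) - Gf f f' (v₂ r) (θ₂ r) (Z r))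
      (Ioc s t)) :
    ∫ r in Ioc s t, (Gf f f' (v₁ r) (θ₁ r) (Z r) - Gf f f' (v₂ r) (θ₂ r) (Z r)) ≤
      M * R * (4 * κ + 2 * C0 a b * ρ) * d * E := by
  have hM := G.M_nonneg
  have hC := C0_pos (a := a) (b := b)
  have hd := hδ.nonneg
  have hE := hZ.nonneg
  have hR0 := hθ₂.nonneg
  obtain ⟨a1, a2⟩ := hδ.int_Sb hst h1 hκ
  obtain ⟨b1, b2⟩ := hZ.int_Sb hst h1 hκ
  obtain ⟨e1, e2⟩ := hθ₂.int_Sb hst h1 hκ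
  obtain ⟨g1, g2⟩ := hδ.int_Sb_Sb hst h1 hZ
  have mδ := hδ.cur.mS hst
  have mZ := hZ.cur.mS hst
  have m2 := hθ₂.cur.mS hst
  have dδ := hδ.cur.aesm hst
  have dZ := hZ.cur.aesm hst
  have d2 := hθ₂.cur.aesm hst
  obtain ⟨p1, q1⟩ := cs_integral hd (by positivity) dδ mZ (hδ.cur.iD2 hst) b1 hδ.J b2
  obtain ⟨p2, q2⟩ := cs_integral (by positivity) hρ0 (mδ.mul mZ) d2 g1 (hθ₂.cur.iD2 hst) g2 hρ
  obtain ⟨p3, q3⟩ := cs_integral (by positivity) hE mδ dZ a1 (hZ.cur.iD2 hst) a2 hZ.J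
  obtain ⟨p4, q4⟩ := cs_integral hρ0 (by positivity) d2 mZ (hθ₂.cur.iD2 hst) b1 hρ b2
  obtain ⟨p5, q5⟩ := cs_integral (by positivity) hE m2 dZ e1 (hZ.cur.iD2 hst) e2 hZ.J
  have hb := (((p1.add p2).add p3).const_mul (M * R)).add ((p4.add p5).const_mul (M * d))
  refine (integral_mono_ae hi hb ?_).trans ?_
  · filter_upwards [ae_restrict_mem measurableSet_Ioc, c₁.inV, hθ₂.cur.inV, hZ.cur.inV]
      with r hr k1 k2 k3
    have n1 := hR r (Ioc_subset_Icc_self hr)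
    have n2 := hν r (Ioc_subset_Icc_self hr)
    have := (le_abs_self _).trans (abs_Gf_sub_le G (v₁ r) (v₂ r) k1 k2 k3)
    refine this.trans ?_
    simp only [Pi.add_apply, Pi.mul_apply, abs_mul, abs_norm, abs_of_nonneg (Sb_nonneg _)]
    have s1 := Sb_nonneg (θ₁ r - θ₂ r)
    have s2 := Sb_nonneg (Z r)
    have s3 := Sb_nonneg (θ₂ r)
    refine add_le_add ?_ ?_
    · calc _ ≤ M * R * ((‖Dx (θ₁ r - θ₂ r)‖ + Sb (θ₁ r - θ₂ r) * ‖Dx (θ₂ r)‖) * Sb (Z r) +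
            Sb (θ₁ r - θ₂ r) * ‖Dx (Z r)‖) := by gcongr
        _ = _ := by ring
    · gcongr
  · have e0 := integral_add (((p1.add p2).add p3).const_mul (M * R)) ((p4.add p5).const_mul (M * d))
    have e3 := integral_add (p1.add p2) p3
    have e4 := integral_add p1 p2
    have e5 := integral_add p4 p5
    rw [integral_const_mul, integral_const_mul] at e0
    refine e0.le.trans ?_
    refine (add_le_add (mul_le_mul_of_nonneg_left (e3.le.trans (add_le_add (e4.le.trans
      (add_le_add q1 q2)) q3)) (by positivity)) (mul_le_mul_of_nonneg_left
          (e5.le.trans (add_le_add q4 q5))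
      (by positivity))).trans ?_
    have : ρ * (κ * E) ≤ R * (κ * E) := by gcongr
    nlinarith [mul_nonneg (mul_nonneg hM hd) (sub_nonneg.2 this)]

/-- One step of the fixed point iteration. -/
structure Step (f f' : ℝ → ℝ) (s t : ℝ) (v θ V W Z : ℝ → HS a b) : Prop where
  wave : WaveEq s t (fun r => FN f' (θ r)) V W
  cur : CurV s t Z
  heat : HeatEq s t (fun r => Gf f f' (v r) (θ r)) Z

theorem diff_est (G : C11 f f' M) {s t : ℝ} (hst : s ≤ t) (h1 : t - s ≤ 1)
    {v₁ v₂ θ₁ θ₂ V₁ V₂ W₁ W₂ Z₁ Z₂ : ℝ → HS a b} {R ρ κ d K : ℝ} (hκ0 : √(t - s) ≤ κ)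
    (hκ : 2 * C0 a b * √(t - s) ≤ κ ^ 2)
    (hv₁ : ContinuousOn v₁ (Icc s t)) (hv₂ : ContinuousOn v₂ (Icc s t)) (c₁ : CurV s t θ₁)
    (S₁ : Step f f' s t v₁ θ₁ V₁ W₁ Z₁) (S₂ : Step f f' s t v₂ θ₂ V₂ W₂ Z₂)
    (eV : V₁ s = V₂ s) (eW : W₁ s = W₂ s) (eZ : Z₁ s = Z₂ s)
    (hR : ∀ r ∈ Icc s t, ‖v₁ r‖ ≤ R) (hθ₂ : Sz s t θ₂ R) (hρ0 : 0 ≤ ρ) (hρR : ρ ≤ R)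
    (hρ : ∫ r in Ioc s t, ‖Dx (θ₂ r)‖ ^ 2 ≤ ρ ^ 2) (hδ : Sz s t (fun r => θ₁ r - θ₂ r) d)
    (hν : ∀ r ∈ Icc s t, ‖v₁ r - v₂ r‖ ≤ d)
    (hK1 : 2 * (M * R * (4 * κ + 2 * C0 a b * ρ)) ≤ K) (hK2 : 2 * (M * (κ + κ * ρ)) ≤ K) :
    Sz s t (fun r => Z₁ r - Z₂ r) (K * d) ∧
      ∀ r ∈ Icc s t, ‖V₁ r - V₂ r‖ ≤ K * d ∧ ‖W₁ r - W₂ r‖ ≤ K * d := by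
  have hM := G.M_nonneg
  have hC := C0_pos (a := a) (b := b)
  have hd := hδ.nonneg
  have hR0 := hθ₂.nonneg
  have hκn : 0 ≤ κ := (Real.sqrt_nonneg _).trans hκ0
  constructor
  · have F₁ := force_Gf G hst hv₁ c₁
    have F₂ := force_Gf G hst hv₂ hθ₂.cur
    have F := F₁.sub F₂
    have hZ := S₁.cur.sub hst S₂.cur
    have hH := HeatEq.sub hst F₁ F₂ S₁.cur S₂.cur S₁.heat S₂.heat
    obtain ⟨E, hE, hE'⟩ := sz_exact hst hZ
    have key : ∀ r ∈ Icc s t, ‖Z₁ r - Z₂ r‖ ^ 2 + 2 * ∫ q in Ioc s r, ‖Dx (Z₁ q - Z₂ q)‖ ^ 2 ≤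
        2 * (M * R * (4 * κ + 2 * C0 a b * ρ) * d * E) := fun r hr => by
      have hr1 : r - s ≤ t - s := by linarith [hr.2]
      have hsub : Icc s r ⊆ Icc s t := Icc_subset_Icc_right hr.2
      obtain ⟨i1, i2⟩ := heat_energy hr.1 (F.mono le_rfl hr.1 hr.2) (hZ.mono le_rfl hr.1 hr.2)
        (hH.mono F hZ le_rfl hr.1 hr.2)
      rw [intervalIntegral.integral_of_le hr.1, intervalIntegral.integral_of_le hr.1, eZ, sub_self,
        norm_zero] at i2
      have := Gf_diff_int G hr.1 (by linarith) hκn (κ := κ)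
        ((mul_le_mul_of_nonneg_left (Real.sqrt_le_sqrt hr1) (by positivity)).trans hκ)
        (c₁.mono le_rfl hr.1 hr.2) (fun q hq => hR q (hsub hq)) (hθ₂.mono hr) hρ0 hρR
        ((setIntegral_mono_set (hθ₂.cur.iD2 hst) (Eventually.of_forall fun _ => sq_nonneg _)
          (Eventually.of_forall (Ioc_subset_Ioc_right hr.2))).trans hρ)
        (hδ.mono hr) (fun q hq => hν q (hsub hq)) (hE.mono hr)
        ((intervalIntegrable_iff_integrableOn_Ioc_of_le hr.1).1 i1)
      linarith
    have hJ0 : ∀ r, 0 ≤ ∫ q in Ioc s r, ‖Dx (Z₁ q - Z₂ q)‖ ^ 2 := fun r =>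
      integral_nonneg fun _ => sq_nonneg _
    set ε := M * R * (4 * κ + 2 * C0 a b * ρ)
    have hε : 0 ≤ ε := by positivity
    have hE0 := hE.nonneg
    have h2 : E ^ 2 ≤ 2 * (ε * d * E) := by
      rcases hE' with ⟨r, hr, h⟩ | h
      · have := key r hr
        rw [h] at this
        linarith [hJ0 r]
      · have := key t (right_mem_Icc.2 hst)
        rw [h] at this
        have h0 : 0 ≤ ε * d * E := by positivity
        nlinarith [sq_nonneg ‖Z₁ t - Z₂ t‖]
    have h3 : E ≤ 2 * ε * d := by
      rcases hE0.eq_or_lt with h | h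
      · rw [← h]; positivity
      · by_contra hcon
        nlinarith
    exact hE.mono_d (h3.trans (mul_le_mul_of_nonneg_right hK1 hd))
  · have F₁ := wforce_FN G c₁
    have F₂ := wforce_FN G hθ₂.cur
    have F := F₁.sub F₂
    have hH := WaveEq.sub hst F₁ F₂ S₁.wave S₂.wave
    obtain ⟨p, hp, hmax⟩ := isCompact_Icc.exists_isMaxOn (nonempty_Icc.2 hst) hH.cv.norm
    have hm : ∀ r ∈ Icc s t, ‖V₁ r - V₂ r‖ ≤ ‖V₁ p - V₂ p‖ := fun r hr => hmax hr
    obtain ⟨i1, i2⟩ := hδ.int_D hst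
    obtain ⟨a1, a2⟩ := hδ.int_Sb hst h1 hκ
    obtain ⟨p2, q2⟩ := cs_integral (by positivity) hρ0 (hδ.cur.mS hst) (hθ₂.cur.aesm hst) a1
      (hθ₂.cur.iD2 hst) a2 hρ
    simp only [abs_norm, abs_of_nonneg (Sb_nonneg _)] at p2 q2
    have hA : ∫ r in Ioc s t, M * (‖Dx (θ₁ r - θ₂ r)‖ + Sb (θ₁ r - θ₂ r) * ‖Dx (θ₂ r)‖) ≤
        M * (κ + κ * ρ) * d := by
      rw [integral_const_mul, integral_add i1 p2]
      have : √(t - s) * d ≤ κ * d := by gcongr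
      calc _ ≤ M * (κ * d + κ * d * ρ) := by gcongr; linarith
        _ = _ := by ring
    have hb : IntegrableOn (fun r => M * (‖Dx (θ₁ r - θ₂ r)‖ + Sb (θ₁ r - θ₂ r) * ‖Dx (θ₂ r)‖))
      (Ioc s t) := (i1.add p2).const_mul M
    set A := M * (κ + κ * ρ) * d with hAdef
    have hA0 : 0 ≤ A := by positivity
    have key : ∀ r ∈ Icc s t, ‖V₁ r - V₂ r‖ ^ 2 + ‖W₁ r - W₂ r‖ ^ 2 ≤ 2 * ‖V₁ p - V₂ p‖ * A := by
      intro r hr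
      obtain ⟨j1, j2⟩ := wave_energy hr.1 (F.mono le_rfl hr.1 hr.2) (hH.mono F le_rfl hr.1 hr.2)
      rw [eV, eW, sub_self, sub_self, norm_zero] at j2
      have j1' := (intervalIntegrable_iff_integrableOn_Ioc_of_le hr.1).1 j1
      have hbr := hb.mono_set (Ioc_subset_Ioc_right hr.2)
      have j3 : -∫ q in s..r, ⟪V₁ q - V₂ q, FN f' (θ₁ q) - FN f' (θ₂ q)⟫_ℝ ≤
          ‖V₁ p - V₂ p‖ * A := by
        rw [intervalIntegral.integral_of_le hr.1, ← integral_neg]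
        refine (integral_mono_ae j1'.neg (hbr.const_mul ‖V₁ p - V₂ p‖) ?_).trans ?_
        · filter_upwards [ae_restrict_mem measurableSet_Ioc,
            ae_restrict_of_ae_restrict_of_subset (Ioc_subset_Ioc_right hr.2) c₁.inV,
            ae_restrict_of_ae_restrict_of_subset (Ioc_subset_Ioc_right hr.2) hθ₂.cur.inV]
            with q hq k1 k2
          have l1 := (neg_le_abs _).trans
            (abs_real_inner_le_norm (V₁ q - V₂ q) (FN f' (θ₁ q) - FN f' (θ₂ q)))
          refine l1.trans (mul_le_mul (hm q ⟨hq.1.le, hq.2.trans hr.2⟩) ?_ (norm_nonneg _)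
            (norm_nonneg _))
          refine (norm_FN_sub_le G k1 k2).trans (le_of_eq ?_)
          rw [← Dx_sub k1 k2]; ring
        · rw [integral_const_mul]
          refine mul_le_mul_of_nonneg_left (le_trans ?_ hA) (norm_nonneg _)
          refine setIntegral_mono_set hb (Eventually.of_forall fun q => ?_)
            (Eventually.of_forall (Ioc_subset_Ioc_right hr.2))
          have := Sb_nonneg (θ₁ q - θ₂ q)
          simp only [Pi.zero_apply]; positivity
      nlinarith
    have h2 : ‖V₁ p - V₂ p‖ ≤ 2 * A := by
      have := key p hp
      rcases (norm_nonneg (V₁ p - V₂ p)).eq_or_lt with h | h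
      · rw [← h]; positivity
      · by_contra hcon
        nlinarith [sq_nonneg ‖W₁ p - W₂ p‖]
    have h3 : 2 * A ≤ K * d := by
      rw [hAdef]
      calc _ = 2 * (M * (κ + κ * ρ)) * d := by ring
        _ ≤ _ := by gcongr
    refine fun r hr => ⟨(hm r hr).trans (h2.trans h3), ?_⟩
    have := key r hr
    refine le_trans ?_ h3
    refine abs_le_of_sq_le_sq' ?_ (by positivity) |>.2
    nlinarith [sq_nonneg ‖V₁ r - V₂ r‖]

end

section

variable {a b : ℝ} [hab : Fact (a < b)] {f f' : ℝ → ℝ} {M : ℝ}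

lemma J_tri {s t : ℝ} (hst : s ≤ t) {θ η : ℝ → HS a b} (hθ : CurV s t θ) (hη : CurV s t η)
    {d e : ℝ} (hd : 0 ≤ d) (he : 0 ≤ e) (h1 : ∫ r in Ioc s t, ‖Dx (θ r - η r)‖ ^ 2 ≤ d ^ 2)
    (h2 : ∫ r in Ioc s t, ‖Dx (η r)‖ ^ 2 ≤ e ^ 2) :
    ∫ r in Ioc s t, ‖Dx (θ r)‖ ^ 2 ≤ (d + e) ^ 2 := by
  have hδ := hθ.sub hst hη
  obtain ⟨i, j⟩ := cs_integral hd he (hδ.aesm hst) (hη.aesm hst) (hδ.iD2 hst) (hη.iD2 hst) h1 h2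
  simp only [abs_norm] at i j
  have hb : IntegrableOn (fun r => ‖Dx (θ r - η r)‖ ^ 2 +
      2 * (‖Dx (θ r - η r)‖ * ‖Dx (η r)‖) + ‖Dx (η r)‖ ^ 2) (Ioc s t) :=
    ((hδ.iD2 hst).add (i.const_mul 2)).add (hη.iD2 hst)
  have e1 : ∫ r in Ioc s t, (‖Dx (θ r - η r)‖ ^ 2 + 2 * (‖Dx (θ r - η r)‖ * ‖Dx (η r)‖) +
      ‖Dx (η r)‖ ^ 2) = (∫ r in Ioc s t, ‖Dx (θ r - η r)‖ ^ 2) +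
      2 * (∫ r in Ioc s t, (‖Dx (θ r - η r)‖ * ‖Dx (η r)‖)) + ∫ r in Ioc s t, ‖Dx (η r)‖ ^ 2 := by
    rw [← integral_const_mul, ← integral_add (hδ.iD2 hst) (i.const_mul 2)]
    exact integral_add ((hδ.iD2 hst).add (i.const_mul 2)) (hη.iD2 hst)
  refine (integral_mono_ae (hθ.iD2 hst) hb ?_).trans ?_
  · filter_upwards [hθ.inV, hη.inV] with r k1 k2
    have h3 : ‖Dx (θ r)‖ ≤ ‖Dx (θ r - η r)‖ + ‖Dx (η r)‖ := by
      rw [Dx_sub k1 k2]; exact norm_le_norm_sub_add _ _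
    calc _ ≤ (‖Dx (θ r - η r)‖ + ‖Dx (η r)‖) ^ 2 := by gcongr
      _ = _ := by ring
  · rw [e1]; nlinarith

lemma Sz.tri {s t : ℝ} (hst : s ≤ t) {x y z : ℝ → HS a b} (hx : CurV s t x) (hz : CurV s t z)
    {d e : ℝ} (h1 : Sz s t (fun r => x r - y r) d) (h2 : Sz s t (fun r => y r - z r) e) :
    Sz s t (fun r => x r - z r) (d + e) where
  nonneg := add_nonneg h1.nonneg h2.nonneg
  cur := hx.sub hst hz
  sup r hr := (norm_sub_le_norm_sub_add_norm_sub _ (y r) _).trans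
    (add_le_add (h1.sup r hr) (h2.sup r hr))
  J := by
    refine J_tri hst (hx.sub hst hz) h2.cur h1.nonneg h2.nonneg ?_ h2.J
    simpa only [sub_sub_sub_cancel_right] using h1.J

lemma Sz.of_sub {s t : ℝ} (hst : s ≤ t) {x y : ℝ → HS a b} (hx : CurV s t x)
    {d e : ℝ} (h1 : Sz s t (fun r => x r - y r) d) (h2 : Sz s t y e) : Sz s t x (d + e) where
  nonneg := add_nonneg h1.nonneg h2.nonneg
  cur := hx
  sup r hr := (norm_le_norm_sub_add _ (y r)).trans (add_le_add (h1.sup r hr) (h2.sup r hr))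
  J := J_tri hst hx h2.cur h1.nonneg h2.nonneg h1.J h2.J

lemma curV_zero (s t : ℝ) : CurV s t (fun _ => (0 : HS a b)) where
  cont := continuousOn_const
  inV := Eventually.of_forall fun _ => inV_zero
  sq := by simp

lemma qD_le_liminf {h : ℕ → HS a b} {h₀ : HS a b} (H : Tendsto h atTop (𝓝 h₀)) :
    qD h₀ ≤ liminf (fun k => qD (h k)) atTop := by
  have : LowerSemicontinuous (qD : HS a b → ℝ≥0∞) := by
    refine lowerSemicontinuous_tsum fun n => Continuous.lowerSemicontinuous ?_
    exact ENNReal.continuous_ofReal.comp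
      ((continuous_const.mul (continuous_const.inner continuous_id)).pow 2)
  have h1 : qD h₀ ≤ liminf qD (𝓝 h₀) := lowerSemicontinuousAt_iff_le_liminf.1 (this h₀)
  exact h1.trans (liminf_le_liminf_of_le H)

/-- Weak lower semicontinuity of the size under uniform convergence. -/
lemma Sz.of_tendsto {s t : ℝ} (hst : s ≤ t) {x : ℕ → ℝ → HS a b} {y : ℝ → HS a b} {d : ℝ}
    (H : ∀ k, Sz s t (x k) d) (hy : ContinuousOn y (Icc s t))
    (hl : ∀ r ∈ Icc s t, Tendsto (fun k => x k r) atTop (𝓝 (y r))) : Sz s t y d := by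
  have hd := (H 0).nonneg
  have hle : ∫⁻ r in Ioc s t, qD (y r) ≤ ENNReal.ofReal (d ^ 2) := by
    calc ∫⁻ r in Ioc s t, qD (y r) ≤ ∫⁻ r in Ioc s t, liminf (fun k => qD (x k r)) atTop :=
          lintegral_mono_ae ((ae_restrict_mem measurableSet_Ioc).mono fun r hr =>
            qD_le_liminf (hl r (Ioc_subset_Icc_self hr)))
      _ ≤ liminf (fun k => ∫⁻ r in Ioc s t, qD (x k r)) atTop :=
          lintegral_liminf_le' fun k => aemeasurable_qD (H k).cur.cont
      _ ≤ _ := by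
          refine liminf_le_of_le (by isBoundedDefault) fun c hc => ?_
          obtain ⟨k, hk⟩ := hc.exists
          refine hk.trans ?_
          rw [lintegral_qD hst (H k).cur, intervalIntegral.integral_of_le hst]
          exact ENNReal.ofReal_le_ofReal (H k).J
  have hc : CurV s t y := CurV.of_lintegral hst hy (hle.trans_lt ENNReal.ofReal_lt_top)
  refine ⟨hd, hc, fun r hr => le_of_tendsto (hl r hr).norm
    (Eventually.of_forall fun k => (H k).sup r hr), ?_⟩
  rw [lintegral_qD hst hc, intervalIntegral.integral_of_le hst] at hle
  exact (ENNReal.ofReal_le_ofReal_iff (by positivity)).1 hle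

lemma exists_params (hM : 0 ≤ M) {R : ℝ} (hR : 1 ≤ R) : ∃ ρ κ : ℝ, 0 < ρ ∧ ρ ≤ 1 ∧ 0 < κ ∧
    2 * (M * R * (4 * κ + 2 * C0 a b * ρ)) ≤ 1 / 2 ∧ 2 * (M * (κ + κ * ρ)) ≤ 1 / 2 ∧
    2 * (M * R * (4 * κ)) * R ≤ ρ / 2 ∧ 2 * (M * κ) ≤ 2 * (M * R * (4 * κ)) := by
  have hC := C0_pos (a := a) (b := b)
  have hR0 : 0 < R := by linarith
  set A := 1 + 16 * M * R * C0 a b with hA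
  have hA1 : 1 ≤ A := by rw [hA]; have : 0 ≤ 16 * M * R * C0 a b := by positivity
                         linarith
  set B := 32 * (1 + M * R ^ 2) with hB
  have hBp : 0 < B := by positivity
  have e1 : A * (1 / A) = 1 := by field_simp
  have hρ : 0 < 1 / A := by positivity
  have hρ1 : 1 / A ≤ 1 := by rw [div_le_one (by linarith)]; exact hA1
  set ρ := 1 / A
  have e2 : B * (ρ / B) = ρ := by field_simp
  have hκ : 0 < ρ / B := by positivity
  set κ := ρ / B
  have k1 : 32 * M * R ^ 2 * κ ≤ ρ := by
    rw [← e2, hB]; nlinarith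
  have k2 : M * R * κ ≤ M * R ^ 2 * κ := by
    have : R ≤ R ^ 2 := by nlinarith
    gcongr
  have k3 : M * κ ≤ M * R * κ := by
    have : M * κ * 1 ≤ M * κ * R := by gcongr
    linarith
  have k4 : 16 * M * R * C0 a b * ρ ≤ 1 := by
    rw [← e1, hA]; nlinarith
  have k5 : M * κ * ρ ≤ M * κ := by
    have : M * κ * ρ ≤ M * κ * 1 := by gcongr
    linarith
  exact ⟨ρ, κ, hρ, hρ1, hκ, by nlinarith, by nlinarith, by nlinarith, by nlinarith⟩

lemma exists_time {s t : ℝ} (hst : s < t) {κ ρ : ℝ} (hκ : 0 < κ) (hρ : 0 < ρ)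
    {θ : ℝ → HS a b} (H : CurV s t θ) : ∃ t', s < t' ∧ t' ≤ t ∧ t' - s ≤ 1 / 2 ∧
      √(t' - s) ≤ κ ∧ 2 * C0 a b * √(t' - s) ≤ κ ^ 2 ∧
      ∫ r in Ioc s t', ‖Dx (θ r)‖ ^ 2 ≤ ρ ^ 2 := by
  have hc : Tendsto (fun r => √(r - s)) (𝓝[>] s) (𝓝 0) := by
    have : Continuous (fun r => √(r - s)) := by fun_prop
    simpa using (this.tendsto s).mono_left nhdsWithin_le_nhds
  have hc2 : Tendsto (fun r => 2 * C0 a b * √(r - s)) (𝓝[>] s) (𝓝 0) := by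
    simpa using hc.const_mul (2 * C0 a b)
  have hi : IntegrableOn (fun r => ‖Dx (θ r)‖ ^ 2) (Icc s t) :=
    (integrableOn_Icc_iff_integrableOn_Ioc (by simp)).2 (H.iD2 hst.le)
  have hJ : Tendsto (fun r => ∫ q in Ioc s r, ‖Dx (θ q)‖ ^ 2) (𝓝[>] s) (𝓝 0) := by
    have h1 := (intervalIntegral.continuousOn_primitive hi) s (left_mem_Icc.2 hst.le)
    have h2 : Tendsto (fun r => ∫ q in Ioc s r, ‖Dx (θ q)‖ ^ 2) (𝓝[Icc s t] s)
      (𝓝 (∫ q in Ioc s s, ‖Dx (θ q)‖ ^ 2)) := h1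
    rw [Ioc_self, Measure.restrict_empty, integral_zero_measure] at h2
    refine h2.mono_left ?_
    rw [nhdsWithin_Icc_eq_nhdsGE hst]
    exact nhdsWithin_mono _ Ioi_subset_Ici_self
  have h1 : ∀ᶠ r in 𝓝[>] s, r < min t (s + 1 / 2) :=
    nhdsWithin_le_nhds (Iio_mem_nhds (lt_min hst (by linarith)))
  obtain ⟨r, h1, ⟨h2, h3, h4⟩, h5⟩ := (h1.and (((hc.eventually (gt_mem_nhds hκ)).and
    ((hc2.eventually (gt_mem_nhds (by positivity : 0 < κ ^ 2))).and
    (hJ.eventually (gt_mem_nhds (by positivity : 0 < ρ ^ 2))))).and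
        (self_mem_nhdsWithin : Ioi s ∈ 𝓝[>] s))).exists
  rw [lt_min_iff] at h1
  exact ⟨r, h5, h1.1.le, by linarith [h1.2], h2.le, h3.le, h4.le⟩

lemma Step.mono (G : C11 f f' M) {s t s' t' : ℝ} {v θ V W Z : ℝ → HS a b}
    (hv : ContinuousOn v (Icc s t)) (hθ : CurV s t θ) (H : Step f f' s t v θ V W Z)
    (hs : s ≤ s') (h : s' ≤ t') (ht : t' ≤ t) : Step f f' s' t' v θ V W Z where
  wave := H.wave.mono (wforce_FN G hθ) hs h ht
  cur := H.cur.mono hs h ht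
  heat := H.heat.mono (force_Gf G (hs.trans (h.trans ht)) hv hθ) H.cur hs h ht

lemma Step.congr {s t : ℝ} {v θ V W Z v' θ' : ℝ → HS a b} (H : Step f f' s t v θ V W Z)
    (hv : ∀ r ∈ Icc s t, v r = v' r) (hθ : ∀ r ∈ Icc s t, θ r = θ' r) :
    Step f f' s t v' θ' V W Z where
  wave := by
    refine ⟨H.wave.cv, H.wave.cw, fun n r hr => ?_, H.wave.eqw, H.wave.zero⟩
    rw [H.wave.eqv n r hr]
    congr 1
    refine intervalIntegral.integral_congr fun q hq => ?_
    rw [uIcc_of_le hr.1] at hq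
    simp only [hθ q ⟨hq.1, hq.2.trans hr.2⟩]
  cur := H.cur
  heat n r hr := by
    rw [H.heat n r hr]
    congr 1
    refine intervalIntegral.integral_congr fun q hq => ?_
    rw [uIcc_of_le hr.1] at hq
    simp only [hθ q ⟨hq.1, hq.2.trans hr.2⟩, hv q ⟨hq.1, hq.2.trans hr.2⟩]

lemma exists_step (G : C11 f f' M) {s t : ℝ} (hst : s ≤ t) (hl : t - s ≤ 1 / 2)
    {v θ : ℝ → HS a b} (hv : ContinuousOn v (Icc s t)) (hθ : CurV s t θ) (v0 w0 θ0 : HS a b) :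
    ∃ V W Z, V s = v0 ∧ W s = w0 ∧ Z s = θ0 ∧ Step f f' s t v θ V W Z := by
  obtain ⟨V, W, h1, h2, h3⟩ := wave_solve hst hl (wforce_FN G hθ) v0 w0
  obtain ⟨Z, h4, h5, h6⟩ := heat_solve hst hl (force_Gf G hst hv hθ) θ0
  exact ⟨V, W, Z, h1, h2, h4, h3, h5, h6⟩

/-- Solutions of the coupled system on `[s,t]`. -/
def IsSol (f f' : ℝ → ℝ) (s t : ℝ) (v w θ : ℝ → HS a b) : Prop := Step f f' s t v θ v w θ

lemma IsSol.mono (G : C11 f f' M) {s t s' t' : ℝ} {v w θ : ℝ → HS a b}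
    (H : IsSol f f' s t v w θ) (hs : s ≤ s') (h : s' ≤ t') (ht : t' ≤ t) :
    IsSol f f' s' t' v w θ := Step.mono G H.wave.cv H.cur H hs h ht

lemma exists_bound_cont {s t : ℝ} {v : ℝ → HS a b} (hv : ContinuousOn v (Icc s t)) :
    ∃ R, ∀ r ∈ Icc s t, ‖v r‖ ≤ R := isCompact_Icc.exists_bound_of_continuousOn hv

lemma unique_local (G : C11 f f' M) {s t : ℝ} (hst : s < t) {v₁ w₁ θ₁ v₂ w₂ θ₂ : ℝ → HS a b}
    (H₁ : IsSol f f' s t v₁ w₁ θ₁) (H₂ : IsSol f f' s t v₂ w₂ θ₂) (ev : v₁ s = v₂ s)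
    (ew : w₁ s = w₂ s) (eθ : θ₁ s = θ₂ s) : ∃ t', s < t' ∧ t' ≤ t ∧
      v₁ t' = v₂ t' ∧ w₁ t' = w₂ t' ∧ θ₁ t' = θ₂ t' := by
  obtain ⟨R₁, hR₁⟩ := exists_bound_cont H₁.wave.cv
  obtain ⟨R₂, hR₂, -⟩ := sz_exact hst.le H₂.cur
  set R := max 1 (max R₁ R₂)
  have hR1 : 1 ≤ R := le_max_left _ _
  obtain ⟨ρ, κ, hρ, hρ1, hκ, k1, k2, -⟩ := exists_params (a := a) (b := b) G.M_nonneg hR1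
  obtain ⟨t', ht1, ht2, ht3, l1, l2, l3⟩ := exists_time hst hκ hρ H₂.cur
  have hsub : Icc s t' ⊆ Icc s t := Icc_subset_Icc_right ht2
  have S₁ := H₁.mono G le_rfl ht1.le ht2
  have S₂ := H₂.mono G le_rfl ht1.le ht2
  obtain ⟨E, hE, hE'⟩ := sz_exact ht1.le (S₁.cur.sub ht1.le S₂.cur)
  obtain ⟨p, hp, hmax⟩ := isCompact_Icc.exists_isMaxOn (nonempty_Icc.2 ht1.le)
    (S₁.wave.cv.sub S₂.wave.cv).norm
  have hm : ∀ r ∈ Icc s t', ‖v₁ r - v₂ r‖ ≤ ‖v₁ p - v₂ p‖ := fun r hr => hmax hr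
  set d := max E ‖v₁ p - v₂ p‖
  obtain ⟨r1, r2⟩ := diff_est G ht1.le (by linarith) l1 l2 S₁.wave.cv S₂.wave.cv S₁.cur S₁ S₂ ev ew
    eθ (fun r hr => (hR₁ r (hsub hr)).trans ((le_max_left _ _).trans (le_max_right _ _)))
    ((hR₂.mono ⟨ht1.le, ht2⟩).mono_d ((le_max_right _ _).trans (le_max_right _ _))) hρ.le
    (hρ1.trans hR1) l3 (hE.mono_d (le_max_left _ _))
    (fun r hr => (hm r hr).trans (le_max_right E _)) k1 k2
  have hd0 : 0 ≤ d := hE.nonneg.trans (le_max_left _ _)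
  have hd : d ≤ 1 / 2 * d := by
    refine max_le ?_ (r2 p hp).1
    rcases hE' with ⟨r, hr, h⟩ | h
    · rw [← h]; exact r1.sup r hr
    · exact le_of_sq_le_sq (by rw [← h]; exact r1.J) (by positivity)
  have hd' : 1 / 2 * d ≤ 0 := by linarith
  have hz : ∀ x : HS a b, ‖x‖ ≤ 1 / 2 * d → x = 0 := fun x hx =>
    norm_le_zero_iff.1 (hx.trans hd')
  have ht := right_mem_Icc.2 ht1.le
  exact ⟨t', ht1, ht2, sub_eq_zero.1 (hz _ (r2 t' ht).1), sub_eq_zero.1 (hz _ (r2 t' ht).2),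
    sub_eq_zero.1 (hz _ (r1.sup t' ht))⟩

theorem unique_sol (G : C11 f f' M) {s t : ℝ} {v₁ w₁ θ₁ v₂ w₂ θ₂ : ℝ → HS a b}
    (H₁ : IsSol f f' s t v₁ w₁ θ₁) (H₂ : IsSol f f' s t v₂ w₂ θ₂) (ev : v₁ s = v₂ s)
    (ew : w₁ s = w₂ s) (eθ : θ₁ s = θ₂ s) :
    ∀ r ∈ Icc s t, v₁ r = v₂ r ∧ w₁ r = w₂ r ∧ θ₁ r = θ₂ r := by
  set S : Set ℝ := {r | v₁ r = v₂ r ∧ w₁ r = w₂ r ∧ θ₁ r = θ₂ r}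
  have hcl : IsClosed (S ∩ Icc s t) := by
    have e : S ∩ Icc s t = (Icc s t ∩ (fun r =>
        (v₁ r - v₂ r, w₁ r - w₂ r, θ₁ r - θ₂ r)) ⁻¹' {0}) := by
      ext r; simp only [S, mem_inter_iff, mem_ofPred_eq, mem_preimage, mem_singleton_iff,
        Prod.mk_eq_zero, sub_eq_zero]; tauto
    rw [e]
    exact ((H₁.wave.cv.sub H₂.wave.cv).prodMk ((H₁.wave.cw.sub H₂.wave.cw).prodMk
      (H₁.cur.cont.sub H₂.cur.cont))).preimage_isClosed_of_isClosed isClosed_Icc isClosed_singleton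
  refine hcl.Icc_subset_of_forall_exists_gt ⟨ev, ew, eθ⟩ fun x hx y hy => ?_
  have h1 : x < min y t := lt_min hy hx.2.2
  have hm : min y t ≤ t := min_le_right _ _
  obtain ⟨t', p1, p2, p3⟩ := unique_local G h1 (H₁.mono G hx.2.1 h1.le hm)
    (H₂.mono G hx.2.1 h1.le hm) hx.1.1 hx.1.2.1 hx.1.2.2
  exact ⟨t', p3, p1, p2.trans (min_le_left _ _)⟩

end

section

variable {a b : ℝ} [hab : Fact (a < b)] {f f' : ℝ → ℝ} {M : ℝ}

lemma exists_uniform_limit {s t C : ℝ} {x : ℕ → ℝ → HS a b}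
    (hc : ∀ k, ContinuousOn (x k) (Icc s t))
    (h : ∀ k, ∀ r ∈ Icc s t, ‖x (k + 1) r - x k r‖ ≤ C * (1 / 2) ^ k) :
    ∃ y : ℝ → HS a b, ContinuousOn y (Icc s t) ∧ ∀ r ∈ Icc s t,
      Tendsto (fun k => x k r) atTop (𝓝 (y r)) ∧ ∀ k, ‖y r - x k r‖ ≤ 2 * C * (1 / 2) ^ k := by
  have hd : ∀ r ∈ Icc s t, ∀ k, dist (x k r) (x (k + 1) r) ≤ C * (1 / 2) ^ k := fun r hr k => by
    rw [dist_comm, dist_eq_norm]; exact h k r hr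
  have hex : ∀ r, ∃ l, r ∈ Icc s t → Tendsto (fun k => x k r) atTop (𝓝 l) := fun r => by
    by_cases hr : r ∈ Icc s t
    · obtain ⟨l, hl⟩ := cauchySeq_tendsto_of_complete
        (cauchySeq_of_le_geometric (1 / 2) C (by norm_num) (hd r hr))
      exact ⟨l, fun _ => hl⟩
    · exact ⟨0, fun h => absurd h hr⟩
  choose y hy using hex
  have hb : ∀ r ∈ Icc s t, ∀ k, dist (x k r) (y r) ≤ 2 * C * (1 / 2) ^ k := fun r hr k => by
    refine (dist_le_of_le_geometric_of_tendsto (1 / 2) C (by norm_num) (hd r hr) (hy r hr)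
      k).trans (le_of_eq ?_)
    ring
  have hz : Tendsto (fun k : ℕ => 2 * C * (1 / 2 : ℝ) ^ k) atTop (𝓝 0) := by
    simpa using (tendsto_pow_atTop_nhds_zero_of_lt_one (by norm_num : (0 : ℝ) ≤ 1 / 2)
      (by norm_num)).const_mul (2 * C)
  have hu : TendstoUniformlyOn x y atTop (Icc s t) := by
    rw [Metric.tendstoUniformlyOn_iff]
    intro ε hε
    filter_upwards [hz.eventually (gt_mem_nhds hε)] with k hk r hr
    rw [dist_comm]
    exact (hb r hr k).trans_lt hk
  refine ⟨y, hu.continuousOn (Frequently.of_forall hc), fun r hr => ⟨hy r hr, fun k => ?_⟩⟩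
  rw [← dist_eq_norm, dist_comm]
  exact hb r hr k

theorem local_exists (G : C11 f f' M) (s : ℝ) (v0 w0 θ0 : HS a b) :
    ∃ t, s < t ∧ ∃ v w θ, v s = v0 ∧ w s = w0 ∧ θ s = θ0 ∧ IsSol f f' s t v w θ := by
  have hs0 : s < s + 1 / 2 := by linarith
  obtain ⟨vl, wl, θl, iv, iw, iθ, Sl⟩ := exists_step G hs0.le (by linarith)
    (continuousOn_const (c := (0 : HS a b))) (curV_zero s (s + 1 / 2)) v0 w0 θ0
  obtain ⟨R₁, hR₁⟩ := exists_bound_cont Sl.wave.cv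
  obtain ⟨R₂, hR₂, -⟩ := sz_exact hs0.le Sl.cur
  set R := 1 + max R₁ R₂
  have hRR1 : R₁ + 1 ≤ R := by linarith [le_max_left R₁ R₂]
  have hRR2 : R₂ + 1 ≤ R := by linarith [le_max_right R₁ R₂]
  have hR1 : 1 ≤ R := by linarith [hR₂.nonneg]
  obtain ⟨ρ, κ, hρ, hρ1, hκ, k1, k2, k3, k4⟩ := exists_params (a := a) (b := b) G.M_nonneg hR1
  obtain ⟨t, ht1, ht2, ht3, l1, l2, l3⟩ := exists_time hs0 hκ (half_pos hρ) Sl.cur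
  have hsub : Icc s t ⊆ Icc s (s + 1 / 2) := Icc_subset_Icc_right ht2
  replace Sl := Sl.mono G continuousOn_const (curV_zero _ _) le_rfl ht1.le ht2
  replace hR₂ := hR₂.mono ⟨ht1.le, ht2⟩
  replace hR₁ : ∀ r ∈ Icc s t, ‖vl r‖ ≤ R₁ := fun r hr => hR₁ r (hsub hr)
  have ht1' : t - s ≤ 1 := by linarith
  have hρ2 : 0 ≤ ρ / 2 := by linarith
  let P : (ℝ → HS a b) × (ℝ → HS a b) → Prop := fun X => ContinuousOn X.1 (Icc s t) ∧
    CurV s t X.2 ∧ (∀ r ∈ Icc s t, ‖X.1 r - vl r‖ ≤ ρ / 2) ∧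
    Sz s t (fun r => X.2 r - θl r) (ρ / 2)
  have hP : ∀ X, P X → (∀ r ∈ Icc s t, ‖X.1 r‖ ≤ R) ∧ Sz s t X.2 R ∧
      ∫ r in Ioc s t, ‖Dx (X.2 r)‖ ^ 2 ≤ ρ ^ 2 := fun X hX => by
    refine ⟨fun r hr => ?_, (hX.2.2.2.of_sub ht1.le hX.2.1 hR₂).mono_d (by linarith), ?_⟩
    · have := norm_le_norm_sub_add (X.1 r) (vl r)
      linarith [hX.2.2.1 r hr, hR₁ r hr]
    · have := J_tri ht1.le hX.2.1 Sl.cur hρ2 hρ2 hX.2.2.2.J l3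
      rwa [add_halves] at this
  have hstep : ∀ X, P X → ∃ Y W, P Y ∧ Step f f' s t X.1 X.2 Y.1 W Y.2 ∧ Y.1 s = v0 ∧ W s = w0 ∧
      Y.2 s = θ0 := fun X hX => by
    obtain ⟨h1, h2, -⟩ := hP X hX
    obtain ⟨V, W, Z, jv, jw, jθ, S⟩ := exists_step G ht1.le ht3 hX.1 hX.2.1 v0 w0 θ0
    have h2' : Sz s t (fun r => X.2 r - 0) R := by simpa only [sub_zero] using h2
    have hz : Sz s t (fun _ => (0 : HS a b)) R :=
      ⟨h2.nonneg, curV_zero _ _,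
          fun r _ => by simpa using h2.nonneg, by simpa [Dx_zero] using sq_nonneg R⟩
    obtain ⟨r1, r2⟩ := diff_est G ht1.le ht1' l1 l2 hX.1 continuousOn_const hX.2.1 S Sl
      (jv.trans iv.symm) (jw.trans iw.symm) (jθ.trans iθ.symm) h1 hz le_rfl (by linarith)
      (by simp [Dx_zero]) h2' (fun r hr => by simpa only [sub_zero] using h1 r hr)
      (K := 2 * (M * R * (4 * κ))) (by simp) (by simpa using k4)
    exact ⟨(V, Z), W, ⟨S.wave.cv, S.cur, fun r hr => (r2 r hr).1.trans k3, r1.mono_d k3⟩, S, jv, jw,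
      jθ⟩
  have hstep' : ∀ X : {X // P X}, ∃ Y : {Y // P Y}, ∃ W, Step f f' s t X.1.1 X.1.2 Y.1.1 W Y.1.2 ∧
      Y.1.1 s = v0 ∧ W s = w0 ∧ Y.1.2 s = θ0 := fun X => by
    obtain ⟨Y, W, h1, h2⟩ := hstep X.1 X.2
    exact ⟨⟨Y, h1⟩, W, h2⟩
  choose T W hT using hstep'
  have hPl : P (vl, θl) := ⟨Sl.wave.cv, Sl.cur, fun r _ => by simpa using hρ2,
    ⟨hρ2, by simpa using curV_zero s t, fun r _ => by simpa using hρ2,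
      by simpa [Dx_zero] using sq_nonneg (ρ / 2)⟩⟩
  let x : ℕ → {X // P X} := fun k => T^[k] ⟨(vl, θl), hPl⟩
  have hx : ∀ k, x (k + 1) = T (x k) := fun k => iterate_succ_apply' _ _ _
  have contr : ∀ (X Y : {X // P X}) (d : ℝ), Sz s t (fun r => X.1.2 r - Y.1.2 r) d →
      (∀ r ∈ Icc s t, ‖X.1.1 r - Y.1.1 r‖ ≤ d) →
      Sz s t (fun r => (T X).1.2 r - (T Y).1.2 r) (1 / 2 * d) ∧
      (∀ r ∈ Icc s t, ‖(T X).1.1 r - (T Y).1.1 r‖ ≤ 1 / 2 * d) := fun X Y d h1 h2 => by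
    obtain ⟨p1, p2, p3⟩ := hP X.1 X.2
    obtain ⟨q1, q2, q3⟩ := hP Y.1 Y.2
    obtain ⟨S, e1, e2, e3⟩ := hT X
    obtain ⟨S', e1', e2', e3'⟩ := hT Y
    obtain ⟨r1, r2⟩ := diff_est G ht1.le ht1' l1 l2 X.2.1 Y.2.1 X.2.2.1 S S'
      (e1.trans e1'.symm) (e2.trans e2'.symm) (e3.trans e3'.symm) p1 q2 hρ.le (by linarith)
      q3 h1 h2 k1 k2
    exact ⟨r1, fun r hr => (r2 r hr).1⟩
  have hd : ∀ k, Sz s t (fun r => (x (k + 1)).1.2 r - (x k).1.2 r) (ρ * (1 / 2) ^ k) ∧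
      ∀ r ∈ Icc s t, ‖(x (k + 1)).1.1 r - (x k).1.1 r‖ ≤ ρ * (1 / 2) ^ k := fun k => by
    induction k with
    | zero =>
      have h := (x 1).2
      simp only [pow_zero, mul_one]
      exact ⟨h.2.2.2.mono_d (by linarith), fun r hr => (h.2.2.1 r hr).trans (by linarith)⟩
    | succ k ih =>
      have := contr _ _ _ ih.1 ih.2
      rw [← hx, ← hx] at this
      have e : ρ * (1 / 2) ^ (k + 1) = 1 / 2 * (ρ * (1 / 2) ^ k) := by ring
      rw [e]
      exact this
  obtain ⟨v, cv, hv⟩ := exists_uniform_limit (fun k => (x k).2.1) (fun k => (hd k).2)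
  obtain ⟨θ, cθ, hθ⟩ := exists_uniform_limit (fun k => (x k).2.2.1.cont) (fun k => (hd k).1.sup)
  have htel : ∀ k m, Sz s t (fun r => (x (k + m)).1.2 r - (x k).1.2 r)
      (2 * ρ * (1 / 2) ^ k - 2 * ρ * (1 / 2) ^ (k + m)) := fun k m => by
    induction m with
    | zero =>
      simp only [add_zero, sub_self]
      exact ⟨le_rfl, curV_zero _ _, by simp, by simp [Dx_zero]⟩
    | succ m ih =>
      refine (Sz.tri ht1.le (x (k + m + 1)).2.2.1 (x k).2.2.1 (hd (k + m)).1 ih).mono_d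
        (le_of_eq ?_)
      rw [← add_assoc, pow_succ _ (k + m)]
      ring
  have hlim : ∀ k, Sz s t (fun r => θ r - (x k).1.2 r) (2 * ρ * (1 / 2) ^ k) := fun k => by
    refine Sz.of_tendsto ht1.le (x := fun m r => (x (k + m)).1.2 r - (x k).1.2 r)
      (fun m => (htel k m).mono_d ?_) (cθ.sub (x k).2.2.1.cont) fun r hr => ?_
    · have : 0 ≤ 2 * ρ * (1 / 2) ^ (k + m) := by positivity
      linarith
    · refine Tendsto.sub_const ?_ _
      have := (hθ r hr).1.comp (tendsto_add_atTop_nat k)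
      refine this.congr fun m => ?_
      simp only [comp_apply, add_comm m k]
  have h0 := (hlim 0).cur
  have cur : CurV s t θ := by
    have := h0.sub ht1.le ((curV_zero s t).sub ht1.le (x 0).2.2.1)
    simpa using this
  have hPX : P (v, θ) := by
    refine ⟨cv, cur, fun r hr => ?_, ?_⟩
    · exact le_of_tendsto ((hv r hr).1.sub_const _).norm
        (Eventually.of_forall fun k => (x k).2.2.2.1 r hr)
    · exact Sz.of_tendsto ht1.le (fun k => (x k).2.2.2.2) (cθ.sub Sl.cur.cont)
        fun r hr => (hθ r hr).1.sub_const _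
  let X : {X // P X} := ⟨(v, θ), hPX⟩
  have hc : ∀ k, Sz s t (fun r => (T X).1.2 r - (x (k + 1)).1.2 r) (ρ * (1 / 2) ^ k) ∧
      ∀ r ∈ Icc s t, ‖(T X).1.1 r - (x (k + 1)).1.1 r‖ ≤ ρ * (1 / 2) ^ k := fun k => by
    have := contr X (x k) _ (hlim k) (fun r hr => (hv r hr).2 k)
    rw [← hx] at this
    have e : ρ * (1 / 2) ^ k = 1 / 2 * (2 * ρ * (1 / 2) ^ k) := by ring
    rw [e]
    exact this
  have hz : Tendsto (fun k : ℕ => ρ * (1 / 2 : ℝ) ^ k) atTop (𝓝 0) := by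
    simpa using (tendsto_pow_atTop_nhds_zero_of_lt_one (by norm_num : (0 : ℝ) ≤ 1 / 2)
      (by norm_num)).const_mul ρ
  have ev : ∀ r ∈ Icc s t, v r = (T X).1.1 r := fun r hr => by
    refine tendsto_nhds_unique ((hv r hr).1.comp (tendsto_add_atTop_nat 1)) ?_
    rw [tendsto_iff_norm_sub_tendsto_zero]
    refine squeeze_zero (fun _ => norm_nonneg _) (fun k => ?_) hz
    rw [norm_sub_rev]; exact (hc k).2 r hr
  have eθ : ∀ r ∈ Icc s t, θ r = (T X).1.2 r := fun r hr => by
    refine tendsto_nhds_unique ((hθ r hr).1.comp (tendsto_add_atTop_nat 1)) ?_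
    rw [tendsto_iff_norm_sub_tendsto_zero]
    refine squeeze_zero (fun _ => norm_nonneg _) (fun k => ?_) hz
    rw [norm_sub_rev]; exact (hc k).1.sup r hr
  obtain ⟨S, e1, e2, e3⟩ := hT X
  exact ⟨t, ht1, _, _, _, e1, e2, e3, S.congr ev eθ⟩

end

section

variable {a b : ℝ} [hab : Fact (a < b)] {f f' : ℝ → ℝ} {M : ℝ}

lemma heat_unique {s t : ℝ} {G : ℝ → HS a b → ℝ} {γ : ℝ → ℝ} {z₁ z₂ : ℝ → HS a b}
    (H : Force s t G γ) (c₁ : CurV s t z₁) (c₂ : CurV s t z₂) (h₁ : HeatEq s t G z₁)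
    (h₂ : HeatEq s t G z₂) (h0 : z₁ s = z₂ s) : ∀ r ∈ Icc s t, z₁ r = z₂ r := fun r hr => by
  have H' := H.mono le_rfl hr.1 hr.2
  have c₁' := c₁.mono le_rfl hr.1 hr.2
  have c₂' := c₂.mono le_rfl hr.1 hr.2
  have h := HeatEq.sub hr.1 H' H' c₁' c₂' (h₁.mono H c₁ le_rfl hr.1 hr.2)
    (h₂.mono H c₂ le_rfl hr.1 hr.2)
  have e := (heat_energy hr.1 (H'.sub H') (c₁'.sub hr.1 c₂') h).2
  simp only [sub_self, h0, norm_zero, intervalIntegral.integral_zero] at e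
  have p : 0 ≤ ∫ q in s..r, ‖Dx (z₁ q - z₂ q)‖ ^ 2 :=
    intervalIntegral.integral_nonneg hr.1 fun _ _ => sq_nonneg _
  have : ‖z₁ r - z₂ r‖ ^ 2 ≤ 0 := by
    have e0 : (0 : ℝ) ^ 2 + 2 * 0 = 0 := by norm_num
    rw [e0] at e; linarith
  have : ‖z₁ r - z₂ r‖ = 0 := by nlinarith [norm_nonneg (z₁ r - z₂ r)]
  exact sub_eq_zero.1 (norm_eq_zero.1 this)

lemma wave_unique {s t : ℝ} {F v₁ w₁ v₂ w₂ : ℝ → HS a b}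
    (H : WForce s t F) (h₁ : WaveEq s t F v₁ w₁) (h₂ : WaveEq s t F v₂ w₂) (hv : v₁ s = v₂ s)
    (hw : w₁ s = w₂ s) : ∀ r ∈ Icc s t, v₁ r = v₂ r ∧ w₁ r = w₂ r := fun r hr => by
  have H' := H.mono le_rfl hr.1 hr.2
  have h := WaveEq.sub hr.1 H' H' (h₁.mono H le_rfl hr.1 hr.2) (h₂.mono H le_rfl hr.1 hr.2)
  have e := (wave_energy hr.1 (H'.sub H') h).2
  simp only [sub_self, hv, hw, norm_zero, inner_zero_right, intervalIntegral.integral_zero] at e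
  have e0 : (0 : ℝ) ^ 2 + 0 ^ 2 - 2 * 0 = 0 := by norm_num
  rw [e0] at e
  have e1 : ‖v₁ r - v₂ r‖ = 0 := by
    nlinarith [norm_nonneg (v₁ r - v₂ r), sq_nonneg ‖w₁ r - w₂ r‖]
  have e2 : ‖w₁ r - w₂ r‖ = 0 := by
    nlinarith [norm_nonneg (w₁ r - w₂ r), sq_nonneg ‖v₁ r - v₂ r‖]
  exact ⟨sub_eq_zero.1 (norm_eq_zero.1 e1), sub_eq_zero.1 (norm_eq_zero.1 e2)⟩

lemma iUnion_Ioc_eq {s t : ℝ} {u : ℕ → ℝ} (hu : ∀ n, u n ∈ Ioo s t)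
    (hl : Tendsto u atTop (𝓝 t)) : ⋃ n, Ioc s (u n) = Ioo s t := by
  ext x
  simp only [mem_iUnion]
  constructor
  · rintro ⟨n, h1, h2⟩; exact ⟨h1, h2.trans_lt (hu n).2⟩
  · rintro ⟨h1, h2⟩
    obtain ⟨n, hn⟩ := (hl.eventually (lt_mem_nhds h2)).exists
    exact ⟨n, h1, hn.le⟩

lemma ae_Ioc_exhaust {s t : ℝ} {u : ℕ → ℝ} (hu : ∀ n, u n ∈ Ioo s t)
    (hl : Tendsto u atTop (𝓝 t)) {P : ℝ → Prop}
    (h : ∀ n, ∀ᵐ r ∂volume.restrict (Ioc s (u n)), P r) : ∀ᵐ r ∂volume.restrict (Ioc s t), P r := by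
  rw [← restrict_Ioo_eq_restrict_Ioc, ← iUnion_Ioc_eq hu hl, ae_restrict_iUnion_iff]
  exact h

lemma aesm_Ioc_exhaust {s t : ℝ} {u : ℕ → ℝ} (hu : ∀ n, u n ∈ Ioo s t)
    (hl : Tendsto u atTop (𝓝 t)) {g : ℝ → ℝ}
    (h : ∀ n, AEStronglyMeasurable g (volume.restrict (Ioc s (u n)))) :
    AEStronglyMeasurable g (volume.restrict (Ioc s t)) := by
  rw [← restrict_Ioo_eq_restrict_Ioc, ← iUnion_Ioc_eq hu hl, aestronglyMeasurable_iUnion_iff]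
  exact h

lemma IsSol.congr {s t : ℝ} (hst : s ≤ t) {v w θ v' w' θ' : ℝ → HS a b} (H : IsSol f f' s t v w θ)
    (hv : ∀ r ∈ Icc s t, v r = v' r) (hw : ∀ r ∈ Icc s t, w r = w' r)
    (hθ : ∀ r ∈ Icc s t, θ r = θ' r) : IsSol f f' s t v' w' θ' := by
  have H' : Step f f' s t v' θ' v w θ := Step.congr H hv hθ
  have hs : ∀ r ∈ Icc s t, s ∈ Icc s t := fun r hr => left_mem_Icc.2 (hr.1.trans hr.2)
  have hq : ∀ r ∈ Icc s t, ∀ q ∈ uIcc s r, q ∈ Icc s t := fun r hr q h => by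
    rw [uIcc_of_le hr.1] at h; exact ⟨h.1, h.2.trans hr.2⟩
  refine ⟨⟨H'.wave.cv.congr fun r hr => (hv r hr).symm, H'.wave.cw.congr fun r hr => (hw r hr).symm,
    fun n r hr => ?_, fun n r hr => ?_, fun r hr => ?_⟩, ⟨H'.cur.cont.congr fun r hr =>
      (hθ r hr).symm, ?_, ?_⟩, fun n r hr => ?_⟩
  · rw [← hv r hr, ← hv s (hs r hr), H'.wave.eqv n r hr]
    congr 1
    refine intervalIntegral.integral_congr fun q h => ?_
    simp only [hw q (hq r hr q h)]
  · rw [← hw r hr, ← hw s (hs r hr), H'.wave.eqw n r hr]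
    congr 1
    refine intervalIntegral.integral_congr fun q h => ?_
    simp only [hv q (hq r hr q h)]
  · rw [← hw r hr, ← hw s (hs r hr), H'.wave.zero r hr]
  · filter_upwards [H'.cur.inV, ae_restrict_mem measurableSet_Ioc] with r h1 h2
    rw [← hθ r (Ioc_subset_Icc_self h2)]; exact h1
  · refine H'.cur.sq.congr fun r hr => ?_
    rw [uIoc_of_le hst] at hr
    simp only [hθ r (Ioc_subset_Icc_self hr)]
  · rw [← hθ r hr, ← hθ s (hs r hr), H'.heat n r hr]
    congr 1
    refine intervalIntegral.integral_congr fun q h => ?_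
    simp only [hθ q (hq r hr q h)]

lemma glue_mode {s m t : ℝ} {y h : ℝ → ℝ} (hm : m ∈ Icc s t)
    (i₁ : IntervalIntegrable h volume s m) (i₂ : IntervalIntegrable h volume m t)
    (h₁ : ∀ r ∈ Icc s m, y r = y s + ∫ q in s..r, h q)
    (h₂ : ∀ r ∈ Icc m t, y r = y m + ∫ q in m..r, h q) :
    ∀ r ∈ Icc s t, y r = y s + ∫ q in s..r, h q := fun r hr => by
  rcases le_total r m with h | h
  · exact h₁ r ⟨hr.1, h⟩
  · rw [h₂ r ⟨h, hr.2⟩, h₁ m ⟨hm.1, le_rfl⟩, ← intervalIntegral.integral_add_adjacent_intervals i₁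
      (i₂.mono_set (sub_Icc ⟨h, hr.2⟩)), add_assoc]

lemma IsSol.glue_same (G : C11 f f' M) {s m t : ℝ} (h1 : s ≤ m) (h2 : m ≤ t)
    {v w θ : ℝ → HS a b} (H₁ : IsSol f f' s m v w θ) (H₂ : IsSol f f' m t v w θ) :
    IsSol f f' s t v w θ := by
  have hm : m ∈ Icc s t := ⟨h1, h2⟩
  have hc : ∀ {x : ℝ → HS a b}, ContinuousOn x (Icc s m) → ContinuousOn x (Icc m t) →
      ContinuousOn x (Icc s t) := fun h h' => by
    rw [← Icc_union_Icc_eq_Icc h1 h2]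
    exact h.union_of_isClosed h' isClosed_Icc isClosed_Icc
  have F₁ := wforce_FN G H₁.cur
  have F₂ := wforce_FN G H₂.cur
  have G₁ := force_Gf G h1 H₁.wave.cv H₁.cur
  have G₂ := force_Gf G h2 H₂.wave.cv H₂.cur
  refine ⟨⟨hc H₁.wave.cv H₂.wave.cv, hc H₁.wave.cw H₂.wave.cw, fun n => ?_, fun n => ?_,
    fun r hr => ?_⟩, ⟨hc H₁.cur.cont H₂.cur.cont, ?_, H₁.cur.sq.trans H₂.cur.sq⟩, fun n => ?_⟩
  · exact glue_mode (y := fun r => ⟪sinH a b n, v r⟫_ℝ) hm (H₁.wave.int_v h1 F₁ n)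
      (H₂.wave.int_v h2 F₂ n) (H₁.wave.eqv n) (H₂.wave.eqv n)
  · exact glue_mode (y := fun r => ⟪cosH a b (n + 1), w r⟫_ℝ) hm (H₁.wave.int_w h1 n)
      (H₂.wave.int_w h2 n) (H₁.wave.eqw n) (H₂.wave.eqw n)
  · rcases le_total r m with h | h
    · exact H₁.wave.zero r ⟨hr.1, h⟩
    · rw [H₂.wave.zero r ⟨h, hr.2⟩, H₁.wave.zero m ⟨h1, le_rfl⟩]
  · rw [← Ioc_union_Ioc_eq_Ioc h1 h2, ae_restrict_union_iff]
    exact ⟨H₁.cur.inV, H₂.cur.inV⟩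
  · exact glue_mode (y := fun r => ⟪cosH a b n, θ r⟫_ℝ) hm
      (((continuousOn_const.inner (H₁.cur.cOn h1)).const_mul _).intervalIntegrable.add
        (G₁.int h1 n))
      (((continuousOn_const.inner (H₂.cur.cOn h2)).const_mul _).intervalIntegrable.add
        (G₂.int h2 n)) (H₁.heat n) (H₂.heat n)

lemma IsSol.glue (G : C11 f f' M) {s m t : ℝ} (h1 : s ≤ m) (h2 : m ≤ t)
    {v w θ v' w' θ' : ℝ → HS a b} (H₁ : IsSol f f' s m v w θ) (H₂ : IsSol f f' m t v' w' θ')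
    (ev : v m = v' m) (ew : w m = w' m) (eθ : θ m = θ' m) :
    IsSol f f' s t (fun r => if r ≤ m then v r else v' r) (fun r => if r ≤ m then w r else w' r)
      (fun r => if r ≤ m then θ r else θ' r) := by
  have key : ∀ {x x' : ℝ → HS a b}, x m = x' m → ∀ r ∈ Icc m t,
      x' r = if r ≤ m then x r else x' r := fun e r hr => by
    split_ifs with h
    · rw [le_antisymm h hr.1, e]
    · rfl
  exact IsSol.glue_same G h1 h2
    (H₁.congr h1 (fun r hr => (if_pos hr.2).symm) (fun r hr => (if_pos hr.2).symm)
      (fun r hr => (if_pos hr.2).symm))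
    (H₂.congr h2 (key ev) (key ew) (key eθ))

/-- A bounded solution on a half-open interval extends to the end point. -/
lemma extend_closed (G : C11 f f' M) {s t B : ℝ} (hst : s < t) (hl : t - s ≤ 1 / 2)
    {v w θ : ℝ → HS a b} (H : ∀ r ∈ Ico s t, IsSol f f' s r v w θ)
    (hv : ∀ r ∈ Ico s t, ‖v r‖ ≤ B) (hθ : ∀ r ∈ Ico s t, ‖θ r‖ ≤ B)
    (hJ : ∀ r ∈ Ico s t, ∫ q in Ioc s r, ‖Dx (θ q)‖ ^ 2 ≤ B) :
    ∃ V W Z : ℝ → HS a b, IsSol f f' s t V W Z ∧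
      ∀ r ∈ Ico s t, V r = v r ∧ W r = w r ∧ Z r = θ r := by
  obtain ⟨u, -, hu, hul⟩ := exists_seq_strictMono_tendsto' hst
  have hu' : ∀ n, u n ∈ Ico s t := fun n => ⟨(hu n).1.le, (hu n).2⟩
  have hB : 0 ≤ B := (norm_nonneg _).trans (hv s ⟨le_rfl, hst⟩)
  have hD : IntegrableOn (fun q => ‖Dx (θ q)‖ ^ 2) (Ioc s t) := by
    refine integrableOn_Ioc_of_intervalIntegral_norm_bounded_right (I := B)
      (fun n => (H _ (hu' n)).cur.iD2 (hu' n).1) hul (Eventually.of_forall fun n => ?_)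
    simpa using hJ _ (hu' n)
  have hFn := fun n => force_Gf G (hu' n).1 (H _ (hu' n)).wave.cv (H _ (hu' n)).cur
  have hIoc : ∀ᵐ r ∂volume.restrict (Ioc s t), r ∈ Ico s t :=
    ae_Ioc_exhaust hu hul fun n => (ae_restrict_mem measurableSet_Ioc).mono fun r hr =>
      ⟨hr.1.le, hr.2.trans_lt (hu n).2⟩
  have hWF : WForce s t (fun r => FN f' (θ r)) := by
    refine ⟨fun n => aesm_Ioc_exhaust hu hul fun k => (wforce_FN G (H _ (hu' k)).cur).meas n,
      fun r => M * ‖Dx (θ r)‖, ?_, Eventually.of_forall fun r => norm_FN_le G _⟩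
    rw [intervalIntegrable_iff_integrableOn_Ioc_of_le hst.le]
    simp only [mul_pow]
    exact hD.const_mul (M ^ 2)
  have hF : Force s t (fun r => Gf f f' (v r) (θ r))
      (fun r => 2 * M * C1 a b * ‖v r‖ * (‖θ r‖ + ‖Dx (θ r)‖)) := by
    refine ⟨ae_Ioc_exhaust hu hul fun n => (hFn n).lin, ?_,
      fun n => aesm_Ioc_exhaust hu hul fun k => (hFn k).meas n⟩
    rw [intervalIntegrable_iff_integrableOn_Ioc_of_le hst.le]
    have hi : IntegrableOn (fun r => (2 * M * C1 a b * B) ^ 2 * (2 * B ^ 2 + 2 * ‖Dx (θ r)‖ ^ 2))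
        (Ioc s t) := ((integrable_one_Ioc s t (2 * B ^ 2)).add (hD.const_mul 2)).const_mul _
    refine hi.mono' (aesm_Ioc_exhaust hu hul fun n =>
      ((intervalIntegrable_iff_integrableOn_Ioc_of_le (hu' n).1).1
          (hFn n).sq).aestronglyMeasurable) ?_
    filter_upwards [hIoc] with r hr
    have h1 := hv r hr
    have h2 := hθ r hr
    have hM := G.M_nonneg
    have hC := C1_pos (a := a) (b := b)
    rw [norm_pow, norm_mul, mul_pow]
    refine mul_le_mul ?_ ?_ (by positivity) (by positivity)
    · rw [Real.norm_of_nonneg (by positivity)]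
      gcongr
    · rw [Real.norm_of_nonneg (by positivity)]
      have : (‖θ r‖ + ‖Dx (θ r)‖) ^ 2 ≤ (B + ‖Dx (θ r)‖) ^ 2 := by gcongr
      nlinarith [sq_nonneg (B - ‖Dx (θ r)‖)]
  obtain ⟨V, W, hV0, hW0, hVW⟩ := wave_solve hst.le hl hWF (v s) (w s)
  obtain ⟨Z, hZ0, cZ, hZ⟩ := heat_solve hst.le hl hF (θ s)
  have agree : ∀ r ∈ Ico s t, V r = v r ∧ W r = w r ∧ Z r = θ r := fun r hr => by
    have hr' := right_mem_Icc.2 hr.1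
    obtain ⟨e1, e2⟩ := wave_unique (hWF.mono le_rfl hr.1 hr.2.le) (hVW.mono hWF le_rfl hr.1 hr.2.le)
      (H r hr).wave hV0 hW0 r hr'
    exact ⟨e1, e2, heat_unique (hF.mono le_rfl hr.1 hr.2.le) (cZ.mono le_rfl hr.1 hr.2.le)
      (H r hr).cur (hZ.mono hF cZ le_rfl hr.1 hr.2.le) (H r hr).heat hZ0 r hr'⟩
  refine ⟨V, W, Z, ⟨⟨hVW.cv, hVW.cw, fun n r hr => ?_, hVW.eqw, hVW.zero⟩, cZ, fun n r hr => ?_⟩,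
    agree⟩
  · rw [hVW.eqv n r hr]
    congr 1
    refine intervalIntegral.integral_congr_Ioo_of_le hr.1 fun q hq => ?_
    simp only [(agree q ⟨hq.1.le, hq.2.trans_le hr.2⟩).2.2]
  · rw [hZ n r hr]
    congr 1
    refine intervalIntegral.integral_congr_Ioo_of_le hr.1 fun q hq => ?_
    obtain ⟨e1, -, e2⟩ := agree q ⟨hq.1.le, hq.2.trans_le hr.2⟩
    simp only [e1, e2]

lemma IsSol.point (v0 w0 θ0 : HS a b) (s : ℝ) :
    IsSol f f' s s (fun _ => v0) (fun _ => w0) (fun _ => θ0) := by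
  have hz : ∀ r ∈ Icc s s, r = s := fun r hr => le_antisymm hr.2 hr.1
  refine ⟨⟨continuousOn_const, continuousOn_const, fun n r hr => ?_, fun n r hr => ?_,
    fun r hr => rfl⟩, ⟨continuousOn_const, by simp, by simp⟩, fun n r hr => ?_⟩ <;>
  · obtain rfl := hz r hr
    simp

theorem global_exists (G : C11 f f' M) (v0 w0 θ0 : HS a b)
    (hB : ∀ T, 0 ≤ T → ∃ B, ∀ t ∈ Icc 0 T, ∀ v w θ : ℝ → HS a b, v 0 = v0 → w 0 = w0 → θ 0 = θ0 →
      IsSol f f' 0 t v w θ → ‖v t‖ ≤ B ∧ ‖θ t‖ ≤ B ∧ ∫ q in Ioc 0 t, ‖Dx (θ q)‖ ^ 2 ≤ B) :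
    ∃ v w θ : ℝ → HS a b, v 0 = v0 ∧ w 0 = w0 ∧ θ 0 = θ0 ∧
      ∀ T, 0 ≤ T → IsSol f f' 0 T v w θ := by
  let S : ℝ → Prop := fun t => ∃ v w θ : ℝ → HS a b, v 0 = v0 ∧ w 0 = w0 ∧ θ 0 = θ0 ∧
    IsSol f f' 0 t v w θ
  have amalg : ∀ I : Set ℝ, (∀ r ∈ I, 0 ≤ r ∧ S r) → (∀ r ∈ I, ∀ q, 0 ≤ q → q ≤ r → q ∈ I) →
      0 ∈ I → ∃ v w θ : ℝ → HS a b, v 0 = v0 ∧ w 0 = w0 ∧ θ 0 = θ0 ∧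
        ∀ r ∈ I, IsSol f f' 0 r v w θ := fun I hI hd h0 => by
    choose! v w θ hv hw hθ hs using fun r hr => (hI r hr).2
    refine ⟨fun r => v r r, fun r => w r r, fun r => θ r r, hv 0 h0, hw 0 h0, hθ 0 h0,
      fun r hr => ?_⟩
    have key : ∀ q ∈ Icc 0 r, v r q = v q q ∧ w r q = w q q ∧ θ r q = θ q q := fun q hq => by
      have hqI := hd r hr q hq.1 hq.2
      exact unique_sol G ((hs r hr).mono G le_rfl hq.1 hq.2) (hs q hqI) ((hv r hr).trans
        (hv q hqI).symm) ((hw r hr).trans (hw q hqI).symm) ((hθ r hr).trans (hθ q hqI).symm) q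
        (right_mem_Icc.2 hq.1)
    exact (hs r hr).congr (hI r hr).1 (fun q hq => (key q hq).1) (fun q hq => (key q hq).2.1)
      (fun q hq => (key q hq).2.2)
  suffices hS : ∀ T, 0 ≤ T → S T from by
    obtain ⟨v, w, θ, h1, h2, h3, h4⟩ := amalg (Ici 0) (fun r hr => ⟨hr, hS r hr⟩)
      (fun r _ q hq _ => hq) (mem_Ici.2 le_rfl)
    exact ⟨v, w, θ, h1, h2, h3, h4⟩
  intro T hT
  have hmono : ∀ r q, 0 ≤ q → q ≤ r → S r → S q := by
    rintro r q h1 h2 ⟨v, w, θ, e1, e2, e3, H⟩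
    exact ⟨v, w, θ, e1, e2, e3, H.mono G le_rfl h1 h2⟩
  set A : Set ℝ := {t | t ∈ Icc 0 T ∧ S t} with hA
  have hA0 : (0 : ℝ) ∈ A := ⟨⟨le_rfl, hT⟩, _, _, _, rfl, rfl, rfl, IsSol.point v0 w0 θ0 0⟩
  have hbd : BddAbove A := ⟨T, fun t ht => ht.1.2⟩
  set τ := sSup A
  have hτ0 : 0 ≤ τ := le_csSup hbd hA0
  have hτT : τ ≤ T := csSup_le ⟨0, hA0⟩ fun t ht => ht.1.2
  have hlt : ∀ r, 0 ≤ r → r < τ → S r := fun r h1 h2 => by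
    obtain ⟨q, hq, h3⟩ := exists_lt_of_lt_csSup ⟨0, hA0⟩ h2
    exact hmono q r h1 h3.le hq.2
  have hτS : S τ := by
    rcases hτ0.eq_or_lt with h | hpos
    · rw [← h]; exact hA0.2
    obtain ⟨v, w, θ, e1, e2, e3, H⟩ := amalg (Ico 0 τ) (fun r hr => ⟨hr.1, hlt r hr.1 hr.2⟩)
      (fun r hr q h1 h2 => ⟨h1, h2.trans_lt hr.2⟩) ⟨le_rfl, hpos⟩
    obtain ⟨B, hB⟩ := hB T hT
    set m := max 0 (τ - 1 / 2)
    have hm0 : 0 ≤ m := le_max_left _ _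
    have hmτ : m < τ := max_lt hpos (by linarith)
    have hm2 : τ - m ≤ 1 / 2 := by linarith [le_max_right 0 (τ - 1 / 2)]
    have hbb := fun r (hr : r ∈ Ico m τ) => hB r ⟨hm0.trans hr.1, hr.2.le.trans hτT⟩ v w θ e1 e2 e3
      (H r ⟨hm0.trans hr.1, hr.2⟩)
    obtain ⟨V, W, Z, H', e⟩ := extend_closed G hmτ hm2 (v := v) (w := w) (θ := θ) (B := B)
      (fun r hr => (H r ⟨hm0.trans hr.1, hr.2⟩).mono G hm0 hr.1 le_rfl)
      (fun r hr => (hbb r hr).1) (fun r hr => (hbb r hr).2.1) (fun r hr => by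
        refine (setIntegral_mono_set ((H r ⟨hm0.trans hr.1, hr.2⟩).cur.iD2 (hm0.trans hr.1))
          (Eventually.of_forall fun _ => sq_nonneg _)
          (Eventually.of_forall (Ioc_subset_Ioc_left hm0))).trans (hbb r hr).2.2)
    obtain ⟨f1, f2, f3⟩ := e m ⟨le_rfl, hmτ⟩
    exact ⟨_, _, _, (if_pos hm0).trans e1, (if_pos hm0).trans e2, (if_pos hm0).trans e3,
      IsSol.glue G hm0 hmτ.le (H m ⟨hm0, hmτ⟩) H' f1.symm f2.symm f3.symm⟩
  rcases hτT.eq_or_lt with h | h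
  · rw [← h]; exact hτS
  exfalso
  obtain ⟨v, w, θ, e1, e2, e3, H⟩ := hτS
  obtain ⟨t, ht, V, W, Z, f1, f2, f3, H'⟩ := local_exists G τ (v τ) (w τ) (θ τ)
  have hg := IsSol.glue G hτ0 ht.le H H' f1.symm f2.symm f3.symm
  have : min t T ∈ A := ⟨⟨le_min (hτ0.trans ht.le) hT, min_le_right _ _⟩,
    hmono t _ (le_min (hτ0.trans ht.le) hT) (min_le_left _ _)
      ⟨_, _, _, (if_pos hτ0).trans e1, (if_pos hτ0).trans e2, (if_pos hτ0).trans e3, hg⟩⟩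
  exact absurd (le_csSup hbd this) (not_le.2 (lt_min ht h))

end

section

/-- Linear extension of the nonlinearity to negative arguments. -/
def fe (f f' : ℝ → ℝ) (y : ℝ) : ℝ := if 0 ≤ y then f y else f' 0 * y

/-- Derivative of `fe`. -/
def fe' (f' : ℝ → ℝ) (y : ℝ) : ℝ := f' (max y 0)

lemma fe_of_nonneg {f f' : ℝ → ℝ} {y : ℝ} (hy : 0 ≤ y) : fe f f' y = f y := if_pos hy

lemma fe'_of_nonneg {f' : ℝ → ℝ} {y : ℝ} (hy : 0 ≤ y) : fe' f' y = f' y := by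
  rw [fe', max_eq_left hy]

lemma hypF_C11 {f f' f'' : ℝ → ℝ} (hf : HypF f f' f'') : ∃ M, C11 (fe f f') (fe' f') M := by
  obtain ⟨M, hM⟩ := hf.bdd
  refine ⟨M, by rw [fe_of_nonneg le_rfl, hf.zero], fun x => ?_, fun x =>
      (hM _ (mem_Ici.2 (le_max_right _ _))).1,
    fun x y => ?_⟩
  · have hlin : ∀ x, HasDerivAt (fun y => f' 0 * y) (f' 0) x := fun x => by
      simpa using (hasDerivAt_id x).const_mul (f' 0)
    rcases lt_trichotomy x 0 with h | h | h
    · have : fe' f' x = f' 0 := by rw [fe', max_eq_right h.le]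
      rw [this]
      refine (hlin x).congr_of_eventuallyEq ?_
      filter_upwards [Iio_mem_nhds h] with y hy
      exact if_neg (not_le.2 hy)
    · subst h
      rw [fe'_of_nonneg le_rfl]
      have h1 : HasDerivWithinAt (fe f f') (f' 0) (Ici 0) 0 :=
        (hf.hasDeriv₁ 0 self_mem_Ici).congr (fun y hy => fe_of_nonneg hy) (fe_of_nonneg le_rfl)
      have h2 : HasDerivWithinAt (fe f f') (f' 0) (Iic 0) 0 := by
        refine (hlin 0).hasDerivWithinAt.congr (fun y hy => ?_) ?_
        · rcases eq_or_lt_of_le (mem_Iic.1 hy) with h | h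
          · rw [h, fe_of_nonneg le_rfl, hf.zero, mul_zero]
          · exact if_neg (not_le.2 h)
        · rw [fe_of_nonneg le_rfl, hf.zero, mul_zero]
      have := h1.union h2
      rwa [Ici_union_Iic, hasDerivWithinAt_univ] at this
    · rw [fe'_of_nonneg h.le]
      refine ((hf.hasDeriv₁ x h.le).hasDerivAt (Ici_mem_nhds h)).congr_of_eventuallyEq ?_
      filter_upwards [Ioi_mem_nhds h] with y hy
      exact fe_of_nonneg (le_of_lt hy)
  · have h1 := (convex_Ici (0 : ℝ)).norm_image_sub_le_of_norm_hasDerivWithin_le hf.hasDeriv₂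
      (fun z hz => (hM z hz).2) (mem_Ici.2 (le_max_right y 0)) (mem_Ici.2 (le_max_right x 0))
    have hM0 : 0 ≤ M := (abs_nonneg _).trans (hM 0 self_mem_Ici).1
    exact h1.trans (mul_le_mul_of_nonneg_left (abs_max_sub_max_le_abs x y 0) hM0)

lemma hasDerivAt_min {g g' : ℝ → ℝ} (h : ∀ y, HasDerivAt g (g' y) y) (h0 : g' 0 = 0) (y : ℝ) :
    HasDerivAt (fun y => g (min y 0)) (g' (min y 0)) y := by
  have hl : ∀ y ≤ 0, HasDerivWithinAt (fun y => g (min y 0)) (g' (min y 0)) (Iic 0) y :=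
    fun y hy => by
      rw [min_eq_left hy]
      exact (h y).hasDerivWithinAt.congr (fun z hz => by rw [min_eq_left (mem_Iic.1 hz)])
        (by rw [min_eq_left hy])
  have hr : ∀ y, 0 ≤ y → HasDerivWithinAt (fun y => g (min y 0)) (g' (min y 0)) (Ici 0) y :=
    fun y hy => by
      rw [min_eq_right hy, h0]
      exact (hasDerivWithinAt_const y _ (g 0)).congr
        (fun z hz => by rw [min_eq_right (mem_Ici.1 hz)]) (by rw [min_eq_right hy])
  rcases lt_trichotomy y 0 with hy | hy | hy
  · exact (hl y hy.le).hasDerivAt (Iic_mem_nhds hy)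
  · subst hy
    have := (hl 0 le_rfl).union (hr 0 le_rfl)
    rwa [Iic_union_Ici, hasDerivWithinAt_univ] at this
  · exact (hr y hy.le).hasDerivAt (Ici_mem_nhds hy)

/-- The positive root `√(1+y²)`. -/
def sq1 (y : ℝ) : ℝ := Real.sqrt (1 + y ^ 2)

lemma sq1_sq (y : ℝ) : sq1 y ^ 2 = 1 + y ^ 2 := Real.sq_sqrt (by positivity)

lemma one_le_sq1 (y : ℝ) : 1 ≤ sq1 y := Real.one_le_sqrt.2 (by nlinarith [sq_nonneg y])

lemma sq1_pos (y : ℝ) : 0 < sq1 y := lt_of_lt_of_le one_pos (one_le_sq1 y)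

lemma hasDerivAt_sq1 (y : ℝ) : HasDerivAt sq1 (y / sq1 y) y := by
  have h0 : HasDerivAt (fun y : ℝ => 1 + y ^ 2) (2 * y) y := by
    simpa using (hasDerivAt_pow 2 y).const_add 1
  refine (h0.sqrt (by positivity)).congr_deriv ?_
  change _ / (2 * sq1 y) = _
  have := (sq1_pos y).ne'
  field_simp

lemma abs_div_sq1_le (y : ℝ) : |y / sq1 y| ≤ 1 := by
  rw [abs_div, abs_of_pos (sq1_pos y), div_le_one (sq1_pos y)]
  exact abs_le_of_sq_le_sq (by rw [sq1_sq]; linarith) (sq1_pos y).le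

lemma hasDerivAt_div_sq1 (y : ℝ) : HasDerivAt (fun y => y / sq1 y) (1 / sq1 y ^ 3) y := by
  have h := (hasDerivAt_id y).div (hasDerivAt_sq1 y) (sq1_pos y).ne'
  refine h.congr_deriv ?_
  have h1 := (sq1_pos y).ne'
  have h2 := sq1_sq y
  simp only [id]
  field_simp
  linear_combination h2

lemma hasDerivAt_inv_sq1 (y : ℝ) :
    HasDerivAt (fun y => 2 * (1 - 1 / sq1 y ^ 3)) (6 * (y / sq1 y) * (1 / sq1 y ^ 4)) y := by
  have h1 := (sq1_pos y).ne'
  have h := ((((hasDerivAt_sq1 y).pow 3).inv (pow_ne_zero 3 h1)).const_sub 1).const_mul 2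
  have h' : HasDerivAt (fun y => 2 * (1 - 1 / sq1 y ^ 3)) _ y :=
    h.congr_of_eventuallyEq (Eventually.of_forall fun z => by simp)
  refine h'.congr_deriv ?_
  simp only [Pi.pow_apply]
  field_simp
  norm_num
  ring

/-- Smooth convex penalty vanishing exactly on `[0,∞)`. -/
def qm (y : ℝ) : ℝ := sq1 (min y 0) - 1
/-- Derivative of `qm`. -/
def qm' (y : ℝ) : ℝ := min y 0 / sq1 (min y 0)
/-- Derivative of `qm²`. -/
def gm (y : ℝ) : ℝ := 2 * (min y 0 - min y 0 / sq1 (min y 0))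
/-- Second derivative of `qm²`. -/
def gm' (y : ℝ) : ℝ := 2 * (1 - 1 / sq1 (min y 0) ^ 3)

lemma lip_min {h h' : ℝ → ℝ} {K : ℝ} (H : ∀ y, HasDerivAt h (h' y) y) (hK : ∀ y, |h' y| ≤ K)
    (x y : ℝ) : |h (min x 0) - h (min y 0)| ≤ K * |x - y| := by
  have h1 := convex_univ.norm_image_sub_le_of_norm_hasDerivWithin_le
    (fun z _ => (H z).hasDerivWithinAt) (fun z _ => hK z) (mem_univ (min y 0)) (mem_univ (min x 0))
  exact h1.trans (mul_le_mul_of_nonneg_left (abs_min_sub_min_le_max' x y)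
    ((abs_nonneg _).trans (hK 0)))
where
  abs_min_sub_min_le_max' (x y : ℝ) : ‖min x 0 - min y 0‖ ≤ |x - y| := by
    simpa using abs_min_sub_min_le_max x 0 y 0

lemma sq1_zero : sq1 0 = 1 := by simp [sq1]

lemma c11_qm : C11 qm qm' 1 where
  zero := by simp [qm, sq1_zero]
  deriv y := hasDerivAt_min (g := fun y => sq1 y - 1) (g' := fun y => y / sq1 y)
    (fun y => (hasDerivAt_sq1 y).sub_const 1) (by simp) y
  bdd y := abs_div_sq1_le _
  lip x y := lip_min hasDerivAt_div_sq1 (fun y => by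
    have := one_le_pow₀ (one_le_sq1 y) (n := 3)
    rw [abs_of_nonneg (by positivity), div_le_one (by positivity)]; exact this) x y

lemma c11_gm : C11 gm gm' 6 where
  zero := by simp [gm]
  deriv y := hasDerivAt_min (g := fun y => 2 * (y - y / sq1 y))
    (g' := fun y => 2 * (1 - 1 / sq1 y ^ 3))
    (fun y => ((hasDerivAt_id y).sub (hasDerivAt_div_sq1 y)).const_mul 2) (by simp [sq1_zero]) y
  bdd y := by
    have := one_le_pow₀ (one_le_sq1 (min y 0)) (n := 3)
    have h1 : 1 / sq1 (min y 0) ^ 3 ≤ 1 := by rw [div_le_one (by positivity)]; exact this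
    have h2 : 0 < 1 / sq1 (min y 0) ^ 3 := by positivity
    rw [gm', abs_le]; constructor <;> linarith
  lip x y := lip_min hasDerivAt_inv_sq1 (fun y => by
    have := one_le_pow₀ (one_le_sq1 y) (n := 4)
    have h1 : 1 / sq1 y ^ 4 ≤ 1 := by rw [div_le_one (by positivity)]; exact this
    have h2 : 0 < 1 / sq1 y ^ 4 := by positivity
    rw [abs_mul, abs_mul, abs_of_pos h2, abs_of_pos (by norm_num : (0:ℝ) < 6)]
    have := abs_div_sq1_le y
    nlinarith [abs_nonneg (y / sq1 y)]) x y

lemma hasDerivAt_qm_sq (y : ℝ) : HasDerivAt (fun y => qm y ^ 2) (gm y) y := by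
  refine ((c11_qm.deriv y).pow 2).congr_deriv ?_
  have := (sq1_pos (min y 0)).ne'
  simp only [qm, qm', gm]
  field_simp
  norm_num
  ring

lemma qm_nonneg (y : ℝ) : 0 ≤ qm y := sub_nonneg.2 (one_le_sq1 _)

lemma qm_of_nonneg {y : ℝ} (h : 0 ≤ y) : qm y = 0 := by simp [qm, min_eq_right h, sq1_zero]

lemma nonneg_of_qm {y : ℝ} (h : qm y = 0) : 0 ≤ y := by
  by_contra! hy
  have h1 := sq1_sq (min y 0)
  have h2 : sq1 (min y 0) = 1 := by rw [qm] at h; linarith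
  rw [h2, min_eq_left hy.le] at h1
  nlinarith

lemma gm'_ge (y : ℝ) : 2 * qm' y ^ 2 ≤ gm' y := by
  set m := min y 0 with hm
  have h1 := one_le_sq1 m
  have h0 := sq1_pos m
  have h2 := sq1_sq m
  have e : qm' y ^ 2 = 1 - 1 / sq1 m ^ 2 := by
    rw [qm', ← hm, div_pow]; field_simp; linarith
  rw [e, gm', ← hm]
  have : 1 / sq1 m ^ 3 ≤ 1 / sq1 m ^ 2 :=
    one_div_le_one_div_of_le (by positivity) (pow_le_pow_right₀ h1 (by norm_num))
  linarith

lemma cross_bound {f f' : ℝ → ℝ} {M : ℝ} (hM : |f' 0| ≤ M) (y : ℝ) :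
    |fe' f' y * gm y + gm' y * fe f f' y| ≤ 8 * M * (|qm' y| * qm y) := by
  rcases le_or_gt 0 y with hy | hy
  · have h1 : gm y = 0 := by simp [gm, min_eq_right hy]
    have h2 : gm' y = 0 := by simp [gm', min_eq_right hy, sq1_zero]
    rw [h1, h2]
    have := (abs_nonneg _).trans hM
    have := qm_nonneg y
    simp only [mul_zero, zero_mul, add_zero, abs_zero]
    positivity
  · have e1 : fe' f' y = f' 0 := by rw [fe', max_eq_right hy.le]
    have e2 : fe f f' y = f' 0 * y := if_neg (not_le.2 hy)
    have h0 := sq1_pos y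
    have h1 := one_le_sq1 y
    have h2 := sq1_sq y
    have e : fe' f' y * gm y + gm' y * fe f f' y
        = f' 0 * (qm' y * qm y * (2 + 2 * (1 + 1 / sq1 y + 1 / sq1 y ^ 2))) := by
      rw [e1, e2, gm, gm', qm, qm', min_eq_left hy.le]
      field_simp
      ring
    have hb1 : 1 / sq1 y ≤ 1 := by rw [div_le_one h0]; exact h1
    have hb2 : 1 / sq1 y ^ 2 ≤ 1 := by
      rw [div_le_one (by positivity)]; exact one_le_pow₀ h1
    have hp1 : 0 < 1 / sq1 y := by positivity
    have hp2 : 0 < 1 / sq1 y ^ 2 := by positivity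
    rw [e, abs_mul, abs_mul, abs_mul, abs_of_nonneg (qm_nonneg y),
      abs_of_pos (by linarith : 0 < 2 + 2 * (1 + 1 / sq1 y + 1 / sq1 y ^ 2))]
    have hq : 0 ≤ |qm' y| * qm y := mul_nonneg (abs_nonneg _) (qm_nonneg y)
    calc |f' 0| * (|qm' y| * qm y * (2 + 2 * (1 + 1 / sq1 y + 1 / sq1 y ^ 2)))
        ≤ M * (|qm' y| * qm y * 8) :=
          mul_le_mul hM (mul_le_mul_of_nonneg_left (by linarith) hq)
            (mul_nonneg hq (by linarith)) ((abs_nonneg _).trans hM)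
      _ = _ := by ring

lemma taylor_bound {P g g' : ℝ → ℝ} {M : ℝ} (G : C11 g g' M) (H : ∀ y, HasDerivAt P (g y) y)
    (x y : ℝ) : |P x - P y - g y * (x - y)| ≤ M * (x - y) ^ 2 := by
  have h1 := (convex_uIcc y x).norm_image_sub_le_of_norm_hasDerivWithin_le
    (f := fun z => P z - g y * z) (f' := fun z => g z - g y) (C := M * |x - y|)
    (fun z _ => ((H z).sub (by simpa using (hasDerivAt_id z).const_mul (g y))).hasDerivWithinAt)
    (fun z hz => (G.abs_sub_le z y).trans
      (mul_le_mul_of_nonneg_left (abs_sub_left_of_mem_uIcc hz) G.M_nonneg))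
    left_mem_uIcc right_mem_uIcc
  rw [Real.norm_eq_abs, Real.norm_eq_abs, mul_assoc, ← sq, sq_abs] at h1
  refine le_trans (le_of_eq ?_) h1
  congr 1; ring

section
variable {a b : ℝ} [hab : Fact (a < b)] {f f' g g' : ℝ → ℝ} {M : ℝ}

lemma hasFDerivAt_sq_nem {q q' : ℝ → ℝ} {N : ℝ} (Q : C11 q q' N) (G : C11 g g' M)
    (H : ∀ y, HasDerivAt (fun y => q y ^ 2) (g y) y) (h : HS a b) :
    HasFDerivAt (fun h : HS a b => ‖nem q h‖ ^ 2) (innerSL ℝ (nem g h)) h := by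
  have e : ∀ k : HS a b, ‖nem q k‖ ^ 2 = ∫ x, q (k x) ^ 2 ∂mu a b := fun k => by
    rw [norm_sq_HS]
    exact integral_congr_ae ((coeFn_nem Q k).mono fun x hx => by simp only [hx])
  have i : ∀ k : HS a b, Integrable (fun x => q (k x) ^ 2) (mu a b) := fun k =>
    (memLp_nem Q k).integrable_sq
  have key : ∀ k : HS a b, ‖‖nem q k‖ ^ 2 - ‖nem q h‖ ^ 2 - innerSL ℝ (nem g h) (k - h)‖
      ≤ M * ‖‖k - h‖ ^ 2‖ := fun k => by
    have e1 : innerSL ℝ (nem g h) (k - h) = ∫ x, nem g h x * (k - h : HS a b) x ∂mu a b := by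
      rw [innerSL_apply_apply, inner_HS]
    have hi : Integrable (fun x => q (k x) ^ 2 - q (h x) ^ 2) (mu a b) := (i k).sub (i h)
    rw [e1, e, e, ← integral_sub (i k) (i h),
      ← integral_sub hi
        (integrable_mul_HS (nem g h) (k - h)), Real.norm_of_nonneg
            (sq_nonneg ‖k - h‖), norm_sq_HS, ← integral_const_mul]
    refine norm_integral_le_of_norm_le ((Lp.memLp (k - h)).integrable_sq.const_mul M) ?_
    filter_upwards [coeFn_nem G h, Lp.coeFn_sub k h] with x h1 h2
    rw [h1, h2]
    exact taylor_bound G H (k x) (h x)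
  have hO := (Asymptotics.IsBigO.of_bound M (Eventually.of_forall key) :
    (fun k : HS a b => ‖nem q k‖ ^ 2 - ‖nem q h‖ ^ 2 - innerSL ℝ (nem g h) (k - h))
      =O[𝓝 h] fun k => ‖k - h‖ ^ 2)
  have h2 : (fun k : HS a b => ‖k - h‖ ^ 2) =o[𝓝 h] fun k => k - h :=
    (Asymptotics.isLittleO_pow_sub_sub h one_lt_two)
  exact HasFDerivAt.of_isLittleO (hO.trans_isLittleO h2)

/-- Absorption of a product into the Dirichlet energy. -/
lemma young_Sb {P : ℝ} (hP : 0 ≤ P) : ∃ K, 0 ≤ K ∧ ∀ h : HS a b,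
    P * (‖Dx h‖ * Sb h) ≤ 1 / 2 * ‖Dx h‖ ^ 2 + K * ‖h‖ ^ 2 := by
  have hη : (0 : ℝ) < 1 / (4 * (P + 1)) := by positivity
  set L := C0 a b / (1 / (4 * (P + 1))) + C0 a b + 1 with hL
  refine ⟨(P * L) ^ 2, sq_nonneg _, fun h => ?_⟩
  have h1 := Sb_le_add hη h
  rw [← hL] at h1
  have h2 : 0 ≤ ‖Dx h‖ := norm_nonneg _
  have h3 : P * (‖Dx h‖ * Sb h) ≤ P * (‖Dx h‖ * (1 / (4 * (P + 1)) * ‖Dx h‖ + L * ‖h‖)) :=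
    mul_le_mul_of_nonneg_left (mul_le_mul_of_nonneg_left h1 h2) hP
  have h4 : P * (1 / (4 * (P + 1))) ≤ 1 / 4 := by
    rw [mul_one_div, div_le_div_iff₀ (by positivity) (by norm_num)]; linarith
  have h5 : P * (‖Dx h‖ * (1 / (4 * (P + 1)) * ‖Dx h‖ + L * ‖h‖))
      = P * (1 / (4 * (P + 1))) * ‖Dx h‖ ^ 2 + (P * L * ‖h‖) * ‖Dx h‖ := by ring
  nlinarith [mul_le_mul_of_nonneg_right h4 (sq_nonneg ‖Dx h‖),
    sq_nonneg (‖Dx h‖ / 2 - P * L * ‖h‖)]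

lemma gronwall_int {s T A K : ℝ} {y : ℝ → ℝ} (hK : 0 ≤ K) (hy : ContinuousOn y (Icc s T))
    (h : ∀ r ∈ Icc s T, y r ≤ A + K * ∫ q in s..r, y q) :
    ∀ r ∈ Icc s T, y r ≤ A * Real.exp (K * (r - s)) := fun r hr => by
  have hsT : s ≤ T := hr.1.trans hr.2
  set Y : ℝ → ℝ := fun r => A + K * ∫ q in s..r, y q with hY
  have hint : IntervalIntegrable y volume s T :=
    ContinuousOn.intervalIntegrable (by rwa [uIcc_of_le hsT])
  have hYc : ContinuousOn Y (Icc s T) := by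
    have := intervalIntegral.continuousOn_primitive_interval' hint left_mem_uIcc
    rw [uIcc_of_le hsT] at this
    exact continuousOn_const.add (continuousOn_const.mul this)
  have hd : ∀ x ∈ Ico s T, HasDerivWithinAt Y (K * y x) (Ici x) x := fun x hx => by
    have hx' : Icc s T ∈ 𝓝[>] x := by
      refine mem_of_superset (Ioc_mem_nhdsGT hx.2) fun z hz => ⟨hx.1.trans hz.1.le, hz.2⟩
    have hc : ContinuousWithinAt y (Ioi x) x :=
      (hy x ⟨hx.1, hx.2.le⟩).mono_of_mem_nhdsWithin hx'
    have hm : StronglyMeasurableAtFilter y (𝓝[>] x) :=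
      ⟨Icc s T, hx', hy.aestronglyMeasurable measurableSet_Icc⟩
    have := intervalIntegral.integral_hasDerivWithinAt_right
      (hint.mono_set (by rw [uIcc_of_le hx.1, uIcc_of_le hsT]; exact Icc_subset_Icc_right hx.2.le))
      (s := Ici x) (t := Ioi x) hm hc
    exact (this.const_mul K).const_add A
  have hb := le_gronwallBound_of_liminf_deriv_right_le hYc
    (fun x hx ρ hρ => ((hd x hx).Ioi_of_Ici.limsup_slope_le' (by simp) hρ).frequently) (δ := A)
    (ε := 0) (K := K) (by simp [hY])
    (fun x hx => by
      rw [add_zero]; exact mul_le_mul_of_nonneg_left (h x ⟨hx.1, hx.2.le⟩) hK) r hr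
  rw [gronwallBound_ε0] at hb
  exact (h r hr).trans hb

end

end

section

variable {a b : ℝ} [hab : Fact (a < b)] {f f' : ℝ → ℝ} {M : ℝ}

lemma abs_Gf_gm_le (G : C11 (fe f f') (fe' f') M) (v : HS a b) {θ : HS a b} (H : InV θ) :
    |Gf (fe f f') (fe' f') v θ (nem gm θ)|
      ≤ 8 * M * ‖v‖ * (‖Dx (nem qm θ)‖ * Sb (nem qm θ)) := by
  have hM : |f' 0| ≤ M := by simpa [fe'] using G.bdd 0
  have hM0 := G.M_nonneg
  have hS := Sb_nonneg (nem qm θ)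
  rw [Gf, tri, tri, ← integral_add (integrable_tri (bd_nem c11_gm H) _ _)
    (integrable_tri (bd_nem G H) _ _), ← Real.norm_eq_abs]
  refine (norm_integral_le_of_norm_le (g := fun x => 8 * M * Sb (nem qm θ) *
    |FN qm' θ x * v x|) ((integrable_mul_HS _ _).abs.const_mul _) ?_).trans ?_
  · rw [Dx_nem c11_gm H]
    filter_upwards [coeFn_FN G θ, coeFn_nem c11_gm θ, coeFn_FN c11_gm θ, coeFn_nem G θ,
      coeFn_FN c11_qm θ, coeFn_nem c11_qm θ, (inV_nem c11_qm H).bd] with x h1 h2 h3 h4 h5 h6 h7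
    rw [h1, h2, h3, h4, h5]
    rw [h6, abs_of_nonneg (qm_nonneg _)] at h7
    have e : fe' f' (θ x) * Dx θ x * gm (θ x) * v x + gm' (θ x) * Dx θ x * fe f f' (θ x) * v x
        = (fe' f' (θ x) * gm (θ x) + gm' (θ x) * fe f f' (θ x)) * (Dx θ x * v x) := by ring
    rw [e, norm_mul, Real.norm_eq_abs, Real.norm_eq_abs]
    have c := cross_bound (f := f) hM (θ x)
    calc |fe' f' (θ x) * gm (θ x) + gm' (θ x) * fe f f' (θ x)| * |Dx θ x * v x|
        ≤ 8 * M * (|qm' (θ x)| * Sb (nem qm θ)) * |Dx θ x * v x| := by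
          refine mul_le_mul_of_nonneg_right (c.trans ?_) (abs_nonneg _)
          exact mul_le_mul_of_nonneg_left (mul_le_mul_of_nonneg_left h7 (abs_nonneg _))
            (by positivity)
      _ = _ := by rw [mul_assoc (qm' (θ x)), abs_mul (qm' (θ x))]; ring
  · rw [integral_const_mul, Dx_nem c11_qm H]
    calc _ ≤ 8 * M * Sb (nem qm θ) * (‖FN qm' θ‖ * ‖v‖) :=
          mul_le_mul_of_nonneg_left (integral_abs_mul_le _ _) (by positivity)
      _ = _ := by ring

lemma inner_FN_gm_ge (θ : HS a b) : 2 * ‖FN qm' θ‖ ^ 2 ≤ ⟪Dx θ, FN gm' θ⟫_ℝ := by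
  rw [norm_sq_HS, inner_HS, ← integral_const_mul]
  refine integral_mono_ae ((Lp.memLp _).integrable_sq.const_mul 2) (integrable_mul_HS _ _) ?_
  filter_upwards [coeFn_FN c11_qm θ, coeFn_FN c11_gm θ] with x h1 h2
  simp only [h1, h2]
  nlinarith [mul_le_mul_of_nonneg_right (gm'_ge (θ x)) (sq_nonneg (Dx θ x))]

theorem positivity_sol (G : C11 (fe f f') (fe' f') M) {s t : ℝ} {v w θ : ℝ → HS a b}
    (H : IsSol (fe f f') (fe' f') s t v w θ) (h0 : nem qm (θ s) = 0) :
    ∀ r ∈ Icc s t, nem qm (θ r) = 0 := by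
  obtain ⟨R, hR⟩ := exists_bound_cont H.wave.cv
  have hM := G.M_nonneg
  obtain ⟨K, hK, hKy⟩ := young_Sb (a := a) (b := b) (P := 8 * M * |R|) (by positivity)
  have hc : ContinuousOn (fun r => ‖nem qm (θ r)‖ ^ 2) (Icc s t) :=
    ((continuous_nem c11_qm).comp_continuousOn H.cur.cont).norm.pow 2
  have key := gronwall_int (A := 0) hK hc fun r hr => by
    have Hr := H.mono G le_rfl hr.1 hr.2
    obtain ⟨i, e⟩ := heat_chain hr.1 (force_Gf G hr.1 Hr.wave.cv Hr.cur) Hr.cur Hr.heat c11_gm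
      (hasFDerivAt_sq_nem c11_qm c11_gm hasDerivAt_qm_sq)
    simp only [h0, norm_zero] at e
    have e' : ‖nem qm (θ r)‖ ^ 2 = ∫ q in s..r, (-⟪Dx (θ q), FN gm' (θ q)⟫_ℝ +
        Gf (fe f f') (fe' f') (v q) (θ q) (nem gm (θ q))) := by rw [← e]; ring
    rw [zero_add, e', ← intervalIntegral.integral_const_mul]
    have hcr : ContinuousOn (fun r => ‖nem qm (θ r)‖ ^ 2) (uIcc s r) := by
      rw [uIcc_of_le hr.1]; exact hc.mono (Icc_subset_Icc_right hr.2)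
    refine intervalIntegral.integral_mono_ae_restrict hr.1 i (hcr.intervalIntegrable.const_mul K) ?_
    rw [← restrict_Ioc_eq_restrict_Icc]
    filter_upwards [Hr.cur.inV, ae_restrict_mem measurableSet_Ioc] with q hq hqm
    have h1 := inner_FN_gm_ge (θ q)
    have h2 := (abs_le.1 (abs_Gf_gm_le G (v q) hq)).2
    have h3 := hKy (nem qm (θ q))
    have h4 : ‖v q‖ ≤ |R| := (hR q ⟨hqm.1.le, hqm.2.trans hr.2⟩).trans (le_abs_self R)
    have h5 : 8 * M * ‖v q‖ * (‖Dx (nem qm (θ q))‖ * Sb (nem qm (θ q)))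
        ≤ 8 * M * |R| * (‖Dx (nem qm (θ q))‖ * Sb (nem qm (θ q))) :=
      mul_le_mul_of_nonneg_right (mul_le_mul_of_nonneg_left h4 (by positivity))
        (mul_nonneg (norm_nonneg _) (Sb_nonneg _))
    rw [Dx_nem c11_qm hq] at h2 h3 h5
    have := sq_nonneg ‖FN qm' (θ q)‖
    linarith
  intro r hr
  have := key r hr
  rw [zero_mul] at this
  have : ‖nem qm (θ r)‖ = 0 := by nlinarith [norm_nonneg (nem qm (θ r))]
  exact norm_eq_zero.1 this

lemma ae_nonneg_of_qm {θ : HS a b} (h : nem qm θ = 0) : ∀ᵐ x ∂mu a b, 0 ≤ θ x := by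
  filter_upwards [coeFn_nem c11_qm θ, (Lp.eq_zero_iff_ae_eq_zero.1 h)] with x h1 h2
  exact nonneg_of_qm (by rw [← h1, h2]; rfl)

lemma nem_qm_eq_zero {θ : HS a b} (h : ∀ᵐ x ∂mu a b, 0 ≤ θ x) : nem qm θ = 0 := by
  refine Lp.eq_zero_iff_ae_eq_zero.2 ?_
  filter_upwards [coeFn_nem c11_qm θ, h] with x h1 h2
  rw [h1, qm_of_nonneg h2]; rfl

lemma Dx_cosH_zero : Dx (cosH a b 0) = 0 := by
  refine HasD.eq fun n => ?_
  rw [inner_zero_right, (orthonormal_cosH a b).inner_eq_zero (Nat.succ_ne_zero n), mul_zero]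

lemma inner_cosH_zero (h : HS a b) : ⟪cosH a b 0, h⟫_ℝ = √(1 / (b - a)) * ∫ x, h x ∂mu a b := by
  rw [inner_cosH]
  simp only [cosF_zero]
  rw [integral_mul_const, mul_comm]

lemma Gf_cosH_zero (v θ : HS a b) :
    Gf f f' v θ (cosH a b 0) = √(1 / (b - a)) * ⟪v, FN f' θ⟫_ℝ := by
  have h2 : tri (Dx (cosH a b 0)) (nem f θ) v = 0 := by
    rw [Dx_cosH_zero, tri]
    refine integral_eq_zero_of_ae ?_
    filter_upwards [Lp.coeFn_zero ℝ 2 (mu a b)] with x hx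
    rw [hx]; simp
  rw [Gf, h2, add_zero, tri, inner_HS, ← integral_const_mul]
  refine integral_congr_ae ?_
  filter_upwards [coeFn_toH (a := a) (b := b) (g := cosF a b 0) (by fun_prop)] with x hx
  rw [cosH, hx, cosF_zero]; ring

lemma energy_sol {M : ℝ} (G : C11 f f' M) {s t : ℝ} (hst : s ≤ t) {v w θ : ℝ → HS a b}
    (H : IsSol f f' s t v w θ) :
    ‖v t‖ ^ 2 + ‖w t‖ ^ 2 + 2 * (b - a) * (√(1 / (b - a)) * ⟪cosH a b 0, θ t⟫_ℝ)
      = ‖v s‖ ^ 2 + ‖w s‖ ^ 2 + 2 * (b - a) * (√(1 / (b - a)) * ⟪cosH a b 0, θ s⟫_ℝ) := by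
  have hL : 0 < b - a := sub_pos.2 hab.out
  obtain ⟨-, e⟩ := wave_energy hst (wforce_FN G H.cur) H.wave
  have h0 := H.heat 0 t (right_mem_Icc.2 hst)
  simp only [kf_zero, Gf_cosH_zero] at h0
  have e1 : ∀ q, -(0 : ℝ) ^ 2 * ⟪cosH a b 0, θ q⟫_ℝ + √(1 / (b - a)) * ⟪v q, FN f' (θ q)⟫_ℝ
      = √(1 / (b - a)) * ⟪v q, FN f' (θ q)⟫_ℝ := fun q => by ring
  simp only [e1, intervalIntegral.integral_const_mul] at h0
  have hs : √(1 / (b - a)) * √(1 / (b - a)) * (b - a) = 1 := by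
    rw [Real.mul_self_sqrt (by positivity)]; field_simp
  rw [e, h0]
  linear_combination 2 * (∫ q in s..t, ⟪v q, FN f' (θ q)⟫_ℝ) * hs

theorem apriori (G : C11 (fe f f') (fe' f') M) {v0 w0 θ0 : HS a b} (h0 : nem qm θ0 = 0)
    (T : ℝ) (hT : 0 ≤ T) :
    ∃ B, ∀ t ∈ Icc 0 T, ∀ v w θ : ℝ → HS a b, v 0 = v0 → w 0 = w0 → θ 0 = θ0 →
      IsSol (fe f f') (fe' f') 0 t v w θ →
      ‖v t‖ ≤ B ∧ ‖θ t‖ ≤ B ∧ ∫ q in Ioc 0 t, ‖Dx (θ q)‖ ^ 2 ≤ B := by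
  have hM := G.M_nonneg
  have hL : 0 < b - a := sub_pos.2 hab.out
  set E0 := ‖v0‖ ^ 2 + ‖w0‖ ^ 2 + 2 * (b - a) * (√(1 / (b - a)) * ⟪cosH a b 0, θ0⟫_ℝ) with hE0
  set R := √E0 with hR
  obtain ⟨K, hK, hKy⟩ := young_Sb (a := a) (b := b) (P := 2 * M * R) (by positivity)
  set A := ‖θ0‖ ^ 2 * Real.exp (2 * K * T) with hA
  have hA0 : 0 ≤ A := by positivity
  refine ⟨R + (A + 1) + (‖θ0‖ ^ 2 + 2 * K * (T * A)), fun t ht v w θ ev ew eθ H => ?_⟩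
  have hR0 : 0 ≤ R := Real.sqrt_nonneg _
  have hQ : 0 ≤ ‖θ0‖ ^ 2 + 2 * K * (T * A) := by positivity
  have hp := positivity_sol G H (by rw [eθ]; exact h0)
  have hv : ∀ r ∈ Icc 0 t, ‖v r‖ ≤ R := fun r hr => by
    have e := energy_sol G hr.1 (H.mono G le_rfl hr.1 hr.2)
    rw [ev, ew, eθ, ← hE0] at e
    have hn : 0 ≤ ⟪cosH a b 0, θ r⟫_ℝ := by
      rw [inner_cosH_zero]
      exact mul_nonneg (Real.sqrt_nonneg _) (integral_nonneg_of_ae (ae_nonneg_of_qm (hp r hr)))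
    refine Real.le_sqrt_of_sq_le ?_
    have : 0 ≤ 2 * (b - a) * (√(1 / (b - a)) * ⟪cosH a b 0, θ r⟫_ℝ) := by positivity
    nlinarith [sq_nonneg ‖w r‖]
  have hθc : ContinuousOn (fun r => ‖θ r‖ ^ 2) (Icc 0 t) := H.cur.cont.norm.pow 2
  have est : ∀ r ∈ Icc 0 t, ‖θ r‖ ^ 2 + (∫ q in (0:ℝ)..r, ‖Dx (θ q)‖ ^ 2)
      ≤ ‖θ0‖ ^ 2 + 2 * K * ∫ q in (0:ℝ)..r, ‖θ q‖ ^ 2 := fun r hr => by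
    have Hr := H.mono G le_rfl hr.1 hr.2
    obtain ⟨i, e⟩ := heat_energy hr.1 (force_Gf G hr.1 Hr.wave.cv Hr.cur) Hr.cur Hr.heat
    rw [eθ] at e
    have hcr : ContinuousOn (fun r => ‖θ r‖ ^ 2) (uIcc 0 r) := by
      rw [uIcc_of_le hr.1]; exact hθc.mono (Icc_subset_Icc_right hr.2)
    have i2 : IntervalIntegrable (fun q => 1 / 2 * ‖Dx (θ q)‖ ^ 2 + K * ‖θ q‖ ^ 2) volume 0 r :=
      (Hr.cur.sq.const_mul _).add (hcr.intervalIntegrable.const_mul K)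
    have h1 : (∫ q in (0:ℝ)..r, Gf (fe f f') (fe' f') (v q) (θ q) (θ q))
        ≤ ∫ q in (0:ℝ)..r, (1 / 2 * ‖Dx (θ q)‖ ^ 2 + K * ‖θ q‖ ^ 2) := by
      refine intervalIntegral.integral_mono_ae_restrict hr.1 i i2 ?_
      rw [← restrict_Ioc_eq_restrict_Icc]
      filter_upwards [Hr.cur.inV, ae_restrict_mem measurableSet_Ioc] with q hq hqm
      have h2 := (abs_le.1 (abs_Gf_le G (v q) hq hq)).2
      have h3 := hKy (θ q)
      have h4 := hv q ⟨hqm.1.le, hqm.2.trans hr.2⟩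
      have h5 : M * ‖v q‖ * (‖Dx (θ q)‖ * Sb (θ q) + Sb (θ q) * ‖Dx (θ q)‖)
          ≤ M * R * (‖Dx (θ q)‖ * Sb (θ q) + Sb (θ q) * ‖Dx (θ q)‖) :=
        mul_le_mul_of_nonneg_right (mul_le_mul_of_nonneg_left h4 hM)
          (by have := Sb_nonneg (θ q); positivity)
      nlinarith
    rw [intervalIntegral.integral_add (Hr.cur.sq.const_mul _)
      (hcr.intervalIntegrable.const_mul K), intervalIntegral.integral_const_mul,
      intervalIntegral.integral_const_mul] at h1
    linarith
  have hθ : ∀ r ∈ Icc 0 t, ‖θ r‖ ^ 2 ≤ A := fun r hr => by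
    have h1 := gronwall_int (A := ‖θ0‖ ^ 2) (K := 2 * K) (by positivity) hθc (fun q hq => by
      have h2 : 0 ≤ ∫ q in (0:ℝ)..q, ‖Dx (θ q)‖ ^ 2 :=
        intervalIntegral.integral_nonneg hq.1 fun _ _ => sq_nonneg _
      linarith [est q hq]) r hr
    refine h1.trans (mul_le_mul_of_nonneg_left (Real.exp_le_exp.2 ?_) (sq_nonneg _))
    exact mul_le_mul_of_nonneg_left (by rw [sub_zero]; exact hr.2.trans ht.2) (by positivity)
  have htm := right_mem_Icc.2 ht.1
  refine ⟨by linarith [hv t htm], ?_, ?_⟩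
  · have := hθ t htm
    nlinarith [sq_nonneg (‖θ t‖ - 1), norm_nonneg (θ t)]
  · have h1 := est t htm
    rw [intervalIntegral.integral_of_le ht.1] at h1
    have hcr : ContinuousOn (fun r => ‖θ r‖ ^ 2) (uIcc 0 t) := by rw [uIcc_of_le ht.1]; exact hθc
    have h2 : (∫ q in (0:ℝ)..t, ‖θ q‖ ^ 2) ≤ ∫ q in (0:ℝ)..t, A :=
      intervalIntegral.integral_mono_on ht.1 hcr.intervalIntegrable intervalIntegrable_const hθ
    rw [intervalIntegral.integral_const, sub_zero, smul_eq_mul] at h2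
    have h3 : 2 * K * (∫ q in (0:ℝ)..t, ‖θ q‖ ^ 2) ≤ 2 * K * (T * A) :=
      mul_le_mul_of_nonneg_left (h2.trans (mul_le_mul_of_nonneg_right ht.2 hA0)) (by positivity)
    linarith [sq_nonneg ‖θ t‖]

theorem global_pos (G : C11 (fe f f') (fe' f') M) (v0 w0 : HS a b) {θ0 : HS a b}
    (h0 : ∀ᵐ x ∂mu a b, 0 ≤ θ0 x) :
    ∃ v w θ : ℝ → HS a b, v 0 = v0 ∧ w 0 = w0 ∧ θ 0 = θ0 ∧
      (∀ T, 0 ≤ T → IsSol (fe f f') (fe' f') 0 T v w θ) ∧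
      ∀ t, 0 ≤ t → ∀ᵐ x ∂mu a b, 0 ≤ θ t x := by
  have hq := nem_qm_eq_zero h0
  obtain ⟨v, w, θ, ev, ew, eθ, H⟩ := global_exists G v0 w0 θ0 (apriori G hq)
  exact ⟨v, w, θ, ev, ew, eθ, H, fun t ht => ae_nonneg_of_qm
    (positivity_sol G (H t ht) (by rw [eθ]; exact hq) t (right_mem_Icc.2 ht))⟩

end

section

variable {a b : ℝ} [hab : Fact (a < b)]

/-- `w` is the derivative of `u`, where `u` vanishes at both ends, in terms of Fourier modes. -/
def ZD (u w : HS a b) : Prop :=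
  (∀ n, ⟪cosH a b (n + 1), w⟫_ℝ = kf a b (n + 1) * ⟪sinH a b n, u⟫_ℝ) ∧ ⟪cosH a b 0, w⟫_ℝ = 0

theorem ZD.pair {u w p q : HS a b} (H : ZD u w) (K : HasD p q) : ⟪u, q⟫_ℝ = -⟪w, p⟫_ℝ := by
  have h1 := (sinB a b).hasSum_inner_mul_inner u q
  have h2 := (hasSum_nat_add_iff' 1).2 ((cosB a b).hasSum_inner_mul_inner w p)
  simp only [sinB_apply, cosB_apply] at h1 h2
  rw [Finset.range_one, Finset.sum_singleton, real_inner_comm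
      (cosH a b 0) w, H.2, zero_mul, sub_zero] at h2
  have e : ∀ n, ⟪u, sinH a b n⟫_ℝ * ⟪sinH a b n, q⟫_ℝ
      = -(⟪w, cosH a b (n + 1)⟫_ℝ * ⟪cosH a b (n + 1), p⟫_ℝ) := by
    intro n
    rw [K n, real_inner_comm (cosH a b (n + 1)) w, H.1 n, real_inner_comm (sinH a b n) u]
    ring
  have h3 := h2.neg
  simp only [← e] at h3
  have := h1.unique h3
  exact this

theorem _root_.MemL2.memLp {g : ℝ → ℝ} (h : MemL2 a b g) : MemLp g 2 (mu a b) :=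
  (memLp_two_iff_integrable_sq h.1).2 h.2

theorem memL2_of_ae {g : ℝ → ℝ} (h : HS a b) (e : g =ᵐ[mu a b] h) : MemL2 a b g := by
  have m : MemLp g 2 (mu a b) := (memLp_congr_ae e).2 (Lp.memLp h)
  exact ⟨m.1, (memLp_two_iff_integrable_sq m.1).1 m⟩

theorem integral_mul_toH {g : ℝ → ℝ} {h : HS a b} (e : g =ᵐ[mu a b] h) {φ : ℝ → ℝ}
    (hφ : Continuous φ) : ∫ x in Ioo a b, g x * φ x = ⟪toH a b φ hφ, h⟫_ℝ := by
  rw [inner_toH]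
  exact integral_congr_ae (e.mono fun x hx => by simp only [hx])

theorem cont_deriv_of_smooth {ψ : ℝ → ℝ} (h : ContDiff ℝ (⊤ : ℕ∞) ψ) : Continuous (deriv ψ) :=
  h.continuous_deriv (by simp)

theorem hasDerivAt_of_smooth {ψ : ℝ → ℝ} (h : ContDiff ℝ (⊤ : ℕ∞) ψ) (x : ℝ) :
    HasDerivAt ψ (deriv ψ x) x :=
  (h.differentiable (by simp) x).hasDerivAt

theorem hasD_smooth {ψ : ℝ → ℝ} (h : ContDiff ℝ (⊤ : ℕ∞) ψ) :
    HasD (toH a b ψ h.continuous) (toH a b (deriv ψ) (cont_deriv_of_smooth h)) :=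
  hasD_of_deriv (hasDerivAt_of_smooth h) (cont_deriv_of_smooth h) (coeFn_toH _) (coeFn_toH _)

theorem ZD.weak {g g' : ℝ → ℝ} {u w : HS a b} (H : ZD u w) (e : g =ᵐ[mu a b] u)
    (e' : g' =ᵐ[mu a b] w) : WeakDerivZ a b g g' := by
  intro ψ hψ
  rw [integral_mul_toH e (cont_deriv_of_smooth hψ), integral_mul_toH e' hψ.continuous,
    real_inner_comm, H.pair (hasD_smooth hψ), real_inner_comm]

theorem ZD.of_weak {g g' : ℝ → ℝ} {u w : HS a b} (H : WeakDerivZ a b g g')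
    (e : g =ᵐ[mu a b] u) (e' : g' =ᵐ[mu a b] w) : ZD u w := by
  have key : ∀ n, ∫ x in Ioo a b, g x * deriv (cosF a b n) x = -⟪cosH a b n, w⟫_ℝ := by
    intro n
    rw [H _ (contDiff_cosF a b n), integral_mul_toH e' (contDiff_cosF a b n).continuous]
    rfl
  constructor
  · intro n
    have h := key (n + 1)
    have : ∀ x, deriv (cosF a b (n + 1)) x = -kf a b (n + 1) * sinF a b n x :=
      fun x => (hasDerivAt_cosF_succ a b n x).deriv
    have e2 : ∫ x in Ioo a b, g x * deriv (cosF a b (n + 1)) x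
        = -kf a b (n + 1) * ⟪sinH a b n, u⟫_ℝ := by
      rw [show ⟪sinH a b n, u⟫_ℝ = ∫ x in Ioo a b, g x * sinF a b n x from
        (integral_mul_toH e (by fun_prop)).symm, ← integral_const_mul]
      congr 1; ext x; rw [this]; ring
    linarith
  · have h := key 0
    have : ∀ x, deriv (cosF a b 0) x = 0 := by
      intro x
      have : cosF a b 0 = fun _ => √(1 / (b - a)) := funext fun y => cosF_zero a b y
      rw [this]; simp
    simp only [this, mul_zero, integral_zero] at h
    linarith

theorem ZD.of_smooth {ψ : ℝ → ℝ} (h : ContDiff ℝ (⊤ : ℕ∞) ψ) (ha : ψ a = 0) (hb : ψ b = 0) :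
    ZD (toH a b ψ h.continuous) (toH a b (deriv ψ) (cont_deriv_of_smooth h)) := by
  have key : ∀ c d : ℝ → ℝ, (hc : Continuous c) → (hd : Continuous d) →
      (∀ x, HasDerivAt c (d x) x) →
      ∫ x, deriv ψ x * c x ∂mu a b = -∫ x, ψ x * d x ∂mu a b := by
    intro c d hc hd hcd
    rw [integral_mu_eq hab.out.le, integral_mu_eq hab.out.le]
    have := intervalIntegral.integral_mul_deriv_eq_deriv_mul (a := a) (b := b)
      (fun x _ => hcd x) (fun x _ => hasDerivAt_of_smooth h x)
      (hd.intervalIntegrable _ _) ((cont_deriv_of_smooth h).intervalIntegrable _ _)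
    simp only [ha, hb, mul_zero, sub_zero, zero_sub] at this
    rw [show ∫ x in a..b, deriv ψ x * c x = ∫ x in a..b, c x * deriv ψ x from by
      congr 1; ext x; ring, this]
    congr 1; congr 1; ext x; ring
  constructor
  · intro n
    rw [inner_cosH, inner_sinH]
    have e1 : ∫ x, (toH a b (deriv ψ) (cont_deriv_of_smooth h)) x * cosF a b (n+1) x ∂mu a b
        = ∫ x, deriv ψ x * cosF a b (n+1) x ∂mu a b :=
      integral_congr_ae ((coeFn_toH (cont_deriv_of_smooth h)).mono fun x hx => by simp only [hx])
    have e2 : ∫ x, (toH a b ψ h.continuous) x * sinF a b n x ∂mu a b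
        = ∫ x, ψ x * sinF a b n x ∂mu a b :=
      integral_congr_ae ((coeFn_toH h.continuous).mono fun x hx => by simp only [hx])
    rw [e1, e2, key (cosF a b (n+1)) (fun x => -kf a b (n + 1) * sinF a b n x) (by fun_prop)
      (by fun_prop) (hasDerivAt_cosF_succ a b n), ← integral_const_mul, ← integral_neg]
    congr 1; ext x; ring
  · rw [inner_cosH]
    have e1 : ∫ x, (toH a b (deriv ψ) (cont_deriv_of_smooth h)) x * cosF a b 0 x ∂mu a b
        = ∫ x, deriv ψ x * cosF a b 0 x ∂mu a b :=
      integral_congr_ae ((coeFn_toH (cont_deriv_of_smooth h)).mono fun x hx => by simp only [hx])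
    rw [e1, key (cosF a b 0) (fun _ => 0) (by fun_prop) (by fun_prop) (fun x => ?_)]
    · simp
    · have : cosF a b 0 = fun _ => √(1 / (b - a)) := funext fun y => cosF_zero a b y
      rw [this]; exact hasDerivAt_const _ _

theorem zero_of_tsupport {ψ : ℝ → ℝ} (h : tsupport ψ ⊆ Ioo a b) : ψ a = 0 ∧ ψ b = 0 :=
  ⟨image_eq_zero_of_notMem_tsupport fun hx => lt_irrefl _ (h hx).1,
    image_eq_zero_of_notMem_tsupport fun hx => lt_irrefl _ (h hx).2⟩

theorem HasD.weak {g g' : ℝ → ℝ} {h h' : HS a b} (H : HasD h h') (e : g =ᵐ[mu a b] h)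
    (e' : g' =ᵐ[mu a b] h') : WeakDerivI a b g g' := by
  intro ψ hψ hs
  have hz := ZD.of_smooth (a := a) (b := b) hψ (zero_of_tsupport hs).1 (zero_of_tsupport hs).2
  rw [integral_mul_toH e (cont_deriv_of_smooth hψ), integral_mul_toH e' hψ.continuous,
    hz.pair H, neg_neg]

theorem exists_Icc_of_compact {K : Set ℝ} (hK : IsCompact K) (h : K ⊆ Ioo a b) :
    ∃ c d, a < c ∧ c ≤ d ∧ d < b ∧ K ⊆ Icc c d := by
  have hm : (a + b) / 2 ∈ Ioo a b := by constructor <;> linarith [hab.out]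
  have hK' : IsCompact (insert ((a + b) / 2) K) := hK.insert _
  have hne : (insert ((a + b) / 2) K).Nonempty := ⟨_, mem_insert _ _⟩
  have hs : insert ((a + b) / 2) K ⊆ Ioo a b := insert_subset hm h
  obtain ⟨c, hc⟩ := hK'.exists_isLeast hne
  obtain ⟨d, hd⟩ := hK'.exists_isGreatest hne
  exact ⟨c, d, (hs hc.1).1, hc.2 hd.1, (hs hd.1).2,
    fun x hx => ⟨hc.2 (mem_insert_of_mem _ hx), hd.2 (mem_insert_of_mem _ hx)⟩⟩

theorem exists_primitive_test {σ : ℝ → ℝ} (hσ : ContDiff ℝ (⊤ : ℕ∞) σ) (hs : tsupport σ ⊆ Ioo a b)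
    (h0 : ∫ x in a..b, σ x = 0) :
    ∃ ψ : ℝ → ℝ, ContDiff ℝ (⊤ : ℕ∞) ψ ∧ tsupport ψ ⊆ Ioo a b ∧ deriv ψ = σ := by
  have hd : ∀ x, HasDerivAt (fun x => ∫ y in a..x, σ y) (σ x) x := fun x =>
    intervalIntegral.integral_hasDerivAt_right (hσ.continuous.intervalIntegrable _ _)
      hσ.continuous.stronglyMeasurable.stronglyMeasurableAtFilter hσ.continuous.continuousAt
  have hd' : deriv (fun x => ∫ y in a..x, σ y) = σ := funext fun x => (hd x).deriv
  refine ⟨_, ?_, ?_, hd'⟩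
  · refine contDiff_infty_iff_deriv.2 ⟨fun x => (hd x).differentiableAt, ?_⟩
    rw [hd']; exact hσ
  · have hK : IsCompact (tsupport σ) :=
      isCompact_Icc.of_isClosed_subset (isClosed_tsupport _) (hs.trans Ioo_subset_Icc_self)
    obtain ⟨c, d, hac, hcd, hdb, hK'⟩ := exists_Icc_of_compact hK hs
    have hz : ∀ y, y ∉ Icc c d → σ y = 0 := fun y hy =>
      image_eq_zero_of_notMem_tsupport fun h => hy (hK' h)
    have : support (fun x => ∫ y in a..x, σ y) ⊆ Icc c d := by
      intro x hx
      by_contra hn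
      apply hx
      rw [mem_Icc, not_and_or, not_le, not_le] at hn
      show ∫ y in a..x, σ y = 0
      rcases hn with hn | hn
      · refine (intervalIntegral.integral_congr (g := fun _ => (0 : ℝ)) fun y hy => ?_).trans
          (by simp)
        refine hz y fun hy' => ?_
        rcases le_max_iff.1 hy.2 with h | h <;> linarith [hy'.1]
      · rw [← intervalIntegral.integral_add_adjacent_intervals (b := b)
          (hσ.continuous.intervalIntegrable _ _) (hσ.continuous.intervalIntegrable _ _), h0,
          zero_add]
        refine (intervalIntegral.integral_congr (g := fun _ => (0 : ℝ)) fun y hy => ?_).trans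
          (by simp)
        refine hz y fun hy' => ?_
        rcases min_le_iff.1 hy.1 with h | h <;> linarith [hy'.2]
    exact (closure_minimal this isClosed_Icc).trans fun x hx =>
        ⟨hac.trans_le hx.1, hx.2.trans_lt hdb⟩

theorem exists_unit_test (a b : ℝ) [hab : Fact (a < b)] : ∃ ρ : ℝ → ℝ, ContDiff ℝ (⊤ : ℕ∞) ρ
    ∧ tsupport ρ ⊆ Ioo a b ∧
    ∫ x in a..b, ρ x = 1 := by
  have hlt := hab.out
  let B : ContDiffBump ((a + b) / 2) := ⟨(b - a) / 8, (b - a) / 4, by linarith, by linarith⟩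
  have hs : tsupport (B.normed volume) ⊆ Ioo a b := by
    rw [B.tsupport_normed_eq, Real.closedBall_eq_Icc]
    intro x hx
    have h1 : (a + b) / 2 - (b - a) / 4 ≤ x := hx.1
    have h2 : x ≤ (a + b) / 2 + (b - a) / 4 := hx.2
    constructor <;> linarith
  refine ⟨B.normed volume, B.contDiff_normed, hs, ?_⟩
  rw [intervalIntegral.integral_of_le hlt.le, setIntegral_eq_integral_of_forall_compl_eq_zero,
    B.integral_normed]
  intro x hx
  exact image_eq_zero_of_notMem_tsupport fun h => hx ⟨(hs h).1, (hs h).2.le⟩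

theorem kf_one_le (n : ℕ) : kf a b 1 ≤ kf a b (n + 1) := by
  have := hab.out
  unfold kf
  have : 0 < b - a := by linarith
  gcongr
  simp

theorem kf_one_pos : 0 < kf a b 1 := by
  have := hab.out
  unfold kf
  have : 0 < b - a := by linarith
  positivity

theorem exists_hasD (h' : HS a b) : ∃ K : HS a b, HasD K h' := by
  have hp := kf_one_pos (a := a) (b := b)
  let c : ℕ → ℝ := fun n => Nat.casesOn n 0 fun m => -⟪sinH a b m, h'⟫_ℝ / kf a b (m + 1)
  have hc : Summable fun n => c n ^ 2 := by
    rw [← summable_nat_add_iff 1]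
    refine Summable.of_nonneg_of_le (fun n => sq_nonneg _) (fun n => ?_)
      ((hasSum_sq_sin h').summable.mul_left (1 / kf a b 1 ^ 2))
    show (-⟪sinH a b n, h'⟫_ℝ / kf a b (n + 1)) ^ 2 ≤ _
    rw [div_pow, neg_sq, div_eq_mul_one_div, mul_comm]
    gcongr
    exact kf_one_le n
  obtain ⟨K, hK⟩ := exists_cos (a := a) (b := b) hc
  refine ⟨K, fun n => ?_⟩
  have := hp.trans_le (kf_one_le n)
  rw [hK (n + 1)]
  show _ = -kf a b (n + 1) * (-⟪sinH a b n, h'⟫_ℝ / kf a b (n + 1))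
  field_simp

/-- A function orthogonal to all derivatives of test functions is constant. -/
theorem ae_eq_const_of_test {g : ℝ → ℝ} (hg : Integrable g (mu a b))
    (H : ∀ ψ : ℝ → ℝ, ContDiff ℝ (⊤ : ℕ∞) ψ → tsupport ψ ⊆ Ioo a b →
      ∫ x, g x * deriv ψ x ∂mu a b = 0) : ∃ c : ℝ, ∀ᵐ x ∂mu a b, g x = c := by
  obtain ⟨ρ₀, hρ₀, hs₀, h1⟩ := exists_unit_test a b
  set c := ∫ x, g x * ρ₀ x ∂mu a b with hc
  suffices hz : (fun x => g x - c) =ᵐ[mu a b] 0 from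
    ⟨c, hz.mono fun x hx => by simpa [sub_eq_zero] using hx⟩
  refine ae_eq_zero_of_integral_contDiff (hg.sub (integrable_const _)) ?_
  intro ρ hρ hsρ
  set m := ∫ x in a..b, ρ x with hm
  have hσ : ContDiff ℝ (⊤ : ℕ∞) (fun x => ρ x - m * ρ₀ x) := hρ.sub (contDiff_const.mul hρ₀)
  have hσs : tsupport (fun x => ρ x - m * ρ₀ x) ⊆ Ioo a b := by
    refine closure_minimal ?_ (isClosed_tsupport _ |>.union (isClosed_tsupport _)) |>.trans
      (union_subset hsρ hs₀)
    intro x hx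
    by_contra hn
    rw [mem_union, not_or] at hn
    apply hx
    simp [image_eq_zero_of_notMem_tsupport hn.1, image_eq_zero_of_notMem_tsupport hn.2]
  have hσ0 : ∫ x in a..b, (ρ x - m * ρ₀ x) = 0 := by
    rw [intervalIntegral.integral_sub (hρ.continuous.intervalIntegrable _ _)
      ((hρ₀.continuous.const_mul m).intervalIntegrable _ _), intervalIntegral.integral_const_mul,
      h1]
    simp [hm]
  obtain ⟨ψ, hψ, hψs, hψd⟩ := exists_primitive_test (a := a) (b := b) hσ hσs hσ0
  have w2 := H ψ hψ hψs
  simp only [hψd] at w2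
  have i1 := integrable_mul_continuous hg hρ.continuous
  have i2 := integrable_mul_continuous hg hρ₀.continuous
  have j : m = ∫ x, ρ x ∂mu a b := (integral_mu_eq hab.out.le _).symm
  have i3 : Integrable ρ (mu a b) :=
    memLp_one_iff_integrable.1 (memLp_of_continuous hρ.continuous a b 1)
  have e3 : ∫ x, g x * (ρ x - m * ρ₀ x) ∂mu a b
      = (∫ x, g x * ρ x ∂mu a b) - m * ∫ x, g x * ρ₀ x ∂mu a b := by
    rw [← integral_const_mul, ← integral_sub i1 (i2.const_mul m)]
    congr 1; ext x; ring
  rw [e3] at w2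
  simp only [sub_mul]
  rw [integral_sub i1 (i3.const_mul _), integral_const_mul, ← j]
  linarith

theorem HasD.of_test {h h' : HS a b} (H : ∀ ψ : ℝ → ℝ, (hψ : ContDiff ℝ (⊤ : ℕ∞) ψ) →
    tsupport ψ ⊆ Ioo a b → ⟪toH a b (deriv ψ) (cont_deriv_of_smooth hψ), h⟫_ℝ
      = -⟪toH a b ψ hψ.continuous, h'⟫_ℝ) : HasD h h' := by
  obtain ⟨K, hK⟩ := exists_hasD h'
  obtain ⟨c, hc⟩ := ae_eq_const_of_test (a := a) (b := b) (integrable_HS (h - K)) fun ψ hψ hψs => by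
    have hz := ZD.of_smooth (a := a) (b := b) hψ (zero_of_tsupport hψs).1 (zero_of_tsupport hψs).2
    have w := H ψ hψ hψs
    rw [hz.pair hK, neg_neg] at w
    rw [← inner_toH (h - K) (cont_deriv_of_smooth hψ), inner_sub_right, w, sub_self]
  have hpos : 0 < √(1 / (b - a)) := Real.sqrt_pos.2 (one_div_pos.2 (by linarith [hab.out]))
  have e : h - K = (c / √(1 / (b - a))) • cosH a b 0 := by
    refine Lp.ext ?_
    filter_upwards [hc, Lp.coeFn_smul (c / √(1 / (b - a))) (cosH a b 0),
      coeFn_toH (a := a) (b := b) (by fun_prop : Continuous (cosF a b 0))] with x h1 h2 h3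
    have h3 : (cosH a b 0) x = cosF a b 0 x := h3
    rw [h2, Pi.smul_apply, h3, cosF_zero, smul_eq_mul, div_mul_cancel₀ _ hpos.ne', h1]
  intro n
  have : h = K + (c / √(1 / (b - a))) • cosH a b 0 := by rw [← e]; abel
  rw [hK n, this, inner_add_right, inner_smul_right,
    (orthonormal_cosH a b).2 (by simp : n + 1 ≠ 0)]
  simp

theorem HasD.of_weak {g g' : ℝ → ℝ} {h h' : HS a b} (H : WeakDerivI a b g g')
    (e : g =ᵐ[mu a b] h) (e' : g' =ᵐ[mu a b] h') : HasD h h' := by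
  refine HasD.of_test fun ψ hψ hψs => ?_
  rw [← integral_mul_toH e (cont_deriv_of_smooth hψ), ← integral_mul_toH e' hψ.continuous]
  exact H ψ hψ hψs

theorem eq_zero_of_test {h : HS a b} (H : ∀ ψ : ℝ → ℝ, (hψ : ContDiff ℝ (⊤ : ℕ∞) ψ) →
    tsupport ψ ⊆ Ioo a b → ⟪toH a b ψ hψ.continuous, h⟫_ℝ = 0) : h = 0 := by
  have := ae_eq_zero_of_integral_contDiff (integrable_HS h) fun ψ hψ hψs => by
    rw [← inner_toH h hψ.continuous]; exact H ψ hψ hψs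
  exact (Lp.eq_zero_iff_ae_eq_zero).2 this

end

section

variable {a b : ℝ} [hab : Fact (a < b)]

/-- The measure on `Ω × (0,T)`. -/
theorem restrict_prod_eq (a b T : ℝ) :
    (volume : Measure (ℝ × ℝ)).restrict (Ioo a b ×ˢ Ioo 0 T) = (mu a b).prod (mu 0 T) := by
  rw [Measure.volume_eq_prod, ← Measure.prod_restrict]

theorem intOmT_eq {T : ℝ} {F : ℝ → ℝ → ℝ}
    (h : IntegrableOn (fun p : ℝ × ℝ => F p.1 p.2) (Ioo a b ×ˢ Ioo 0 T)) :
    intOmT a b T F = ∫ t, (∫ x, F x t ∂mu a b) ∂mu 0 T ∧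
      Integrable (fun t => ∫ x, F x t ∂mu a b) (mu 0 T) := by
  unfold intOmT
  rw [IntegrableOn, restrict_prod_eq] at h
  rw [restrict_prod_eq]
  exact ⟨integral_prod_symm _ h, h.integral_prod_right⟩

/-- The slice at time `t` of a jointly continuous function. -/
def slH (φ : ℝ → ℝ → ℝ) (hφ : Continuous (uncurry φ)) (t : ℝ) : HS a b :=
  toH a b (fun x => φ x t) (hφ.comp (by fun_prop : Continuous fun x => (x, t)))

/-- An integrable function on `Ω × (0,T)` with time slices represented by `U`. -/
structure Fld (T : ℝ) (u : ℝ → ℝ → ℝ) (U : ℝ → HS a b) : Prop where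
  int : IntegrableOn (fun p : ℝ × ℝ => u p.1 p.2) (Ioo a b ×ˢ Ioo 0 T)
  slice : ∀ᵐ t ∂mu 0 T, (fun x => u x t) =ᵐ[mu a b] U t

theorem integrable_mul_test {T : ℝ} {u φ : ℝ → ℝ → ℝ}
    (h : IntegrableOn (fun p : ℝ × ℝ => u p.1 p.2) (Ioo a b ×ˢ Ioo 0 T))
    (hφ : Continuous (uncurry φ)) :
    IntegrableOn (fun p : ℝ × ℝ => u p.1 p.2 * φ p.1 p.2) (Ioo a b ×ˢ Ioo 0 T) := by
  have hK : IsCompact (Icc a b ×ˢ Icc 0 T) := isCompact_Icc.prod isCompact_Icc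
  obtain ⟨C, hC⟩ := hK.exists_bound_of_continuousOn hφ.continuousOn
  refine Integrable.mul_bdd (c := C) h hφ.aestronglyMeasurable ?_
  refine (ae_restrict_iff' (measurableSet_Ioo.prod measurableSet_Ioo)).2 (.of_forall ?_)
  intro p hp
  exact hC p ⟨Ioo_subset_Icc_self hp.1, Ioo_subset_Icc_self hp.2⟩

theorem Fld.test {T : ℝ} {u φ : ℝ → ℝ → ℝ} {U : ℝ → HS a b} (H : Fld T u U)
    (hφ : Continuous (uncurry φ)) :
    intOmT a b T (fun x t => u x t * φ x t) = ∫ t, ⟪slH φ hφ t, U t⟫_ℝ ∂mu 0 T ∧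
      Integrable (fun t => ⟪slH φ hφ t, U t⟫_ℝ) (mu 0 T) := by
  obtain ⟨h1, h2⟩ := intOmT_eq (F := fun x t => u x t * φ x t) (integrable_mul_test H.int hφ)
  have e : ∀ᵐ t ∂mu 0 T, ∫ x, u x t * φ x t ∂mu a b = ⟪slH φ hφ t, U t⟫_ℝ :=
    H.slice.mono fun t ht => integral_mul_toH ht _
  exact ⟨h1.trans (integral_congr_ae e), h2.congr e⟩

theorem memLp_of_slices {T : ℝ} {g : ℝ → ℝ → ℝ} {W : ℝ → HS a b}
    (hg : AEStronglyMeasurable (fun p : ℝ × ℝ => g p.1 p.2)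
      (volume.restrict (Ioo a b ×ˢ Ioo 0 T)))
    (hs : ∀ᵐ t ∂mu 0 T, (fun x => g x t) =ᵐ[mu a b] W t)
    (hW : Integrable (fun t => ‖W t‖ ^ 2) (mu 0 T)) :
    MemLp (fun p : ℝ × ℝ => g p.1 p.2) 2 (volume.restrict (Ioo a b ×ˢ Ioo 0 T)) := by
  refine (memLp_two_iff_integrable_sq hg).2 ?_
  rw [restrict_prod_eq] at hg ⊢
  refine (integrable_prod_iff' (hg.pow 2)).2 ⟨?_, ?_⟩
  · filter_upwards [hs] with t ht
    have := (memL2_of_ae (W t) ht).2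
    exact this
  · refine hW.congr ?_
    filter_upwards [hs] with t ht
    rw [norm_sq_HS]
    refine integral_congr_ae ?_
    filter_upwards [ht] with x hx
    show W t x ^ 2 = ‖g x t ^ 2‖
    rw [hx, norm_pow, Real.norm_eq_abs, sq_abs]

theorem integral_sub_eq_norm {g h : ℝ → ℝ} {G H : HS a b} (e : g =ᵐ[mu a b] G)
    (e' : h =ᵐ[mu a b] H) : ∫ x in Ioo a b, (g x - h x) ^ 2 = ‖G - H‖ ^ 2 := by
  rw [norm_sq_HS]
  refine integral_congr_ae ?_
  filter_upwards [e, e', Lp.coeFn_sub G H] with x h1 h2 h3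
  rw [h3, h1, h2]; rfl

theorem contL2_of_slices {J : Set ℝ} {g : ℝ → ℝ → ℝ} {W : ℝ → HS a b} (hW : ContinuousOn W J)
    (hs : ∀ t ∈ J, (fun x => g x t) =ᵐ[mu a b] W t) : ContL2 a b J g := by
  refine ⟨fun t ht => memL2_of_ae _ (hs t ht), fun t₀ h₀ => ?_⟩
  have h1 : Tendsto (fun t => ‖W t - W t₀‖ ^ 2) (𝓝[J] t₀) (𝓝 0) := by
    have h : Tendsto (fun t => W t - W t₀) (𝓝[J] t₀) (𝓝 (W t₀ - W t₀)) :=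
      (hW t₀ h₀).tendsto.sub tendsto_const_nhds
    simpa using h.norm.pow 2
  refine h1.congr' ?_
  filter_upwards [self_mem_nhdsWithin] with t ht
  exact (integral_sub_eq_norm (hs t ht) (hs t₀ h₀)).symm

theorem _root_.ContL2.slice {J : Set ℝ} {g : ℝ → ℝ → ℝ} (H : ContL2 a b J g) {t : ℝ} (ht : t ∈ J) :
    (fun x => g x t) =ᵐ[mu a b] mkH a b (fun x => g x t) :=
  (coeFn_mkH (H.1 t ht).memLp).symm

theorem _root_.ContL2.continuousOn {J : Set ℝ} {g : ℝ → ℝ → ℝ} (H : ContL2 a b J g) :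
    ContinuousOn (fun t => mkH a b (fun x => g x t)) J := by
  intro t₀ h₀
  refine tendsto_iff_norm_sub_tendsto_zero.2 ?_
  have h1 : Tendsto (fun t => ‖mkH a b (fun x => g x t) - mkH a b (fun x => g x t₀)‖ ^ 2)
      (𝓝[J] t₀) (𝓝 0) := by
    refine (H.2 t₀ h₀).congr' ?_
    filter_upwards [self_mem_nhdsWithin] with t ht
    exact integral_sub_eq_norm (H.slice ht) (H.slice h₀)
  have h2 := h1.sqrt
  simpa [Real.sqrt_sq] using h2

/-- A measurable curve in `L²(Ω)` has a jointly measurable representative. -/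
theorem joint_rep {W : ℝ → HS a b} (hW : StronglyMeasurable W) :
    ∃ g : ℝ → ℝ → ℝ, Measurable (uncurry g) ∧ ∀ t, (fun x => g x t) =ᵐ[mu a b] W t := by
  let h : ℝ → ℝ → ℝ := fun t => (Ioo a b).indicator (W t)
  have hi : ∀ t, Integrable (h t) := fun t =>
    (integrable_indicator_iff measurableSet_Ioo).2 (integrable_HS (W t))
  have hset : ∀ S : Set ℝ, MeasurableSet S → StronglyMeasurable fun t => ∫ y in S, h t y := by
    intro S hS
    have : ∀ t, ∫ y in S, h t y = ⟪mkH a b (S.indicator fun _ => (1 : ℝ)), W t⟫_ℝ := by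
      intro t
      have hm : MemLp (S.indicator fun _ => (1 : ℝ)) 2 (mu a b) := (memLp_const 1).indicator hS
      rw [inner_HS, ← integral_indicator hS, ← integral_indicator measurableSet_Ioo |>.trans
        (show ∫ x in Ioo a b, S.indicator (fun _ => (1 : ℝ)) x * W t x = _ from
          integral_congr_ae ((coeFn_mkH hm).mono fun x hx => by simp only [hx]))]
      congr 1; ext x
      by_cases h1 : x ∈ S <;> by_cases h2 : x ∈ Ioo a b <;> simp [h, h1, h2]
    simp only [this]
    exact (continuous_const.inner continuous_id).comp_stronglyMeasurable hW
  let Φ : ℝ → ℝ → ℝ := fun x t => ∫ y in a..x, h t y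
  have hΦm : ∀ x, StronglyMeasurable fun t => Φ x t := by
    intro x
    exact (hset _ measurableSet_Ioc).sub (hset _ measurableSet_Ioc)
  have hΦc : ∀ t, Continuous fun x => Φ x t := fun t =>
    intervalIntegral.continuous_primitive (fun _ _ => (hi t).intervalIntegrable) a
  have hΦ : Measurable (uncurry Φ) :=
    (stronglyMeasurable_uncurry_of_continuous_of_stronglyMeasurable hΦc hΦm).measurable
  let q : ℕ → ℝ × ℝ → ℝ := fun n p => ((n : ℝ) + 1) * (Φ (p.1 + 1 / ((n : ℝ) + 1)) p.2 - Φ p.1 p.2)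
  have hq : ∀ n, Measurable (q n) := by
    intro n
    have : Measurable fun p : ℝ × ℝ => uncurry Φ (p.1 + 1 / ((n : ℝ) + 1), p.2) :=
      hΦ.comp (by fun_prop)
    exact (this.sub hΦ).const_mul _
  refine ⟨fun x t => limsup (fun n => q n (x, t)) atTop, Measurable.limsup hq, fun t => ?_⟩
  have hae := LocallyIntegrable.ae_hasDerivAt_integral (hi t).locallyIntegrable
  filter_upwards [ae_restrict_of_ae hae, ae_mu_mem a b] with x hx hm
  have hd := (hx a).tendsto_slope
  have e : h t x = W t x := indicator_of_mem hm _
  rw [← e]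
  refine Tendsto.limsup_eq ?_
  have hs : Tendsto (fun n : ℕ => x + 1 / ((n : ℝ) + 1)) atTop (𝓝[≠] x) := by
    refine tendsto_nhdsWithin_iff.2 ⟨?_, .of_forall fun n => ?_⟩
    · simpa using tendsto_const_nhds.add (tendsto_one_div_add_atTop_nhds_zero_nat (𝕜 := ℝ))
    · have : (0 : ℝ) < 1 / ((n : ℝ) + 1) := by positivity
      simpa using (by positivity : ((n : ℝ) + 1) ≠ 0)
  refine (hd.comp hs).congr fun n => ?_
  simp only [Function.comp, slope_def_field, q, Φ, add_sub_cancel_left]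
  field_simp

end

section

/-- Integration by parts for an absolutely continuous and a `C¹` function. -/
theorem integral_parts {T : ℝ} (hT : 0 ≤ T) {z h c d : ℝ → ℝ} (hz : ContinuousOn z (Icc 0 T))
    (hh : IntervalIntegrable h volume 0 T) (hzh : ∀ r ∈ Icc 0 T, z r = z 0 + ∫ q in 0..r, h q)
    (hc : ∀ t, HasDerivAt c (d t) t) (hd : Continuous d) :
    (∫ t in 0..T, d t * z t) + (∫ t in 0..T, c t * h t) = c T * z T - c 0 * z 0 := by
  have hcc : Continuous c := continuous_iff_continuousAt.2 fun t => (hc t).continuousAt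
  have hci : ∀ r ∈ Icc 0 T, c r = c 0 + ∫ q in 0..r, d q := by
    intro r hr
    rw [intervalIntegral.integral_eq_sub_of_hasDerivAt (fun x _ => hc x)
        (hd.intervalIntegrable _ _)]
    ring
  have hdi := hd.intervalIntegrable (μ := volume) 0 T
  have hz' : ContinuousOn z (uIcc 0 T) := by rwa [uIcc_of_le hT]
  have s1 := sq_chain hT hdi hcc.continuousOn hci
  have s2 := sq_chain hT hh hz hzh
  have s3 := sq_chain (y := fun t => c t + z t) (h := fun t => d t + h t) hT (hdi.add hh)
    (hcc.continuousOn.add hz) fun r hr => by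
      rw [intervalIntegral.integral_add (hd.intervalIntegrable _ _)
        (hh.mono_set (by rw [uIcc_of_le hT, uIcc_of_le hr.1]; exact Icc_subset_Icc_right hr.2)),
        hci r hr, hzh r hr]
      ring
  have i1 : IntervalIntegrable (fun t => d t * z t) volume 0 T := hdi.mul_continuousOn hz'
  have i2 : IntervalIntegrable (fun t => c t * h t) volume 0 T :=
    hh.continuousOn_mul hcc.continuousOn
  have i3 : IntervalIntegrable (fun t => 2 * c t * d t) volume 0 T :=
    ((continuous_const.mul hcc).mul hd).intervalIntegrable _ _
  have i4 : IntervalIntegrable (fun t => 2 * z t * h t) volume 0 T :=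
    hh.continuousOn_mul (continuousOn_const.mul hz')
  have e : ∀ t, 2 * (c t + z t) * (d t + h t)
      = (2 * c t * d t + 2 * z t * h t) + 2 * (d t * z t + c t * h t) := fun t => by ring
  simp only [e] at s3
  rw [intervalIntegral.integral_add (i3.add i4) ((i1.add i2).const_mul 2),
    intervalIntegral.integral_add i3 i4, ← s1, ← s2, intervalIntegral.integral_const_mul,
    intervalIntegral.integral_add i1 i2] at s3
  linarith

theorem abs_sum_inner_mul_le {E : Type*} [NormedAddCommGroup E] [InnerProductSpace ℝ E]
    (B : HilbertBasis ℕ ℝ E) (s : Finset ℕ) (x y : E) :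
    |∑ n ∈ s, ⟪x, B n⟫_ℝ * ⟪B n, y⟫_ℝ| ≤ ‖x‖ * ‖y‖ := by
  have h1 : ∀ x : E, ∑ n ∈ s, ⟪x, B n⟫_ℝ ^ 2 ≤ ‖x‖ ^ 2 := fun x => by
    simpa [real_inner_comm] using B.orthonormal.sum_inner_products_le (x := x) (s := s)
  have h2 := Finset.sum_mul_sq_le_sq_mul_sq s (fun n => ⟪x, B n⟫_ℝ) (fun n => ⟪B n, y⟫_ℝ)
  have h3 : ∑ n ∈ s, ⟪B n, y⟫_ℝ ^ 2 ≤ ‖y‖ ^ 2 := by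
    simpa only [real_inner_comm] using h1 y
  refine abs_le_of_sq_le_sq (h2.trans ?_) (by positivity)
  rw [mul_pow]
  exact mul_le_mul (h1 x) h3 (Finset.sum_nonneg fun _ _ => sq_nonneg _) (sq_nonneg _)

theorem tendsto_sum_inner_mul {E : Type*} [NormedAddCommGroup E] [InnerProductSpace ℝ E]
    [CompleteSpace E] (B : HilbertBasis ℕ ℝ E) (x y : E) :
    Tendsto (fun N => ∑ n ∈ Finset.range (N + 1), ⟪x, B n⟫_ℝ * ⟪B n, y⟫_ℝ) atTop (𝓝 ⟪x, y⟫_ℝ) :=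
  (B.hasSum_inner_mul_inner x y).tendsto_sum_nat.comp (tendsto_add_atTop_nat 1)

/-- Testing an evolution equation given in modes with a time-dependent test function. -/
theorem time_test {E : Type*} [NormedAddCommGroup E] [InnerProductSpace ℝ E]
    [CompleteSpace E] (B : HilbertBasis ℕ ℝ E) {T : ℝ} (hT : 0 ≤ T) {z : ℝ → E}
    (hz : ContinuousOn z (Icc 0 T)) {h : ℕ → ℝ → ℝ}
    (hh : ∀ n, IntervalIntegrable (h n) volume 0 T)
    (hzh : ∀ n, ∀ r ∈ Icc 0 T, ⟪B n, z r⟫_ℝ = ⟪B n, z 0⟫_ℝ + ∫ q in 0..r, h n q)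
    {φ φ' : ℝ → E} (hφ : ∀ k t, HasDerivAt (fun t => ⟪k, φ t⟫_ℝ) ⟪k, φ' t⟫_ℝ t)
    (hφ' : Continuous φ') (hφT : φ T = 0) {R bnd : ℝ → ℝ} (hb : IntervalIntegrable bnd volume 0 T)
    (hbd : ∀ᵐ t ∂volume.restrict (Ioc 0 T), ∀ N,
      |∑ n ∈ Finset.range (N + 1), h n t * ⟪B n, φ t⟫_ℝ| ≤ bnd t)
    (hR : ∀ᵐ t ∂volume.restrict (Ioc 0 T),
      Tendsto (fun N => ∑ n ∈ Finset.range (N + 1), h n t * ⟪B n, φ t⟫_ℝ) atTop (𝓝 (R t))) :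
    (∫ t in 0..T, ⟪z t, φ' t⟫_ℝ) + ⟪z 0, φ 0⟫_ℝ = -∫ t in 0..T, R t := by
  have hz' : ContinuousOn z (uIcc 0 T) := by rwa [uIcc_of_le hT]
  have j1 : ∀ n, IntervalIntegrable (fun t => ⟪z t, B n⟫_ℝ * ⟪B n, φ' t⟫_ℝ) volume 0 T := fun n =>
    ((hz'.inner continuousOn_const).mul
      (continuous_const.inner hφ').continuousOn).intervalIntegrable
  have hφc : ∀ k, Continuous fun t => ⟪k, φ t⟫_ℝ := fun k =>
    continuous_iff_continuousAt.2 fun t => (hφ k t).continuousAt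
  have j2 : ∀ n, IntervalIntegrable (fun t => h n t * ⟪B n, φ t⟫_ℝ) volume 0 T := fun n =>
    (hh n).mul_continuousOn (hφc _).continuousOn
  have key : ∀ n, (∫ t in 0..T, ⟪z t, B n⟫_ℝ * ⟪B n, φ' t⟫_ℝ) + ⟪z 0, B n⟫_ℝ * ⟪B n, φ 0⟫_ℝ
      = -∫ t in 0..T, h n t * ⟪B n, φ t⟫_ℝ := by
    intro n
    have := integral_parts hT (continuousOn_const.inner hz) (hh n) (hzh n) (hφ (B n))
      (continuous_const.inner hφ')
    rw [hφT, inner_zero_right, zero_mul, zero_sub] at this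
    have e1 : ∫ t in 0..T, ⟪z t, B n⟫_ℝ * ⟪B n, φ' t⟫_ℝ
        = ∫ t in 0..T, ⟪B n, φ' t⟫_ℝ * ⟪B n, z t⟫_ℝ := by
      congr 1; ext t; rw [real_inner_comm (B n) (z t), mul_comm]
    have e2 : ∫ t in 0..T, h n t * ⟪B n, φ t⟫_ℝ = ∫ t in 0..T, ⟪B n, φ t⟫_ℝ * h n t := by
      congr 1; ext t; rw [mul_comm]
    rw [e1, e2, real_inner_comm (B n) (z 0)]
    linarith
  have L1 : Tendsto (fun N => ∫ t in 0..T, ∑ n ∈ Finset.range (N + 1), ⟪z t, B n⟫_ℝ * ⟪B n, φ' t⟫_ℝ)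
      atTop (𝓝 (∫ t in 0..T, ⟪z t, φ' t⟫_ℝ)) := by
    refine intervalIntegral.tendsto_integral_filter_of_dominated_convergence
      (fun t => ‖z t‖ * ‖φ' t‖) (.of_forall fun N => ?_) (.of_forall fun N => .of_forall fun t _ =>
        abs_sum_inner_mul_le B _ _ _) ?_ (.of_forall fun t _ => tendsto_sum_inner_mul B _ _)
    · exact (IntervalIntegrable.sum (Finset.range (N + 1))
          (fun n _ => j1 n)).aestronglyMeasurable_restrict_uIoc.congr
        (.of_forall fun t => by simp)
    · exact (hz'.norm.mul hφ'.norm.continuousOn).intervalIntegrable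
  have L2 : Tendsto (fun N => ∫ t in 0..T, ∑ n ∈ Finset.range (N + 1), h n t * ⟪B n, φ t⟫_ℝ)
      atTop (𝓝 (∫ t in 0..T, R t)) := by
    rw [ae_restrict_iff' measurableSet_Ioc] at hbd hR
    refine intervalIntegral.tendsto_integral_filter_of_dominated_convergence
      bnd (.of_forall fun N => ?_) (.of_forall fun N => ?_) hb ?_
    · exact (IntervalIntegrable.sum (Finset.range (N + 1))
          (fun n _ => j2 n)).aestronglyMeasurable_restrict_uIoc.congr
        (.of_forall fun t => by simp)
    · filter_upwards [hbd] with t ht hm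
      rw [uIoc_of_le hT] at hm
      exact ht hm N
    · filter_upwards [hR] with t ht hm
      rw [uIoc_of_le hT] at hm
      exact ht hm
  refine tendsto_nhds_unique (L1.add (tendsto_sum_inner_mul B (z 0) (φ 0)))
      (L2.neg.congr fun N => ?_)
  rw [intervalIntegral.integral_finsetSum fun n _ => j1 n,
    intervalIntegral.integral_finsetSum fun n _ => j2 n, ← Finset.sum_neg_distrib,
    ← Finset.sum_add_distrib]
  exact Finset.sum_congr rfl fun n _ => (key n).symm

section
variable {φ : ℝ → ℝ → ℝ}

theorem hasDerivAt_pdt (h : ContDiff ℝ (⊤ : ℕ∞) (uncurry φ)) (x t : ℝ) :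
    HasDerivAt (fun s => φ x s) (pdt φ x t) t := by
  have : Differentiable ℝ fun s => uncurry φ (x, s) :=
    (h.comp (by fun_prop : ContDiff ℝ (⊤ : ℕ∞) fun s : ℝ => (x, s))).differentiable (by simp)
  exact (this t).hasDerivAt

theorem hasDerivAt_pdx (h : ContDiff ℝ (⊤ : ℕ∞) (uncurry φ)) (x t : ℝ) :
    HasDerivAt (fun y => φ y t) (pdx φ x t) x := by
  have : Differentiable ℝ fun y => uncurry φ (y, t) :=
    (h.comp (by fun_prop : ContDiff ℝ (⊤ : ℕ∞) fun y : ℝ => (y, t))).differentiable (by simp)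
  exact (this x).hasDerivAt

theorem contDiff_pdt (h : ContDiff ℝ (⊤ : ℕ∞) (uncurry φ)) :
    ContDiff ℝ (⊤ : ℕ∞) (uncurry (pdt φ)) := by
  have e : uncurry (pdt φ) = fun p => fderiv ℝ (uncurry φ) p (0, 1) := by
    ext ⟨x, t⟩
    have h1 : HasFDerivAt (uncurry φ) (fderiv ℝ (uncurry φ) (x, t)) (x, t) :=
      (h.differentiable (by simp) _).hasFDerivAt
    have h2 : HasDerivAt (fun s : ℝ => (x, s)) (0, 1) t :=
      (hasDerivAt_const t x).prodMk (hasDerivAt_id t)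
    exact (hasDerivAt_pdt h x t).unique (h1.comp_hasDerivAt t h2)
  rw [e]
  exact (h.fderiv_right (m := (⊤ : ℕ∞)) (by simp)).clm_apply contDiff_const

theorem contDiff_pdx (h : ContDiff ℝ (⊤ : ℕ∞) (uncurry φ)) :
    ContDiff ℝ (⊤ : ℕ∞) (uncurry (pdx φ)) := by
  have e : uncurry (pdx φ) = fun p => fderiv ℝ (uncurry φ) p (1, 0) := by
    ext ⟨x, t⟩
    have h1 : HasFDerivAt (uncurry φ) (fderiv ℝ (uncurry φ) (x, t)) (x, t) :=
      (h.differentiable (by simp) _).hasFDerivAt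
    have h2 : HasDerivAt (fun y : ℝ => (y, t)) (1, 0) x :=
      (hasDerivAt_id x).prodMk (hasDerivAt_const x t)
    have h3 : HasDerivAt (fun y => φ y t) (fderiv ℝ (uncurry φ) (x, t) (1, 0)) x :=
      h1.comp_hasDerivAt (f := fun y : ℝ => (y, t)) x h2
    exact (hasDerivAt_pdx h x t).unique h3
  rw [e]
  exact (h.fderiv_right (m := (⊤ : ℕ∞)) (by simp)).clm_apply contDiff_const

end

section
variable {a b : ℝ} [hab : Fact (a < b)] {φ : ℝ → ℝ → ℝ}

theorem continuous_slH (hφ : Continuous (uncurry φ)) :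
    Continuous (slH (a := a) (b := b) φ hφ) := by
  rw [continuous_iff_continuousAt]
  intro t₀
  refine tendsto_iff_norm_sub_tendsto_zero.2 ?_
  have h1 : ∀ t, ∫ x in Ioo a b, (φ x t - φ x t₀) ^ 2
      = ‖slH (a := a) (b := b) φ hφ t - slH φ hφ t₀‖ ^ 2 := fun t =>
    integral_sub_eq_norm (coeFn_toH _).symm (coeFn_toH _).symm
  have h2 : Continuous fun t => ∫ x in a..b, (φ x t - φ x t₀) ^ 2 := by
    refine intervalIntegral.continuous_parametric_intervalIntegral_of_continuous' ?_ a b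
    have e1 : Continuous fun p : ℝ × ℝ => uncurry φ (p.2, p.1) := hφ.comp (by fun_prop)
    have e2 : Continuous fun p : ℝ × ℝ => uncurry φ (p.2, t₀) := hφ.comp (by fun_prop)
    exact (e1.sub e2).pow 2
  have h3 := (h2.tendsto t₀).sqrt
  have e : ∀ t, √(∫ x in a..b, (φ x t - φ x t₀) ^ 2)
      = ‖slH (a := a) (b := b) φ hφ t - slH φ hφ t₀‖ := by
    intro t
    rw [← integral_mu_eq hab.out.le, ← Real.sqrt_sq (norm_nonneg (slH φ hφ t - slH φ hφ t₀)),
      ← h1 t]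
  simpa [e] using h3

theorem hasDerivAt_inner_slH (hφ : ContDiff ℝ (⊤ : ℕ∞) (uncurry φ)) (k : HS a b) (t : ℝ) :
    HasDerivAt (fun t => ⟪k, slH φ hφ.continuous t⟫_ℝ)
      ⟪k, slH (pdt φ) (contDiff_pdt hφ).continuous t⟫_ℝ t := by
  have e : ∀ (ψ : ℝ → ℝ → ℝ) (hψ : Continuous (uncurry ψ)) (t : ℝ),
      ⟪k, slH ψ hψ t⟫_ℝ = ∫ x, k x * ψ x t ∂mu a b := fun ψ hψ t => by
    exact (real_inner_comm _ _).trans (inner_toH k _)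
  simp only [e]
  obtain ⟨C, hC⟩ := (isCompact_Icc.prod isCompact_Icc : IsCompact (Icc a b ×ˢ Icc (t - 1) (t + 1)))
    |>.exists_bound_of_continuousOn (contDiff_pdt hφ).continuous.continuousOn
  have hs : ∀ (ψ : ℝ → ℝ → ℝ) (hψ : Continuous (uncurry ψ)) (t : ℝ), Continuous fun x => ψ x t :=
    fun ψ hψ t => hψ.comp (by fun_prop : Continuous fun x => (x, t))
  refine (hasDerivAt_integral_of_dominated_loc_of_deriv_le (μ := mu a b)
    (F := fun s x => k x * φ x s) (F' := fun s x => k x * pdt φ x s) (bound := fun x => |k x| * C)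
    (Metric.ball_mem_nhds t one_pos) (.of_forall fun s => ?_) ?_ ?_ ?_ ?_ ?_).2
  · exact (integrable_mul_continuous (integrable_HS k) (hs φ hφ.continuous s)).1
  · exact integrable_mul_continuous (integrable_HS k) (hs φ hφ.continuous t)
  · exact (integrable_mul_continuous (integrable_HS k) (hs _ (contDiff_pdt hφ).continuous t)).1
  · filter_upwards [ae_mu_mem a b] with x hx s hs'
    rw [Real.norm_eq_abs, abs_mul]
    refine mul_le_mul_of_nonneg_left ?_ (abs_nonneg _)
    rw [Real.ball_eq_Ioo] at hs'
    exact hC (x, s) ⟨Ioo_subset_Icc_self hx, Ioo_subset_Icc_self hs'⟩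
  · exact (integrable_HS k).abs.mul_const _
  · exact .of_forall fun x s _ => (hasDerivAt_pdt hφ x s).const_mul _

theorem hasD_slH (hφ : ContDiff ℝ (⊤ : ℕ∞) (uncurry φ)) (t : ℝ) :
    HasD (slH (a := a) (b := b) φ hφ.continuous t)
      (slH (pdx φ) (contDiff_pdx hφ).continuous t) :=
  hasD_smooth (hφ.comp (by fun_prop : ContDiff ℝ (⊤ : ℕ∞) fun x : ℝ => (x, t)))

theorem zD_slH (hφ : ContDiff ℝ (⊤ : ℕ∞) (uncurry φ)) {t : ℝ} (ha : φ a t = 0) (hb : φ b t = 0) :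
    ZD (slH (a := a) (b := b) φ hφ.continuous t)
      (slH (pdx φ) (contDiff_pdx hφ).continuous t) :=
  ZD.of_smooth (hφ.comp (by fun_prop : ContDiff ℝ (⊤ : ℕ∞) fun x : ℝ => (x, t))) ha hb

theorem slH_eq_zero (hφ : Continuous (uncurry φ)) {t : ℝ} (h : ∀ x, φ x t = 0) :
    slH (a := a) (b := b) φ hφ t = 0 :=
  (Lp.eq_zero_iff_ae_eq_zero).2 ((coeFn_toH _).trans (.of_forall h))

end

end

section

variable {a b : ℝ} [hab : Fact (a < b)] {f f' : ℝ → ℝ} {M T : ℝ} {v w θ : ℝ → HS a b}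
  {φ : ℝ → ℝ → ℝ}

theorem heat_test (G : C11 f f' M) (hT : 0 ≤ T) (S : IsSol f f' 0 T v w θ)
    (hφ : ContDiff ℝ (⊤ : ℕ∞) (uncurry φ)) (hφT : ∀ x, φ x T = 0) :
    (∫ t in 0..T, ⟪θ t, slH (pdt φ) (contDiff_pdt hφ).continuous t⟫_ℝ)
        + ⟪θ 0, slH φ hφ.continuous 0⟫_ℝ
      = -∫ t in 0..T, (-⟪Dx (θ t), slH (pdx φ) (contDiff_pdx hφ).continuous t⟫_ℝ
        + Gf f f' (v t) (θ t) (slH φ hφ.continuous t)) := by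
  have F := force_Gf G hT S.wave.cv S.cur
  have hc := continuous_slH (a := a) (b := b) hφ.continuous
  have hcx := continuous_slH (a := a) (b := b) (contDiff_pdx hφ).continuous
  have hγ : IntervalIntegrable (fun r => 2 * M * C1 a b * ‖v r‖ * (‖θ r‖ + ‖Dx (θ r)‖))
      volume 0 T := by
    have hv' : ContinuousOn v (uIcc 0 T) := by rw [uIcc_of_le hT]; exact S.wave.cv
    have h1 : IntervalIntegrable (fun r => ‖θ r‖ + ‖Dx (θ r)‖) volume 0 T :=
      (S.cur.cOn hT).norm.intervalIntegrable.add (S.cur.int_D hT)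
    exact h1.continuousOn_mul (hv'.norm.const_mul _)
  have hV := fun t => hasD_slH (a := a) (b := b) hφ t
  refine time_test (cosB a b) hT S.cur.cont
    (h := fun n q => -kf a b n ^ 2 * ⟪cosH a b n, θ q⟫_ℝ + Gf f f' (v q) (θ q) (cosH a b n))
    (bnd := fun t => ‖Dx (θ t)‖ * ‖slH (a := a) (b := b) (pdx φ) (contDiff_pdx hφ).continuous t‖
      + 2 * M * C1 a b * ‖v t‖ * (‖θ t‖ + ‖Dx (θ t)‖)
        * (‖slH (a := a) (b := b) φ hφ.continuous t‖
          + ‖slH (a := a) (b := b) (pdx φ) (contDiff_pdx hφ).continuous t‖))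
    (fun n => ?_) (fun n r hr => ?_) (hasDerivAt_inner_slH hφ)
    (continuous_slH (contDiff_pdt hφ).continuous) (slH_eq_zero _ hφT) ?_ ?_ ?_
  · exact ((continuousOn_const.inner (S.cur.cOn hT)).const_mul _).intervalIntegrable.add
      (F.int hT n)
  · simpa only [cosB_apply] using S.heat n r hr
  · exact ((S.cur.int_D hT).mul_continuousOn hcx.norm.continuousOn).add
      (hγ.mul_continuousOn (hc.norm.add hcx.norm).continuousOn)
  · filter_upwards [S.cur.inV, F.lin] with t ht hL N
    simp only [cosB_apply]
    rw [heat_flux_trunc hL N (hV t).inV, (hV t).eq]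
    refine (abs_add_le _ _).trans (add_le_add ?_ ((hL.bound _ (inV_PN _ _)).trans ?_))
    · rw [abs_neg]
      exact (abs_real_inner_le_norm _ _).trans
        (mul_le_mul_of_nonneg_right (norm_DN_le N ht) (norm_nonneg _))
    · refine mul_le_mul_of_nonneg_left (add_le_add (norm_PN_le _ _) ?_) ?_
      · rw [Dx_PN, ← (hV t).eq]; exact norm_DN_le N (hV t).inV
      · have := G.M_nonneg
        have := C1_pos (a := a) (b := b)
        positivity
  · filter_upwards [S.cur.inV, F.lin] with t ht hL
    simp only [cosB_apply]
    have h1 : Tendsto (fun N => -⟪DN N (θ t), slH (pdx φ) (contDiff_pdx hφ).continuous t⟫_ℝ)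
        atTop (𝓝 (-⟪Dx (θ t), slH (pdx φ) (contDiff_pdx hφ).continuous t⟫_ℝ)) :=
      ((tendsto_DN ht).inner tendsto_const_nhds).neg
    have h2 := hL.tendsto (fun N => inV_PN N _) (hV t).inV (tendsto_PN _)
      (by simpa only [Dx_PN] using tendsto_DN (hV t).inV)
    refine (h1.add h2).congr fun N => ?_
    rw [heat_flux_trunc hL N (hV t).inV, (hV t).eq]

theorem wave_test (G : C11 f f' M) (hT : 0 ≤ T) (S : IsSol f f' 0 T v w θ)
    (hφ : ContDiff ℝ (⊤ : ℕ∞) (uncurry φ)) (hφT : ∀ x, φ x T = 0) (ha : ∀ t, φ a t = 0)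
    (hb : ∀ t, φ b t = 0) :
    (∫ t in 0..T, ⟪v t, slH (pdt φ) (contDiff_pdt hφ).continuous t⟫_ℝ)
        + ⟪v 0, slH φ hφ.continuous 0⟫_ℝ
      = -∫ t in 0..T, (-⟪w t, slH (pdx φ) (contDiff_pdx hφ).continuous t⟫_ℝ
        - ⟪FN f' (θ t), slH φ hφ.continuous t⟫_ℝ) := by
  have F := wforce_FN G S.cur
  have hc := continuous_slH (a := a) (b := b) hφ.continuous
  have hcx := continuous_slH (a := a) (b := b) (contDiff_pdx hφ).continuous
  have hw' : ContinuousOn w (uIcc 0 T) := by rw [uIcc_of_le hT]; exact S.wave.cw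
  have key : ∀ (t : ℝ) (N : ℕ), ∑ n ∈ Finset.range (N + 1),
      (-kf a b (n + 1) * ⟪cosH a b (n + 1), w t⟫_ℝ - ⟪sinH a b n, FN f' (θ t)⟫_ℝ)
        * ⟪sinH a b n, slH φ hφ.continuous t⟫_ℝ
      = -(∑ n ∈ Finset.range (N + 1 + 1), ⟪w t, cosB a b n⟫_ℝ
          * ⟪cosB a b n, slH (pdx φ) (contDiff_pdx hφ).continuous t⟫_ℝ)
        - ∑ n ∈ Finset.range (N + 1), ⟪FN f' (θ t), sinB a b n⟫_ℝ
          * ⟪sinB a b n, slH φ hφ.continuous t⟫_ℝ := by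
    intro t N
    obtain ⟨h1, h2⟩ := zD_slH (a := a) (b := b) hφ (ha t) (hb t)
    rw [Finset.sum_range_succ' _ (N + 1)]
    simp only [cosB_apply, sinB_apply, h1, h2, mul_zero, add_zero]
    rw [← Finset.sum_neg_distrib, ← Finset.sum_sub_distrib]
    refine Finset.sum_congr rfl fun n _ => ?_
    rw [real_inner_comm (cosH a b (n + 1)), real_inner_comm (sinH a b n)]
    ring
  refine time_test (sinB a b) hT S.wave.cv
    (h := fun n q => -kf a b (n + 1) * ⟪cosH a b (n + 1), w q⟫_ℝ - ⟪sinH a b n, FN f' (θ q)⟫_ℝ)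
    (bnd := fun t => ‖w t‖ * ‖slH (a := a) (b := b) (pdx φ) (contDiff_pdx hφ).continuous t‖
      + M * ‖Dx (θ t)‖ * ‖slH (a := a) (b := b) φ hφ.continuous t‖)
    (fun n => S.wave.int_v hT F n) (fun n r hr => ?_) (hasDerivAt_inner_slH hφ)
    (continuous_slH (contDiff_pdt hφ).continuous) (slH_eq_zero _ hφT) ?_ ?_ ?_
  · simpa only [sinB_apply] using S.wave.eqv n r hr
  · exact (hw'.norm.mul hcx.norm.continuousOn).intervalIntegrable.add
      (((S.cur.int_D hT).const_mul M).mul_continuousOn hc.norm.continuousOn)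
  · refine .of_forall fun t N => ?_
    simp only [sinB_apply] at key ⊢
    rw [key]
    refine (abs_sub _ _).trans (add_le_add ?_ ?_)
    · rw [abs_neg]; exact abs_sum_inner_mul_le _ _ _ _
    · have := abs_sum_inner_mul_le (sinB a b) (Finset.range (N + 1)) (FN f' (θ t))
        (slH φ hφ.continuous t)
      simp only [sinB_apply] at this
      exact this.trans (mul_le_mul_of_nonneg_right (norm_FN_le G _) (norm_nonneg _))
  · refine .of_forall fun t => ?_
    simp only [sinB_apply] at key ⊢
    have h1 := (tendsto_sum_inner_mul (cosB a b) (w t)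
      (slH (pdx φ) (contDiff_pdx hφ).continuous t)).comp (tendsto_add_atTop_nat 1)
    have h2 := tendsto_sum_inner_mul (sinB a b) (FN f' (θ t)) (slH φ hφ.continuous t)
    simp only [sinB_apply] at h2
    exact (h1.neg.sub h2).congr fun N => (key t N).symm

/-- The position curve with velocity `v`. -/
def Uc (U0 : HS a b) (v : ℝ → HS a b) (t : ℝ) : HS a b := U0 + ∫ s in 0..t, v s

theorem Uc_zero (U0 : HS a b) (v : ℝ → HS a b) : Uc U0 v 0 = U0 := by simp [Uc]

theorem inner_Uc {U0 : HS a b} (hv : ContinuousOn v (Icc 0 T)) (k : HS a b) {r : ℝ}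
    (hr : r ∈ Icc 0 T) : ⟪k, Uc U0 v r⟫_ℝ = ⟪k, U0⟫_ℝ + ∫ q in 0..r, ⟪k, v q⟫_ℝ := by
  have hi : IntervalIntegrable v volume 0 r := ContinuousOn.intervalIntegrable (by
    rw [uIcc_of_le hr.1]; exact hv.mono (Icc_subset_Icc_right hr.2))
  rw [Uc, inner_add_right]
  congr 1
  exact ((innerSL ℝ k).intervalIntegral_comp_comm hi).symm

theorem continuousOn_Uc {U0 : HS a b} (hT : 0 ≤ T) (hv : ContinuousOn v (Icc 0 T)) :
    ContinuousOn (Uc U0 v) (Icc 0 T) := by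
  rw [← uIcc_of_le hT] at hv ⊢
  exact continuousOn_const.add (intervalIntegral.continuousOn_primitive_interval'
    hv.intervalIntegrable left_mem_uIcc)

theorem zD_Uc (S : WaveEq 0 T (fun r => FN f' (θ r)) v w) {U0 : HS a b} (h0 : ZD U0 (w 0)) {r : ℝ}
    (hr : r ∈ Icc 0 T) : ZD (Uc U0 v r) (w r) := by
  refine ⟨fun n => ?_, (S.zero r hr).trans h0.2⟩
  rw [S.eqw n r hr, h0.1, inner_Uc S.cv _ hr, intervalIntegral.integral_const_mul, mul_add]

theorem Uc_test (hT : 0 ≤ T) (hv : ContinuousOn v (Icc 0 T)) (U0 : HS a b)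
    (hφ : ContDiff ℝ (⊤ : ℕ∞) (uncurry φ)) (hφT : ∀ x, φ x T = 0) :
    (∫ t in 0..T, ⟪Uc U0 v t, slH (pdt φ) (contDiff_pdt hφ).continuous t⟫_ℝ)
        + ⟪U0, slH φ hφ.continuous 0⟫_ℝ
      = -∫ t in 0..T, ⟪v t, slH φ hφ.continuous t⟫_ℝ := by
  have hc := continuous_slH (a := a) (b := b) hφ.continuous
  have hv' : ContinuousOn v (uIcc 0 T) := by rwa [uIcc_of_le hT]
  nth_rw 2 [← Uc_zero U0 v]
  refine time_test (sinB a b) hT (continuousOn_Uc hT hv) (h := fun n q => ⟪v q, sinB a b n⟫_ℝ)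
    (bnd := fun t => ‖v t‖ * ‖slH (a := a) (b := b) φ hφ.continuous t‖)
    (fun n => (hv'.inner continuousOn_const).intervalIntegrable) (fun n r hr => ?_)
    (hasDerivAt_inner_slH hφ)
    (continuous_slH (contDiff_pdt hφ).continuous) (slH_eq_zero _ hφT) ?_ ?_ ?_
  · simp only [inner_Uc hv _ hr, Uc_zero, real_inner_comm (sinB a b n)]
  · exact (hv'.norm.mul hc.norm.continuousOn).intervalIntegrable
  · exact .of_forall fun t N => abs_sum_inner_mul_le _ _ _ _
  · exact .of_forall fun t => tendsto_sum_inner_mul _ _ _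

end

section

variable {a b : ℝ} [hab : Fact (a < b)] {f f' : ℝ → ℝ} {M T : ℝ} {v w θ : ℝ → HS a b}
  {φ : ℝ → ℝ → ℝ}

theorem slice_FN (G : C11 (fe f f') (fe' f') M) {h : HS a b} {p q : ℝ → ℝ}
    (e : p =ᵐ[mu a b] h) (e' : q =ᵐ[mu a b] Dx h) (h0 : ∀ᵐ x ∂mu a b, 0 ≤ h x) :
    (fun x => f' (p x) * q x) =ᵐ[mu a b] FN (fe' f') h := by
  filter_upwards [coeFn_FN G h, e, e', h0] with x h1 h2 h3 h4
  rw [h1, h2, h3, fe'_of_nonneg h4]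

theorem slice_Gf (G : C11 (fe f f') (fe' f') M) {h k : HS a b} {p q r : ℝ → ℝ}
    (e : p =ᵐ[mu a b] h) (e' : q =ᵐ[mu a b] Dx h) (er : r =ᵐ[mu a b] k)
    (h0 : ∀ᵐ x ∂mu a b, 0 ≤ h x) (hφ : ContDiff ℝ (⊤ : ℕ∞) (uncurry φ)) (t : ℝ) :
    Gf (fe f f') (fe' f') k h (slH φ hφ.continuous t) =
      (∫ x, f' (p x) * q x * r x * φ x t ∂mu a b) + ∫ x, f (p x) * r x * pdx φ x t ∂mu a b := by
  rw [Gf, tri, tri]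
  congr 1
  · refine integral_congr_ae ?_
    have hs : slH (a := a) (b := b) φ hφ.continuous t =ᵐ[mu a b] fun x => φ x t := coeFn_toH _
    filter_upwards [slice_FN G e e' h0, er, hs] with x h1 h2 h3
    rw [← h1, h2, h3]; ring
  · refine integral_congr_ae ?_
    have hs : slH (a := a) (b := b) (pdx φ) (contDiff_pdx hφ).continuous t
      =ᵐ[mu a b] fun x => pdx φ x t := coeFn_toH _
    filter_upwards [coeFn_nem G h, er, hs, e, h0] with x h1 h2 h3 h4 h5
    rw [(hasD_slH hφ t).eq, h1, h2, h3, h4, fe_of_nonneg h5]; ring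

theorem _root_.TestU.smooth_pdt (H : TestU a b T φ) : TestU a b T (pdt φ) where
  smooth := contDiff_pdt H.smooth
  suppx := by
    obtain ⟨K, h1, h2, h3⟩ := H.suppx
    refine ⟨K, h1, h2, fun x t hx => ?_⟩
    simp [pdt, h3 x _ hx]
  suppt := by
    obtain ⟨T', h1, h2⟩ := H.suppt
    refine ⟨(T' + T) / 2, by linarith, fun x t ht => ?_⟩
    have : (fun s => φ x s) =ᶠ[𝓝 t] fun _ => 0 :=
      eventually_of_mem (Ioi_mem_nhds (by linarith : T' < t)) fun s hs => h2 x s (le_of_lt hs)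
    rw [pdt, this.deriv_eq, deriv_const]

theorem _root_.TestU.end_eq (H : TestU a b T φ) (x : ℝ) : φ x T = 0 := by
  obtain ⟨T', h1, h2⟩ := H.suppt
  exact h2 x T h1.le

theorem _root_.TestU.left (H : TestU a b T φ) (t : ℝ) : φ a t = 0 := by
  obtain ⟨K, h1, h2, h3⟩ := H.suppx
  exact h3 a t fun h => lt_irrefl _ (h2 h).1

theorem _root_.TestU.right (H : TestU a b T φ) (t : ℝ) : φ b t = 0 := by
  obtain ⟨K, h1, h2, h3⟩ := H.suppx
  exact h3 b t fun h => lt_irrefl _ (h2 h).2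

theorem _root_.TestT.end_eq (H : TestT T φ) (x : ℝ) : φ x T = 0 := by
  obtain ⟨T', h1, h2⟩ := H.suppt
  exact h2 x T h1.le

theorem _root_.TestInt.end_eq (H : TestInt a b T φ) (x : ℝ) : φ x T = 0 := by
  obtain ⟨K, h1, h2, h3⟩ := H.supptime
  exact h3 x T fun h => lt_irrefl _ (h2 h).2

theorem _root_.TestInt.start_eq (H : TestInt a b T φ) (x : ℝ) : φ x 0 = 0 := by
  obtain ⟨K, h1, h2, h3⟩ := H.supptime
  exact h3 x 0 fun h => lt_irrefl _ (h2 h).1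

theorem integral_mu_zero (hT : 0 ≤ T) (g : ℝ → ℝ) : ∫ t, g t ∂mu 0 T = ∫ t in 0..T, g t :=
  integral_mu_eq hT g

/-- Functions on `Ω × (0,T)` whose time slices are given by curves in `L²`. -/
structure Flds (f f' : ℝ → ℝ) (T : ℝ) (u ut ux Θ Θx : ℝ → ℝ → ℝ) (U v w θ : ℝ → HS a b) :
    Prop where
  su : Fld T u U
  sut : Fld T ut v
  sux : Fld T ux w
  sΘ : Fld T Θ θ
  sΘx : Fld T Θx fun t => Dx (θ t)
  pos : ∀ᵐ t ∂mu 0 T, ∀ᵐ x ∂mu a b, 0 ≤ θ t x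
  g1 : IntegrableOn (fun p : ℝ × ℝ => f' (Θ p.1 p.2) * Θx p.1 p.2) (Ioo a b ×ˢ Ioo 0 T)
  g2 : IntegrableOn (fun p : ℝ × ℝ => f' (Θ p.1 p.2) * Θx p.1 p.2 * ut p.1 p.2)
    (Ioo a b ×ˢ Ioo 0 T)
  g3 : IntegrableOn (fun p : ℝ × ℝ => f (Θ p.1 p.2) * ut p.1 p.2) (Ioo a b ×ˢ Ioo 0 T)

variable {u ut ux Θ Θx : ℝ → ℝ → ℝ} {U : ℝ → HS a b}

theorem Flds.fn (G : C11 (fe f f') (fe' f') M) (F : Flds f f' T u ut ux Θ Θx U v w θ) :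
    Fld T (fun x t => f' (Θ x t) * Θx x t) fun t => FN (fe' f') (θ t) where
  int := F.g1
  slice := by
    filter_upwards [F.sΘ.slice, F.sΘx.slice, F.pos] with t h1 h2 h3
    exact slice_FN G h1 h2 h3

theorem Flds.gf (G : C11 (fe f f') (fe' f') M) (F : Flds f f' T u ut ux Θ Θx U v w θ)
    (hφ : ContDiff ℝ (⊤ : ℕ∞) (uncurry φ)) :
    intOmT a b T (fun x t => f' (Θ x t) * Θx x t * ut x t * φ x t)
        + intOmT a b T (fun x t => f (Θ x t) * ut x t * pdx φ x t)
      = ∫ t, Gf (fe f f') (fe' f') (v t) (θ t) (slH φ hφ.continuous t) ∂mu 0 T ∧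
    Integrable (fun t => Gf (fe f f') (fe' f') (v t) (θ t) (slH φ hφ.continuous t)) (mu 0 T) := by
  obtain ⟨h1, i1⟩ := intOmT_eq (a := a) (b := b) (F := fun x t => f'
      (Θ x t) * Θx x t * ut x t * φ x t)
    (integrable_mul_test (u := fun x t => f' (Θ x t) * Θx x t * ut x t) F.g2 hφ.continuous)
  obtain ⟨h2, i2⟩ := intOmT_eq (a := a) (b := b) (F := fun x t => f (Θ x t) * ut x t * pdx φ x t)
    (integrable_mul_test (u := fun x t => f (Θ x t) * ut x t) F.g3 (contDiff_pdx hφ).continuous)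
  have e : (fun t => (∫ x, f' (Θ x t) * Θx x t * ut x t * φ x t ∂mu a b)
      + ∫ x, f (Θ x t) * ut x t * pdx φ x t ∂mu a b) =ᵐ[mu 0 T]
      fun t => Gf (fe f f') (fe' f') (v t) (θ t) (slH φ hφ.continuous t) := by
    filter_upwards [F.sΘ.slice, F.sΘx.slice, F.sut.slice, F.pos] with t k1 k2 k3 k4
    exact (slice_Gf G k1 k2 k3 k4 hφ t).symm
  rw [h1, h2, ← integral_add i1 i2]
  exact ⟨integral_congr_ae e, (i1.add i2).congr e⟩

theorem ut_weak_of_Uc (hT : 0 ≤ T) (hv : ContinuousOn v (Icc 0 T)) {U0 : HS a b}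
    (hu : Fld T u (Uc U0 v)) (hut : Fld T ut v) (H : TestInt a b T φ) :
    intOmT a b T (fun x t => u x t * pdt φ x t) = - intOmT a b T (fun x t => ut x t * φ x t) := by
  have h1 := Uc_test hT hv U0 H.smooth H.end_eq
  rw [slH_eq_zero _ H.start_eq, inner_zero_right, add_zero] at h1
  rw [(hu.test (contDiff_pdt H.smooth).continuous).1, (hut.test H.smooth.continuous).1,
    integral_mu_zero hT, integral_mu_zero hT]
  simpa only [real_inner_comm] using h1

theorem weak_u_of_sol (G : C11 (fe f f') (fe' f') M) (hT : 0 ≤ T) {U0 : HS a b} {u0 u0t : ℝ → ℝ}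
    (S : IsSol (fe f f') (fe' f') 0 T v w θ) (F : Flds f f' T u ut ux Θ Θx (Uc U0 v) v w θ)
    (e0 : u0 =ᵐ[mu a b] U0) (e1 : u0t =ᵐ[mu a b] v 0) (H : TestU a b T φ) :
    intOmT a b T (fun x t => u x t * pdt (pdt φ) x t)
        - intOm a b (fun x => u0t x * φ x 0) + intOm a b (fun x => u0 x * pdt φ x 0)
      = - intOmT a b T (fun x t => ux x t * pdx φ x t)
        - intOmT a b T (fun x t => f' (Θ x t) * Θx x t * φ x t) := by
  have H' := H.smooth_pdt
  have h1 := Uc_test hT S.wave.cv U0 H'.smooth H'.end_eq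
  have h2 := wave_test G hT S H.smooth H.end_eq H.left H.right
  obtain ⟨e2, i2⟩ := F.sux.test (contDiff_pdx H.smooth).continuous
  obtain ⟨e3, i3⟩ := (F.fn G).test H.smooth.continuous
  have e4 : intOm a b (fun x => u0t x * φ x 0) = ⟪v 0, slH φ H.smooth.continuous 0⟫_ℝ :=
    (integral_mul_toH e1 _).trans (real_inner_comm _ _)
  have e5 : intOm a b (fun x => u0 x * pdt φ x 0) = ⟪U0, slH (pdt φ) H'.smooth.continuous 0⟫_ℝ :=
    (integral_mul_toH e0 _).trans (real_inner_comm _ _)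
  rw [(F.su.test (contDiff_pdt H'.smooth).continuous).1, e2, e3, e4, e5, ← neg_add',
    ← integral_add i2 i3, integral_mu_zero hT, integral_mu_zero hT]
  simp only [← neg_add', intervalIntegral.integral_neg, neg_neg] at h2
  simp only [real_inner_comm (slH _ _ _)] at h1 h2 ⊢
  linarith

theorem weak_Θ_of_sol (G : C11 (fe f f') (fe' f') M) (hT : 0 ≤ T) {Θ0 : ℝ → ℝ}
    (S : IsSol (fe f f') (fe' f') 0 T v w θ) (F : Flds f f' T u ut ux Θ Θx U v w θ)
    (e0 : Θ0 =ᵐ[mu a b] θ 0) (H : TestT T φ) :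
    - intOmT a b T (fun x t => Θ x t * pdt φ x t) - intOm a b (fun x => Θ0 x * φ x 0)
      = - intOmT a b T (fun x t => Θx x t * pdx φ x t)
        + intOmT a b T (fun x t => f' (Θ x t) * Θx x t * ut x t * φ x t)
        + intOmT a b T (fun x t => f (Θ x t) * ut x t * pdx φ x t) := by
  have h1 := heat_test G hT S H.smooth H.end_eq
  obtain ⟨e2, i2⟩ := F.sΘx.test (contDiff_pdx H.smooth).continuous
  obtain ⟨e3, i3⟩ := F.gf G H.smooth
  have e4 : intOm a b (fun x => Θ0 x * φ x 0) = ⟪θ 0, slH φ H.smooth.continuous 0⟫_ℝ :=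
    (integral_mul_toH e0 _).trans (real_inner_comm _ _)
  rw [add_assoc, e3, e2, e4, (F.sΘ.test (contDiff_pdt H.smooth).continuous).1, neg_add_eq_sub,
    ← integral_sub i3 i2, integral_mu_zero hT, integral_mu_zero hT]
  simp only [neg_add_eq_sub, real_inner_comm (Dx _)] at h1 ⊢
  simp only [real_inner_comm (θ _)] at h1 ⊢
  linarith

end

section

variable {a b : ℝ} [hab : Fact (a < b)] {f f' : ℝ → ℝ} {M T : ℝ} {U v w θ : ℝ → HS a b}
  {u ut ux Θ Θx : ℝ → ℝ → ℝ}

theorem CurV.aesm_Dx {s t : ℝ} {θ : ℝ → HS a b} (H : CurV s t θ) :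
    AEStronglyMeasurable (fun r => Dx (θ r)) (volume.restrict (Ioc s t)) := by
  refine aestronglyMeasurable_of_tendsto_ae atTop (f := fun N r => DN N (θ r)) (fun N => ?_) ?_
  · exact (((continuous_DN N).comp_continuousOn H.cont).mono
      Ioc_subset_Icc_self).aestronglyMeasurable measurableSet_Ioc
  · exact H.inV.mono fun r hr => tendsto_DN hr

theorem integrable_sq_of_cont {W : ℝ → HS a b} (h : ContinuousOn W (Icc 0 T)) :
    Integrable (fun t => ‖W t‖ ^ 2) (mu 0 T) :=
  (h.norm.pow 2).integrableOn_Icc.mono_set Ioo_subset_Icc_self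

theorem ae_mu_of_Icc {P : ℝ → Prop} (h : ∀ t ∈ Icc 0 T, P t) : ∀ᵐ t ∂mu 0 T, P t :=
  (ae_mu_mem 0 T).mono fun _ ht => h _ (Ioo_subset_Icc_self ht)

instance isFiniteMeasure_prod (a b T : ℝ) :
    IsFiniteMeasure ((volume : Measure (ℝ × ℝ)).restrict (Ioo a b ×ˢ Ioo 0 T)) := by
  rw [restrict_prod_eq]; infer_instance

/-- Measurable functions with slices in `L²`, whose nonlinear products are integrable. -/
theorem Flds.of_slices (G : C11 (fe f f') (fe' f') M) (hT : 0 ≤ T)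
    (S : IsSol (fe f f') (fe' f') 0 T v w θ) (hU : ContinuousOn U (Icc 0 T))
    (hmu : Measurable (uncurry u)) (hmut : Measurable (uncurry ut)) (mux : Measurable (uncurry ux))
    (mΘ : Measurable (uncurry Θ)) (mΘx : Measurable (uncurry Θx)) (pos : ∀ x t, 0 ≤ Θ x t)
    (hu : ∀ t ∈ Icc 0 T, (fun x => u x t) =ᵐ[mu a b] U t)
    (hut : ∀ t ∈ Icc 0 T, (fun x => ut x t) =ᵐ[mu a b] v t)
    (hux : ∀ t ∈ Icc 0 T, (fun x => ux x t) =ᵐ[mu a b] w t)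
    (hΘ : ∀ t ∈ Icc 0 T, (fun x => Θ x t) =ᵐ[mu a b] θ t)
    (hΘx : ∀ᵐ t ∂mu 0 T, (fun x => Θx x t) =ᵐ[mu a b] Dx (θ t)) :
    Flds f f' T u ut ux Θ Θx U v w θ ∧
      IntegrableOn (fun p : ℝ × ℝ => Θ p.1 p.2 ^ 2) (Ioo a b ×ˢ Ioo 0 T) ∧
      IntegrableOn (fun p : ℝ × ℝ => Θx p.1 p.2 ^ 2) (Ioo a b ×ˢ Ioo 0 T) := by
  have aes : ∀ {g : ℝ → ℝ → ℝ}, Measurable (uncurry g) →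
      AEStronglyMeasurable (fun p : ℝ × ℝ => g p.1 p.2)
        (volume.restrict (Ioo a b ×ˢ Ioo 0 T)) := fun h => h.aestronglyMeasurable
  have Lu := memLp_of_slices (aes hmu) (ae_mu_of_Icc hu) (integrable_sq_of_cont hU)
  have Lut := memLp_of_slices (aes hmut) (ae_mu_of_Icc hut) (integrable_sq_of_cont S.wave.cv)
  have Lux := memLp_of_slices (aes mux) (ae_mu_of_Icc hux) (integrable_sq_of_cont S.wave.cw)
  have LΘ := memLp_of_slices (aes mΘ) (ae_mu_of_Icc hΘ) (integrable_sq_of_cont S.cur.cont)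
  have LΘx := memLp_of_slices (aes mΘx) hΘx ((S.cur.iD2 hT).mono_set Ioo_subset_Ioc_self)
  have e1 : ∀ p : ℝ × ℝ, f' (Θ p.1 p.2) = fe' f' (Θ p.1 p.2) := fun p =>
    (fe'_of_nonneg (pos _ _)).symm
  have e2 : ∀ p : ℝ × ℝ, f (Θ p.1 p.2) = fe f f' (Θ p.1 p.2) := fun p =>
    (fe_of_nonneg (pos _ _)).symm
  have L1 : MemLp (fun p : ℝ × ℝ => f' (Θ p.1 p.2) * Θx p.1 p.2) 2
      (volume.restrict (Ioo a b ×ˢ Ioo 0 T)) := by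
    simp only [e1]
    refine LΘx.of_le_mul (c := M) ((G.continuous'.measurable.comp mΘ).mul
      mΘx).aestronglyMeasurable (.of_forall fun p => ?_)
    rw [norm_mul]
    exact mul_le_mul_of_nonneg_right (G.bdd _) (norm_nonneg _)
  have L2 : MemLp (fun p : ℝ × ℝ => f (Θ p.1 p.2)) 2
      (volume.restrict (Ioo a b ×ˢ Ioo 0 T)) := by
    simp only [e2]
    exact LΘ.of_le_mul (c := M) (G.continuous.measurable.comp mΘ).aestronglyMeasurable
      (.of_forall fun p => G.abs_le _)
  refine ⟨⟨⟨Lu.integrable one_le_two, ae_mu_of_Icc hu⟩,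
      ⟨Lut.integrable one_le_two, ae_mu_of_Icc hut⟩,
    ⟨Lux.integrable one_le_two, ae_mu_of_Icc hux⟩, ⟨LΘ.integrable one_le_two, ae_mu_of_Icc hΘ⟩,
    ⟨LΘx.integrable one_le_two, hΘx⟩, ae_mu_of_Icc fun t ht => ?_, L1.integrable one_le_two,
    L1.integrable_mul Lut, L2.integrable_mul Lut⟩, LΘ.integrable_sq, LΘx.integrable_sq⟩
  filter_upwards [hΘ t ht] with x hx
  rw [← hx]; exact pos x t

theorem IsWeakSol.of_flds (G : C11 (fe f f') (fe' f') M) (hT : 0 < T) {U0 : HS a b}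
    (h0 : ZD U0 (w 0)) (S : IsSol (fe f f') (fe' f') 0 T v w θ)
    (F : Flds f f' T u ut ux Θ Θx (Uc U0 v) v w θ) (pos : ∀ x t, 0 ≤ Θ x t)
    (hu : ∀ t ∈ Icc 0 T, (fun x => u x t) =ᵐ[mu a b] Uc U0 v t) {u0 u0t Θ0 : ℝ → ℝ}
    (e0 : u0 =ᵐ[mu a b] U0) (e1 : u0t =ᵐ[mu a b] v 0) (e2 : Θ0 =ᵐ[mu a b] θ 0) :
    IsWeakSol a b T f f' u0 u0t Θ0 u ut ux Θ Θx where
  u_sliceL1 t ht := (integrable_congr (hu t ht)).2 (integrable_HS _)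
  u_contL1 t₀ h₀ := by
    have hc := continuousOn_Uc (U0 := U0) hT.le S.wave.cv t₀ h₀
    refine squeeze_zero' (g := fun t => ‖Uc U0 v t - Uc U0 v t₀‖ * ‖toH a b
        (fun _ => 1) continuous_const‖)
      (.of_forall fun t => integral_nonneg fun x => abs_nonneg _) ?_ ?_
    · filter_upwards [self_mem_nhdsWithin] with t ht
      refine le_trans (le_of_eq ?_) (integral_abs_mul_le (Uc U0 v t - Uc U0 v t₀)
        (toH a b (fun _ => 1) continuous_const))
      refine integral_congr_ae ?_
      filter_upwards [hu t ht, hu t₀ h₀, Lp.coeFn_sub (Uc U0 v t) (Uc U0 v t₀),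
        coeFn_toH (a := a) (b := b) (continuous_const (y := (1 : ℝ)))] with x h1 h2 h3 h4
      rw [h1, h2, h3, h4]; simp
    · have := (hc.tendsto.sub (tendsto_const_nhds (x := Uc U0 v t₀))).norm.mul_const
        ‖toH a b (fun _ => 1) continuous_const‖
      simpa using this
  u_int := F.su.int
  ux_int := F.sux.int
  u_W0 := by
    filter_upwards [F.su.slice, F.sux.slice, ae_mu_mem 0 T] with t h1 h2 h3
    exact (zD_Uc S.wave h0 (Ioo_subset_Icc_self h3)).weak h1 h2
  Θ_int := F.sΘ.int
  Θx_int := F.sΘx.int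
  Θ_W := by
    have hV : ∀ᵐ t ∂mu 0 T, InV
        (θ t) := ae_restrict_of_ae_restrict_of_subset Ioo_subset_Ioc_self S.cur.inV
    filter_upwards [F.sΘ.slice, F.sΘx.slice, hV] with t h1 h2 h3
    exact h3.hasD.weak h1 h2
  Θ_nonneg := .of_forall fun p => pos _ _
  ut_weak φ H := ut_weak_of_Uc hT.le S.wave.cv F.su F.sut H
  ut_int := F.sut.int
  g1_int := F.g1
  g2_int := F.g2
  g3_int := F.g3
  weak_u φ H := weak_u_of_sol G hT.le S F e0 e1 H
  weak_Θ φ H := weak_Θ_of_sol G hT.le S F e2 H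

theorem exists_weak_sol (G : C11 (fe f f') (fe' f') M) {u0 u0x u0t Θ0 : ℝ → ℝ}
    (D : DataI a b u0 u0x u0t Θ0) : ∃ u ut ux Θ Θx : ℝ → ℝ → ℝ,
      (∀ T > (0 : ℝ), IsWeakSol a b T f f' u0 u0t Θ0 u ut ux Θ Θx) ∧
        ∀ T > (0 : ℝ), RegT a b T u ut ux Θ Θx := by
  have k0 := coeFn_mkH D.u0_L2.memLp
  have kx := coeFn_mkH D.u0x_L2.memLp
  have kt := coeFn_mkH D.u0t_L2.memLp
  have kΘ := coeFn_mkH D.Θ0_L2.memLp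
  have hpos : ∀ᵐ x ∂mu a b, 0 ≤ mkH a b Θ0 x := by
    filter_upwards [kΘ, D.Θ0_nonneg] with x h1 h2
    rwa [h1]
  have hZ : ZD (mkH a b u0) (mkH a b u0x) := ZD.of_weak D.u0_W0 k0.symm kx.symm
  obtain ⟨v, w, θ, ev, ew, eθ, S, pos⟩ := global_pos G (mkH a b u0t) (mkH a b u0x) hpos
  rw [← ew] at hZ
  set U0 := mkH a b u0
  have hc : ∀ {W : ℝ → HS a b}, (∀ T > 0, ContinuousOn W (Icc 0 T)) →
      StronglyMeasurable fun t => W (max t 0) := by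
    intro W hW
    have h1 : ContinuousOn W (Ici 0) := by
      intro t ht
      have h2 := hW (t + 1) (by linarith [mem_Ici.1 ht]) t ⟨ht, by linarith⟩
      refine h2.mono_of_mem_nhdsWithin ?_
      exact inter_mem_nhdsWithin _ (Iic_mem_nhds (by linarith))
    exact (h1.comp_continuous (by fun_prop) fun t => mem_Ici.2
        (le_max_right t 0)).stronglyMeasurable
  have hD : AEStronglyMeasurable (fun t => Dx (θ t)) (volume.restrict (Ioi 0)) := by
    have e : Ioi (0 : ℝ) = ⋃ n : ℕ, Ioc 0 (n : ℝ) := by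
      ext x
      simp only [mem_Ioi, mem_iUnion, mem_Ioc]
      exact ⟨fun h => ⟨_, h, Nat.le_ceil x⟩, fun ⟨n, h, _⟩ => h⟩
    rw [e, aestronglyMeasurable_iUnion_iff]
    exact fun n => (S n n.cast_nonneg).cur.aesm_Dx
  obtain ⟨gu, mu', hu⟩ := joint_rep (hc fun T hT => continuousOn_Uc (U0 := U0) hT.le
      (S T hT.le).wave.cv)
  obtain ⟨gv, mv, hv⟩ := joint_rep (hc fun T hT => (S T hT.le).wave.cv)
  obtain ⟨gw, mw, hw⟩ := joint_rep (hc fun T hT => (S T hT.le).wave.cw)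
  obtain ⟨gθ, mθ, hθ⟩ := joint_rep (hc fun T hT => (S T hT.le).cur.cont)
  obtain ⟨gx, mx, hx⟩ := joint_rep hD.stronglyMeasurable_mk
  have sl : ∀ {W : ℝ → HS a b} {g : ℝ → ℝ → ℝ}, (∀ t, (fun x => g x t) =ᵐ[mu a b] W (max t 0)) →
      ∀ T, ∀ t ∈ Icc 0 T, (fun x => g x t) =ᵐ[mu a b] W t := fun h T t ht => by
    simpa only [max_eq_left ht.1] using h t
  have sΘ : ∀ T, ∀ t ∈ Icc 0 T, (fun x => max (gθ x t) 0) =ᵐ[mu a b] θ t := fun T t ht => by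
    filter_upwards [sl hθ T t ht, pos t ht.1] with x h1 h2
    rw [h1, max_eq_left h2]
  have sx : ∀ T, ∀ᵐ t ∂mu 0 T, (fun x => gx x t) =ᵐ[mu a b] Dx (θ t) := fun T => by
    filter_upwards [ae_restrict_of_ae_restrict_of_subset Ioo_subset_Ioi_self hD.ae_eq_mk] with t ht
    rw [ht]; exact hx t
  have F := fun T (hT : 0 < T) => Flds.of_slices (Θ := fun x t => max (gθ x t) 0) G hT.le
      (S T hT.le)
    (continuousOn_Uc (U0 := U0) hT.le (S T hT.le).wave.cv) mu' mv mw (mθ.max measurable_const) mx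
    (fun x t => le_max_right _ _) (sl hu T) (sl hv T) (sl hw T) (sΘ T) (sx T)
  refine ⟨gu, gv, gw, fun x t => max (gθ x t) 0, gx, fun T hT => ?_, fun T hT => ?_⟩
  · exact IsWeakSol.of_flds G hT hZ (S T hT.le) (F T hT).1 (fun x t => le_max_right _ _) (sl hu T)
      k0.symm (ev ▸ kt.symm) (eθ ▸ kΘ.symm)
  · exact ⟨contL2_of_slices (continuousOn_Uc hT.le (S T hT.le).wave.cv) (sl hu T),
      contL2_of_slices (S T hT.le).wave.cw (sl hw T),
      fun t ht => (zD_Uc (S T hT.le).wave hZ ht).weak (sl hu T t ht) (sl hw T t ht),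
      contL2_of_slices (S T hT.le).wave.cv (sl hv T),
      contL2_of_slices (S T hT.le).cur.cont (sΘ T), (F T hT).2.1, (F T hT).2.2⟩

end

section

variable {T : ℝ} {z h : ℝ → ℝ}

theorem continuousOn_prim (hT : 0 ≤ T) (hh : IntervalIntegrable h volume 0 T) :
    ContinuousOn (fun r => ∫ q in 0..r, h q) (Icc 0 T) := by
  have := intervalIntegral.continuousOn_primitive_interval' hh left_mem_uIcc
  rwa [uIcc_of_le hT] at this

theorem eqOn_of_mu (hT : 0 < T) {y : ℝ → ℝ} (hz : ContinuousOn z (Icc 0 T))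
    (hy : ContinuousOn y (Icc 0 T)) (e : z =ᵐ[mu 0 T] y) : EqOn z y (Icc 0 T) := by
  refine Measure.eqOn_Icc_of_ae_eq volume hT.ne ?_ hz hy
  rwa [← Measure.restrict_congr_set Ioo_ae_eq_Icc]

/-- Temporal test functions that are constant near `0` and vanish near `T`. -/
structure TimeTest (T : ℝ) (χ : ℝ → ℝ) : Prop where
  smooth : ContDiff ℝ (⊤ : ℕ∞) χ
  suppt : ∃ T' < T, ∀ t, T' ≤ t → χ t = 0
  supp : tsupport (deriv χ) ⊆ Ioo 0 T

theorem exists_timeTest (hT : 0 < T) {ρ : ℝ → ℝ} (hρ : ContDiff ℝ (⊤ : ℕ∞) ρ)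
    (hs : tsupport ρ ⊆ Ioo 0 T) : ∃ χ, TimeTest T χ ∧ deriv χ = ρ := by
  have : Fact (0 < T) := ⟨hT⟩
  have hd : ∀ x, HasDerivAt (fun x => ∫ y in T..x, ρ y) (ρ x) x := fun x =>
    intervalIntegral.integral_hasDerivAt_right (hρ.continuous.intervalIntegrable _ _)
      hρ.continuous.stronglyMeasurable.stronglyMeasurableAtFilter hρ.continuous.continuousAt
  have hd' : deriv (fun x => ∫ y in T..x, ρ y) = ρ := funext fun x => (hd x).deriv
  refine ⟨fun x => ∫ y in T..x, ρ y, ⟨?_, ?_, by rwa [hd']⟩, hd'⟩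
  · refine contDiff_infty_iff_deriv.2 ⟨fun x => (hd x).differentiableAt, ?_⟩
    rw [hd']; exact hρ
  · have hK : IsCompact (tsupport ρ) :=
      isCompact_Icc.of_isClosed_subset (isClosed_tsupport _) (hs.trans Ioo_subset_Icc_self)
    obtain ⟨c, d, _, _, hdT, hK'⟩ := exists_Icc_of_compact hK hs
    refine ⟨(d + T) / 2, by linarith, fun t ht => ?_⟩
    refine (intervalIntegral.integral_congr (g := fun _ => (0 : ℝ)) fun y hy => ?_).trans (by simp)
    refine image_eq_zero_of_notMem_tsupport fun h => ?_
    have := (hK' h).2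
    rcases min_le_iff.1 hy.1 with h' | h' <;> linarith

theorem integrable_mu_of_cont (hz : ContinuousOn z (Icc 0 T)) : Integrable z (mu 0 T) :=
  hz.integrableOn_Icc.mono_set Ioo_subset_Icc_self

/-- The fundamental theorem of calculus, tested against functions constant near `0`. -/
theorem eq_add_integral_of_test (hT : 0 < T) (hz : ContinuousOn z (Icc 0 T))
    (hh : IntervalIntegrable h volume 0 T) {c : ℝ}
    (H : ∀ χ, TimeTest T χ →
      (∫ t in 0..T, deriv χ t * z t) + c * χ 0 = -∫ t in 0..T, χ t * h t) :
    ∀ r ∈ Icc 0 T, z r = c + ∫ q in 0..r, h q := by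
  have hy : ContinuousOn (fun r => c + ∫ q in 0..r, h q) (Icc 0 T) :=
    continuousOn_const.add (continuousOn_prim hT.le hh)
  refine eqOn_of_mu hT hz hy ?_
  have hi := (integrable_mu_of_cont hz).sub (integrable_mu_of_cont hy)
  have h0 := ae_eq_zero_of_integral_contDiff hi fun ρ hρ hs => by
    obtain ⟨χ, hχ, rfl⟩ := exists_timeTest hT hρ hs
    obtain ⟨T', hT', hv⟩ := hχ.suppt
    have h1 := integral_parts hT.le hy hh (fun r _ => by simp) (hasDerivAt_of_smooth hχ.smooth)
      hρ.continuous
    have h2 := H χ hχ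
    rw [hv T hT'.le] at h1
    rw [integral_mu_zero hT.le]
    have i1 : IntervalIntegrable (fun t => deriv χ t * z t) volume 0 T :=
      ((hρ.continuous.continuousOn.mul hz).intervalIntegrable_of_Icc hT.le)
    have i2 : IntervalIntegrable (fun t => deriv χ t * (c + ∫ q in 0..t, h q)) volume 0 T :=
      ((hρ.continuous.continuousOn.mul hy).intervalIntegrable_of_Icc hT.le)
    have h3 := intervalIntegral.integral_sub i1 i2
    simp only [intervalIntegral.integral_same, add_zero] at h1
    refine (intervalIntegral.integral_congr fun t _ => ?_).trans (h3.trans (by linarith))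
    simp only [Pi.sub_apply]; ring
  filter_upwards [h0] with t ht
  exact sub_eq_zero.1 ht

/-- The fundamental theorem of calculus, tested against functions with compact support. -/
theorem eq_add_integral_of_test_int (hT : 0 < T) (hz : ContinuousOn z (Icc 0 T))
    (hh : IntervalIntegrable h volume 0 T)
    (H : ∀ χ : ℝ → ℝ, ContDiff ℝ (⊤ : ℕ∞) χ → tsupport χ ⊆ Ioo 0 T →
      (∫ t in 0..T, deriv χ t * z t) = -∫ t in 0..T, χ t * h t) :
    ∀ r ∈ Icc 0 T, z r = z 0 + ∫ q in 0..r, h q := by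
  have : Fact (0 < T) := ⟨hT⟩
  have hy := continuousOn_prim hT.le hh
  have hi := (integrable_mu_of_cont hz).sub (integrable_mu_of_cont hy)
  obtain ⟨c, hc⟩ := ae_eq_const_of_test hi fun χ hχ hs => by
    have hρ := cont_deriv_of_smooth hχ
    have h1 := integral_parts hT.le hy hh (fun r _ => by simp) (hasDerivAt_of_smooth hχ) hρ
    have h2 := H χ hχ hs
    obtain ⟨e0, e1⟩ := zero_of_tsupport hs
    rw [e0, e1] at h1
    rw [integral_mu_zero hT.le]
    have i1 : IntervalIntegrable (fun t => deriv χ t * z t) volume 0 T :=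
      ((hρ.continuousOn.mul hz).intervalIntegrable_of_Icc hT.le)
    have i2 : IntervalIntegrable (fun t => deriv χ t * (∫ q in 0..t, h q)) volume 0 T :=
      ((hρ.continuousOn.mul hy).intervalIntegrable_of_Icc hT.le)
    have h3 := intervalIntegral.integral_sub i1 i2
    refine (intervalIntegral.integral_congr fun t _ => ?_).trans (h3.trans (by linarith))
    simp only [Pi.sub_apply]; ring
  have key : EqOn z (fun r => c + ∫ q in 0..r, h q) (Icc 0 T) :=
    eqOn_of_mu hT hz (continuousOn_const.add hy) <| by
      filter_upwards [hc] with t ht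
      simp only [Pi.sub_apply] at ht; linarith
  intro r hr
  rw [key hr, key (left_mem_Icc.2 hT.le)]; simp

theorem exists_time_slope (hT : 0 < T) : ∃ χ : ℝ → ℝ, ContDiff ℝ (⊤ : ℕ∞) χ ∧
    (∃ T' < T, ∀ t, T' ≤ t → χ t = 0) ∧ deriv χ 0 = 1 := by
  let β : ContDiffBump (0 : ℝ) := ⟨T / 4, T / 2, by positivity, by linarith⟩
  refine ⟨fun t => t * β t, contDiff_id.mul β.contDiff, ⟨T / 2, by linarith, fun t ht => ?_⟩, ?_⟩
  · show t * β t = 0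
    rw [β.zero_of_le_dist, mul_zero]
    rw [Real.dist_eq, sub_zero]; exact ht.trans (le_abs_self t)
  · have h1 : HasDerivAt β (deriv β 0) 0 := (β.contDiff (n := 1)).differentiable
        (by simp) 0 |>.hasDerivAt
    have h2 := (hasDerivAt_id (0 : ℝ)).mul h1
    have h3 : β 0 = 1 := β.one_of_mem_closedBall (Metric.mem_closedBall_self (by positivity))
    refine h2.deriv.trans ?_
    simp [h3]

end

section

variable {a b : ℝ} [hab : Fact (a < b)] {f f' : ℝ → ℝ} {M T : ℝ} {U v w θ : ℝ → HS a b}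
  {u ut ux Θ Θx : ℝ → ℝ → ℝ} {χ ψ : ℝ → ℝ}

theorem contDiff_prodTest (hχ : ContDiff ℝ (⊤ : ℕ∞) χ) (hψ : ContDiff ℝ (⊤ : ℕ∞) ψ) :
    ContDiff ℝ (⊤ : ℕ∞) (uncurry fun x t => χ t * ψ x) :=
  (hχ.comp contDiff_snd).mul (hψ.comp contDiff_fst)

theorem pdt_prodTest (hχ : ContDiff ℝ (⊤ : ℕ∞) χ) (ψ : ℝ → ℝ) :
    pdt (fun x t => χ t * ψ x) = fun x t => deriv χ t * ψ x := by
  ext x t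
  exact ((hasDerivAt_of_smooth hχ t).mul_const _).deriv

theorem pdx_prodTest (χ : ℝ → ℝ) (hψ : ContDiff ℝ (⊤ : ℕ∞) ψ) :
    pdx (fun x t => χ t * ψ x) = fun x t => χ t * deriv ψ x := by
  ext x t
  exact ((hasDerivAt_of_smooth hψ x).const_mul _).deriv

theorem contDiff_deriv (hχ : ContDiff ℝ (⊤ : ℕ∞) χ) : ContDiff ℝ (⊤ : ℕ∞) (deriv χ) :=
  (contDiff_infty_iff_deriv.1 hχ).2

theorem slH_prodTest (hψ : Continuous ψ)
    (h : Continuous (uncurry fun x t => χ t * ψ x)) (t : ℝ) :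
    slH (a := a) (b := b) (fun x t => χ t * ψ x) h t = χ t • toH a b ψ hψ := by
  refine Lp.ext ?_
  filter_upwards [coeFn_toH (a := a) (b := b) (h.comp (by fun_prop : Continuous fun x => (x, t))),
    Lp.coeFn_smul (χ t) (toH a b ψ hψ), coeFn_toH (a := a) (b := b) hψ] with x h1 h2 h3
  rw [h2, Pi.smul_apply, h3]
  exact h1

theorem Fld.prodTest (hT : 0 ≤ T) (H : Fld T u U) (hχ : Continuous χ) (hψ : Continuous ψ) :
    intOmT a b T (fun x t => u x t * (χ t * ψ x)) = ∫ t in 0..T, χ t * ⟪toH a b ψ hψ, U t⟫_ℝ := by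
  have hc : Continuous (uncurry fun x t => χ t * ψ x) :=
    (hχ.comp continuous_snd).mul (hψ.comp continuous_fst)
  rw [(H.test hc).1, integral_mu_zero hT]
  simp only [slH_prodTest hψ, real_inner_smul_left]

theorem intOm_prodTest {g : ℝ → ℝ} {h : HS a b} (e : g =ᵐ[mu a b] h) (c : ℝ) (hψ : Continuous ψ) :
    intOm a b (fun x => g x * (c * ψ x)) = c * ⟪toH a b ψ hψ, h⟫_ℝ := by
  rw [← integral_mul_toH e hψ, intOm, ← integral_const_mul]
  exact integral_congr_ae (.of_forall fun x => by ring)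

theorem testInt_prod (hχ : ContDiff ℝ (⊤ : ℕ∞) χ) (hs : tsupport χ ⊆ Ioo 0 T)
    (hψ : ContDiff ℝ (⊤ : ℕ∞) ψ) (hs' : tsupport ψ ⊆ Ioo a b) :
    TestInt a b T (fun x t => χ t * ψ x) := by
  refine ⟨contDiff_prodTest hχ hψ, ⟨tsupport ψ, ?_, hs', fun x t hx => ?_⟩,
    ⟨tsupport χ, ?_, hs, fun x t ht => ?_⟩⟩
  · exact isCompact_Icc.of_isClosed_subset (isClosed_tsupport _) (hs'.trans Ioo_subset_Icc_self)
  · rw [image_eq_zero_of_notMem_tsupport hx, mul_zero]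
  · exact isCompact_Icc.of_isClosed_subset (isClosed_tsupport _) (hs.trans Ioo_subset_Icc_self)
  · rw [image_eq_zero_of_notMem_tsupport ht, zero_mul]

theorem testU_prod (hχ : ContDiff ℝ (⊤ : ℕ∞) χ) (hs : ∃ T' < T, ∀ t, T' ≤ t → χ t = 0)
    (hψ : ContDiff ℝ (⊤ : ℕ∞) ψ) (hs' : tsupport ψ ⊆ Ioo a b) :
    TestU a b T (fun x t => χ t * ψ x) := by
  obtain ⟨T', h1, h2⟩ := hs
  refine ⟨contDiff_prodTest hχ hψ, ⟨tsupport ψ, ?_, hs', fun x t hx => ?_⟩,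
    ⟨T', h1, fun x t ht => ?_⟩⟩
  · exact isCompact_Icc.of_isClosed_subset (isClosed_tsupport _) (hs'.trans Ioo_subset_Icc_self)
  · rw [image_eq_zero_of_notMem_tsupport hx, mul_zero]
  · rw [h2 t ht, zero_mul]

theorem testT_prod (hχ : ContDiff ℝ (⊤ : ℕ∞) χ) (hs : ∃ T' < T, ∀ t, T' ≤ t → χ t = 0)
    (hψ : ContDiff ℝ (⊤ : ℕ∞) ψ) : TestT T (fun x t => χ t * ψ x) := by
  obtain ⟨T', h1, h2⟩ := hs
  exact ⟨contDiff_prodTest hχ hψ, T', h1, fun x t ht => by rw [h2 t ht, zero_mul]⟩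

theorem inner_intervalIntegral {r : ℝ} (hv : IntervalIntegrable v volume 0 r) (k : HS a b) :
    ⟪k, ∫ q in 0..r, v q⟫_ℝ = ∫ q in 0..r, ⟪k, v q⟫_ℝ :=
  ((innerSL ℝ k).intervalIntegral_comp_comm hv).symm

/-- A weak time derivative which is continuous in `L²` is a classical one. -/
theorem eq_Uc_of_weak (hT : 0 < T) (hU : ContinuousOn U (Icc 0 T)) (hv : ContinuousOn v (Icc 0 T))
    (su : Fld T u U) (sut : Fld T ut v)
    (H : ∀ φ : ℝ → ℝ → ℝ, TestInt a b T φ →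
      intOmT a b T (fun x t => u x t * pdt φ x t) = - intOmT a b T (fun x t => ut x t * φ x t)) :
    ∀ r ∈ Icc 0 T, U r = Uc (U 0) v r := by
  intro r hr
  refine sub_eq_zero.1 (eq_zero_of_test fun ψ hψ hψs => ?_)
  have h1 := eq_add_integral_of_test_int hT (z := fun t => ⟪toH a b ψ hψ.continuous, U t⟫_ℝ)
    (h := fun t => ⟪toH a b ψ hψ.continuous, v t⟫_ℝ) (continuousOn_const.inner hU)
    ((continuousOn_const.inner hv).intervalIntegrable_of_Icc hT.le) fun χ hχ hχs => by
      have h2 := H _ (testInt_prod hχ hχs hψ hψs)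
      rw [pdt_prodTest hχ, su.prodTest hT.le (cont_deriv_of_smooth hχ) hψ.continuous,
        sut.prodTest hT.le hχ.continuous hψ.continuous] at h2
      exact h2
  rw [inner_sub_right, inner_Uc hv _ hr, h1 r hr, sub_self]

/-- The weak momentum balance implies its time-integrated form and the initial conditions. -/
theorem wave_of_weak (hT : 0 < T) {p : ℝ → ℝ → ℝ} {F : ℝ → HS a b} {u0 u0t : ℝ → ℝ} {U0 V0 : HS a b}
    (hv : ContinuousOn v (Icc 0 T)) (hw : ContinuousOn w (Icc 0 T))
    (hF : IntervalIntegrable F volume 0 T) (hU : ∀ r ∈ Icc 0 T, U r = Uc (U 0) v r)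
    (su : Fld T u U) (sux : Fld T ux w) (sp : Fld T p F)
    (e0 : u0 =ᵐ[mu a b] U0) (e1 : u0t =ᵐ[mu a b] V0)
    (H : ∀ φ : ℝ → ℝ → ℝ, TestU a b T φ →
      intOmT a b T (fun x t => u x t * pdt (pdt φ) x t)
        - intOm a b (fun x => u0t x * φ x 0) + intOm a b (fun x => u0 x * pdt φ x 0)
      = - intOmT a b T (fun x t => ux x t * pdx φ x t)
        - intOmT a b T (fun x t => p x t * φ x t)) :
    U 0 = U0 ∧ v 0 = V0 ∧ ∀ n, ∀ r ∈ Icc 0 T, ⟪sinH a b n, v r⟫_ℝ = ⟪sinH a b n, v 0⟫_ℝ +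
      ∫ q in 0..r, (-kf a b (n + 1) * ⟪cosH a b (n + 1), w q⟫_ℝ - ⟪sinH a b n, F q⟫_ℝ) := by
  have iF : ∀ k : HS a b, IntervalIntegrable (fun t => ⟪k, F t⟫_ℝ) volume 0 T := fun k =>
    ((innerSL ℝ k).integrable_comp hF.1 |> fun h => ⟨h, (innerSL ℝ k).integrable_comp hF.2⟩)
  have iw : ∀ k : HS a b, IntervalIntegrable (fun t => ⟪k, w t⟫_ℝ) volume 0 T := fun k =>
    (continuousOn_const.inner hw).intervalIntegrable_of_Icc hT.le
  have iw' : ∀ k : HS a b, IntervalIntegrable (fun t => -⟪k, w t⟫_ℝ) volume 0 T := fun k =>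
    (iw k).neg
  have key : ∀ {ψ χ : ℝ → ℝ} (hψ : ContDiff ℝ (⊤ : ℕ∞) ψ), tsupport ψ ⊆ Ioo a b →
      ContDiff ℝ (⊤ : ℕ∞) χ → (∃ T' < T, ∀ t, T' ≤ t → χ t = 0) →
      (∫ t in 0..T, deriv χ t * ⟪toH a b ψ hψ.continuous, v t⟫_ℝ) +
        ⟪toH a b ψ hψ.continuous, V0⟫_ℝ * χ 0 + deriv χ 0 * ⟪toH a b ψ hψ.continuous, U 0 - U0⟫_ℝ =
      -∫ t in 0..T, χ t * (-⟪toH a b (deriv ψ) (cont_deriv_of_smooth hψ), w t⟫_ℝ -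
        ⟪toH a b ψ hψ.continuous, F t⟫_ℝ) := by
    intro ψ χ hψ hψs hχ hs
    have hχ' := contDiff_deriv hχ
    have h1 := H _ (testU_prod hχ hs hψ hψs)
    rw [pdt_prodTest hχ, pdt_prodTest hχ', pdx_prodTest _ hψ,
      su.prodTest hT.le (contDiff_deriv hχ').continuous hψ.continuous,
      sux.prodTest hT.le hχ.continuous (cont_deriv_of_smooth hψ),
      sp.prodTest hT.le hχ.continuous hψ.continuous, intOm_prodTest e1 _ hψ.continuous,
      intOm_prodTest e0 _ hψ.continuous] at h1
    have e : ∀ r ∈ Icc 0 T, ⟪toH a b ψ hψ.continuous, U r⟫_ℝ = ⟪toH a b ψ hψ.continuous, U 0⟫_ℝ +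
        ∫ q in 0..r, ⟪toH a b ψ hψ.continuous, v q⟫_ℝ := fun r hr => by
      rw [hU r hr, inner_Uc hv _ hr]
    have hUc : ContinuousOn (fun r => ⟪toH a b ψ hψ.continuous, U r⟫_ℝ) (Icc 0 T) :=
      continuousOn_const.inner ((continuousOn_Uc (U0 := U 0) hT.le hv).congr hU)
    have h2 := integral_parts hT.le hUc
      ((continuousOn_const.inner hv).intervalIntegrable_of_Icc hT.le) e
      (hasDerivAt_of_smooth hχ') (contDiff_deriv hχ').continuous
    obtain ⟨T', hT', hz⟩ := hs
    have h3 : deriv χ T = 0 := by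
      have : χ =ᶠ[𝓝 T] fun _ => 0 := by
        filter_upwards [Ioi_mem_nhds hT'] with t ht using hz t (le_of_lt ht)
      rw [this.deriv_eq, deriv_const]
    have h4 : (∫ t in 0..T, χ t * (-⟪toH a b (deriv ψ) (cont_deriv_of_smooth hψ), w t⟫_ℝ -
        ⟪toH a b ψ hψ.continuous, F t⟫_ℝ)) =
        -(∫ t in 0..T, χ t * ⟪toH a b (deriv ψ) (cont_deriv_of_smooth hψ), w t⟫_ℝ) -
          ∫ t in 0..T, χ t * ⟪toH a b ψ hψ.continuous, F t⟫_ℝ := by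
      rw [← intervalIntegral.integral_neg, ← intervalIntegral.integral_sub]
      · exact intervalIntegral.integral_congr fun t _ => by ring
      · exact ((iw _).continuousOn_mul hχ.continuous.continuousOn).neg
      · exact (iF _).continuousOn_mul hχ.continuous.continuousOn
    rw [h3] at h2
    rw [h4, inner_sub_right]
    linarith
  have ode : ∀ {ψ : ℝ → ℝ} (hψ : ContDiff ℝ (⊤ : ℕ∞) ψ), tsupport ψ ⊆ Ioo a b → ∀ r ∈ Icc 0 T,
      ⟪toH a b ψ hψ.continuous, v r⟫_ℝ = ⟪toH a b ψ hψ.continuous, V0⟫_ℝ + ∫ q in 0..r,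
        (-⟪toH a b (deriv ψ) (cont_deriv_of_smooth hψ), w q⟫_ℝ -
          ⟪toH a b ψ hψ.continuous, F q⟫_ℝ) := by
    intro ψ hψ hψs
    refine eq_add_integral_of_test hT (continuousOn_const.inner hv) ((iw' _).sub (iF _))
      fun χ hχ => ?_
    have h0 : deriv χ 0 = 0 :=
      image_eq_zero_of_notMem_tsupport fun h => lt_irrefl _ (hχ.supp h).1
    have := key hψ hψs hχ.smooth hχ.suppt
    rwa [h0, zero_mul, add_zero] at this
  have hV0 : v 0 = V0 := sub_eq_zero.1 <| eq_zero_of_test fun ψ hψ hψs => by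
    rw [inner_sub_right, ode hψ hψs 0 (left_mem_Icc.2 hT.le)]; simp
  refine ⟨sub_eq_zero.1 <| eq_zero_of_test fun ψ hψ hψs => ?_, hV0, fun n r hr => ?_⟩
  · obtain ⟨χ, hχ, hs, h1⟩ := exists_time_slope hT
    have h2 := key hψ hψs hχ hs
    have h3 := integral_parts hT.le (continuousOn_const.inner hv) ((iw' _).sub (iF _))
      (fun r hr => by
        rw [ode hψ hψs r hr, ode hψ hψs 0 (left_mem_Icc.2 hT.le), intervalIntegral.integral_same,
          add_zero]) (hasDerivAt_of_smooth hχ) (cont_deriv_of_smooth hχ)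
    obtain ⟨T', hT', hz⟩ := hs
    rw [hz T hT'.le, hV0] at h3
    rw [h1] at h2
    linarith
  · have hF' : IntervalIntegrable F volume 0 r :=
      hF.mono_set (by rw [uIcc_of_le hr.1, uIcc_of_le hT.le]; exact Icc_subset_Icc_right hr.2)
    have hw' : IntervalIntegrable w volume 0 r :=
      (hw.mono (Icc_subset_Icc_right hr.2)).intervalIntegrable_of_Icc hr.1
    have sub : ∀ {g : ℝ → ℝ}, IntervalIntegrable g volume 0 T → IntervalIntegrable g volume 0 r :=
      fun h => h.mono_set (by
        rw [uIcc_of_le hr.1, uIcc_of_le hT.le]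
        exact Icc_subset_Icc_right hr.2)
    have hD : HasD (∫ q in 0..r, w q) (v r - V0 + ∫ q in 0..r, F q) := by
      refine HasD.of_test fun ψ hψ hψs => ?_
      have h1 := ode hψ hψs r hr
      rw [intervalIntegral.integral_sub (sub (iw' _)) (sub (iF _)),
        intervalIntegral.integral_neg] at h1
      rw [inner_add_right, inner_sub_right, inner_intervalIntegral hw',
          inner_intervalIntegral hF', h1]
      ring
    have h2 := hD n
    rw [inner_add_right, inner_sub_right, inner_intervalIntegral hw',
        inner_intervalIntegral hF'] at h2
    rw [intervalIntegral.integral_sub (sub ((iw _).const_mul _)) (sub (iF _)),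
      intervalIntegral.integral_const_mul, hV0]
    linarith

end

section

variable {a b : ℝ} [hab : Fact (a < b)] {f f' : ℝ → ℝ} {M T : ℝ} {U v w θ : ℝ → HS a b}
  {u ut ux Θ Θx : ℝ → ℝ → ℝ}

theorem contDiff_cosF' (a b : ℝ) (n : ℕ) : ContDiff ℝ (⊤ : ℕ∞) (cosF a b n) := contDiff_cosF a b n

theorem HasD.inner_deriv_cosF {h h' : HS a b} (H : HasD h h') (n : ℕ) :
    ⟪toH a b (deriv (cosF a b n)) (cont_deriv_of_smooth (contDiff_cosF' a b n)), h'⟫_ℝ =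
      kf a b n ^ 2 * ⟪cosH a b n, h⟫_ℝ := by
  rw [inner_toH]
  rcases n with _ | n
  · have : cosF a b 0 = fun _ => √(1 / (b - a)) := funext (cosF_zero a b)
    rw [this, kf_zero]
    simp
  · have e : deriv (cosF a b (n + 1)) = fun x => -kf a b (n + 1) * sinF a b n x :=
      funext fun x => (hasDerivAt_cosF_succ a b n x).deriv
    have h1 := H n
    rw [inner_sinH] at h1
    simp only [e]
    calc ∫ x, h' x * (-kf a b (n + 1) * sinF a b n x) ∂mu a b
        = ∫ x, -kf a b (n + 1) * (h' x * sinF a b n x) ∂mu a b :=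
          integral_congr_ae (.of_forall fun x => by ring)
      _ = _ := by rw [integral_const_mul, h1]; ring

/-- The weak heat balance implies its modewise time-integrated form and the initial condition. -/
theorem heat_of_weak (G : C11 (fe f f') (fe' f') M) (hT : 0 < T) {Θ0 : ℝ → ℝ} {Z0 : HS a b}
    (hv : ContinuousOn v (Icc 0 T)) (C : CurV 0 T θ)
    (F : Flds f f' T u ut ux Θ Θx U v w θ) (e0 : Θ0 =ᵐ[mu a b] Z0)
    (H : ∀ φ : ℝ → ℝ → ℝ, TestT T φ →
      - intOmT a b T (fun x t => Θ x t * pdt φ x t) - intOm a b (fun x => Θ0 x * φ x 0)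
      = - intOmT a b T (fun x t => Θx x t * pdx φ x t)
        + intOmT a b T (fun x t => f' (Θ x t) * Θx x t * ut x t * φ x t)
        + intOmT a b T (fun x t => f (Θ x t) * ut x t * pdx φ x t)) :
    θ 0 = Z0 ∧ HeatEq 0 T (fun r => Gf (fe f f') (fe' f') (v r) (θ r)) θ := by
  have iG := (force_Gf G hT.le hv C).int hT.le
  have iθ : ∀ n, IntervalIntegrable (fun t => -kf a b n ^ 2 * ⟪cosH a b n, θ t⟫_ℝ) volume 0 T :=
    fun n => (continuousOn_const.mul
        (continuousOn_const.inner C.cont)).intervalIntegrable_of_Icc hT.le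
  have key : ∀ n, ∀ r ∈ Icc 0 T, ⟪cosH a b n, θ r⟫_ℝ = ⟪cosH a b n, Z0⟫_ℝ +
      ∫ q in 0..r, (-kf a b n ^ 2 * ⟪cosH a b n, θ q⟫_ℝ +
        Gf (fe f f') (fe' f') (v q) (θ q) (cosH a b n)) := by
    intro n
    refine eq_add_integral_of_test hT (continuousOn_const.inner C.cont) ((iθ n).add (iG n))
      fun χ hχ => ?_
    have hc := contDiff_cosF' a b n
    have h1 := H _ (testT_prod hχ.smooth hχ.suppt hc)
    have hφ := contDiff_prodTest hχ.smooth hc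
    rw [add_assoc, (F.gf G hφ).1, pdt_prodTest hχ.smooth, pdx_prodTest _ hc,
      F.sΘ.prodTest hT.le (cont_deriv_of_smooth hχ.smooth) hc.continuous,
      F.sΘx.prodTest hT.le hχ.smooth.continuous (cont_deriv_of_smooth hc),
      intOm_prodTest e0 _ hc.continuous, integral_mu_zero hT.le] at h1
    have h2 : ∀ᵐ t ∂volume.restrict (uIoc 0 T), InV (θ t) := by
      rw [uIoc_of_le hT.le]; exact C.inV
    have h3 : ∫ t in 0..T, Gf (fe f f') (fe' f') (v t) (θ t) (slH _ hφ.continuous t) =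
        ∫ t in 0..T, χ t * Gf (fe f f') (fe' f') (v t) (θ t) (cosH a b n) := by
      refine intervalIntegral.integral_congr_ae_restrict ?_
      filter_upwards [h2] with t ht
      rw [slH_prodTest hc.continuous]
      exact (linV_Gf G (v t) ht).smul _ _ (inV_cosH n)
    have h4 : ∫ t in 0..T, χ t * ⟪toH a b (deriv (cosF a b n)) (cont_deriv_of_smooth hc),
        Dx (θ t)⟫_ℝ = -∫ t in 0..T, χ t * (-kf a b n ^ 2 * ⟪cosH a b n, θ t⟫_ℝ) := by
      rw [← intervalIntegral.integral_neg]
      refine intervalIntegral.integral_congr_ae_restrict ?_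
      filter_upwards [h2] with t ht
      rw [ht.hasD.inner_deriv_cosF]; ring
    have h5 : (∫ t in 0..T, χ t * (-kf a b n ^ 2 * ⟪cosH a b n, θ t⟫_ℝ +
        Gf (fe f f') (fe' f') (v t) (θ t) (cosH a b n))) =
        (∫ t in 0..T, χ t * (-kf a b n ^ 2 * ⟪cosH a b n, θ t⟫_ℝ)) +
          ∫ t in 0..T, χ t * Gf (fe f f') (fe' f') (v t) (θ t) (cosH a b n) := by
      rw [← intervalIntegral.integral_add]
      · exact intervalIntegral.integral_congr fun t _ => by ring
      · exact (iθ n).continuousOn_mul hχ.smooth.continuous.continuousOn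
      · exact (iG n).continuousOn_mul hχ.smooth.continuous.continuousOn
    rw [h3, h4] at h1
    rw [h5]
    change -(∫ t in 0..T, deriv χ t * ⟪cosH a b n, θ t⟫_ℝ) - χ 0 * ⟪cosH a b n, Z0⟫_ℝ = _ at h1
    linarith
  have h0 : θ 0 = Z0 := ext_cos fun n => by
    rw [key n 0 (left_mem_Icc.2 hT.le)]; simp
  exact ⟨h0, fun n r hr => by rw [key n r hr, h0]⟩

theorem ae_prod_swap {P : ℝ × ℝ → Prop}
    (h : ∀ᵐ p ∂volume.restrict (Ioo a b ×ˢ Ioo 0 T), P p) :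
    ∀ᵐ t ∂mu 0 T, ∀ᵐ x ∂mu a b, P (x, t) := by
  rw [restrict_prod_eq, ← Measure.prod_swap] at h
  exact Measure.ae_ae_of_ae_prod (ae_of_ae_map measurable_swap.aemeasurable h)

theorem curV_of_weak (hT : 0 ≤ T) (hc : ContinuousOn θ (Icc 0 T))
    (hs : ∀ t ∈ Icc 0 T, (fun x => Θ x t) =ᵐ[mu a b] θ t)
    (hx : IntegrableOn (fun p : ℝ × ℝ => Θx p.1 p.2) (Ioo a b ×ˢ Ioo 0 T))
    (hxx : IntegrableOn (fun p : ℝ × ℝ => Θx p.1 p.2 ^ 2) (Ioo a b ×ˢ Ioo 0 T))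
    (hW : ∀ᵐ t ∂volume.restrict (Ioo 0 T), WeakDerivI a b (fun x => Θ x t) (fun x => Θx x t)) :
    CurV 0 T θ ∧ ∀ᵐ t ∂mu 0 T, (fun x => Θx x t) =ᵐ[mu a b] Dx (θ t) := by
  rw [IntegrableOn, restrict_prod_eq] at hx hxx
  have h1 : ∀ᵐ t ∂mu 0 T, HasD (θ t) (mkH a b fun x => Θx x t) ∧
      (fun x => Θx x t) =ᵐ[mu a b] mkH a b fun x => Θx x t := by
    filter_upwards [hx.prod_left_ae, hxx.prod_left_ae, hW, ae_mu_mem 0 T] with t i1 i2 h ht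
    have e := coeFn_mkH ((memLp_two_iff_integrable_sq i1.1).2 i2)
    exact ⟨HasD.of_weak h (hs t (Ioo_subset_Icc_self ht)) e.symm, e.symm⟩
  have e : volume.restrict (Ioc 0 T) = mu 0 T := Measure.restrict_congr_set Ioo_ae_eq_Ioc.symm
  refine ⟨⟨hc, ?_, ?_⟩, h1.mono fun t ht => by rw [ht.1.eq]; exact ht.2⟩
  · rw [e]; exact h1.mono fun t ht => ht.1.inV
  · rw [intervalIntegrable_iff_integrableOn_Ioc_of_le hT, IntegrableOn, e]
    refine hxx.integral_prod_right.congr ?_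
    filter_upwards [h1] with t ht
    rw [ht.1.eq, norm_sq_HS]
    exact integral_congr_ae (ht.2.mono fun x hx => by simp only [hx])

/-- The `L²` curve of the slices of a function on the space-time cylinder. -/
def cls (a b : ℝ) (g : ℝ → ℝ → ℝ) (t : ℝ) : HS a b := mkH a b fun x => g x t

theorem CurV.aesm_FN (C : CurV 0 T θ) (G : C11 f f' M) :
    AEStronglyMeasurable (fun t => FN f' (θ t)) (volume.restrict (Ioc 0 T)) := by
  refine aestronglyMeasurable_of_tendsto_ae atTop (f := fun N t => DN N (nem f (θ t)))
    (fun N => ?_) ?_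
  · exact (((continuous_DN N).comp_continuousOn ((continuous_nem G).comp_continuousOn C.cont)).mono
      Ioc_subset_Icc_self).aestronglyMeasurable measurableSet_Ioc
  · refine C.inV.mono fun t ht => ?_
    rw [← Dx_nem G ht]
    exact tendsto_DN (inV_nem G ht)

theorem isSol_of_weak (G : C11 (fe f f') (fe' f') M) (hT : 0 < T) {u0 u0x u0t Θ0 : ℝ → ℝ}
    (D : DataI a b u0 u0x u0t Θ0) (W : IsWeakSol a b T f f' u0 u0t Θ0 u ut ux Θ Θx)
    (R : RegT a b T u ut ux Θ Θx) :
    IsSol (fe f f') (fe' f') 0 T (cls a b ut) (cls a b ux) (cls a b Θ) ∧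
      cls a b ut 0 = mkH a b u0t ∧ cls a b ux 0 = mkH a b u0x ∧ cls a b Θ 0 = mkH a b Θ0 := by
  have hv : ContinuousOn (cls a b ut) (Icc 0 T) := R.ut_cont.continuousOn
  have hw : ContinuousOn (cls a b ux) (Icc 0 T) := R.ux_cont.continuousOn
  have hθ : ContinuousOn (cls a b Θ) (Icc 0 T) := R.Θ_cont.continuousOn
  have hU : ContinuousOn (cls a b u) (Icc 0 T) := R.u_cont.continuousOn
  obtain ⟨C, hx⟩ := curV_of_weak hT.le hθ (fun t ht => R.Θ_cont.slice ht) W.Θx_int R.Θx_sq_int W.Θ_W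
  have F : Flds f f' T u ut ux Θ Θx (cls a b u) (cls a b ut) (cls a b ux) (cls a b Θ) := by
    refine ⟨⟨W.u_int, ae_mu_of_Icc fun t ht => R.u_cont.slice ht⟩,
      ⟨W.ut_int, ae_mu_of_Icc fun t ht => R.ut_cont.slice ht⟩,
      ⟨W.ux_int, ae_mu_of_Icc fun t ht => R.ux_cont.slice ht⟩,
      ⟨W.Θ_int, ae_mu_of_Icc fun t ht => R.Θ_cont.slice ht⟩, ⟨W.Θx_int, hx⟩, ?_,
      W.g1_int, W.g2_int, W.g3_int⟩
    filter_upwards [ae_prod_swap W.Θ_nonneg, ae_mu_mem 0 T] with t h1 h2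
    filter_upwards [h1, R.Θ_cont.slice (Ioo_subset_Icc_self h2)] with x h3 h4
    rw [cls, ← h4]; exact h3
  have hUc := eq_Uc_of_weak hT hU hv F.su F.sut W.ut_weak
  have hF : IntervalIntegrable (fun t => FN (fe' f') (cls a b Θ t)) volume 0 T := by
    have h1 := (C.int_D hT.le).const_mul M
    rw [intervalIntegrable_iff_integrableOn_Ioc_of_le hT.le] at h1 ⊢
    exact h1.mono' (C.aesm_FN G) (.of_forall fun t => norm_FN_le G _)
  obtain ⟨hU0, hv0, eqv⟩ := wave_of_weak hT hv hw hF hUc F.su F.sux (F.fn G)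
    (coeFn_mkH D.u0_L2.memLp).symm (coeFn_mkH D.u0t_L2.memLp).symm W.weak_u
  obtain ⟨hθ0, heat⟩ := heat_of_weak G hT hv C F (coeFn_mkH D.Θ0_L2.memLp).symm W.weak_Θ
  have hZ : ∀ r ∈ Icc 0 T, ZD (cls a b u r) (cls a b ux r) := fun r hr =>
    ZD.of_weak (R.u_W0 r hr) (R.u_cont.slice hr) (R.ux_cont.slice hr)
  have h0 : (0 : ℝ) ∈ Icc 0 T := left_mem_Icc.2 hT.le
  have hZ0 : ZD (mkH a b u0) (mkH a b u0x) := ZD.of_weak D.u0_W0 (coeFn_mkH D.u0_L2.memLp).symm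
    (coeFn_mkH D.u0x_L2.memLp).symm
  refine ⟨⟨⟨hv, hw, eqv, fun n r hr => ?_, fun r hr => ?_⟩, C, heat⟩, hv0, ?_, hθ0⟩
  · rw [(hZ r hr).1, (hZ 0 h0).1, hUc r hr, inner_Uc hv _ hr, intervalIntegral.integral_const_mul]
    ring
  · rw [(hZ r hr).2, (hZ 0 h0).2]
  · refine ext_cos fun n => ?_
    rcases n with _ | n
    · rw [(hZ 0 h0).2, hZ0.2]
    · rw [(hZ 0 h0).1, hZ0.1, hU0]

theorem ZD.unique {p q r : HS a b} (H : ZD p r) (K : ZD q r) : p = q := by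
  refine ext_sin fun n => mul_left_cancel₀ ((kf_one_pos (a := a) (b := b)).trans_le
      (kf_one_le n)).ne' ?_
  rw [← H.1, ← K.1]

theorem ae_eq_of_slices {g h : ℝ → ℝ → ℝ}
    (hg : IntegrableOn (fun p : ℝ × ℝ => g p.1 p.2) (Ioo a b ×ˢ Ioo 0 T))
    (hh : IntegrableOn (fun p : ℝ × ℝ => h p.1 p.2) (Ioo a b ×ˢ Ioo 0 T))
    (H : ∀ t ∈ Icc 0 T, (fun x => g x t) =ᵐ[mu a b] fun x => h x t) :
    ∀ᵐ p ∂volume.restrict (Ioo a b ×ˢ Ioo 0 T), g p.1 p.2 = h p.1 p.2 := by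
  have hi : Integrable (fun p : ℝ × ℝ => |g p.1 p.2 - h p.1 p.2|)
      (volume.restrict (Ioo a b ×ˢ Ioo 0 T)) := (hg.sub hh).abs
  have h0 : ∫ p in Ioo a b ×ˢ Ioo 0 T, |g p.1 p.2 - h p.1 p.2| = 0 := by
    refine (intOmT_eq (a := a) (b := b) (F := fun x t => |g x t - h x t|) hi).1.trans ?_
    refine integral_eq_zero_of_ae ?_
    filter_upwards [ae_mu_mem 0 T] with t ht
    refine integral_eq_zero_of_ae ((H t (Ioo_subset_Icc_self ht)).mono fun x hx => ?_)
    simp only at hx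
    simp [hx]
  have h1 := (integral_eq_zero_iff_of_nonneg (fun p => abs_nonneg _) hi).1 h0
  filter_upwards [h1] with p hp
  exact sub_eq_zero.1 (abs_eq_zero.1 hp)

theorem weak_unique (G : C11 (fe f f') (fe' f') M) (hT : 0 < T) {u0 u0x u0t Θ0 : ℝ → ℝ}
    (D : DataI a b u0 u0x u0t Θ0) {u₁ ut₁ ux₁ Θ₁ Θx₁ : ℝ → ℝ → ℝ}
    (W : IsWeakSol a b T f f' u0 u0t Θ0 u ut ux Θ Θx) (R : RegT a b T u ut ux Θ Θx)
    (W₁ : IsWeakSol a b T f f' u0 u0t Θ0 u₁ ut₁ ux₁ Θ₁ Θx₁) (R₁ : RegT a b T u₁ ut₁ ux₁ Θ₁ Θx₁) :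
    (∀ᵐ p ∂volume.restrict (Ioo a b ×ˢ Ioo 0 T), u p.1 p.2 = u₁ p.1 p.2) ∧
      ∀ᵐ p ∂volume.restrict (Ioo a b ×ˢ Ioo 0 T), Θ p.1 p.2 = Θ₁ p.1 p.2 := by
  obtain ⟨S, ev, ew, eθ⟩ := isSol_of_weak G hT D W R
  obtain ⟨S₁, ev₁, ew₁, eθ₁⟩ := isSol_of_weak G hT D W₁ R₁
  have key := unique_sol G S S₁ (ev.trans ev₁.symm) (ew.trans ew₁.symm) (eθ.trans eθ₁.symm)
  refine ⟨ae_eq_of_slices W.u_int W₁.u_int fun t ht => ?_,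
    ae_eq_of_slices W.Θ_int W₁.Θ_int fun t ht => ?_⟩
  · have h1 := ZD.of_weak (R.u_W0 t ht) (R.u_cont.slice ht) (R.ux_cont.slice ht)
    have h2 := ZD.of_weak (R₁.u_W0 t ht) (R₁.u_cont.slice ht) (R₁.ux_cont.slice ht)
    have h3 : (mkH a b fun x => ux x t) = mkH a b fun x => ux₁ x t := (key t ht).2.1
    rw [h3] at h1
    refine (R.u_cont.slice ht).trans ?_
    rw [h1.unique h2]
    exact (R₁.u_cont.slice ht).symm
  · have h3 : (mkH a b fun x => Θ x t) = mkH a b fun x => Θ₁ x t := (key t ht).2.2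
    refine (R.Θ_cont.slice ht).trans ?_
    rw [h3]
    exact (R₁.Θ_cont.slice ht).symm

end

end TE

/-- Theorem 1.1: well-posedness — existence of precisely one global weak
solution of (P) in the regularity class (R). -/
theorem statement0
    (a b : ℝ) (hab : a < b)
    (f f' f'' : ℝ → ℝ) (hf : HypF f f' f'')
    (u0 u0x u0t Θ0 : ℝ → ℝ) (hdata : DataI a b u0 u0x u0t Θ0) :
    ∃ u ut ux Θ Θx : ℝ → ℝ → ℝ,
      ((∀ T > (0 : ℝ), IsWeakSol a b T f f' u0 u0t Θ0 u ut ux Θ Θx) ∧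
        (∀ T > (0 : ℝ), RegT a b T u ut ux Θ Θx)) ∧
      (∀ u' ut' ux' Θ' Θx' : ℝ → ℝ → ℝ,
        (∀ T > (0 : ℝ), IsWeakSol a b T f f' u0 u0t Θ0 u' ut' ux' Θ' Θx') →
        (∀ T > (0 : ℝ), RegT a b T u' ut' ux' Θ' Θx') →
        ∀ T > (0 : ℝ),
          (∀ᵐ p ∂volume.restrict ((Ioo a b) ×ˢ (Ioo 0 T)), u p.1 p.2 = u' p.1 p.2) ∧
          (∀ᵐ p ∂volume.restrict ((Ioo a b) ×ˢ (Ioo 0 T)), Θ p.1 p.2 = Θ' p.1 p.2)) := by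
  have : Fact (a < b) := ⟨hab⟩
  obtain ⟨M, G⟩ := TE.hypF_C11 hf
  obtain ⟨u, ut, ux, Θ, Θx, h1, h2⟩ := TE.exists_weak_sol G hdata
  exact ⟨u, ut, ux, Θ, Θx, ⟨h1, h2⟩, fun _ _ _ _ _ k1 k2 T hT =>
    TE.weak_unique G hT hdata (h1 T hT) (h2 T hT) (k1 T hT) (k2 T hT)⟩
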